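/- If (p_n : ℝ)/f_n tends to 1/3 as n → ∞, then (g_n : ℝ)/(1 + f_n) tends to 5/6 as n → ∞. -/

import Mathlib

open Filter Pointwise

/-- `nthPrime n` is the `n`-th prime number (1-indexed): `nthPrime 1 = 2`, etc. -/
noncomputable def nthPrime (n : ℕ) : ℕ := Nat.nth Nat.Prime (n - 1)

/-- `S n` is the additive submonoid of `ℕ` generated by the primes `q ≥ nthPrime n`. -/
def S (n : ℕ) : AddSubmonoid ℕ :=
  AddSubmonoid.closure {q : ℕ | q.Prime ∧ nthPrime n ≤ q}

/-- `frob n` is the Frobenius number of `S n`: the largest natural number not in `S n`. -/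
noncomputable def frob (n : ℕ) : ℕ := sSup {m : ℕ | m ∉ S n}

/-- `genus n` is the number of natural numbers not in `S n`. -/
noncomputable def genus (n : ℕ) : ℕ := {m : ℕ | m ∉ S n}.ncard

/-- `atoms n` is the minimal generating set `S n \ {0} \ ((S n \ {0}) + (S n \ {0}))`. -/
def atoms (n : ℕ) : Set ℕ :=
  ((S n : Set ℕ) \ {0}) \ (((S n : Set ℕ) \ {0}) + ((S n : Set ℕ) \ {0}))

/-- `u n` is the largest atom of `S n`. -/
noncomputable def u (n : ℕ) : ℕ := sSup (atoms n)

/-- `e n` is the embedding dimension of `S n`: the number of atoms. -/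
noncomputable def e (n : ℕ) : ℕ := (atoms n).ncard

/-- The additive character `x ↦ exp (2πix)`. -/
noncomputable def expi (x : ℝ) : ℂ := Complex.exp ((2 * Real.pi * x : ℝ) * Complex.I)

theorem expi_add (x y : ℝ) : expi (x + y) = expi x * expi y := by
  rw [expi, expi, expi, ← Complex.exp_add]; congr 1; push_cast; ring

theorem expi_zero : expi 0 = 1 := by simp [expi]

theorem expi_neg (x : ℝ) : expi (-x) = (starRingEnd ℂ) (expi x) := by
  rw [expi, expi, ← Complex.exp_conj, map_mul, Complex.conj_ofReal, Complex.conj_I]; congr 1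
  push_cast; ring

theorem norm_expi (x : ℝ) : ‖expi x‖ = 1 := Complex.norm_exp_ofReal_mul_I _

theorem expi_int (k : ℤ) : expi k = 1 := by
  rw [expi, Complex.exp_eq_one_iff]; exact ⟨k, by push_cast; ring⟩

theorem expi_add_int (x : ℝ) (k : ℤ) : expi (x + k) = expi x := by
  rw [expi_add, expi_int, mul_one]

theorem expi_nat_mul (n : ℕ) (x : ℝ) : expi (n * x) = expi x ^ n := by
  rw [expi, expi, ← Complex.exp_nat_mul]; congr 1; push_cast; ring

theorem norm_expi_sub_one (x : ℝ) : ‖expi x - 1‖ = 2 * |Real.sin (Real.pi * x)| := by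
  rw [expi, mul_comm (Complex.ofReal _) Complex.I, Complex.norm_exp_I_mul_ofReal_sub_one]
  rw [norm_mul, Real.norm_eq_abs, Real.norm_eq_abs, abs_two]
  congr 3; ring

theorem norm_expi_sub_one_le (x : ℝ) : ‖expi x - 1‖ ≤ 2 * Real.pi * |x| := by
  rw [norm_expi_sub_one]
  have := Real.abs_sin_le_abs (x := Real.pi * x)
  rw [abs_mul, abs_of_pos Real.pi_pos] at this
  linarith

theorem le_norm_expi_sub_one {x : ℝ} (hx : |x| ≤ 1 / 2) : 4 * |x| ≤ ‖expi x - 1‖ := by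
  rw [norm_expi_sub_one]
  have h := Real.mul_abs_le_abs_sin (x := Real.pi * x)
    (by rw [abs_mul, abs_of_pos Real.pi_pos]; nlinarith [Real.pi_pos])
  rw [abs_mul, abs_of_pos Real.pi_pos] at h
  have : 2 / Real.pi * (Real.pi * |x|) = 2 * |x| := by field_simp
  linarith

theorem norm_expi_sub_expi_le (x y : ℝ) : ‖expi x - expi y‖ ≤ 2 * Real.pi * |x - y| := by
  have : expi x - expi y = expi y * (expi (x - y) - 1) := by
    rw [mul_sub, ← expi_add]; simp
  rw [this, norm_mul, norm_expi, one_mul]; exact norm_expi_sub_one_le _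

theorem sum_expi_div (L : ℕ) (hL : 0 < L) (k : ℤ) :
    ∑ u ∈ Finset.range L, expi (k * (u / L)) = if (L : ℤ) ∣ k then (L : ℂ) else 0 := by
  have hL' : (L : ℝ) ≠ 0 := by positivity
  have h1 : ∀ u : ℕ, expi (k * (u / L)) = expi (k / L) ^ u := fun u => by
    rw [← expi_nat_mul]; congr 1; ring
  simp_rw [h1]
  split_ifs with h
  · obtain ⟨c, rfl⟩ := h
    have : expi ((((L : ℤ) * c : ℤ) : ℝ) / L) = 1 := by
      rw [← expi_int c]; congr 1; push_cast; field_simp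
    simp only [this, one_pow, Finset.sum_const, Finset.card_range, nsmul_eq_mul, mul_one]
  · have hne : expi (k / L) ≠ 1 := by
      intro he
      rw [expi, Complex.exp_eq_one_iff] at he
      obtain ⟨c, hc⟩ := he
      apply h
      refine ⟨c, ?_⟩
      have h2 : ((2 * Real.pi * (k / L) : ℝ) : ℂ) = ((c * (2 * Real.pi) : ℝ) : ℂ) := by
        apply mul_right_cancel₀ Complex.I_ne_zero
        rw [hc]; push_cast; ring
      have h3 : 2 * Real.pi * (k / L) = c * (2 * Real.pi) := by exact_mod_cast h2
      have h4 : (k : ℝ) / L = c := by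
        have := Real.pi_pos
        apply mul_left_cancel₀ Real.two_pi_pos.ne'
        rw [h3]; ring
      rw [div_eq_iff hL'] at h4
      have h5 : (k : ℝ) = ((L * c : ℤ) : ℝ) := by rw [h4]; push_cast; ring
      exact_mod_cast h5
    rw [geom_sum_eq hne, ← expi_nat_mul]
    have : expi (L * (k / L)) = 1 := by
      rw [← expi_int k]; congr 1; field_simp
    simp [this]

/-- Trigonometric polynomial with coefficients `a` on `s`. -/
noncomputable def trig (s : Finset ℕ) (a : ℕ → ℂ) (x : ℝ) : ℂ := ∑ n ∈ s, a n * expi (n * x)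

theorem norm_trig_le (s : Finset ℕ) (a : ℕ → ℂ) (x : ℝ) : ‖trig s a x‖ ≤ ∑ n ∈ s, ‖a n‖ := by
  refine (norm_sum_le _ _).trans (Finset.sum_le_sum fun n _ => ?_)
  rw [norm_mul, norm_expi, mul_one]

theorem trig_add_int (s : Finset ℕ) (a : ℕ → ℂ) (x : ℝ) (k : ℤ) :
    trig s a (x + k) = trig s a x := by
  refine Finset.sum_congr rfl fun n _ => ?_
  rw [mul_add, ← expi_add_int (n * x) (n * k)]; push_cast; rfl

theorem sum_trig_mul_conj (L : ℕ) (hL : 0 < L) (A : ℕ) (s : Finset ℕ)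
    (hs : s ⊆ Finset.Ico A (A + L)) (a b : ℕ → ℂ) :
    ∑ u ∈ Finset.range L, trig s a (u / L) * (starRingEnd ℂ) (trig s b (u / L))
      = L * ∑ n ∈ s, a n * (starRingEnd ℂ) (b n) := by
  have h1 : ∀ u : ℕ, trig s a (u / L) * (starRingEnd ℂ) (trig s b (u / L))
      = ∑ n ∈ s, ∑ m ∈ s, a n * (starRingEnd ℂ) (b m) * expi ((n - m : ℤ) * (u / L)) := by
    intro u
    rw [trig, trig, map_sum, Finset.sum_mul_sum]
    refine Finset.sum_congr rfl fun n _ => Finset.sum_congr rfl fun m _ => ?_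
    rw [map_mul, ← expi_neg]
    have : expi (((n - m : ℤ) : ℝ) * (u / L)) = expi (n * (u / L)) * expi (-(m * (u / L))) := by
      rw [← expi_add]; congr 1; push_cast; ring
    rw [this]; ring
  simp_rw [h1]
  rw [Finset.sum_comm, Finset.mul_sum]
  refine Finset.sum_congr rfl fun n hn => ?_
  rw [Finset.sum_comm]
  simp_rw [← Finset.mul_sum, sum_expi_div L hL]
  rw [Finset.sum_eq_single n]
  · simp; ring
  · intro m hm hmn
    have h2 := Finset.mem_Ico.mp (hs hn)
    have h3 := Finset.mem_Ico.mp (hs hm)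
    rw [if_neg, mul_zero]
    intro hd
    have := Int.eq_zero_of_abs_lt_dvd hd (by rw [abs_lt]; constructor <;> omega)
    omega
  · exact fun h => absurd hn h

theorem sum_norm_trig_sq (L : ℕ) (hL : 0 < L) (A : ℕ) (s : Finset ℕ)
    (hs : s ⊆ Finset.Ico A (A + L)) (a : ℕ → ℂ) :
    ∑ u ∈ Finset.range L, ‖trig s a (u / L)‖ ^ 2 = L * ∑ n ∈ s, ‖a n‖ ^ 2 := by
  have h := sum_trig_mul_conj L hL A s hs a a
  simp only [Complex.mul_conj, Complex.normSq_eq_norm_sq] at h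
  exact_mod_cast h

/-- The constant of the large sieve inequality. -/
noncomputable def lsC : ℝ := Real.exp (2 * Real.pi) ^ 2

theorem lsC_pos : 0 < lsC := by unfold lsC; positivity

theorem sum_norm_trig_shift_sq_le (L : ℕ) (hL : 0 < L) (A : ℕ) (s : Finset ℕ)
    (hs : s ⊆ Finset.Ico A (A + L)) (a : ℕ → ℂ) (t : ℕ → ℝ) (ht : ∀ u, |t u| ≤ 1) :
    ∑ u ∈ Finset.range L, ‖trig s a ((u + t u) / L)‖ ^ 2 ≤ lsC * L * ∑ n ∈ s, ‖a n‖ ^ 2 := by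
  have hL' : (0 : ℝ) < L := by positivity
  set F : ℕ → EuclideanSpace ℂ (Fin L) := fun k => WithLp.toLp 2 fun u =>
    ((2 * Real.pi * t u : ℝ) * Complex.I) ^ k / (k.factorial : ℂ) *
      trig s (fun n => a n * ((((n : ℝ) - A) / L : ℝ) : ℂ) ^ k) (u / L) with hF
  set f : EuclideanSpace ℂ (Fin L) := WithLp.toLp 2 fun u =>
    expi (-(A * (t u / L))) * trig s a ((u + t u) / L) with hf
  have hsum : HasSum F f := by
    have : HasSum (fun k => (fun u : Fin L => F k u)) (fun u => f u) := by
      rw [Pi.hasSum]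
      intro u
      have h1 : f u = ∑ n ∈ s, a n * expi (n * (u / L)) *
          Complex.exp (((2 * Real.pi * t u : ℝ) * Complex.I) * ((((n : ℝ) - A) / L : ℝ) : ℂ)) := by
        simp only [hf, trig, Finset.mul_sum]
        refine Finset.sum_congr rfl fun n _ => ?_
        have e1 : Complex.exp (((2 * Real.pi * t u : ℝ) * Complex.I) *
            ((((n : ℝ) - A) / L : ℝ) : ℂ)) = expi (t u * ((n - A) / L)) := by
          rw [expi]; congr 1; push_cast; ring
        rw [e1, mul_left_comm, mul_assoc, ← expi_add, ← expi_add]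
        congr 2; field_simp; ring
      rw [h1]
      have h2 : ∀ k, F k u = ∑ n ∈ s, a n * expi (n * (u / L)) *
          ((((2 * Real.pi * t u : ℝ) * Complex.I) * ((((n : ℝ) - A) / L : ℝ) : ℂ)) ^ k
            / (k.factorial : ℂ)) := by
        intro k
        simp only [hF, trig, Finset.mul_sum]
        refine Finset.sum_congr rfl fun n _ => ?_
        rw [mul_pow]; ring
      simp_rw [h2]
      refine hasSum_sum fun n _ => HasSum.mul_left _ ?_
      rw [Complex.exp_eq_exp_ℂ]
      exact NormedSpace.expSeries_div_hasSum_exp _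
    exact (EuclideanSpace.equiv (Fin L) ℂ).hasSum.mp this
  have hFn : ∀ k, ‖F k‖ ≤ (2 * Real.pi) ^ k / (k.factorial : ℝ) *
      Real.sqrt (L * ∑ n ∈ s, ‖a n‖ ^ 2) := by
    intro k
    rw [EuclideanSpace.norm_eq]
    rw [← Real.sqrt_sq (show 0 ≤ (2 * Real.pi) ^ k / (k.factorial : ℝ) by positivity),
      ← Real.sqrt_mul (by positivity)]
    apply Real.sqrt_le_sqrt
    have h3 := sum_norm_trig_sq L hL A s hs (fun n => a n * ((((n : ℝ) - A) / L : ℝ) : ℂ) ^ k)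
    have h4 : ∑ n ∈ s, ‖a n * ((((n : ℝ) - A) / L : ℝ) : ℂ) ^ k‖ ^ 2 ≤ ∑ n ∈ s, ‖a n‖ ^ 2 := by
      refine Finset.sum_le_sum fun n hn => ?_
      have h5 := Finset.mem_Ico.mp (hs hn)
      have h6 : (A : ℝ) ≤ n := by exact_mod_cast h5.1
      have h7 : (n : ℝ) < A + L := by exact_mod_cast h5.2
      have h8 : ‖((((n : ℝ) - A) / L : ℝ) : ℂ) ^ k‖ ≤ 1 := by
        rw [norm_pow, Complex.norm_real, Real.norm_eq_abs]
        apply pow_le_one₀ (abs_nonneg _)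
        rw [abs_of_nonneg (div_nonneg (by linarith) hL'.le), div_le_one hL']; linarith
      rw [norm_mul]
      gcongr
      nlinarith [norm_nonneg (a n)]
    calc ∑ u : Fin L, ‖F k u‖ ^ 2 ≤ ∑ u : Fin L, ((2 * Real.pi) ^ k / (k.factorial : ℝ)) ^ 2 *
          ‖trig s (fun n => a n * ((((n : ℝ) - A) / L : ℝ) : ℂ) ^ k) ((u : ℕ) / L)‖ ^ 2 := by
          refine Finset.sum_le_sum fun u _ => ?_
          simp only [hF]
          rw [norm_mul, mul_pow, norm_div, norm_pow, norm_mul, Complex.norm_I, mul_one,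
            Complex.norm_real, Complex.norm_natCast, Real.norm_eq_abs, abs_mul, abs_of_pos
            Real.two_pi_pos]
          have h10 : 2 * Real.pi * |t u| ≤ 2 * Real.pi :=
            mul_le_of_le_one_right Real.two_pi_pos.le (ht u)
          have h11 : 0 ≤ 2 * Real.pi * |t u| := by positivity
          gcongr
      _ = ((2 * Real.pi) ^ k / (k.factorial : ℝ)) ^ 2 * (L * ∑ n ∈ s,
            ‖a n * ((((n : ℝ) - A) / L : ℝ) : ℂ) ^ k‖ ^ 2) := by
          rw [← Finset.mul_sum, ← h3, Finset.sum_range]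
      _ ≤ _ := by gcongr
  have hg : HasSum (fun k : ℕ => (2 * Real.pi) ^ k / (k.factorial : ℝ) *
      Real.sqrt (L * ∑ n ∈ s, ‖a n‖ ^ 2))
      (Real.exp (2 * Real.pi) * Real.sqrt (L * ∑ n ∈ s, ‖a n‖ ^ 2)) := by
    refine HasSum.mul_right _ ?_
    rw [Real.exp_eq_exp_ℝ]
    exact NormedSpace.expSeries_div_hasSum_exp _
  have hfin : ‖f‖ ≤ Real.exp (2 * Real.pi) * Real.sqrt (L * ∑ n ∈ s, ‖a n‖ ^ 2) := by
    rw [← hsum.tsum_eq]; exact tsum_of_norm_bounded hg hFn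
  have h9 : ‖f‖ ^ 2 = ∑ u ∈ Finset.range L, ‖trig s a ((u + t u) / L)‖ ^ 2 := by
    rw [EuclideanSpace.norm_sq_eq, Finset.sum_range]
    refine Finset.sum_congr rfl fun u _ => ?_
    simp only [hf]
    rw [norm_mul, norm_expi, one_mul]
  rw [← h9]
  calc ‖f‖ ^ 2 ≤ (Real.exp (2 * Real.pi) * Real.sqrt (L * ∑ n ∈ s, ‖a n‖ ^ 2)) ^ 2 := by gcongr
    _ = _ := by rw [mul_pow, Real.sq_sqrt (by positivity), lsC]; ring

/-- Large sieve inequality for `1/L`-separated points modulo one. -/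
theorem large_sieve {ι : Type*} (P : Finset ι) (x : ι → ℝ) (L : ℕ) (hL : 0 < L) (A : ℕ)
    (s : Finset ℕ) (hs : s ⊆ Finset.Ico A (A + L)) (a : ℕ → ℂ)
    (hsep : ∀ i ∈ P, ∀ j ∈ P, i ≠ j → ∀ k : ℤ, 1 / (L : ℝ) ≤ |x i - x j - k|) :
    ∑ i ∈ P, ‖trig s a (x i)‖ ^ 2 ≤ lsC * L * ∑ n ∈ s, ‖a n‖ ^ 2 := by
  classical
  have hL' : (0 : ℝ) < L := by positivity
  set g : ι → ℕ := fun i => ⌊L * Int.fract (x i)⌋₊ with hg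
  have hgb : ∀ i, (g i : ℝ) ≤ L * Int.fract (x i) ∧ L * Int.fract (x i) < g i + 1 := fun i =>
    ⟨Nat.floor_le (mul_nonneg hL'.le (Int.fract_nonneg _)), Nat.lt_floor_add_one _⟩
  have hgL : ∀ i, g i < L := fun i => by
    have h1 := (hgb i).1
    have h2 := Int.fract_lt_one (x i)
    have : (g i : ℝ) < L := by nlinarith
    exact_mod_cast this
  have hinj : ∀ i ∈ P, ∀ j ∈ P, g i = g j → i = j := by
    intro i hi j hj hij
    by_contra hne
    have h1 := hsep i hi j hj hne (⌊x i⌋ - ⌊x j⌋)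
    have h2 : x i - x j - ((⌊x i⌋ - ⌊x j⌋ : ℤ) : ℝ) = Int.fract (x i) - Int.fract (x j) := by
      rw [Int.fract, Int.fract]; push_cast; ring
    rw [h2, div_le_iff₀ hL'] at h1
    have h3 := hgb i
    have h4 := hgb j
    rw [hij] at h3
    have h5 : |(Int.fract (x i) - Int.fract (x j)) * L| < 1 := by
      rw [abs_lt]; constructor <;> nlinarith
    rw [abs_mul, abs_of_pos hL'] at h5
    linarith
  set t : ℕ → ℝ := fun u => if h : ∃ i ∈ P, g i = u then L * Int.fract (x h.choose) - u else 0
    with ht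
  have htg : ∀ i ∈ P, t (g i) = L * Int.fract (x i) - g i := by
    intro i hi
    have hex : ∃ j ∈ P, g j = g i := ⟨i, hi, rfl⟩
    simp only [ht]
    rw [dif_pos hex, hinj _ hex.choose_spec.1 i hi hex.choose_spec.2]
  have ht1 : ∀ u, |t u| ≤ 1 := by
    intro u
    by_cases h : ∃ i ∈ P, g i = u
    · obtain ⟨i, hi, rfl⟩ := h
      rw [htg i hi]
      have := hgb i
      rw [abs_le]; constructor <;> linarith
    · simp only [ht]; rw [dif_neg h]; simp
  calc ∑ i ∈ P, ‖trig s a (x i)‖ ^ 2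
      = ∑ i ∈ P, ‖trig s a ((g i + t (g i)) / L)‖ ^ 2 := by
        refine Finset.sum_congr rfl fun i hi => ?_
        rw [htg i hi]
        have : ((g i : ℝ) + (L * Int.fract (x i) - g i)) / L = x i + ((-⌊x i⌋ : ℤ) : ℝ) := by
          rw [Int.fract]; field_simp; push_cast; ring
        rw [this, trig_add_int]
    _ = ∑ u ∈ P.image g, ‖trig s a ((u + t u) / L)‖ ^ 2 := by
        rw [Finset.sum_image fun i hi j hj h => hinj i hi j hj h]
    _ ≤ ∑ u ∈ Finset.range L, ‖trig s a ((u + t u) / L)‖ ^ 2 := by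
        refine Finset.sum_le_sum_of_subset_of_nonneg ?_ fun _ _ _ => by positivity
        intro u hu
        obtain ⟨i, _, rfl⟩ := Finset.mem_image.mp hu
        exact Finset.mem_range.mpr (hgL i)
    _ ≤ _ := sum_norm_trig_shift_sq_le L hL A s hs a t ht1

/-- Residues `b < r` coprime to `r`. -/
def coprimeRes (r : ℕ) : Finset ℕ := (Finset.range r).filter fun b => r.Coprime b

theorem card_coprimeRes (r : ℕ) : (coprimeRes r).card = r.totient := rfl

theorem sum_range_mul_expi (d m : ℕ) (hm : 0 < m) (n : ℕ) (hn : n.Coprime (d * m)) (hd : 0 < d) :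
    ∑ b ∈ (Finset.range (d * m)).filter (fun b => d ∣ b), expi (n * (b / (d * m : ℕ))) =
      if m = 1 then 1 else 0 := by
  have h1 : (Finset.range (d * m)).filter (fun b => d ∣ b) = (Finset.range m).image (d * ·) := by
    ext b
    simp only [Finset.mem_filter, Finset.mem_range, Finset.mem_image]
    constructor
    · rintro ⟨h, c, rfl⟩
      exact ⟨c, lt_of_mul_lt_mul_left h (Nat.zero_le _), rfl⟩
    · rintro ⟨c, hc, rfl⟩
      exact ⟨Nat.mul_lt_mul_of_pos_left hc hd, dvd_mul_right _ _⟩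
  have hd' : (d : ℝ) ≠ 0 := by positivity
  rw [h1, Finset.sum_image (by intro x _ y _ h; exact Nat.eq_of_mul_eq_mul_left hd h)]
  have h2 := sum_expi_div m hm n
  have h3 : ∀ u : ℕ, expi (n * (((d * u : ℕ) : ℝ) / (d * m : ℕ))) = expi ((n : ℤ) * (u / m)) := by
    intro u; congr 1; push_cast; field_simp
  rw [Finset.sum_congr rfl fun u _ => h3 u, h2]
  by_cases h : m = 1
  · simp [h]
  · rw [if_neg h, if_neg]
    intro hdv
    have h4 : m ∣ n := by exact_mod_cast hdv
    have h5 := Nat.Coprime.coprime_mul_left_right hn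
    have := Nat.Coprime.eq_one_of_dvd h5.symm h4
    exact h this

theorem sum_coprimeRes_expi (r : ℕ) (hr : 0 < r) (n : ℕ) (hn : n.Coprime r) :
    ∑ b ∈ coprimeRes r, expi (n * (b / r)) = ArithmeticFunction.moebius r := by
  have h1 : ∀ b : ℕ, (if r.Coprime b then (1 : ℂ) else 0) =
      ∑ d ∈ r.divisors, if d ∣ b then (ArithmeticFunction.moebius d : ℂ) else 0 := by
    intro b
    rw [← Finset.sum_filter]
    have h2 : r.divisors.filter (· ∣ b) = (r.gcd b).divisors := by
      ext d
      simp only [Finset.mem_filter, Nat.mem_divisors, Nat.dvd_gcd_iff, ne_eq, Nat.gcd_eq_zero_iff]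
      constructor
      · rintro ⟨⟨h1, h2⟩, h3⟩; exact ⟨⟨h1, h3⟩, fun h => h2 h.1⟩
      · rintro ⟨⟨h1, h2⟩, h3⟩; exact ⟨⟨h1, hr.ne'⟩, h2⟩
    rw [h2]
    have h3 := congrArg (fun f : ArithmeticFunction ℤ => f (r.gcd b))
      ArithmeticFunction.moebius_mul_coe_zeta
    simp only [ArithmeticFunction.coe_mul_zeta_apply, ArithmeticFunction.one_apply] at h3
    rw [← Int.cast_sum, h3]
    by_cases h : r.gcd b = 1
    · simp [Nat.Coprime, h]
    · simp [Nat.Coprime, h]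
  rw [coprimeRes, Finset.sum_filter]
  have h4 : ∀ b : ℕ, (if r.Coprime b then expi (n * (b / r)) else 0) =
      ∑ d ∈ r.divisors, (ArithmeticFunction.moebius d : ℂ) *
        (if d ∣ b then expi (n * (b / r)) else 0) := by
    intro b
    have := congrArg (· * expi (n * (b / r))) (h1 b)
    simp only [ite_mul, one_mul, zero_mul, Finset.sum_mul] at this
    rw [this]
    refine Finset.sum_congr rfl fun d _ => ?_
    split_ifs <;> simp
  rw [Finset.sum_congr rfl fun b _ => h4 b, Finset.sum_comm]
  simp_rw [← Finset.mul_sum, ← Finset.sum_filter]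
  rw [Finset.sum_eq_single r]
  · have := sum_range_mul_expi r 1 one_pos n (by simpa using hn) hr
    simp only [mul_one] at this
    rw [this]; simp
  · intro d hd hne
    obtain ⟨m, rfl⟩ := Nat.dvd_of_mem_divisors hd
    have hm : 0 < m := Nat.pos_of_ne_zero (by rintro rfl; simp at hr)
    have hd0 : 0 < d := Nat.pos_of_ne_zero (by rintro rfl; simp at hr)
    rw [sum_range_mul_expi d m hm n hn hd0, if_neg, mul_zero]
    rintro rfl; simp at hne
  · intro h; exact absurd (Nat.mem_divisors_self r hr.ne') h

theorem norm_trig_sq_le_sum_coprimeRes (s : Finset ℕ) (a : ℕ → ℂ) (r : ℕ) (hr : Squarefree r)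
    (hs : ∀ n ∈ s, n.Coprime r) (x : ℝ) :
    ‖trig s a x‖ ^ 2 ≤ r.totient * ∑ b ∈ coprimeRes r, ‖trig s a (x + b / r)‖ ^ 2 := by
  have hr0 : 0 < r := Nat.pos_of_ne_zero hr.ne_zero
  have h1 : ∑ b ∈ coprimeRes r, trig s a (x + b / r) = ArithmeticFunction.moebius r * trig s a x := by
    unfold trig
    rw [Finset.sum_comm, Finset.mul_sum]
    refine Finset.sum_congr rfl fun n hn => ?_
    simp_rw [mul_add, expi_add, ← mul_assoc]
    rw [← Finset.mul_sum, sum_coprimeRes_expi r hr0 n (hs n hn)]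
    ring
  have h2 : ‖(ArithmeticFunction.moebius r : ℂ)‖ = 1 := by
    rw [Complex.norm_intCast]
    rcases ArithmeticFunction.moebius_ne_zero_iff_eq_or.mp
      (ArithmeticFunction.moebius_ne_zero_iff_squarefree.mpr hr) with h | h <;> simp [h]
  have h3 : ‖trig s a x‖ ≤ ∑ b ∈ coprimeRes r, ‖trig s a (x + b / r)‖ := by
    calc ‖trig s a x‖ = ‖∑ b ∈ coprimeRes r, trig s a (x + b / r)‖ := by
          rw [h1, norm_mul, h2, one_mul]
      _ ≤ _ := norm_sum_le _ _
  calc ‖trig s a x‖ ^ 2 ≤ (∑ b ∈ coprimeRes r, ‖trig s a (x + b / r)‖) ^ 2 := by gcongr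
    _ ≤ _ := by
      have := sq_sum_le_card_mul_sum_sq (s := coprimeRes r) (f := fun b => ‖trig s a (x + b / r)‖)
      rwa [card_coprimeRes] at this

/-- Squarefree `r ≤ Y` all of whose prime factors exceed `T`. -/
def roughSet (T Y : ℕ) : Finset ℕ :=
  (Finset.Icc 1 Y).filter fun r => Squarefree r ∧ r.Coprime (primorial T)

theorem mem_roughSet {T Y r : ℕ} :
    r ∈ roughSet T Y ↔ (1 ≤ r ∧ r ≤ Y) ∧ Squarefree r ∧ r.Coprime (primorial T) := by
  simp [roughSet]

theorem coprime_of_mem_roughSet {T Y r q : ℕ} (h : r ∈ roughSet T Y) (hq : 1 ≤ q) (hqT : q ≤ T) :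
    r.Coprime q := by
  refine Nat.Coprime.symm (Nat.coprime_of_dvd fun p hp hpq hpr => ?_)
  have h1 : p ≤ T := (Nat.le_of_dvd hq hpq).trans hqT
  have h2 : p ∣ primorial T := by
    unfold primorial
    exact Finset.dvd_prod_of_mem _ (by simp [hp]; omega)
  exact Nat.Prime.not_dvd_one hp (((mem_roughSet.mp h).2.2) ▸ Nat.dvd_gcd hpr h2)

/-- The sieve mass `∑ 1 / φ(r)` over `roughSet T Y`. -/
noncomputable def sieveG (T Y : ℕ) : ℝ := ∑ r ∈ roughSet T Y, 1 / (r.totient : ℝ)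

theorem arith_large_sieve {ι : Type*} (P : Finset ι) (c : ι → ℤ) (q : ι → ℕ) (x : ι → ℝ)
    (L : ℕ) (hL : 0 < L) (A : ℕ) (s : Finset ℕ) (hs : s ⊆ Finset.Ico A (A + L)) (a : ℕ → ℂ)
    (T Y : ℕ) (V : ℝ) (hV : 0 ≤ V) (hq : ∀ i ∈ P, 1 ≤ q i ∧ q i ≤ T) (hx : ∀ i ∈ P, |x i| ≤ V / L)
    (hsep : ∀ i ∈ P, ∀ j ∈ P, i ≠ j →
      ∀ k : ℤ, (c i : ℝ) / q i - c j / q j = k → 1 / (L : ℝ) ≤ |x i - x j|)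
    (hcop : ∀ n ∈ s, ∀ r ∈ roughSet T Y, n.Coprime r)
    (hsize : ((T : ℝ) * Y) ^ 2 * (2 * V + 1) ≤ L) :
    sieveG T Y * ∑ i ∈ P, ‖trig s a (c i / q i + x i)‖ ^ 2 ≤ lsC * L * ∑ n ∈ s, ‖a n‖ ^ 2 := by
  classical
  have hL' : (0 : ℝ) < L := by positivity
  set P' : Finset (ι × (Σ _ : ℕ, ℕ)) := P ×ˢ (roughSet T Y).sigma coprimeRes with hP'
  have key := large_sieve P' (fun z => c z.1 / q z.1 + x z.1 + z.2.2 / z.2.1) L hL A s hs a ?_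
  · refine le_trans ?_ key
    rw [hP', Finset.sum_product, sieveG, Finset.mul_sum]
    refine Finset.sum_le_sum fun i _ => ?_
    rw [Finset.sum_sigma, Finset.sum_mul]
    refine Finset.sum_le_sum fun r hr => ?_
    have hr2 := mem_roughSet.mp hr
    have h1 := norm_trig_sq_le_sum_coprimeRes s a r hr2.2.1 (fun n hn => hcop n hn r hr)
      (c i / q i + x i)
    have h2 : (0 : ℝ) < r.totient := by exact_mod_cast Nat.totient_pos.mpr hr2.1.1
    rw [one_div, inv_mul_le_iff₀ h2]
    exact h1
  · rintro ⟨i, r, b⟩ hi ⟨j, r', b'⟩ hj hne k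
    simp only [hP', Finset.mem_product, Finset.mem_sigma, coprimeRes, Finset.mem_filter,
      Finset.mem_range] at hi hj
    obtain ⟨hi, hr, hb, hbr⟩ := hi
    obtain ⟨hj, hr', hb', hbr'⟩ := hj
    have hr1 := mem_roughSet.mp hr
    have hr1' := mem_roughSet.mp hr'
    obtain ⟨hq1, hqT⟩ := hq i hi
    obtain ⟨hq1', hqT'⟩ := hq j hj
    simp only
    set D : ℤ := (c i * q j - c j * q i - k * q i * q j) * (r * r') + (b * r' - b' * r) * (q i * q j)
      with hD
    have hqi : (0 : ℝ) < q i := by exact_mod_cast hq1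
    have hqj : (0 : ℝ) < q j := by exact_mod_cast hq1'
    have hrp : (0 : ℝ) < r := by exact_mod_cast hr1.1.1
    have hrp' : (0 : ℝ) < r' := by exact_mod_cast hr1'.1.1
    set d : ℝ := q i * q j * r * r' with hd
    have hd0 : 0 < d := by positivity
    have hDd : (c i : ℝ) / q i + x i + b / r - (c j / q j + x j + b' / r') - k
        = D / d + (x i - x j) := by
      rw [hD, hd]; push_cast; field_simp; ring
    rw [hDd]
    by_cases hD0 : D = 0
    · have hcop1 : IsCoprime ((r * r' : ℕ) : ℤ) ((q i * q j : ℕ) : ℤ) := by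
        rw [Nat.isCoprime_iff_coprime]
        exact (Nat.Coprime.mul_left
          ((coprime_of_mem_roughSet hr hq1 hqT).mul_right (coprime_of_mem_roughSet hr hq1' hqT'))
          ((coprime_of_mem_roughSet hr' hq1 hqT).mul_right
            (coprime_of_mem_roughSet hr' hq1' hqT')))
      have hdv : ((r * r' : ℕ) : ℤ) ∣ (b * r' - b' * r) * ((q i * q j : ℕ) : ℤ) := by
        refine ⟨-(c i * q j - c j * q i - k * q i * q j), ?_⟩
        push_cast
        linarith [hD0.symm.trans hD]
      have hdv2 := hcop1.dvd_of_dvd_mul_right hdv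
      have e1 : r ∣ r' := by
        have h1 : (r : ℤ) ∣ b * r' - b' * r := (Dvd.intro (r' : ℤ) (by push_cast; ring)).trans hdv2
        have h2 : (r : ℤ) ∣ b * r' := (dvd_sub_left (dvd_mul_left _ _)).mp h1
        have h3 : r ∣ b * r' := by exact_mod_cast h2
        exact hbr.dvd_of_dvd_mul_left h3
      have e2 : r' ∣ r := by
        have h1 : (r' : ℤ) ∣ b * r' - b' * r := (Dvd.intro_left (r : ℤ) (by push_cast; ring)).trans hdv2
        have h2 : (r' : ℤ) ∣ b' * r := (dvd_sub_right (dvd_mul_left _ _)).mp h1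
        have h3 : r' ∣ b' * r := by exact_mod_cast h2
        exact hbr'.dvd_of_dvd_mul_left h3
      have e3 : r = r' := Nat.dvd_antisymm e1 e2
      subst e3
      have e4 : b = b' := by
        obtain ⟨z, hz⟩ := hdv2
        have hr0 : (r : ℤ) ≠ 0 := by have := hr1.1.1; omega
        have h1 : (b : ℤ) - b' = r * z := by
          apply mul_right_cancel₀ hr0
          push_cast at hz; linarith
        have := Int.eq_zero_of_abs_lt_dvd (Dvd.intro z h1.symm) (by rw [abs_lt]; constructor <;> omega)
        omega
      subst e4
      have hij : i ≠ j := by rintro rfl; exact hne rfl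
      rw [hD0]
      simp only [Int.cast_zero, zero_div, zero_add]
      refine hsep i hi j hj hij k ?_
      have := hDd
      rw [hD0] at this
      simp only [Int.cast_zero, zero_div, zero_add] at this
      linarith
    · have h1 : (1 : ℝ) ≤ |(D : ℝ)| := by exact_mod_cast Int.one_le_abs hD0
      have h2 : d ≤ ((T : ℝ) * Y) ^ 2 := by
        have a1 : (q i : ℝ) ≤ T := by exact_mod_cast hqT
        have a2 : (q j : ℝ) ≤ T := by exact_mod_cast hqT'
        have a3 : (r : ℝ) ≤ Y := by exact_mod_cast hr1.1.2
        have a4 : (r' : ℝ) ≤ Y := by exact_mod_cast hr1'.1.2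
        calc d ≤ T * T * Y * Y := by rw [hd]; gcongr
          _ = _ := by ring
      have h3 : (2 * V + 1) / L ≤ |(D : ℝ) / d| := by
        rw [abs_div, abs_of_pos hd0, div_le_div_iff₀ hL' hd0]
        nlinarith
      have h4 := hx i hi
      have h5 := hx j hj
      have h6 : |x i - x j| ≤ 2 * V / L := by
        calc |x i - x j| ≤ |x i| + |x j| := abs_sub _ _
          _ ≤ V / L + V / L := by gcongr
          _ = _ := by ring
      have h7 : |(D : ℝ) / d| ≤ |(D : ℝ) / d + (x i - x j)| + |x i - x j| := by
        have := abs_sub_abs_le_abs_sub ((D : ℝ) / d) (-(x i - x j))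
        rw [abs_neg, sub_neg_eq_add] at this
        linarith
      have h8 : (2 * V + 1) / L = 2 * V / L + 1 / (L : ℝ) := by ring
      linarith

theorem sum_inv_le_inv_totient (r Y : ℕ) (hr : Squarefree r) :
    ∑ n ∈ (Finset.Icc 1 Y).filter (fun n => ∏ p ∈ n.primeFactors, p = r), (1 : ℝ) / n
      ≤ 1 / r.totient := by
  classical
  set f : ℕ →* ℝ := (invMonoidWithZeroHom : ℝ →*₀ ℝ).toMonoidHom.comp
    (Nat.castRingHom ℝ).toMonoidHom with hf
  have hfa : ∀ n : ℕ, f n = (n : ℝ)⁻¹ := fun n => rfl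
  have hlt : ∀ {p : ℕ}, p.Prime → ‖f p‖ < 1 := by
    intro p hp
    rw [hfa, norm_inv, Real.norm_natCast]
    exact inv_lt_one_of_one_lt₀ (by exact_mod_cast hp.one_lt)
  obtain ⟨h1, h2⟩ := EulerProduct.summable_and_hasSum_factoredNumbers_prod_filter_prime_geometric
    hlt r.primeFactors
  have hr0 : (r : ℝ) ≠ 0 := by exact_mod_cast hr.ne_zero
  have h3 : (1 : ℝ) / r.totient =
      (r : ℝ)⁻¹ * ∏ p ∈ r.primeFactors with p.Prime, (1 - f p)⁻¹ := by
    have h4 : (r.totient : ℝ) = r * ∏ p ∈ r.primeFactors, (1 - (p : ℝ)⁻¹) := by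
      have := Nat.totient_eq_mul_prod_factors r
      have := congrArg (Rat.cast : ℚ → ℝ) this
      push_cast at this
      exact this
    rw [h4, Finset.filter_true_of_mem fun p hp => Nat.prime_of_mem_primeFactors hp,
      Finset.prod_inv_distrib, one_div, mul_inv]
    simp_rw [hfa]
  set s := (Finset.Icc 1 Y).filter (fun n => ∏ p ∈ n.primeFactors, p = r) with hs
  have hsm : ∀ n ∈ s, r ∣ n ∧ n / r ∈ Nat.factoredNumbers r.primeFactors ∧ n ≠ 0 := by
    intro n hn
    simp only [hs, Finset.mem_filter, Finset.mem_Icc] at hn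
    obtain ⟨hn1, hn2⟩ := hn
    have hd : r ∣ n := hn2 ▸ Nat.prod_primeFactors_dvd n
    have hn0 : n ≠ 0 := by omega
    have hpf : r.primeFactors = n.primeFactors := by
      rw [← hn2, Nat.primeFactors_prod]
      exact fun p hp => Nat.prime_of_mem_primeFactors hp
    refine ⟨hd, Nat.mem_factoredNumbers_iff_primeFactors_subset.mpr ⟨?_, ?_⟩, hn0⟩
    · exact (Nat.div_pos (Nat.le_of_dvd (Nat.pos_of_ne_zero hn0) hd)
        (Nat.pos_of_ne_zero hr.ne_zero)).ne'
    · rw [hpf]; exact Nat.primeFactors_mono (Nat.div_dvd_of_dvd hd) hn0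
  have h5 : ∑ n ∈ s, (1 : ℝ) / n = (r : ℝ)⁻¹ * ∑ n ∈ s.attach,
      f ((⟨n.1 / r, (hsm n.1 n.2).2.1⟩ : Nat.factoredNumbers r.primeFactors) : ℕ) := by
    rw [← Finset.sum_attach, Finset.mul_sum]
    refine Finset.sum_congr rfl fun n _ => ?_
    have := (hsm n.1 n.2).1
    rw [hfa]
    simp only
    rw [Nat.cast_div this hr0]; field_simp
  rw [h5, h3]
  refine mul_le_mul_of_nonneg_left ?_ (by positivity)
  rw [← Finset.sum_image (s := s.attach)
    (g := fun n => (⟨n.1 / r, (hsm n.1 n.2).2.1⟩ : Nat.factoredNumbers r.primeFactors))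
    (f := fun m : Nat.factoredNumbers r.primeFactors => f m)]
  · refine sum_le_hasSum _ (fun m _ => ?_) h2
    rw [hfa]; positivity
  · intro n _ m _ h
    simp only [Subtype.mk.injEq] at h
    have h6 := (hsm n.1 n.2).1
    have h7 := (hsm m.1 m.2).1
    ext
    rw [← Nat.div_mul_cancel h6, ← Nat.div_mul_cancel h7, h]

theorem log_le_sum_squarefree (Y : ℕ) :
    Real.log Y ≤ ∑ r ∈ (Finset.Icc 1 Y).filter Squarefree, 1 / (r.totient : ℝ) := by
  have h0 : Real.log Y ≤ ∑ n ∈ Finset.Icc 1 Y, (1 : ℝ) / n := by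
    rcases Nat.eq_zero_or_pos Y with rfl | hY
    · simp
    · have h1 := log_add_one_le_harmonic Y
      have h2 : Real.log Y ≤ Real.log ((Y + 1 : ℕ) : ℝ) :=
        Real.log_le_log (by exact_mod_cast hY) (by push_cast; linarith)
      refine h2.trans (h1.trans (le_of_eq ?_))
      rw [harmonic_eq_sum_Icc]; push_cast
      simp
  refine h0.trans ?_
  rw [← Finset.sum_fiberwise_of_maps_to (s := Finset.Icc 1 Y)
    (t := (Finset.Icc 1 Y).filter Squarefree) (g := fun n => ∏ p ∈ n.primeFactors, p)]
  · refine Finset.sum_le_sum fun r hr => sum_inv_le_inv_totient r Y (Finset.mem_filter.mp hr).2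
  · intro n hn
    simp only [Finset.mem_Icc, Finset.mem_filter] at hn ⊢
    have h1 := Nat.le_of_dvd (by omega) (Nat.prod_primeFactors_dvd n)
    have h2 : 0 < ∏ p ∈ n.primeFactors, p := Finset.prod_pos fun p hp => (Nat.prime_of_mem_primeFactors hp).pos
    refine ⟨⟨h2, by omega⟩, ?_⟩
    refine Finset.squarefree_prod_of_pairwise_isCoprime ?_ ?_
    rotate_left
    · exact fun p hp => (Nat.prime_of_mem_primeFactors hp).squarefree
    · intro p hp q hq hpq
      rw [Function.onFun, ← Nat.coprime_iff_isRelPrime]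
      exact (Nat.coprime_primes (Nat.prime_of_mem_primeFactors hp)
        (Nat.prime_of_mem_primeFactors hq)).mpr hpq

/-- The Euler product `∏_{p ≤ T} (1 - 1/p)⁻¹`, written as a sum. -/
noncomputable def mertE (T : ℕ) : ℝ := ∑ l ∈ (primorial T).divisors, 1 / (l.totient : ℝ)

theorem log_le_mertE_mul_sieveG (T Y : ℕ) : Real.log Y ≤ mertE T * sieveG T Y := by
  classical
  refine (log_le_sum_squarefree Y).trans ?_
  have hP : primorial T ≠ 0 := (primorial_pos T).ne'
  rw [mertE, sieveG, Finset.sum_mul_sum, ← Finset.sum_product']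
  have hfac : ∀ r : ℕ, r ≠ 0 → Squarefree r → r.gcd (primorial T) * (r / r.gcd (primorial T)) = r ∧
      (r.gcd (primorial T)).Coprime (r / r.gcd (primorial T)) := by
    intro r hr0 hr
    have h1 := Nat.mul_div_cancel' (Nat.gcd_dvd_left r (primorial T))
    refine ⟨h1, ?_⟩
    rw [← h1] at hr
    exact Nat.coprime_of_squarefree_mul hr
  set g : ℕ → ℕ × ℕ := fun r => (r.gcd (primorial T), r / r.gcd (primorial T)) with hg
  have h1 : ∀ r ∈ (Finset.Icc 1 Y).filter Squarefree, 1 / (r.totient : ℝ) =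
      1 / ((g r).1.totient : ℝ) * (1 / ((g r).2.totient : ℝ)) := by
    intro r hr
    simp only [Finset.mem_Icc, Finset.mem_filter] at hr
    obtain ⟨h2, h3⟩ := hfac r (by omega) hr.2
    have h4 : r.totient = (g r).1.totient * (g r).2.totient := by
      conv_lhs => rw [← h2]
      exact Nat.totient_mul h3
    rw [h4]; push_cast; rw [one_div_mul_one_div]
  rw [Finset.sum_congr rfl h1, ← Finset.sum_image (g := g)
    (f := fun z : ℕ × ℕ => 1 / (z.1.totient : ℝ) * (1 / (z.2.totient : ℝ)))]
  · refine Finset.sum_le_sum_of_subset_of_nonneg ?_ fun _ _ _ => by positivity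
    intro z hz
    obtain ⟨r, hr, rfl⟩ := Finset.mem_image.mp hz
    simp only [Finset.mem_Icc, Finset.mem_filter] at hr
    obtain ⟨h2, h3⟩ := hfac r (by omega) hr.2
    rw [Finset.mem_product]
    refine ⟨Nat.mem_divisors.mpr ⟨Nat.gcd_dvd_right _ _, hP⟩, mem_roughSet.mpr ⟨⟨?_, ?_⟩, ?_, ?_⟩⟩
    · exact Nat.div_pos (Nat.gcd_le_left _ (by omega)) (Nat.gcd_pos_of_pos_left _ (by omega))
    · exact (Nat.div_le_self _ _).trans hr.1.2
    · exact hr.2.squarefree_of_dvd (Nat.div_dvd_of_dvd (Nat.gcd_dvd_left _ _))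
    · show (r / r.gcd (primorial T)).Coprime (primorial T)
      refine Nat.coprime_of_dvd fun p hp hpr hpP => ?_
      have h5 : p ∣ r.gcd (primorial T) :=
        Nat.dvd_gcd (hpr.trans (Nat.div_dvd_of_dvd (Nat.gcd_dvd_left _ _))) hpP
      exact hp.not_dvd_one (h3 ▸ Nat.dvd_gcd h5 hpr)
  · intro r hr r' hr' h
    simp only [Finset.coe_filter, Finset.mem_Icc, Set.mem_ofPred_eq] at hr hr'
    rw [← (hfac r (by omega) hr.2).1, ← (hfac r' (by omega) hr'.2).1]
    simp only [hg, Prod.mk.injEq] at h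
    rw [h.2]
    congr 1
    exact h.1

theorem sum_log_div_prime_le (n : ℕ) (hn : 1 ≤ n) :
    ∑ p ∈ (Finset.Icc 1 n).filter Nat.Prime, Real.log p / p ≤ Real.log n + Real.log 4 := by
  have hn0 : (0 : ℝ) < n := by exact_mod_cast hn
  have h1 : ∑ k ∈ Finset.Icc 1 n, ∑ p ∈ (Finset.Icc 1 n).filter Nat.Prime,
      (if p ∣ k then Real.log p else 0) ≤ n * Real.log n := by
    calc _ ≤ ∑ k ∈ Finset.Icc 1 n, Real.log n := by
          refine Finset.sum_le_sum fun k hk => ?_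
          have hk' := Finset.mem_Icc.mp hk
          rw [← Finset.sum_filter]
          have : ((Finset.Icc 1 n).filter Nat.Prime).filter (· ∣ k) = k.primeFactors := by
            ext p
            simp only [Finset.mem_filter, Finset.mem_Icc, Nat.mem_primeFactors]
            constructor
            · rintro ⟨⟨_, h⟩, h2⟩; exact ⟨h, h2, by omega⟩
            · rintro ⟨h, h2, h3⟩
              exact ⟨⟨⟨h.one_le, (Nat.le_of_dvd (by omega) h2).trans hk'.2⟩, h⟩, h2⟩
          rw [this, ← Real.log_prod fun p hp =>
            by exact_mod_cast (Nat.prime_of_mem_primeFactors hp).ne_zero]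
          have h2 := Nat.le_of_dvd (by omega) (Nat.prod_primeFactors_dvd k)
          have h3 : 0 < ∏ p ∈ k.primeFactors, p :=
            Finset.prod_pos fun p hp => (Nat.prime_of_mem_primeFactors hp).pos
          rw [← Nat.cast_prod]
          apply Real.log_le_log
          · exact_mod_cast h3
          · exact_mod_cast h2.trans hk'.2
      _ = _ := by simp
  rw [Finset.sum_comm] at h1
  have h2 : ∀ p ∈ (Finset.Icc 1 n).filter Nat.Prime, n * (Real.log p / p) - Real.log p ≤
      ∑ k ∈ Finset.Icc 1 n, (if p ∣ k then Real.log p else 0) := by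
    intro p hp
    simp only [Finset.mem_filter, Finset.mem_Icc] at hp
    have hp0 : (0 : ℝ) < p := by exact_mod_cast hp.2.pos
    rw [← Finset.sum_filter, Finset.sum_const, nsmul_eq_mul]
    have h3 : ((Finset.Icc 1 n).filter (p ∣ ·)).card = n / p := by
      have := Nat.Ioc_filter_dvd_card_eq_div n p
      rw [← this]; congr 1
    rw [h3]
    have h4 : (n : ℝ) / p - 1 ≤ ((n / p : ℕ) : ℝ) := by
      have := Nat.lt_div_mul_add (a := n) hp.2.pos
      have h5 : (n : ℝ) < (n / p : ℕ) * p + p := by exact_mod_cast this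
      rw [sub_le_iff_le_add, div_le_iff₀ hp0]; linarith
    have h5 : 0 ≤ Real.log p := Real.log_natCast_nonneg _
    calc n * (Real.log p / p) - Real.log p = (n / p - 1) * Real.log p := by ring
      _ ≤ _ := by gcongr
  have h3 := (Finset.sum_le_sum h2).trans h1
  rw [Finset.sum_sub_distrib, ← Finset.mul_sum] at h3
  have h4 : ∑ p ∈ (Finset.Icc 1 n).filter Nat.Prime, Real.log p ≤ Real.log 4 * n := by
    have := Chebyshev.theta_le_log4_mul_x (x := n) (by positivity)
    unfold Chebyshev.theta at this
    rw [Nat.floor_natCast] at this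
    exact this
  have h5 : n * ∑ p ∈ (Finset.Icc 1 n).filter Nat.Prime, Real.log p / p ≤
      n * (Real.log n + Real.log 4) := by linarith
  exact le_of_mul_le_mul_left h5 hn0

theorem mertE_eq_prod (T : ℕ) :
    mertE T = ∏ p ∈ (Finset.Icc 1 T).filter Nat.Prime, (1 + 1 / ((p : ℝ) - 1)) := by
  set f : ArithmeticFunction ℝ := ⟨fun n => 1 / (n.totient : ℝ), by simp⟩ with hf
  have hfa : ∀ n, f n = 1 / (n.totient : ℝ) := fun n => rfl
  have hm : f.IsMultiplicative := by
    refine ⟨by simp [hfa], fun {m n} h => ?_⟩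
    rw [hfa, hfa, hfa, Nat.totient_mul h]; push_cast; rw [one_div_mul_one_div]
  have hpf : (primorial T).primeFactors = (Finset.Icc 1 T).filter Nat.Prime := by
    unfold primorial
    rw [Nat.primeFactors_prod]
    · ext p
      simp only [Finset.mem_filter, Finset.mem_range, Finset.mem_Icc]
      constructor
      · rintro ⟨h, h2⟩; exact ⟨⟨h2.one_le, by omega⟩, h2⟩
      · rintro ⟨h, h2⟩; exact ⟨by omega, h2⟩
    · exact fun p hp => (Finset.mem_filter.mp hp).2
  have hsq : Squarefree (primorial T) := by
    unfold primorial
    refine Finset.squarefree_prod_of_pairwise_isCoprime ?_ ?_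
    rotate_left
    · exact fun p hp => (Finset.mem_filter.mp hp).2.squarefree
    · intro p hp q hq hpq
      rw [Function.onFun, ← Nat.coprime_iff_isRelPrime]
      exact (Nat.coprime_primes (Finset.mem_filter.mp hp).2 (Finset.mem_filter.mp hq).2).mpr hpq
  have := hm.prodPrimeFactors_one_add_of_squarefree hsq
  rw [mertE, ← hpf]
  simp_rw [hfa] at this
  rw [← this]
  refine Finset.prod_congr rfl fun p hp => ?_
  have hp := Nat.prime_of_mem_primeFactors hp
  rw [Nat.totient_prime hp, Nat.cast_sub hp.one_le, Nat.cast_one]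

theorem exists_mertE_le (ε : ℝ) (hε : 0 < ε) :
    ∃ C : ℝ, 1 ≤ C ∧ ∀ T : ℕ, 1 ≤ T → mertE T ≤ C * (T : ℝ) ^ ε := by
  obtain ⟨z, hz⟩ : ∃ z : ℕ, Real.exp (2 / ε) ≤ z := exists_nat_ge _
  have hz1 : (1 : ℝ) < z := lt_of_lt_of_le (Real.one_lt_exp_iff.mpr (by positivity)) hz
  have hlz : 2 / ε ≤ Real.log z := by
    rw [Real.le_log_iff_exp_le (by linarith)]; exact hz
  have hl4 : 0 ≤ Real.log 4 := Real.log_nonneg (by norm_num)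
  refine ⟨Real.exp (2 * z + ε * Real.log 4), Real.one_le_exp (by positivity), fun T hT => ?_⟩
  have hT0 : (0 : ℝ) < T := by exact_mod_cast hT
  rw [mertE_eq_prod, Real.rpow_def_of_pos hT0, ← Real.exp_add]
  calc ∏ p ∈ (Finset.Icc 1 T).filter Nat.Prime, (1 + 1 / ((p : ℝ) - 1))
      ≤ ∏ p ∈ (Finset.Icc 1 T).filter Nat.Prime, Real.exp (2 / (p : ℝ)) := by
        refine Finset.prod_le_prod (fun p hp => ?_) fun p hp => ?_
        · have := (Finset.mem_filter.mp hp).2.one_lt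
          have h1 : (1 : ℝ) < p := by exact_mod_cast this
          have : 0 < (p : ℝ) - 1 := by linarith
          positivity
        · have := (Finset.mem_filter.mp hp).2.two_le
          have h1 : (2 : ℝ) ≤ p := by exact_mod_cast this
          have h2 : 1 / ((p : ℝ) - 1) ≤ 2 / p := by
            rw [div_le_div_iff₀ (by linarith) (by linarith)]; linarith
          have h3 := Real.add_one_le_exp (2 / (p : ℝ))
          linarith
    _ = Real.exp (∑ p ∈ (Finset.Icc 1 T).filter Nat.Prime, 2 / (p : ℝ)) := (Real.exp_sum _ _).symm
    _ ≤ _ := by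
        apply Real.exp_le_exp.mpr
        have h1 : ∀ p ∈ (Finset.Icc 1 T).filter Nat.Prime, 2 / (p : ℝ) ≤
            (if p ∈ Finset.Icc 1 z then 2 else 0) + ε * (Real.log p / p) := by
          intro p hp
          obtain ⟨hp1, hp2⟩ := Finset.mem_filter.mp hp
          have h1 : (1 : ℝ) ≤ p := by exact_mod_cast hp2.one_le
          have h2 : 0 ≤ Real.log p := Real.log_nonneg h1
          split_ifs with h
          · have : 2 / (p : ℝ) ≤ 2 := div_le_self (by norm_num) h1
            have : 0 ≤ ε * (Real.log p / p) := by positivity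
            linarith
          · have h3 : z < p := by
              rw [Finset.mem_Icc] at h; have := hp2.one_le; omega
            have h4 : Real.log z ≤ Real.log p :=
              Real.log_le_log (by linarith) (by exact_mod_cast h3.le)
            have h5 : 2 ≤ ε * Real.log p := by
              have := (div_le_iff₀ hε).mp (hlz.trans h4); linarith
            rw [zero_add, mul_div_assoc']
            gcongr
        refine (Finset.sum_le_sum h1).trans ?_
        rw [Finset.sum_add_distrib, ← Finset.mul_sum]
        have h2 := sum_log_div_prime_le T hT
        have h3 : ∑ p ∈ (Finset.Icc 1 T).filter Nat.Prime, (if p ∈ Finset.Icc 1 z then (2 : ℝ) else 0)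
            ≤ 2 * z := by
          rw [← Finset.sum_filter, Finset.sum_const, nsmul_eq_mul]
          have : ((Finset.filter Nat.Prime (Finset.Icc 1 T)).filter (· ∈ Finset.Icc 1 z)).card ≤ z := by
            calc _ ≤ (Finset.Icc 1 z).card := Finset.card_le_card fun p hp => (Finset.mem_filter.mp hp).2
              _ = z := by simp
          have : (((Finset.filter Nat.Prime (Finset.Icc 1 T)).filter (· ∈ Finset.Icc 1 z)).card : ℝ) ≤ z := by
            exact_mod_cast this
          linarith
        nlinarith

theorem mertE_pos (T : ℕ) : 0 < mertE T := by
  refine Finset.sum_pos (fun l hl => ?_) ⟨1, Nat.one_mem_divisors.mpr (primorial_pos T).ne'⟩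
  have := Nat.totient_pos.mpr (Nat.pos_of_mem_divisors hl)
  positivity

theorem prime_large_sieve {ι : Type*} (P : Finset ι) (c : ι → ℤ) (q : ι → ℕ) (x : ι → ℝ)
    (L : ℕ) (hL : 0 < L) (A : ℕ) (s : Finset ℕ) (hs : s ⊆ Finset.Ico A (A + L)) (a : ℕ → ℂ)
    (T Y : ℕ) (V : ℝ) (hV : 0 ≤ V) (hq : ∀ i ∈ P, 1 ≤ q i ∧ q i ≤ T) (hx : ∀ i ∈ P, |x i| ≤ V / L)
    (hsep : ∀ i ∈ P, ∀ j ∈ P, i ≠ j →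
      ∀ k : ℤ, (c i : ℝ) / q i - c j / q j = k → 1 / (L : ℝ) ≤ |x i - x j|)
    (hcop : ∀ n ∈ s, n.Prime ∧ Y < n)
    (hsize : ((T : ℝ) * Y) ^ 2 * (2 * V + 1) ≤ L) :
    Real.log Y * ∑ i ∈ P, ‖trig s a (c i / q i + x i)‖ ^ 2 ≤
      mertE T * (lsC * L * ∑ n ∈ s, ‖a n‖ ^ 2) := by
  have h := arith_large_sieve P c q x L hL A s hs a T Y V hV hq hx hsep ?_ hsize
  · calc _ ≤ mertE T * sieveG T Y * ∑ i ∈ P, ‖trig s a (c i / q i + x i)‖ ^ 2 := by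
          gcongr; exact log_le_mertE_mul_sieveG T Y
      _ = mertE T * (sieveG T Y * ∑ i ∈ P, ‖trig s a (c i / q i + x i)‖ ^ 2) := by ring
      _ ≤ _ := mul_le_mul_of_nonneg_left h (mertE_pos T).le
  · intro n hn r hr
    have hr' := mem_roughSet.mp hr
    obtain ⟨h1, h2⟩ := hcop n hn
    refine (Nat.Prime.coprime_iff_not_dvd h1).mpr fun hd => ?_
    have := Nat.le_of_dvd (by omega) hd
    omega

theorem brun_titchmarsh (q c A J T Y : ℕ) (hq : 1 ≤ q) (hqT : q ≤ T) (hJ : 0 < J)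
    (hsize : ((T : ℝ) * Y) ^ 2 ≤ J) :
    (((Finset.Ico A (A + J)).filter fun n => n.Prime ∧ Y < n ∧ n % q = c).card : ℝ) *
      (q * Real.log Y) ≤ mertE T * (lsC * J) := by
  set s := (Finset.Ico A (A + J)).filter fun n => n.Prime ∧ Y < n ∧ n % q = c with hs
  have hq0 : (q : ℝ) ≠ 0 := by positivity
  have h := prime_large_sieve (Finset.range q) (fun i => (i : ℤ)) (fun _ => q) (fun _ => 0) J hJ A s
    (Finset.filter_subset _ _) (fun _ => 1) T Y 0 le_rfl (fun _ _ => ⟨hq, hqT⟩) (by simp) ?_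
    (fun n hn => ⟨(Finset.mem_filter.mp hn).2.1, (Finset.mem_filter.mp hn).2.2.1⟩)
    (by simpa using hsize)
  · have h1 : ∀ i ∈ Finset.range q, ‖trig s (fun _ => 1) (((i : ℤ) : ℝ) / q + 0)‖ ^ 2
        = (s.card : ℝ) ^ 2 := by
      intro i _
      have h2 : trig s (fun _ => 1) (((i : ℤ) : ℝ) / q + 0) = s.card * expi (c * (i / q)) := by
        rw [trig, Finset.sum_congr rfl fun n hn => ?_, Finset.sum_const, nsmul_eq_mul]
        have h3 := (Finset.mem_filter.mp hn).2.2.2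
        have h4 : (n : ℝ) = c + q * (n / q : ℕ) := by
          rw [← h3]; exact_mod_cast (Nat.mod_add_div n q).symm
        rw [one_mul, h4, add_zero, ← expi_add_int (c * (i / q)) (((n / q : ℕ) : ℤ) * i)]
        congr 1
        rw [Int.cast_mul, Int.cast_natCast, Int.cast_natCast]
        field_simp
      rw [h2, norm_mul, norm_expi, mul_one, Complex.norm_natCast]
    rw [Finset.sum_congr rfl h1] at h
    simp only [Finset.sum_const, Finset.card_range, nsmul_eq_mul, norm_one, one_pow, mul_one] at h
    rcases Nat.eq_zero_or_pos s.card with h5 | h5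
    · rw [h5]; have := mertE_pos T; have := lsC_pos; simp; positivity
    · have h6 : (0 : ℝ) < s.card := by exact_mod_cast h5
      apply le_of_mul_le_mul_right _ h6
      linarith
  · intro i hi j hj hij k hk
    exfalso
    rw [Finset.mem_range] at hi hj
    have h1 : ((i : ℤ) : ℝ) - (j : ℤ) = k * q := by
      field_simp at hk; linarith
    have h2 : (i : ℤ) - j = k * q := by exact_mod_cast h1
    have := Int.eq_zero_of_abs_lt_dvd (Dvd.intro_left k h2.symm) (by rw [abs_lt]; constructor <;> omega)
    omega

/-- The integers in `[X, √2 X]`. -/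
noncomputable def win (X : ℝ) : Finset ℕ := Finset.Icc ⌈X⌉₊ ⌊√2 * X⌋₊

/-- The primes in `[X, √2 X]`. -/
noncomputable def pwin (X : ℝ) : Finset ℕ := (win X).filter Nat.Prime

theorem mem_win {X : ℝ} {k : ℕ} (hX : 0 ≤ X) : k ∈ win X ↔ X ≤ k ∧ (k : ℝ) ≤ √2 * X := by
  rw [win, Finset.mem_Icc, Nat.ceil_le, Nat.le_floor_iff (by positivity)]

theorem mem_pwin {X : ℝ} {k : ℕ} (hX : 0 ≤ X) :
    k ∈ pwin X ↔ (X ≤ k ∧ (k : ℝ) ≤ √2 * X) ∧ k.Prime := by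
  rw [pwin, Finset.mem_filter, mem_win hX]

theorem sqrt_two_lt : √2 < 1.4143 := by
  rw [Real.sqrt_lt' (by norm_num)]; norm_num

theorem sum_log_pwin_le (X : ℝ) (hX : 0 ≤ X) : ∑ k ∈ pwin X, Real.log k ≤ 2 * X := by
  have h := Chebyshev.theta_le_log4_mul_x (x := √2 * X) (by positivity)
  have h1 : ∑ k ∈ pwin X, Real.log k ≤ Chebyshev.theta (√2 * X) := by
    unfold Chebyshev.theta
    refine Finset.sum_le_sum_of_subset_of_nonneg ?_ fun k _ _ => Real.log_natCast_nonneg _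
    intro k hk
    obtain ⟨h1, h2⟩ := (mem_pwin hX).mp hk
    simp only [Finset.mem_filter, Finset.mem_Ioc]
    exact ⟨⟨h2.pos, (Nat.le_floor_iff (by positivity)).mpr h1.2⟩, h2⟩
  have h2 : Real.log 4 < 1.3864 := by
    have : (4 : ℝ) = 2 ^ 2 := by norm_num
    rw [this, Real.log_pow]; have := Real.log_two_lt_d9; push_cast; linarith
  have h3 := sqrt_two_lt
  have h4 : Real.log 4 * (√2 * X) ≤ 1.3864 * (1.4143 * X) := by gcongr
  linarith

theorem exists_sieve_level {M : ℝ} (hM : 256 ≤ M) :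
    ∃ Y : ℕ, (Y : ℝ) ^ 2 ≤ √M ∧ Real.log M ≤ 8 * Real.log Y ∧ (Y : ℝ) < M ∧ 0 < Real.log Y := by
  set t := √√√M with ht
  have h2 : 2 ≤ t := by
    rw [ht]
    refine Real.le_sqrt_of_sq_le (Real.le_sqrt_of_sq_le (Real.le_sqrt_of_sq_le ?_))
    norm_num; linarith
  have e1 : t ^ 2 = √√M := Real.sq_sqrt (by positivity)
  have e2 : (t ^ 2) ^ 2 = √M := by rw [e1]; exact Real.sq_sqrt (by positivity)
  have e3 : ((t ^ 2) ^ 2) ^ 2 = M := by rw [e2]; exact Real.sq_sqrt (by positivity)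
  refine ⟨⌊t ^ 2⌋₊, ?_, ?_, ?_, ?_⟩
  · rw [← e2]; gcongr; exact Nat.floor_le (by positivity)
  all_goals
    have h3 := Nat.lt_floor_add_one (t ^ 2)
    have h4 : t ≤ ⌊t ^ 2⌋₊ := by nlinarith
  · have h5 : Real.log M = 8 * Real.log t := by
      rw [← e3, ← pow_mul, ← pow_mul, Real.log_pow]; norm_num
    rw [h5]; gcongr
  · have h5 := Nat.floor_le (show 0 ≤ t ^ 2 by positivity)
    have h6 : t ^ 2 < M := by
      rw [← e3]
      have : 4 ≤ t ^ 2 := by nlinarith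
      have h7 : t ^ 2 < (t ^ 2) ^ 2 := by nlinarith
      nlinarith
    linarith
  · exact Real.log_pos (by linarith)

theorem log_sqrt_two_mul_le {M : ℝ} (hM : 2 ≤ M) : Real.log (√2 * M) ≤ 2 * Real.log M := by
  have h1 : √2 * M ≤ M ^ 2 := by
    have := sqrt_two_lt; nlinarith
  calc Real.log (√2 * M) ≤ Real.log (M ^ 2) := Real.log_le_log (by positivity) h1
    _ = _ := by rw [Real.log_pow]; norm_num

/-- The large sieve over primes for the points `k (a/q + β)`, with representatives `k = rep z`
of distinct cells. -/
theorem prime_points_large_sieve (a : ℤ) (q : ℕ) (β τ X M : ℝ) (hq : 1 ≤ q) (haq : IsCoprime a q)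
    (hqτ : (q : ℝ) ≤ τ) (hβ : X * M * |β| ≤ τ) (hX : 1 ≤ X) (hM : 1296 * τ ^ 6 ≤ M)
    (J : ℕ) (hJ : 1 ≤ X * M * |β| → X / (X * M * |β|) ≤ J) (R : Finset ℕ)
    (hR : ∀ k ∈ R, (k : ℝ) ≤ √2 * X)
    (hsep : ∀ k ∈ R, ∀ k' ∈ R, k ≠ k' → k % q = k' % q →
      (J : ℝ) ≤ |(k : ℝ) - k'| ∧ 1 ≤ X * M * |β|) :
    ∑ k ∈ R, ‖trig (pwin M) (fun l => (Real.log l : ℂ)) (k * (a / q + β))‖ ^ 2 ≤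
      64 * lsC * mertE ⌈τ⌉₊ * M ^ 2 := by
  have hq1 : (1 : ℝ) ≤ q := by exact_mod_cast hq
  have hτ1 : 1 ≤ τ := hq1.trans hqτ
  have hM1 : 1296 ≤ M := by
    have : 1 ≤ τ ^ 6 := one_le_pow₀ hτ1
    linarith
  obtain ⟨Y, hY1, hY2, hY3, hY4⟩ := exists_sieve_level (M := M) (by linarith)
  have hT : ((⌈τ⌉₊ : ℕ) : ℝ) ≤ 2 * τ := by
    have := Nat.ceil_lt_add_one (show 0 ≤ τ by linarith); linarith
  have hL1 : M ≤ ⌈M⌉₊ := Nat.le_ceil M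
  have hL2 : ((⌈M⌉₊ : ℕ) : ℝ) ≤ 2 * M := by
    have := Nat.ceil_lt_add_one (show 0 ≤ M by linarith); linarith
  have hL0 : (0 : ℝ) < ⌈M⌉₊ := by linarith
  have key := prime_large_sieve R (fun k => k * a) (fun _ => q) (fun k => k * β) ⌈M⌉₊
    (by exact_mod_cast hL0) ⌈M⌉₊ (pwin M) ?_ (fun l => (Real.log l : ℂ)) ⌈τ⌉₊ Y (4 * τ)
    (by linarith) (fun _ _ => ⟨hq, by exact_mod_cast hqτ.trans (Nat.le_ceil τ)⟩) ?_ ?_ ?_ ?_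
  · have h1 : ∀ k ∈ R, ‖trig (pwin M) (fun l => (Real.log l : ℂ)) (k * (a / q + β))‖ ^ 2 =
        ‖trig (pwin M) (fun l => (Real.log l : ℂ)) (((k * a : ℤ) : ℝ) / q + k * β)‖ ^ 2 := by
      intro k _; congr 3; push_cast; ring
    rw [Finset.sum_congr rfl h1]
    have h2 : ∑ n ∈ pwin M, ‖(Real.log n : ℂ)‖ ^ 2 ≤ 4 * M * Real.log M := by
      calc ∑ n ∈ pwin M, ‖(Real.log n : ℂ)‖ ^ 2 ≤ ∑ n ∈ pwin M, Real.log n * (2 * Real.log M) := by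
            refine Finset.sum_le_sum fun n hn => ?_
            obtain ⟨h3, h4⟩ := (mem_pwin (by linarith)).mp hn
            have h5 : 0 ≤ Real.log n := Real.log_natCast_nonneg _
            rw [Complex.norm_real, Real.norm_eq_abs, abs_of_nonneg h5, sq]
            gcongr
            refine le_trans (Real.log_le_log (by exact_mod_cast h4.pos) h3.2)
              (log_sqrt_two_mul_le (by linarith))
        _ ≤ 2 * M * (2 * Real.log M) := by
            rw [← Finset.sum_mul]
            have := sum_log_pwin_le M (by linarith)
            have : 0 ≤ Real.log M := Real.log_nonneg (by linarith)
            gcongr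
        _ = _ := by ring
    have h3 := mertE_pos ⌈τ⌉₊
    have h4 := lsC_pos
    have h5 : Real.log Y * ∑ k ∈ R, ‖trig (pwin M) (fun l => (Real.log l : ℂ))
        (((k * a : ℤ) : ℝ) / q + k * β)‖ ^ 2 ≤ Real.log Y * (64 * lsC * mertE ⌈τ⌉₊ * M ^ 2) := by
      refine key.trans ?_
      calc mertE ⌈τ⌉₊ * (lsC * ⌈M⌉₊ * ∑ n ∈ pwin M, ‖(Real.log n : ℂ)‖ ^ 2)
          ≤ mertE ⌈τ⌉₊ * (lsC * (2 * M) * (4 * M * (8 * Real.log Y))) := by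
            gcongr
            exact h2.trans (by gcongr)
        _ = _ := by ring
    exact le_of_mul_le_mul_left h5 hY4
  · intro l hl
    have h := (mem_pwin (by linarith)).mp hl
    rw [Finset.mem_Ico]
    refine ⟨Nat.ceil_le.mpr h.1.1, ?_⟩
    have h1 := sqrt_two_lt
    have : (l : ℝ) < ((⌈M⌉₊ + ⌈M⌉₊ : ℕ) : ℝ) := by push_cast; nlinarith [h.1.2]
    exact_mod_cast this
  · intro k hk
    rw [abs_mul, Nat.abs_cast]
    have h1 := sqrt_two_lt
    have h2 : (k : ℝ) * |β| ≤ 2 * X * |β| := by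
      have := hR k hk
      gcongr; nlinarith
    have h3 : X * |β| ≤ τ / M := by
      rw [le_div_iff₀ (by linarith)]; linarith
    calc (k : ℝ) * |β| ≤ 2 * (τ / M) := by linarith
      _ = 4 * τ / (2 * M) := by field_simp; ring
      _ ≤ _ := by gcongr
  · intro k hk k' hk' hne m hm
    have hq0 : (q : ℝ) ≠ 0 := by positivity
    have h1 : ((k * a : ℤ) : ℝ) - ((k' * a : ℤ) : ℝ) = ((m * q : ℤ) : ℝ) := by
      push_cast at hm ⊢; field_simp at hm; linarith
    have h2 : (k * a : ℤ) - k' * a = m * q := by exact_mod_cast h1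
    have h3 : (q : ℤ) ∣ (k - k') := by
      refine haq.symm.dvd_of_dvd_mul_right ⟨m, ?_⟩
      linarith
    have h4 : k % q = k' % q := by
      have h5 : (k : ℤ) % q = k' % q := ((Int.modEq_iff_dvd).mpr h3).symm
      exact_mod_cast h5
    obtain ⟨h5, h6⟩ := hsep k hk k' hk' hne h4
    have h7 := (hJ h6).trans h5
    rw [← sub_mul, abs_mul, div_le_iff₀ hL0]
    have hβ0 : 0 < |β| := by
      rcases (abs_nonneg β).lt_or_eq with h | h
      · exact h
      · rw [← h] at h6; norm_num at h6
    have h8 : 1 / (M * |β|) ≤ |(k : ℝ) - k'| := by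
      refine le_trans (le_of_eq ?_) h7
      field_simp
    rw [div_le_iff₀ (by positivity)] at h8
    calc 1 ≤ |(k : ℝ) - k'| * (M * |β|) := h8
      _ ≤ |(k : ℝ) - k'| * (⌈M⌉₊ * |β|) := by gcongr
      _ = _ := by ring
  · intro n hn
    have h := (mem_pwin (by linarith)).mp hn
    exact ⟨h.2, by exact_mod_cast hY3.trans_le h.1.1⟩
  · refine le_trans ?_ hL1
    have h1 : 36 * τ ^ 3 ≤ √M := by
      apply Real.le_sqrt_of_sq_le
      calc (36 * τ ^ 3) ^ 2 = 1296 * τ ^ 6 := by ring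
        _ ≤ M := hM
    calc ((⌈τ⌉₊ : ℝ) * Y) ^ 2 * (2 * (4 * τ) + 1)
        = (⌈τ⌉₊ : ℝ) ^ 2 * (Y : ℝ) ^ 2 * (2 * (4 * τ) + 1) := by ring
      _ ≤ (2 * τ) ^ 2 * √M * (9 * τ) := by gcongr; linarith
      _ = 36 * τ ^ 3 * √M := by ring
      _ ≤ √M * √M := by gcongr
      _ = M := Real.mul_self_sqrt (by linarith)

/-- The bilinear form over primes on one pair of windows. -/
noncomputable def primeBlock (X M α : ℝ) : ℂ :=
  ∑ k ∈ pwin X, (Real.log k : ℂ) * trig (pwin M) (fun l => (Real.log l : ℂ)) (k * α)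

theorem cell_bound_aux {c q lX lY E l J B : ℝ} (hc : 0 ≤ c) (hq : 1 ≤ q) (hE : 0 ≤ E) (hl : 0 ≤ l)
    (h1 : lX ≤ 8 * lY) (h2 : J ≤ 2 * B) (h3 : c * (q * lY) ≤ E * (l * J)) :
    2 * (c * lX) ≤ 32 * l * E * B / q := by
  rw [le_div_iff₀ (by linarith)]
  calc 2 * (c * lX) * q ≤ 2 * (c * (8 * lY)) * q := by gcongr
    _ = 16 * (c * (q * lY)) := by ring
    _ ≤ 16 * (E * (l * (2 * B))) := by
        have : c * (q * lY) ≤ E * (l * (2 * B)) := h3.trans (by gcongr)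
        linarith
    _ = _ := by ring

set_option maxHeartbeats 1000000 in
theorem sum_log_mul_norm_sq_le (a : ℤ) (q : ℕ) (β τ X M : ℝ) (hq : 1 ≤ q) (haq : IsCoprime a q)
    (hqτ : (q : ℝ) ≤ τ) (hβ : X * M * |β| ≤ τ) (hX : 1296 * τ ^ 6 ≤ X) (hM : 1296 * τ ^ 6 ≤ M) :
    (∑ k ∈ pwin X, Real.log k *
      ‖trig (pwin M) (fun l => (Real.log l : ℂ)) (k * (a / q + β))‖ ^ 2) *
      (q * max 1 (X * M * |β|)) ≤ 4096 * lsC ^ 2 * mertE ⌈τ⌉₊ ^ 2 * X * M ^ 2 := by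
  classical
  have hq1 : (1 : ℝ) ≤ q := by exact_mod_cast hq
  have hτ1 : 1 ≤ τ := hq1.trans hqτ
  have hτ6 : 1 ≤ τ ^ 6 := one_le_pow₀ hτ1
  have hX1 : 1296 ≤ X := by linarith
  have hM1 : 1296 ≤ M := by linarith
  obtain ⟨Y, hY1, hY2, hY3, hY4⟩ := exists_sieve_level (M := X) (by linarith)
  have hT : ((⌈τ⌉₊ : ℕ) : ℝ) ≤ 2 * τ := by
    have := Nat.ceil_lt_add_one (show 0 ≤ τ by linarith); linarith
  set b : ℝ := max 1 (X * M * |β|) with hb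
  have hb1 : 1 ≤ b := le_max_left _ _
  have hbτ : b ≤ τ := max_le hτ1 hβ
  have hXb : 1 ≤ X / b := by
    rw [one_le_div (by linarith)]
    have : τ ≤ τ ^ 6 := le_self_pow₀ hτ1 (by norm_num)
    linarith
  set J : ℕ := ⌈X / b⌉₊ with hJ
  have hJ1 : X / b ≤ J := Nat.le_ceil _
  have hJ2 : (J : ℝ) ≤ 2 * (X / b) := by
    have := Nat.ceil_lt_add_one (show 0 ≤ X / b by linarith); linarith
  have hJ0 : 0 < J := by
    have : (0 : ℝ) < J := by linarith
    exact_mod_cast this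
  have hsize : ((⌈τ⌉₊ : ℝ) * Y) ^ 2 ≤ J := by
    refine le_trans ?_ hJ1
    have h1 : 36 * τ ^ 3 ≤ √X := by
      apply Real.le_sqrt_of_sq_le
      calc (36 * τ ^ 3) ^ 2 = 1296 * τ ^ 6 := by ring
        _ ≤ X := hX
    rw [le_div_iff₀ (by linarith)]
    calc ((⌈τ⌉₊ : ℝ) * Y) ^ 2 * b = (⌈τ⌉₊ : ℝ) ^ 2 * (Y : ℝ) ^ 2 * b := by ring
      _ ≤ (2 * τ) ^ 2 * √X * τ := by gcongr
      _ = 4 * τ ^ 3 * √X := by ring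
      _ ≤ √X * √X := by
        have : 0 < τ ^ 3 := by positivity
        gcongr; linarith
      _ = X := Real.mul_self_sqrt (by linarith)
  set K := ⌈X⌉₊ with hK
  set κ : ℕ → ℕ × ℕ := fun k => (k % q, (k - K) / J) with hκ
  set f : ℕ → ℝ := fun k => ‖trig (pwin M) (fun l => (Real.log l : ℂ)) (k * (a / q + β))‖ ^ 2
    with hf
  have hf0 : ∀ k, 0 ≤ f k := fun k => by positivity
  set Z := (pwin X).image κ with hZ
  have hrep : ∀ z : ℕ × ℕ, ∃ k, z ∈ Z → (k ∈ pwin X ∧ κ k = z ∧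
      ∀ k' ∈ pwin X, κ k' = z → f k' ≤ f k) := by
    intro z
    by_cases hz : z ∈ Z
    · obtain ⟨k0, hk0, hk0z⟩ := Finset.mem_image.mp hz
      obtain ⟨k, hk, hmax⟩ := Finset.exists_max_image ((pwin X).filter (κ · = z)) f
        ⟨k0, Finset.mem_filter.mpr ⟨hk0, hk0z⟩⟩
      rw [Finset.mem_filter] at hk
      exact ⟨k, fun _ => ⟨hk.1, hk.2, fun k' h1 h2 => hmax k' (Finset.mem_filter.mpr ⟨h1, h2⟩)⟩⟩
    · exact ⟨0, fun h => absurd h hz⟩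
  choose rep hrep using hrep
  set R := Z.image rep with hR
  have hRp : ∀ k ∈ R, k ∈ pwin X := by
    intro k hk
    obtain ⟨z, hz, rfl⟩ := Finset.mem_image.mp hk
    exact (hrep z hz).1
  have hRinj : ∀ k ∈ R, ∀ k' ∈ R, κ k = κ k' → k = k' := by
    intro k hk k' hk' h
    obtain ⟨z, hz, rfl⟩ := Finset.mem_image.mp hk
    obtain ⟨z', hz', rfl⟩ := Finset.mem_image.mp hk'
    rw [(hrep z hz).2.1, (hrep z' hz').2.1] at h
    rw [h]
  have hpar : ∀ i : ℕ, ∑ k ∈ R.filter (fun k => (κ k).2 % 2 = i), f k ≤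
      64 * lsC * mertE ⌈τ⌉₊ * M ^ 2 := by
    intro i
    refine prime_points_large_sieve a q β τ X M hq haq hqτ hβ (by linarith) hM J ?_ _ ?_ ?_
    · intro h
      rw [hb, max_eq_right h] at hJ1
      exact hJ1
    · intro k hk
      exact ((mem_pwin (by linarith)).mp (hRp k (Finset.mem_filter.mp hk).1)).1.2
    · intro k hk k' hk' hne hkk
      rw [Finset.mem_filter] at hk hk'
      have h1 := (mem_pwin (by linarith)).mp (hRp k hk.1)
      have h2 := (mem_pwin (by linarith)).mp (hRp k' hk'.1)
      have h3 : K ≤ k := Nat.ceil_le.mpr h1.1.1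
      have h4 : K ≤ k' := Nat.ceil_le.mpr h2.1.1
      have h5 : (k - K) / J ≠ (k' - K) / J := by
        intro h
        exact hne (hRinj k hk.1 k' hk'.1 (Prod.ext hkk h))
      have h6 : ((k - K) / J) % 2 = ((k' - K) / J) % 2 := hk.2.trans hk'.2.symm
      have e1 := Nat.div_mul_le_self (k - K) J
      have e2 := Nat.div_mul_le_self (k' - K) J
      have e3 := Nat.lt_div_mul_add (a := k - K) hJ0
      have e4 := Nat.lt_div_mul_add (a := k' - K) hJ0
      set m := (k - K) / J
      set m' := (k' - K) / J
      constructor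
      · have h7 : J ≤ (k - k') ∨ J ≤ k' - k := by
          rcases Nat.lt_or_ge m m' with h | h
          · right
            have : m + 2 ≤ m' := by omega
            have : (m + 2) * J ≤ m' * J := Nat.mul_le_mul_right _ this
            have : (m + 2) * J = m * J + 2 * J := by ring
            omega
          · left
            have : m' + 2 ≤ m := by omega
            have : (m' + 2) * J ≤ m * J := Nat.mul_le_mul_right _ this
            have : (m' + 2) * J = m' * J + 2 * J := by ring
            omega
        rcases h7 with h7 | h7
        · have h8 : J + k' ≤ k := by omega
          have h9 : (J : ℝ) + k' ≤ k := by exact_mod_cast h8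
          rw [le_abs]; left; linarith
        · have h8 : J + k ≤ k' := by omega
          have h9 : (J : ℝ) + k ≤ k' := by exact_mod_cast h8
          rw [le_abs]; right; linarith
      · by_contra hlt
        push Not at hlt
        have h7 : b = 1 := by rw [hb, max_eq_left hlt.le]
        have h8 : K = J := by rw [hJ, hK, h7, div_one]
        have h9 : ∀ n : ℕ, K ≤ n → (n : ℝ) ≤ √2 * X → (n - K) / J = 0 := by
          intro n h10 h11
          rw [Nat.div_eq_zero_iff]; right
          have h12 : (n : ℝ) < 2 * X := by have := sqrt_two_lt; nlinarith
          have h13 : X ≤ K := Nat.le_ceil X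
          have h14 : (n : ℝ) < ((K + K : ℕ) : ℝ) := by push_cast; linarith
          have h15 : n < K + K := by exact_mod_cast h14
          omega
        exact h5 ((h9 k h3 h1.1.2).trans (h9 k' h4 h2.1.2).symm)
  have hRsum : ∑ k ∈ R, f k ≤ 128 * lsC * mertE ⌈τ⌉₊ * M ^ 2 := by
    have h1 : R = R.filter (fun k => (κ k).2 % 2 = 0) ∪ R.filter (fun k => (κ k).2 % 2 = 1) := by
      rw [← Finset.filter_or, Finset.filter_true_of_mem]
      intro k _; omega
    have h2 : ∑ k ∈ R, f k ≤ ∑ k ∈ R.filter (fun k => (κ k).2 % 2 = 0), f k +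
        ∑ k ∈ R.filter (fun k => (κ k).2 % 2 = 1), f k := by
      rw [← Finset.sum_union_inter, ← h1]
      have : 0 ≤ ∑ k ∈ R.filter (fun k => (κ k).2 % 2 = 0) ∩ R.filter (fun k => (κ k).2 % 2 = 1), f k :=
        Finset.sum_nonneg fun k _ => hf0 k
      linarith
    have := hpar 0
    have := hpar 1
    linarith
  have hlsC := lsC_pos
  have hmE := mertE_pos ⌈τ⌉₊
  have hlX : 0 < Real.log X := Real.log_pos (by linarith)
  have hcell : ∀ z ∈ Z, ∑ k ∈ (pwin X).filter (κ · = z), Real.log k * f k ≤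
      f (rep z) * (32 * lsC * mertE ⌈τ⌉₊ * (X / b) / q) := by
    intro z hz
    have h1 : ((((pwin X).filter (κ · = z)).card : ℕ) : ℝ) * (q * Real.log Y) ≤
        mertE ⌈τ⌉₊ * (lsC * J) := by
      refine le_trans ?_ (brun_titchmarsh q z.1 (K + z.2 * J) J ⌈τ⌉₊ Y hq
        (by exact_mod_cast hqτ.trans (Nat.le_ceil τ)) hJ0 hsize)
      gcongr
      intro k hk
      obtain ⟨h1, h2⟩ := Finset.mem_filter.mp hk
      have h3 := (mem_pwin (by linarith)).mp h1
      have h4 : K ≤ k := Nat.ceil_le.mpr h3.1.1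
      rw [Finset.mem_filter, Finset.mem_Ico]
      rw [← h2]
      have e1 := Nat.div_mul_le_self (k - K) J
      have e3 := Nat.lt_div_mul_add (a := k - K) hJ0
      simp only [hκ]
      refine ⟨by omega, h3.2, ?_, trivial⟩
      exact_mod_cast hY3.trans_le h3.1.1
    calc ∑ k ∈ (pwin X).filter (κ · = z), Real.log k * f k
        ≤ ∑ k ∈ (pwin X).filter (κ · = z), (2 * Real.log X) * f (rep z) := by
          refine Finset.sum_le_sum fun k hk => ?_
          obtain ⟨h2, h3⟩ := Finset.mem_filter.mp hk
          have h4 := (mem_pwin (by linarith)).mp h2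
          have h5 := (hrep z hz).2.2 k h2 h3
          have h6 := hf0 k
          gcongr
          exact le_trans (Real.log_le_log (by exact_mod_cast h4.2.pos) h4.1.2)
            (log_sqrt_two_mul_le (by linarith))
      _ = f (rep z) * (2 * (((pwin X).filter (κ · = z)).card * Real.log X)) := by
          rw [Finset.sum_const, nsmul_eq_mul]; ring
      _ ≤ f (rep z) * (32 * lsC * mertE ⌈τ⌉₊ * (X / b) / q) := by
          exact mul_le_mul_of_nonneg_left (cell_bound_aux (Nat.cast_nonneg _) hq1 hmE.le hlsC.le
            (by linarith) hJ2 h1) (hf0 _)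
  have htot : ∑ k ∈ pwin X, Real.log k * f k ≤
      (128 * lsC * mertE ⌈τ⌉₊ * M ^ 2) * (32 * lsC * mertE ⌈τ⌉₊ * (X / b) / q) := by
    rw [← Finset.sum_fiberwise_of_maps_to (t := Z) (g := κ)
      (fun k hk => Finset.mem_image_of_mem _ hk)]
    refine (Finset.sum_le_sum hcell).trans ?_
    rw [← Finset.sum_mul]
    refine mul_le_mul_of_nonneg_right ?_ (by positivity)
    rw [← Finset.sum_image (g := rep) (f := f)]
    · exact hRsum
    · intro z hz z' hz' h
      rw [← (hrep z hz).2.1, ← (hrep z' hz').2.1, h]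
  calc _ ≤ (128 * lsC * mertE ⌈τ⌉₊ * M ^ 2) * (32 * lsC * mertE ⌈τ⌉₊ * (X / b) / q) *
        (q * b) := by gcongr
    _ = _ := by field_simp; ring

theorem norm_primeBlock_sq_le (a : ℤ) (q : ℕ) (β τ X M : ℝ) (hq : 1 ≤ q) (haq : IsCoprime a q)
    (hqτ : (q : ℝ) ≤ τ) (hβ : X * M * |β| ≤ τ) (hX : 1296 * τ ^ 6 ≤ X) (hM : 1296 * τ ^ 6 ≤ M) :
    ‖primeBlock X M (a / q + β)‖ ^ 2 * (q * max 1 (X * M * |β|)) ≤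
      8192 * lsC ^ 2 * mertE ⌈τ⌉₊ ^ 2 * (X * M) ^ 2 := by
  have hq1 : (1 : ℝ) ≤ q := by exact_mod_cast hq
  have hτ6 : 1 ≤ τ ^ 6 := one_le_pow₀ (hq1.trans hqτ)
  have h := sum_log_mul_norm_sq_le a q β τ X M hq haq hqτ hβ hX hM
  set g : ℕ → ℝ := fun k => ‖trig (pwin M) (fun l => (Real.log l : ℂ)) (k * (a / q + β))‖ with hg
  have h1 : ‖primeBlock X M (a / q + β)‖ ≤ ∑ k ∈ pwin X, Real.log k * g k := by
    refine (norm_sum_le _ _).trans (Finset.sum_le_sum fun k _ => ?_)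
    rw [norm_mul, Complex.norm_real, Real.norm_eq_abs, abs_of_nonneg (Real.log_natCast_nonneg _)]
  have h2 : (∑ k ∈ pwin X, Real.log k * g k) ^ 2 ≤
      (∑ k ∈ pwin X, Real.log k) * ∑ k ∈ pwin X, Real.log k * g k ^ 2 := by
    refine Finset.sum_sq_le_sum_mul_sum_of_sq_le_mul _ (fun k _ => Real.log_natCast_nonneg _)
      (fun k _ => mul_nonneg (Real.log_natCast_nonneg _) (by positivity)) fun k _ => le_of_eq (by ring)
  have h3 := sum_log_pwin_le X (by linarith)
  have h4 : 0 ≤ ∑ k ∈ pwin X, Real.log k * g k ^ 2 :=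
    Finset.sum_nonneg fun k _ => mul_nonneg (Real.log_natCast_nonneg _) (by positivity)
  have h5 : (0 : ℝ) ≤ q * max 1 (X * M * |β|) := by positivity
  calc ‖primeBlock X M (a / q + β)‖ ^ 2 * (q * max 1 (X * M * |β|))
      ≤ (2 * X * ∑ k ∈ pwin X, Real.log k * g k ^ 2) * (q * max 1 (X * M * |β|)) := by
        gcongr
        calc _ ≤ (∑ k ∈ pwin X, Real.log k * g k) ^ 2 := by gcongr
          _ ≤ _ := h2.trans (by gcongr)
    _ = 2 * X * ((∑ k ∈ pwin X, Real.log k * g k ^ 2) * (q * max 1 (X * M * |β|))) := by ring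
    _ ≤ 2 * X * (4096 * lsC ^ 2 * mertE ⌈τ⌉₊ ^ 2 * X * M ^ 2) := by
        have : 0 ≤ X := by linarith
        gcongr
    _ = _ := by ring

/-- Half of `log 2`. -/
noncomputable def hlog : ℝ := Real.log 2 / 2

theorem hlog_pos : 0 < hlog := by unfold hlog; positivity

theorem hlog_lt : hlog < 0.35 := by unfold hlog; have := Real.log_two_lt_d9; linarith

theorem exp_hlog : Real.exp hlog = √2 := by
  rw [hlog, Real.exp_half, Real.exp_log (by norm_num)]

/-- The triangle function on `[0, log 2]`. -/
noncomputable def tri (t : ℝ) : ℝ := max 0 (hlog - |t - hlog|)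

theorem tri_nonneg (t : ℝ) : 0 ≤ tri t := le_max_left _ _

theorem tri_le (t : ℝ) : tri t ≤ hlog :=
  max_le hlog_pos.le (by have := abs_nonneg (t - hlog); linarith)

theorem tri_le_one (t : ℝ) : tri t ≤ 1 := (tri_le t).trans (by have := hlog_lt; linarith)

theorem tri_lipschitz (s t : ℝ) : |tri s - tri t| ≤ |s - t| := by
  unfold tri
  have h : |(|s - hlog| - |t - hlog|)| ≤ |s - t| := by
    refine (abs_abs_sub_abs_le _ _).trans (le_of_eq ?_)
    congr 1; ring
  rw [abs_le] at h ⊢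
  simp only [max_def]
  split_ifs <;> constructor <;> linarith [h.1, h.2]

theorem tri_eq_zero_of_nonpos {t : ℝ} (ht : t ≤ 0) : tri t = 0 := by
  unfold tri
  rw [max_eq_left]
  have := neg_abs_le (t - hlog); linarith

theorem tri_eq_zero_of_ge {t : ℝ} (ht : Real.log 2 ≤ t) : tri t = 0 := by
  unfold tri
  rw [max_eq_left]
  have := le_abs_self (t - hlog)
  have h : Real.log 2 = 2 * hlog := by unfold hlog; ring
  linarith

/-- The weight of `n` relative to the scale `N`. -/
noncomputable def wt (N : ℝ) (n : ℝ) : ℝ := tri (Real.log (n / N))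

theorem wt_nonneg (N n : ℝ) : 0 ≤ wt N n := tri_nonneg _

theorem wt_le_one (N n : ℝ) : wt N n ≤ 1 := tri_le_one _

theorem wt_eq_zero_of_le {N n : ℝ} (hN : 0 < N) (hn : 0 ≤ n) (h : n ≤ N) : wt N n = 0 :=
  tri_eq_zero_of_nonpos (Real.log_nonpos (by positivity) ((div_le_one hN).mpr h))

theorem wt_eq_zero_of_ge {N n : ℝ} (hN : 0 < N) (h : 2 * N ≤ n) : wt N n = 0 :=
  tri_eq_zero_of_ge (Real.log_le_log (by norm_num) ((le_div_iff₀ hN).mpr h))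

/-- A bilinear exponential sum over one pair of windows. -/
noncomputable def block (f g : ℕ → ℂ) (X M α : ℝ) : ℂ :=
  ∑ k ∈ win X, f k * trig (win M) g (k * α)

/-- A bilinear exponential sum with the multiplicative weight `wt N`. -/
noncomputable def bilin (f g : ℕ → ℂ) (N α : ℝ) : ℂ :=
  ∑ k ∈ Finset.Icc 1 ⌊2 * N⌋₊, ∑ l ∈ Finset.Icc 1 ⌊2 * N⌋₊,
    f k * g l * wt N (k * l) * expi (k * l * α)

theorem win_exp_eq_empty {x : ℝ} (hx : x < -hlog) : win (Real.exp x) = ∅ := by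
  ext k
  simp only [mem_win (Real.exp_pos x).le, Finset.notMem_empty, iff_false, not_and, not_le]
  intro h
  rw [← exp_hlog, ← Real.exp_add]
  have h1 : (0 : ℝ) < k := lt_of_lt_of_le (Real.exp_pos x) h
  have h2 : (1 : ℝ) ≤ k := by exact_mod_cast (by exact_mod_cast h1 : 0 < k)
  exact lt_of_lt_of_le (by rw [Real.exp_lt_one_iff]; linarith) h2

theorem integral_window (N : ℝ) (hN : 0 < N) (k l : ℕ) (hk : 0 < k) (hl : 0 < l) :
    MeasureTheory.Integrable (fun x : ℝ => if k ∈ win (Real.exp x) ∧ l ∈ win (N * Real.exp (-x))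
      then (1 : ℂ) else 0) ∧
    ∫ x : ℝ, (if k ∈ win (Real.exp x) ∧ l ∈ win (N * Real.exp (-x)) then (1 : ℂ) else 0) =
      wt N (k * l) := by
  have hk' : (0 : ℝ) < k := by exact_mod_cast hk
  have hl' : (0 : ℝ) < l := by exact_mod_cast hl
  set I := Set.Icc (Real.log k - hlog) (Real.log k) ∩
    Set.Icc (Real.log N - Real.log l) (Real.log N - Real.log l + hlog) with hI
  have h1 : (fun x : ℝ => if k ∈ win (Real.exp x) ∧ l ∈ win (N * Real.exp (-x))
      then (1 : ℂ) else 0) = I.indicator (fun _ => 1) := by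
    funext x
    rw [Set.indicator_apply]
    congr 1
    rw [mem_win (Real.exp_pos x).le, mem_win (by positivity), hI, Set.mem_inter_iff, Set.mem_Icc,
      Set.mem_Icc, ← Real.le_log_iff_exp_le hk', ← exp_hlog, ← Real.exp_add,
      ← Real.log_le_iff_le_exp hk', mul_left_comm, ← Real.exp_add]
    nth_rw 1 2 [← Real.exp_log hN]
    rw [← Real.exp_add, ← Real.exp_add, ← Real.le_log_iff_exp_le hl', ← Real.log_le_iff_le_exp hl']
    apply propext
    constructor
    · rintro ⟨⟨a, b⟩, c, d⟩
      refine ⟨⟨?_, ?_⟩, ?_, ?_⟩ <;> linarith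
    · rintro ⟨⟨a, b⟩, c, d⟩
      refine ⟨⟨?_, ?_⟩, ?_, ?_⟩ <;> linarith
  have hm : MeasurableSet I := measurableSet_Icc.inter measurableSet_Icc
  rw [h1]
  refine ⟨(MeasureTheory.integrable_indicator_iff hm).mpr ?_, ?_⟩
  · refine MeasureTheory.integrableOn_const ?_
    exact (lt_of_le_of_lt (MeasureTheory.measure_mono Set.inter_subset_left)
      measure_Icc_lt_top).ne
  · rw [MeasureTheory.integral_indicator hm, MeasureTheory.setIntegral_const, hI, Set.Icc_inter_Icc,
      Real.volume_real_Icc, wt, tri, Real.log_div (by positivity) hN.ne',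
      Real.log_mul hk'.ne' hl'.ne', Complex.real_smul, mul_one, max_comm]
    congr 2
    set a := Real.log k
    set b := Real.log N - Real.log l
    have : a + Real.log l - Real.log N - hlog = a - (b + hlog) := by ring
    rw [this]
    rcases le_total a (b + hlog) with h | h
    · rw [abs_of_nonpos (by linarith)]
      simp only [min_def, max_def]
      split_ifs <;> linarith
    · rw [abs_of_nonneg (by linarith)]
      simp only [min_def, max_def]
      split_ifs <;> linarith

theorem block_eq_sum (f g : ℕ → ℂ) (N α x : ℝ) (hN : 0 < N) :
    block f g (Real.exp x) (N * Real.exp (-x)) α =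
      ∑ k ∈ Finset.Icc 1 ⌊2 * N⌋₊, ∑ l ∈ Finset.Icc 1 ⌊2 * N⌋₊,
        (f k * g l * expi (k * l * α)) *
          (if k ∈ win (Real.exp x) ∧ l ∈ win (N * Real.exp (-x)) then (1 : ℂ) else 0) := by
  unfold block trig
  simp_rw [Finset.mul_sum, mul_ite, mul_one, mul_zero]
  rw [← Finset.sum_product', ← Finset.sum_product', ← Finset.sum_filter]
  refine Finset.sum_congr ?_ fun z _ => ?_
  · ext ⟨k, l⟩
    simp only [Finset.mem_product, Finset.mem_filter, Finset.mem_Icc]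
    constructor
    · rintro ⟨h1, h2⟩
      refine ⟨?_, h1, h2⟩
      rw [mem_win (Real.exp_pos x).le] at h1
      rw [mem_win (by positivity)] at h2
      have hX := Real.exp_pos x
      have hM : 0 < N * Real.exp (-x) := by positivity
      have hXM : Real.exp x * (N * Real.exp (-x)) = N := by
        rw [mul_left_comm, ← Real.exp_add]; simp
      have hs : √2 * √2 = 2 := Real.mul_self_sqrt (by norm_num)
      have hk0 : (0 : ℝ) < k := hX.trans_le h1.1
      have hl0 : (0 : ℝ) < l := hM.trans_le h2.1
      have hk1 : 1 ≤ k := by exact_mod_cast hk0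
      have hl1 : 1 ≤ l := by exact_mod_cast hl0
      have hk1' : (1 : ℝ) ≤ k := by exact_mod_cast hk1
      have hl1' : (1 : ℝ) ≤ l := by exact_mod_cast hl1
      have hkl : (k : ℝ) * l ≤ 2 * N := by
        calc (k : ℝ) * l ≤ (√2 * Real.exp x) * (√2 * (N * Real.exp (-x))) := by
              gcongr
              · exact h1.2
              · exact h2.2
          _ = (√2 * √2) * (Real.exp x * (N * Real.exp (-x))) := by ring
          _ = 2 * N := by rw [hs, hXM]
      refine ⟨⟨hk1, (Nat.le_floor_iff (by positivity)).mpr ?_⟩, hl1,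
        (Nat.le_floor_iff (by positivity)).mpr ?_⟩ <;> nlinarith
    · rintro ⟨_, h1, h2⟩; exact ⟨h1, h2⟩
  · rw [mul_assoc]
    congr 3
    ring

theorem bilin_eq_integral (f g : ℕ → ℂ) (N α : ℝ) (hN : 0 < N) :
    bilin f g N α = ∫ x : ℝ, block f g (Real.exp x) (N * Real.exp (-x)) α := by
  simp_rw [block_eq_sum f g N α _ hN]
  rw [MeasureTheory.integral_finsetSum]
  · unfold bilin
    refine Finset.sum_congr rfl fun k hk => ?_
    rw [MeasureTheory.integral_finsetSum]
    · refine Finset.sum_congr rfl fun l hl => ?_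
      rw [MeasureTheory.integral_const_mul,
        (integral_window N hN k l (Finset.mem_Icc.mp hk).1 (Finset.mem_Icc.mp hl).1).2]
      ring
    · intro l hl
      exact ((integral_window N hN k l (Finset.mem_Icc.mp hk).1
        (Finset.mem_Icc.mp hl).1).1).const_mul _
  · intro k hk
    refine MeasureTheory.integrable_finsetSum _ fun l hl => ?_
    exact ((integral_window N hN k l (Finset.mem_Icc.mp hk).1
        (Finset.mem_Icc.mp hl).1).1).const_mul _

theorem block_eq_zero (f g : ℕ → ℂ) (N α x : ℝ) (hN : 0 < N)
    (hx : x ∉ Set.Icc (-hlog) (Real.log N + hlog)) :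
    block f g (Real.exp x) (N * Real.exp (-x)) α = 0 := by
  unfold block
  rw [Set.mem_Icc, not_and_or, not_le, not_le] at hx
  rcases hx with h | h
  · rw [win_exp_eq_empty h, Finset.sum_empty]
  · have h1 : N * Real.exp (-x) = Real.exp (Real.log N - x) := by
      rw [sub_eq_add_neg, Real.exp_add, Real.exp_log hN]
    rw [h1, win_exp_eq_empty (x := Real.log N - x) (by linarith)]
    simp [trig]

/-- Bounding the bilinear sum by separating extreme and central windows. -/
theorem norm_bilin_le (f g : ℕ → ℂ) (N α A B x₀ : ℝ) (hN : 1 ≤ N) (hA : 0 ≤ A) (hB : 0 ≤ B)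
    (hx₀ : 0 ≤ x₀)
    (h1 : ∀ x, ‖block f g (Real.exp x) (N * Real.exp (-x)) α‖ ≤ A)
    (h2 : ∀ x, x₀ ≤ x → x ≤ Real.log N - x₀ →
      ‖block f g (Real.exp x) (N * Real.exp (-x)) α‖ ≤ B) :
    ‖bilin f g N α‖ ≤ B * (Real.log N + 1) + 2 * A * (x₀ + 1) := by
  rw [bilin_eq_integral f g N α (by linarith)]
  set I := Set.Icc (-hlog) (Real.log N + hlog)
  set I1 := Set.Icc (-hlog) x₀
  set I2 := Set.Icc (Real.log N - x₀) (Real.log N + hlog)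
  have hintg : ∀ (a b c : ℝ), MeasureTheory.Integrable ((Set.Icc a b).indicator fun _ : ℝ => c) := by
    intro a b c
    refine (MeasureTheory.integrable_indicator_iff measurableSet_Icc).mpr ?_
    exact MeasureTheory.integrableOn_const measure_Icc_lt_top.ne
  have hval : ∀ (a b c : ℝ), ∫ x : ℝ, (Set.Icc a b).indicator (fun _ : ℝ => c) x =
      max (b - a) 0 * c := by
    intro a b c
    rw [MeasureTheory.integral_indicator measurableSet_Icc, MeasureTheory.setIntegral_const,
      Real.volume_real_Icc, smul_eq_mul]
  have hle := MeasureTheory.norm_integral_le_of_norm_le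
    (f := fun x => block f g (Real.exp x) (N * Real.exp (-x)) α)
    (g := fun x => I.indicator (fun _ => B) x + (I1.indicator (fun _ => A) x +
      I2.indicator (fun _ => A) x))
    (μ := MeasureTheory.volume)
    ((hintg _ _ _).add ((hintg _ _ _).add (hintg _ _ _)))
    (Filter.Eventually.of_forall fun x => by
      have e1 : 0 ≤ I.indicator (fun _ => B) x := Set.indicator_nonneg (fun _ _ => hB) _
      have e2 : 0 ≤ I1.indicator (fun _ => A) x := Set.indicator_nonneg (fun _ _ => hA) _
      have e3 : 0 ≤ I2.indicator (fun _ => A) x := Set.indicator_nonneg (fun _ _ => hA) _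
      by_cases hx : x ∈ I
      · by_cases hx1 : x ≤ x₀
        · have : x ∈ I1 := ⟨hx.1, hx1⟩
          rw [Set.indicator_of_mem this]
          have := h1 x; linarith
        · by_cases hx2 : x ≤ Real.log N - x₀
          · rw [Set.indicator_of_mem hx]
            have := h2 x (by linarith) hx2; linarith
          · have : x ∈ I2 := ⟨by linarith, hx.2⟩
            rw [Set.indicator_of_mem this]
            have := h1 x; linarith
      · rw [block_eq_zero f g N α x (by linarith) hx, norm_zero]; positivity)
  refine hle.trans ?_
  have hadd : ∫ x : ℝ, (I.indicator (fun _ => B) x + (I1.indicator (fun _ => A) x +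
      I2.indicator (fun _ => A) x)) = (∫ x : ℝ, I.indicator (fun _ => B) x) +
      ((∫ x : ℝ, I1.indicator (fun _ => A) x) + ∫ x : ℝ, I2.indicator (fun _ => A) x) := by
    rw [← MeasureTheory.integral_add (hintg _ _ _) (hintg _ _ _)]
    exact MeasureTheory.integral_add (hintg _ _ _) ((hintg _ _ _).add (hintg _ _ _))
  rw [hadd, hval, hval, hval]
  have hlN : 0 ≤ Real.log N := Real.log_nonneg hN
  have := hlog_pos
  have := hlog_lt
  rw [max_eq_left (by linarith), max_eq_left (by linarith), max_eq_left (by linarith)]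
  nlinarith

/-- `log n` on primes, zero elsewhere. -/
noncomputable def lamP (n : ℕ) : ℝ := if n.Prime then Real.log n else 0

/-- The von Mangoldt function as a real function. -/
noncomputable def vm (n : ℕ) : ℝ := ArithmeticFunction.vonMangoldt n

theorem lamP_nonneg (n : ℕ) : 0 ≤ lamP n := by
  unfold lamP; split_ifs
  · exact Real.log_natCast_nonneg _
  · exact le_rfl

theorem vm_nonneg (n : ℕ) : 0 ≤ vm n := ArithmeticFunction.vonMangoldt_nonneg

theorem lamP_le_vm (n : ℕ) : lamP n ≤ vm n := by
  unfold lamP; split_ifs with h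
  · exact (ArithmeticFunction.vonMangoldt_apply_prime h).ge
  · exact vm_nonneg n

theorem vm_le_log (n : ℕ) : vm n ≤ Real.log n := ArithmeticFunction.vonMangoldt_le_log

theorem sum_vm_le (x : ℝ) (hx : 0 ≤ x) : ∑ n ∈ Finset.Icc 1 ⌊x⌋₊, vm n ≤ 6 * x := by
  have h := Chebyshev.psi_le_const_mul_self hx
  have h2 : Real.log 4 < 1.3864 := by
    have : (4 : ℝ) = 2 ^ 2 := by norm_num
    rw [this, Real.log_pow]; have := Real.log_two_lt_d9; push_cast; linarith
  unfold Chebyshev.psi at h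
  refine le_trans (le_of_eq ?_) (h.trans ?_)
  · rfl
  · nlinarith

theorem exists_sum_vm_sub_lamP_le : ∃ C : ℝ, 0 ≤ C ∧ ∀ x : ℝ, 0 ≤ x →
    ∑ n ∈ Finset.Icc 1 ⌊x⌋₊, (vm n - lamP n) ≤ C * √x := by
  obtain ⟨C, hC⟩ := Chebyshev.psi_sub_theta_le_mul_sqrt
  refine ⟨max C 0, le_max_right _ _, fun x hx => ?_⟩
  have h := hC x
  unfold Chebyshev.psi Chebyshev.theta at h
  rw [Finset.sum_filter, ← Finset.sum_sub_distrib] at h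
  refine le_trans (le_of_eq ?_) (h.trans (by gcongr; exact le_max_left _ _))
  rfl

theorem win_subset {X : ℝ} (hX : 0 < X) : win X ⊆ Finset.Icc 1 ⌊2 * X⌋₊ := by
  intro k hk
  obtain ⟨h1, h2⟩ := (mem_win hX.le).mp hk
  rw [Finset.mem_Icc, Nat.le_floor_iff (by positivity)]
  refine ⟨?_, ?_⟩
  · have : (0 : ℝ) < k := hX.trans_le h1
    exact_mod_cast this
  · have := sqrt_two_lt; nlinarith

theorem sum_vm_win_le {X : ℝ} (hX : 0 < X) : ∑ k ∈ win X, vm k ≤ 12 * X := by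
  refine (Finset.sum_le_sum_of_subset_of_nonneg (win_subset hX) fun k _ _ => vm_nonneg k).trans ?_
  refine (sum_vm_le _ (by positivity)).trans (by linarith)

theorem norm_block_le (f g : ℕ → ℝ) (hf : ∀ n, 0 ≤ f n) (hg : ∀ n, 0 ≤ g n) (X M α : ℝ) :
    ‖block (fun n => f n) (fun n => g n) X M α‖ ≤ (∑ k ∈ win X, f k) * ∑ l ∈ win M, g l := by
  unfold block
  refine (norm_sum_le _ _).trans ?_
  rw [Finset.sum_mul]
  refine Finset.sum_le_sum fun k _ => ?_
  rw [norm_mul, Complex.norm_real, Real.norm_eq_abs, abs_of_nonneg (hf k)]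
  refine mul_le_mul_of_nonneg_left ((norm_trig_le _ _ _).trans (le_of_eq ?_)) (hf k)
  exact Finset.sum_congr rfl fun l _ => by
    rw [Complex.norm_real, Real.norm_eq_abs, abs_of_nonneg (hg l)]

theorem primeBlock_eq_block (X M α : ℝ) :
    primeBlock X M α = block (fun n => lamP n) (fun n => lamP n) X M α := by
  have hin : ∀ y : ℝ, trig (pwin M) (fun l => (Real.log l : ℂ)) y =
      trig (win M) (fun n => (lamP n : ℂ)) y := by
    intro y
    unfold trig pwin
    rw [Finset.sum_filter]
    refine Finset.sum_congr rfl fun l _ => ?_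
    beta_reduce
    by_cases h : l.Prime
    · rw [if_pos h, show lamP l = Real.log l from if_pos h]
    · rw [if_neg h, show lamP l = 0 from if_neg h, Complex.ofReal_zero, zero_mul]
  unfold primeBlock block
  rw [pwin, Finset.sum_filter]
  refine Finset.sum_congr rfl fun k _ => ?_
  rw [hin]
  beta_reduce
  by_cases h : k.Prime
  · rw [if_pos h, show lamP k = Real.log k from if_pos h]
  · rw [if_neg h, show lamP k = 0 from if_neg h, Complex.ofReal_zero, zero_mul]

theorem block_sub (X M α : ℝ) :
    block (fun n => vm n) (fun n => vm n) X M α - block (fun n => lamP n) (fun n => lamP n) X M α =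
      block (fun n => ((vm n - lamP n : ℝ) : ℂ)) (fun n => vm n) X M α +
      block (fun n => lamP n) (fun n => ((vm n - lamP n : ℝ) : ℂ)) X M α := by
  unfold block trig
  simp_rw [Finset.mul_sum]
  rw [← Finset.sum_sub_distrib, ← Finset.sum_add_distrib]
  refine Finset.sum_congr rfl fun k _ => ?_
  rw [← Finset.sum_sub_distrib, ← Finset.sum_add_distrib]
  refine Finset.sum_congr rfl fun l _ => ?_
  push_cast; ring

theorem exists_norm_block_vm_sub_le : ∃ C : ℝ, 0 ≤ C ∧ ∀ X M α : ℝ, 0 < X → 0 < M →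
    ‖block (fun n => vm n) (fun n => vm n) X M α - primeBlock X M α‖ ≤ C * (√X * M + X * √M) := by
  obtain ⟨C, hC0, hC⟩ := exists_sum_vm_sub_lamP_le
  have hw : ∀ X : ℝ, 0 < X → ∑ k ∈ win X, (vm k - lamP k) ≤ C * (2 * √X) := by
    intro X hX
    refine (Finset.sum_le_sum_of_subset_of_nonneg (win_subset hX) fun k _ _ =>
      sub_nonneg.mpr (lamP_le_vm k)).trans ((hC _ (by positivity)).trans ?_)
    gcongr
    rw [Real.sqrt_mul (by norm_num)]
    gcongr
    have := sqrt_two_lt; linarith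
  refine ⟨24 * C, by positivity, fun X M α hX hM => ?_⟩
  rw [primeBlock_eq_block, block_sub]
  have hd : ∀ n, 0 ≤ vm n - lamP n := fun n => sub_nonneg.mpr (lamP_le_vm n)
  have h1 := norm_block_le _ _ hd vm_nonneg X M α
  have h2 := norm_block_le _ _ lamP_nonneg hd X M α
  have h3 : ∑ k ∈ win X, lamP k ≤ 12 * X :=
    (Finset.sum_le_sum fun k _ => lamP_le_vm k).trans (sum_vm_win_le hX)
  have h4 := sum_vm_win_le hM
  have h5 := hw X hX
  have h6 := hw M hM
  have h7 : 0 ≤ ∑ k ∈ win M, vm k := Finset.sum_nonneg fun k _ => vm_nonneg k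
  have h8 : 0 ≤ ∑ k ∈ win M, (vm k - lamP k) := Finset.sum_nonneg fun k _ => hd k
  calc _ ≤ _ := norm_add_le _ _
    _ ≤ (C * (2 * √X)) * (12 * M) + (12 * X) * (C * (2 * √M)) := by
        refine add_le_add (h1.trans ?_) (h2.trans ?_)
        · gcongr
        · gcongr
    _ = _ := by ring

theorem rpow_le_of_sq_mul_le {A τ N K : ℝ} (hτ : 1 ≤ τ) (hN : 0 ≤ N) (hK : 0 ≤ K)
    (h : A ^ 2 * τ ≤ K * τ ^ (1 / 4 : ℝ) * N ^ 2) : A ≤ √K * N * τ ^ (-(3 / 8) : ℝ) := by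
  have hτ0 : 0 < τ := by linarith
  refine le_of_sq_le_sq ?_ (by positivity)
  rw [mul_pow, mul_pow, Real.sq_sqrt hK, ← Real.rpow_natCast (τ ^ (-(3 / 8) : ℝ)),
    ← Real.rpow_mul hτ0.le]
  have e1 : τ ^ (-(3 / 8) * ((2 : ℕ) : ℝ)) = τ ^ (1 / 4 : ℝ) / τ := by
    rw [← Real.rpow_sub_one hτ0.ne']; norm_num
  rw [e1, ← mul_div_assoc, le_div_iff₀ hτ0]
  linarith
where
  le_of_sq_le_sq {a b : ℝ} (h : a ^ 2 ≤ b ^ 2) (hb : 0 ≤ b) : a ≤ b := abs_le_of_sq_le_sq' h hb |>.2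

theorem exists_norm_block_vm_le : ∃ C : ℝ, 0 ≤ C ∧ ∀ (a : ℤ) (q : ℕ) (β τ X M : ℝ), 1 ≤ q →
    IsCoprime a q → τ = max (q : ℝ) (X * M * |β|) → 1296 * τ ^ 6 ≤ X → 1296 * τ ^ 6 ≤ M →
    ‖block (fun n => vm n) (fun n => vm n) X M (a / q + β)‖ ≤ C * (X * M) * τ ^ (-(3 / 8) : ℝ) := by
  obtain ⟨C1, hC1, h1⟩ := exists_norm_block_vm_sub_le
  obtain ⟨C2, hC2, h2⟩ := exists_mertE_le (1 / 8) (by norm_num)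
  refine ⟨C1 + √(8192 * lsC ^ 2 * (C2 * 2) ^ 2), by positivity,
    fun a q β τ X M hq haq hτ hX hM => ?_⟩
  have hq1 : (1 : ℝ) ≤ q := by exact_mod_cast hq
  have hqτ : (q : ℝ) ≤ τ := by rw [hτ]; exact le_max_left _ _
  have hβτ : X * M * |β| ≤ τ := by rw [hτ]; exact le_max_right _ _
  have hτ1 : 1 ≤ τ := hq1.trans hqτ
  have hτ0 : 0 < τ := by linarith
  have hX0 : 0 < X := lt_of_lt_of_le (by positivity) hX
  have hM0 : 0 < M := lt_of_lt_of_le (by positivity) hM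
  have hpb := norm_primeBlock_sq_le a q β τ X M hq haq hqτ hβτ hX hM
  have hτle : τ ≤ q * max 1 (X * M * |β|) := by
    rw [hτ]
    have : 1 ≤ max 1 (X * M * |β|) := le_max_left _ _
    have : X * M * |β| ≤ max 1 (X * M * |β|) := le_max_right _ _
    refine max_le ?_ ?_ <;> nlinarith
  have hE : mertE ⌈τ⌉₊ ≤ C2 * 2 * τ ^ (1 / 8 : ℝ) := by
    have hT : ((⌈τ⌉₊ : ℕ) : ℝ) ≤ 2 * τ := by
      have := Nat.ceil_lt_add_one (show 0 ≤ τ by linarith); linarith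
    refine (h2 _ (Nat.one_le_ceil_iff.mpr hτ0)).trans ?_
    calc C2 * ((⌈τ⌉₊ : ℕ) : ℝ) ^ (1 / 8 : ℝ) ≤ C2 * (2 * τ) ^ (1 / 8 : ℝ) := by gcongr
      _ = C2 * 2 ^ (1 / 8 : ℝ) * τ ^ (1 / 8 : ℝ) := by
          rw [Real.mul_rpow (by norm_num) hτ0.le]; ring
      _ ≤ _ := by
          gcongr
          calc (2 : ℝ) ^ (1 / 8 : ℝ) ≤ 2 ^ (1 : ℝ) :=
                Real.rpow_le_rpow_of_exponent_le (by norm_num) (by norm_num)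
            _ = 2 := Real.rpow_one _
  have hpb2 : ‖primeBlock X M (a / q + β)‖ ≤
      √(8192 * lsC ^ 2 * (C2 * 2) ^ 2) * (X * M) * τ ^ (-(3 / 8) : ℝ) := by
    refine rpow_le_of_sq_mul_le hτ1 (by positivity) (by positivity) ?_
    have hE0 := mertE_pos ⌈τ⌉₊
    calc ‖primeBlock X M (a / q + β)‖ ^ 2 * τ
        ≤ ‖primeBlock X M (a / q + β)‖ ^ 2 * (q * max 1 (X * M * |β|)) := by gcongr
      _ ≤ _ := hpb
      _ ≤ 8192 * lsC ^ 2 * (C2 * 2 * τ ^ (1 / 8 : ℝ)) ^ 2 * (X * M) ^ 2 := by gcongr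
      _ = _ := by
          have : (τ ^ (1 / 8 : ℝ)) ^ 2 = τ ^ (1 / 4 : ℝ) := by
            rw [← Real.rpow_natCast, ← Real.rpow_mul hτ0.le]; norm_num
          rw [mul_pow, this]; ring
  have hs : ∀ X : ℝ, 1296 * τ ^ 6 ≤ X → 2 * √X ≤ X * τ ^ (-(3 / 8) : ℝ) := by
    intro X hX
    have hX0 : 0 < X := lt_of_lt_of_le (by positivity) hX
    have h36 : 36 * τ ^ 3 ≤ √X := by
      apply Real.le_sqrt_of_sq_le
      calc (36 * τ ^ 3) ^ 2 = 1296 * τ ^ 6 := by ring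
        _ ≤ X := hX
    have e1 : 2 ≤ √X * τ ^ (-(3 / 8) : ℝ) := by
      calc (2 : ℝ) ≤ 36 * 1 := by norm_num
        _ ≤ 36 * (τ ^ (3 + -(3 / 8) : ℝ)) := by
            gcongr; exact Real.one_le_rpow hτ1 (by norm_num)
        _ = (36 * τ ^ 3) * τ ^ (-(3 / 8) : ℝ) := by
            rw [Real.rpow_add hτ0, mul_assoc]; norm_cast
        _ ≤ _ := by gcongr
    calc 2 * √X ≤ (√X * τ ^ (-(3 / 8) : ℝ)) * √X := by gcongr
      _ = (√X * √X) * τ ^ (-(3 / 8) : ℝ) := by ring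
      _ = _ := by rw [Real.mul_self_sqrt hX0.le]
  have h3 := h1 X M (a / q + β) hX0 hM0
  have h4 : √X * M + X * √M ≤ X * M * τ ^ (-(3 / 8) : ℝ) := by
    have := mul_le_mul_of_nonneg_right (hs X hX) hM0.le
    have := mul_le_mul_of_nonneg_left (hs M hM) hX0.le
    nlinarith
  calc _ = ‖(block (fun n => vm n) (fun n => vm n) X M (a / q + β) - primeBlock X M (a / q + β)) +
        primeBlock X M (a / q + β)‖ := by rw [sub_add_cancel]
    _ ≤ C1 * (X * M * τ ^ (-(3 / 8) : ℝ)) +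
        √(8192 * lsC ^ 2 * (C2 * 2) ^ 2) * (X * M) * τ ^ (-(3 / 8) : ℝ) :=
        (norm_add_le _ _).trans (add_le_add (h3.trans (by gcongr)) hpb2)
    _ = _ := by ring

/-- The Type II sum on major and intermediate arcs. -/
theorem exists_norm_bilin_vm_le : ∃ C : ℝ, 0 ≤ C ∧ ∀ (a : ℤ) (q : ℕ) (β τ N : ℝ), 1 ≤ q → 1 ≤ N →
    IsCoprime a q → τ = max (q : ℝ) (N * |β|) →
    ‖bilin (fun n => vm n) (fun n => vm n) N (a / q + β)‖ ≤
      C * N * (τ ^ (-(3 / 8) : ℝ) * (Real.log N + 1) + Real.log τ + 1) := by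
  obtain ⟨C1, hC1, h1⟩ := exists_norm_block_vm_le
  refine ⟨C1 + 288 * 9, by positivity, fun a q β τ N hq hN haq hτ => ?_⟩
  have hq1 : (1 : ℝ) ≤ q := by exact_mod_cast hq
  have hqτ : (q : ℝ) ≤ τ := by rw [hτ]; exact le_max_left _ _
  have hτ1 : 1 ≤ τ := hq1.trans hqτ
  have hτ0 : 0 < τ := by linarith
  have hXM : ∀ x : ℝ, Real.exp x * (N * Real.exp (-x)) = N := by
    intro x; rw [mul_left_comm, ← Real.exp_add]; simp
  have hlτ : 0 ≤ Real.log τ := Real.log_nonneg hτ1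
  have hlN : 0 ≤ Real.log N := Real.log_nonneg hN
  have hl1296 : Real.log 1296 ≤ 8 := by
    rw [Real.log_le_iff_le_exp (by norm_num)]
    have h2 : (2.7 : ℝ) ≤ Real.exp 1 := by have := Real.exp_one_gt_d9; linarith
    calc (1296 : ℝ) ≤ 2.7 ^ 8 := by norm_num
      _ ≤ Real.exp 1 ^ 8 := by gcongr
      _ = Real.exp 8 := by rw [← Real.exp_nat_mul]; norm_num
  have hx0 : Real.log (1296 * τ ^ 6) = Real.log 1296 + 6 * Real.log τ := by
    rw [Real.log_mul (by norm_num) (by positivity), Real.log_pow]; norm_num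
  have hl1296' : 0 ≤ Real.log 1296 := Real.log_nonneg (by norm_num)
  have hmain := norm_bilin_le (fun n => (vm n : ℂ)) (fun n => (vm n : ℂ)) N (a / q + β) (144 * N)
    (C1 * N * τ ^ (-(3 / 8) : ℝ)) (Real.log (1296 * τ ^ 6)) hN (by positivity) (by positivity)
    (by rw [hx0]; positivity)
    (fun x => by
      have hX := Real.exp_pos x
      have hM : 0 < N * Real.exp (-x) := by positivity
      refine (norm_block_le vm vm vm_nonneg vm_nonneg _ _ _).trans ?_
      calc _ ≤ (12 * Real.exp x) * (12 * (N * Real.exp (-x))) := by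
            gcongr
            · exact Finset.sum_nonneg fun k _ => vm_nonneg k
            · exact sum_vm_win_le hX
            · exact sum_vm_win_le hM
        _ = 144 * (Real.exp x * (N * Real.exp (-x))) := by ring
        _ = _ := by rw [hXM])
    (fun x hx1 hx2 => by
      have := h1 a q β τ (Real.exp x) (N * Real.exp (-x)) hq haq (by rw [hXM, hτ])
        (by rwa [← Real.log_le_iff_le_exp (by positivity)])
        (by
          have h1 : N * Real.exp (-x) = Real.exp (Real.log N - x) := by
            rw [sub_eq_add_neg, Real.exp_add, Real.exp_log (by linarith)]
          rw [h1, ← Real.log_le_iff_le_exp (by positivity)]; linarith)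
      rwa [hXM] at this)
  refine hmain.trans ?_
  rw [hx0]
  have e1 : 2 * (144 * N) * (Real.log 1296 + 6 * Real.log τ + 1) ≤
      288 * 9 * N * (Real.log τ + 1) := by nlinarith
  have e2 : 0 ≤ 288 * 9 * N * (τ ^ (-(3 / 8) : ℝ) * (Real.log N + 1)) := by positivity
  have e3 : 0 ≤ C1 * N * (Real.log τ + 1) := by positivity
  nlinarith

/-- The Möbius function restricted to integers coprime to `q`. -/
noncomputable def copMu (q : ℕ) : ArithmeticFunction ℝ :=
  ⟨fun n => if n.Coprime q then (ArithmeticFunction.moebius n : ℝ) else 0, by simp⟩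

theorem copMu_apply (q n : ℕ) :
    copMu q n = if n.Coprime q then (ArithmeticFunction.moebius n : ℝ) else 0 := rfl

/-- The indicator function of integers all of whose prime factors divide `q`. -/
noncomputable def smoothInd (q : ℕ) : ArithmeticFunction ℝ :=
  ⟨fun n => if n ≠ 0 ∧ n.primeFactors ⊆ q.primeFactors then 1 else 0, by simp⟩

theorem smoothInd_apply (q n : ℕ) :
    smoothInd q n = if n ≠ 0 ∧ n.primeFactors ⊆ q.primeFactors then 1 else 0 := rfl

theorem abs_copMu_le (q n : ℕ) : |copMu q n| ≤ 1 := by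
  rw [copMu_apply]
  split_ifs
  · exact_mod_cast ArithmeticFunction.abs_moebius_le_one
  · simp

theorem smoothInd_nonneg (q n : ℕ) : 0 ≤ smoothInd q n := by
  rw [smoothInd_apply]; split_ifs <;> norm_num

theorem smoothInd_le_one (q n : ℕ) : smoothInd q n ≤ 1 := by
  rw [smoothInd_apply]; split_ifs <;> norm_num

theorem copMu_mul_zeta (q : ℕ) (hq : q ≠ 0) :
    copMu q * (ArithmeticFunction.zeta : ArithmeticFunction ℝ) = smoothInd q := by
  have h1 : (copMu q).IsMultiplicative := by
    refine ⟨by simp [copMu_apply], fun {m n} h => ?_⟩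
    simp only [copMu_apply, Nat.coprime_mul_iff_left,
      ArithmeticFunction.isMultiplicative_moebius.map_mul_of_coprime h]
    split_ifs <;> simp_all
  have h2 : (smoothInd q).IsMultiplicative := by
    rw [ArithmeticFunction.IsMultiplicative.iff_ne_zero]
    refine ⟨by simp [smoothInd_apply], fun {m n} hm hn h => ?_⟩
    simp only [smoothInd_apply, h.primeFactors_mul, Finset.union_subset_iff, ne_eq, mul_eq_zero,
      hm, hn, or_self, not_false_eq_true, true_and]
    split_ifs <;> simp_all
  rw [ArithmeticFunction.IsMultiplicative.eq_iff_eq_on_prime_powers _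
    (h1.mul ArithmeticFunction.isMultiplicative_zeta.natCast) _ h2]
  intro p i hp
  rw [ArithmeticFunction.coe_mul_zeta_apply, Nat.sum_divisors_prime_pow hp]
  rcases i with _ | i
  · simp [h1.map_one, h2.map_one]
  · rw [Finset.sum_range_succ', Finset.sum_range_succ', Finset.sum_eq_zero]
    · rw [smoothInd_apply, copMu_apply, copMu_apply]
      have hp0 : p ≠ 0 := hp.ne_zero
      simp only [zero_add, pow_one, pow_zero, ne_eq, Nat.primeFactors_prime_pow (Nat.succ_ne_zero i) hp,
        ArithmeticFunction.moebius_apply_prime hp, Finset.singleton_subset_iff,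
        Nat.coprime_one_left_eq_true, hp.coprime_iff_not_dvd, Nat.mem_primeFactors, hp, hq,
        not_false_eq_true, and_true, true_and]
      by_cases h : p ∣ q <;> simp [h, hp0]
    · intro j _
      rw [copMu_apply, ArithmeticFunction.moebius_apply_prime_pow hp (by omega)]
      simp

theorem sum_copMu_mul_sum (q : ℕ) (hq : q ≠ 0) (F : ArithmeticFunction ℝ) (x : ℕ) :
    ∑ d ∈ Finset.Ioc 0 x, copMu q d * ∑ m ∈ Finset.Ioc 0 (x / d),
      ((ArithmeticFunction.zeta : ArithmeticFunction ℝ) * F) m =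
    ∑ a ∈ Finset.Ioc 0 x, smoothInd q a * ∑ c ∈ Finset.Ioc 0 (x / a), F c := by
  rw [← ArithmeticFunction.sum_Ioc_mul_eq_sum_sum, ← ArithmeticFunction.sum_Ioc_mul_eq_sum_sum,
    ← mul_assoc, copMu_mul_zeta q hq]

/-- The square of the logarithm as an arithmetic function. -/
noncomputable def logSq : ArithmeticFunction ℝ :=
  ArithmeticFunction.pmul ArithmeticFunction.log ArithmeticFunction.log

/-- Selberg's function `Λ log + Λ * Λ`. -/
noncomputable def lam2 : ArithmeticFunction ℝ :=
  ArithmeticFunction.pmul ArithmeticFunction.log ArithmeticFunction.vonMangoldt +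
    ArithmeticFunction.vonMangoldt * ArithmeticFunction.vonMangoldt

theorem pmul_log_mul (f g : ArithmeticFunction ℝ) :
    ArithmeticFunction.pmul ArithmeticFunction.log (f * g) =
      ArithmeticFunction.pmul ArithmeticFunction.log f * g +
        f * ArithmeticFunction.pmul ArithmeticFunction.log g := by
  ext n
  simp only [ArithmeticFunction.pmul_apply, ArithmeticFunction.add_apply,
    ArithmeticFunction.mul_apply, Finset.mul_sum, ← Finset.sum_add_distrib]
  refine Finset.sum_congr rfl fun z hz => ?_
  obtain ⟨h1, h2⟩ := Nat.mem_divisorsAntidiagonal.mp hz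
  have hz1 : (z.1 : ℝ) ≠ 0 := by
    intro h; apply h2; rw [← h1, Nat.cast_eq_zero.mp h, zero_mul]
  have hz2 : (z.2 : ℝ) ≠ 0 := by
    intro h; apply h2; rw [← h1, Nat.cast_eq_zero.mp h, mul_zero]
  simp only [ArithmeticFunction.log_apply]
  rw [← h1, Nat.cast_mul, Real.log_mul hz1 hz2]
  ring

theorem zeta_mul_lam2 : (ArithmeticFunction.zeta : ArithmeticFunction ℝ) * lam2 = logSq := by
  have h : ArithmeticFunction.pmul ArithmeticFunction.log
      (ArithmeticFunction.zeta : ArithmeticFunction ℝ) = ArithmeticFunction.log := by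
    simp
  rw [logSq]
  nth_rw 2 [← ArithmeticFunction.zeta_mul_vonMangoldt]
  rw [pmul_log_mul, h, lam2, mul_add, ← mul_assoc, ArithmeticFunction.zeta_mul_vonMangoldt, add_comm]

theorem moebius_mul_logSq : (ArithmeticFunction.moebius : ArithmeticFunction ℝ) * logSq = lam2 := by
  rw [← zeta_mul_lam2, ← mul_assoc, ArithmeticFunction.coe_moebius_mul_coe_zeta, one_mul]

theorem lam2_nonneg (n : ℕ) : 0 ≤ lam2 n := by
  rw [lam2, ArithmeticFunction.add_apply, ArithmeticFunction.pmul_apply,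
    ArithmeticFunction.mul_apply]
  refine add_nonneg (mul_nonneg (by rw [ArithmeticFunction.log_apply]; exact Real.log_natCast_nonneg n)
    ArithmeticFunction.vonMangoldt_nonneg) (Finset.sum_nonneg fun z _ =>
      mul_nonneg ArithmeticFunction.vonMangoldt_nonneg ArithmeticFunction.vonMangoldt_nonneg)

theorem sum_vm_Ioc_le (x : ℕ) : ∑ n ∈ Finset.Ioc 0 x, vm n ≤ 6 * x := by
  have := sum_vm_le x (by positivity)
  rwa [Nat.floor_natCast] at this

theorem sum_log_Ioc_le (x : ℕ) : ∑ n ∈ Finset.Ioc 0 x, Real.log n ≤ x * Real.log x := by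
  refine (Finset.sum_le_card_nsmul _ _ (Real.log x) fun n hn => ?_).trans (by simp)
  obtain ⟨h1, h2⟩ := Finset.mem_Ioc.mp hn
  exact Real.log_le_log (by exact_mod_cast h1) (by exact_mod_cast h2)

theorem sum_vm_div_le (x : ℕ) : ∑ n ∈ Finset.Ioc 0 x, vm n / n ≤ Real.log x + 6 := by
  rcases Nat.eq_zero_or_pos x with rfl | hx
  · simp
  have hx' : (0 : ℝ) < x := by exact_mod_cast hx
  have h1 : ∑ n ∈ Finset.Ioc 0 x, vm n * ((x / n : ℕ) : ℝ) ≤ x * Real.log x := by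
    refine le_trans (le_of_eq ?_) (sum_log_Ioc_le x)
    have := ArithmeticFunction.sum_Ioc_mul_zeta_eq_sum ArithmeticFunction.vonMangoldt x
    rw [ArithmeticFunction.vonMangoldt_mul_zeta] at this
    refine this.symm.trans ?_
    simp [ArithmeticFunction.log_apply]
  have h2 : ∑ n ∈ Finset.Ioc 0 x, vm n * ((x : ℝ) / n) ≤ x * Real.log x + 6 * x := by
    refine le_trans ?_ (add_le_add h1 (sum_vm_Ioc_le x))
    rw [← Finset.sum_add_distrib]
    refine Finset.sum_le_sum fun n hn => ?_
    have : (x : ℝ) / n ≤ ((x / n : ℕ) : ℝ) + 1 := by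
      rw [← Nat.floor_div_eq_div (K := ℝ)]
      exact (Nat.lt_floor_add_one _).le
    have := mul_le_mul_of_nonneg_left this (vm_nonneg n)
    linarith
  have h3 : ∑ n ∈ Finset.Ioc 0 x, vm n * ((x : ℝ) / n) = x * ∑ n ∈ Finset.Ioc 0 x, vm n / n := by
    rw [Finset.mul_sum]; exact Finset.sum_congr rfl fun n _ => by ring
  rw [h3] at h2
  have : x * ∑ n ∈ Finset.Ioc 0 x, vm n / n ≤ x * (Real.log x + 6) := by linarith
  exact le_of_mul_le_mul_left this hx'

theorem sum_lam2_le (x : ℕ) : ∑ n ∈ Finset.Ioc 0 x, lam2 n ≤ 36 * x * (1 + Real.log x) := by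
  have hl : 0 ≤ Real.log x := Real.log_natCast_nonneg x
  simp only [lam2, ArithmeticFunction.add_apply, ArithmeticFunction.pmul_apply]
  rw [Finset.sum_add_distrib, ArithmeticFunction.sum_Ioc_mul_eq_sum_sum]
  have h1 : ∑ n ∈ Finset.Ioc 0 x, ArithmeticFunction.log n * ArithmeticFunction.vonMangoldt n ≤
      6 * x * Real.log x := by
    have := mul_le_mul_of_nonneg_left (sum_vm_Ioc_le x) hl
    rw [Finset.mul_sum] at this
    refine (Finset.sum_le_sum fun n hn => ?_).trans (this.trans (by linarith))
    obtain ⟨h1, h2⟩ := Finset.mem_Ioc.mp hn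
    rw [ArithmeticFunction.log_apply]
    exact mul_le_mul_of_nonneg_right
      (Real.log_le_log (by exact_mod_cast h1) (by exact_mod_cast h2)) (vm_nonneg n)
  have h2 : ∑ n ∈ Finset.Ioc 0 x, ArithmeticFunction.vonMangoldt n *
      ∑ m ∈ Finset.Ioc 0 (x / n), ArithmeticFunction.vonMangoldt m ≤ 6 * x * (Real.log x + 6) := by
    have := mul_le_mul_of_nonneg_left (sum_vm_div_le x) (by positivity : (0 : ℝ) ≤ 6 * x)
    rw [Finset.mul_sum] at this
    refine (Finset.sum_le_sum fun n hn => ?_).trans this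
    have h3 := sum_vm_Ioc_le (x / n)
    have h4 : ((x / n : ℕ) : ℝ) ≤ x / n := Nat.cast_div_le
    have := mul_le_mul_of_nonneg_left (h3.trans (mul_le_mul_of_nonneg_left h4 (by norm_num)))
      (vm_nonneg n)
    refine this.trans (le_of_eq ?_); ring
  have : (0 : ℝ) ≤ x * Real.log x := by positivity
  nlinarith

/-- The truncated sum of reciprocals of integers all of whose prime factors divide `q`. -/
noncomputable def kap (q x : ℕ) : ℝ := ∑ a ∈ Finset.Ioc 0 x, smoothInd q a / a

theorem one_le_kap (q x : ℕ) (hx : 1 ≤ x) : 1 ≤ kap q x := by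
  have := Finset.single_le_sum (s := Finset.Ioc 0 x) (f := fun a => smoothInd q a / (a : ℝ))
    (fun a _ => div_nonneg (smoothInd_nonneg q a) (by positivity))
    (Finset.mem_Ioc.mpr ⟨zero_lt_one, hx⟩)
  refine le_trans (le_of_eq ?_) this
  simp [smoothInd_apply]

theorem kap_le_mertE (q x : ℕ) (hq : 1 ≤ q) : kap q x ≤ mertE q := by
  classical
  have h1 : kap q x = ∑ a ∈ (Finset.Icc 1 x).filter (fun a => a.primeFactors ⊆ q.primeFactors),
      (1 : ℝ) / a := by
    rw [kap, Finset.sum_filter]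
    refine Finset.sum_congr rfl fun a ha => ?_
    have : a ≠ 0 := (Finset.mem_Ioc.mp ha).1.ne'
    simp only [smoothInd_apply, ne_eq, this, not_false_eq_true, true_and]
    split_ifs <;> simp
  have hsub : ∀ a ∈ (Finset.Icc 1 x).filter (fun a => a.primeFactors ⊆ q.primeFactors),
      ∏ p ∈ a.primeFactors, p ∈ (primorial q).divisors := by
    intro a ha
    obtain ⟨h1, h2⟩ := Finset.mem_filter.mp ha
    rw [Nat.mem_divisors]
    refine ⟨?_, (primorial_pos q).ne'⟩
    rw [primorial]
    refine Finset.prod_dvd_prod_of_subset _ _ _ fun p hp => ?_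
    have := Nat.mem_primeFactors.mp (h2 hp)
    simp only [Finset.mem_filter, Finset.mem_range]
    exact ⟨by have := Nat.le_of_dvd (by omega) this.2.1; omega, this.1⟩
  rw [h1, ← Finset.sum_fiberwise_of_maps_to hsub, mertE]
  refine Finset.sum_le_sum fun r hr => ?_
  have hsq : Squarefree r := by
    refine Squarefree.squarefree_of_dvd (Nat.dvd_of_mem_divisors hr) ?_
    rw [primorial]
    refine Finset.squarefree_prod_of_pairwise_isCoprime ?_ ?_
    · intro p hp q hq hpq
      simp only [Finset.coe_filter, Set.mem_ofPred_eq] at hp hq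
      rw [Function.onFun, ← Nat.coprime_iff_isRelPrime]
      exact (Nat.coprime_primes hp.2 hq.2).mpr hpq
    · intro p hp; exact (Finset.mem_filter.mp hp).2.squarefree
  refine le_trans (Finset.sum_le_sum_of_subset_of_nonneg ?_ ?_) (sum_inv_le_inv_totient r x hsq)
  · intro a ha
    simp only [Finset.mem_filter] at ha ⊢
    exact ⟨ha.1.1, ha.2⟩
  · intros; positivity

theorem sum_smoothInd_mul_le (q x : ℕ) (F : ℕ → ℝ) (B : ℝ)
    (hB : ∀ y ∈ Finset.Icc 1 x, ∑ c ∈ Finset.Ioc 0 y, F c ≤ B * y) (hB0 : 0 ≤ B) :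
    ∑ a ∈ Finset.Ioc 0 x, smoothInd q a * ∑ c ∈ Finset.Ioc 0 (x / a), F c ≤ B * x * kap q x := by
  rw [kap, Finset.mul_sum]
  refine Finset.sum_le_sum fun a ha => ?_
  obtain ⟨h1, h2⟩ := Finset.mem_Ioc.mp ha
  have h3 := hB (x / a) (Finset.mem_Icc.mpr ⟨Nat.div_pos h2 h1, Nat.div_le_self _ _⟩)
  have h4 : ((x / a : ℕ) : ℝ) ≤ x / a := Nat.cast_div_le
  have := mul_le_mul_of_nonneg_left (h3.trans (mul_le_mul_of_nonneg_left h4 hB0))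
    (smoothInd_nonneg q a)
  refine this.trans (le_of_eq ?_); ring

theorem abs_sum_Ioc_sub_le {f G : ℝ → ℝ} (hf : MonotoneOn f (Set.Ici 1)) (hf0 : 0 ≤ f 1)
    (hG : ∀ t, 1 ≤ t → HasDerivAt G (f t) t) (y : ℝ) (hy : 1 ≤ y) :
    |∑ m ∈ Finset.Ioc 0 ⌊y⌋₊, f m - (G y - G 1)| ≤ f y := by
  have hmv : ∀ a b, 1 ≤ a → a ≤ b → f a * (b - a) ≤ G b - G a ∧ G b - G a ≤ f b * (b - a) := by
    intro a b ha hab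
    rcases hab.eq_or_lt with rfl | hab
    · simp
    obtain ⟨c, hc, h⟩ := exists_hasDerivAt_eq_slope G f hab
      (fun t ht => (hG t (ha.trans ht.1)).continuousAt.continuousWithinAt)
      (fun t ht => hG t (ha.trans ht.1.le))
    have hba : 0 < b - a := sub_pos.mpr hab
    rw [eq_div_iff hba.ne'] at h
    rw [← h]
    have hc1 : 1 ≤ c := ha.trans hc.1.le
    exact ⟨mul_le_mul_of_nonneg_right (hf ha hc1 hc.1.le) hba.le,
      mul_le_mul_of_nonneg_right (hf hc1 (ha.trans hab.le) hc.2.le) hba.le⟩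
  have key : ∀ M : ℕ, ∑ m ∈ Finset.Ioc 0 (M + 1), f m ≤ f (M + 1 : ℕ) + (G (M + 1 : ℕ) - G 1) ∧
      f 1 + (G (M + 1 : ℕ) - G 1) ≤ ∑ m ∈ Finset.Ioc 0 (M + 1), f m := by
    intro M
    induction M with
    | zero => simp
    | succ M ih =>
      rw [Finset.sum_Ioc_succ_top (by omega)]
      have := hmv (M + 1 : ℕ) (M + 1 + 1 : ℕ) (by push_cast; linarith [M.cast_nonneg (α := ℝ)])
        (by push_cast; linarith)
      have e1 : ((M + 1 + 1 : ℕ) : ℝ) - (M + 1 : ℕ) = 1 := by push_cast; ring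
      rw [e1, mul_one, mul_one] at this
      constructor <;> linarith [this.1, this.2, ih.1, ih.2]
  obtain ⟨M, hM⟩ : ∃ M, ⌊y⌋₊ = M + 1 := Nat.exists_eq_add_one.mpr (Nat.floor_pos.mpr hy)
  have h1 : ((M + 1 : ℕ) : ℝ) ≤ y := hM ▸ Nat.floor_le (by linarith)
  have h2 : y - (M + 1 : ℕ) ≤ 1 := by
    have := Nat.lt_floor_add_one y; rw [hM] at this; linarith
  have hM1 : (1 : ℝ) ≤ (M + 1 : ℕ) := by push_cast; linarith [M.cast_nonneg (α := ℝ)]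
  have h3 := hmv _ y hM1 h1
  have h4 := hf (Set.mem_Ici.mpr hM1) (Set.mem_Ici.mpr hy) h1
  have h5 := hf (Set.mem_Ici.mpr le_rfl) (Set.mem_Ici.mpr hy) hy
  have h6 := hf (Set.mem_Ici.mpr le_rfl) (Set.mem_Ici.mpr hM1) hM1
  have h7 : f y * (y - (M + 1 : ℕ)) ≤ f y := by
    nlinarith
  have h8 : 0 ≤ f (M + 1 : ℕ) * (y - (M + 1 : ℕ)) := mul_nonneg (by linarith) (by linarith)
  rw [hM, abs_le]
  constructor <;> linarith [(key M).1, (key M).2, h3.1, h3.2]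

theorem abs_sum_log_sub_le (y : ℝ) (hy : 1 ≤ y) :
    |∑ m ∈ Finset.Ioc 0 ⌊y⌋₊, Real.log m - (y * Real.log y - y + 1)| ≤ Real.log y := by
  have := abs_sum_Ioc_sub_le (f := Real.log) (G := fun t => t * Real.log t - t)
    (fun a ha b hb h => Real.log_le_log (by simp at ha; linarith) h) (by simp)
    (fun t ht => by
      have := ((hasDerivAt_id t).mul (Real.hasDerivAt_log (by linarith))).sub (hasDerivAt_id t)
      convert! this using 1
      simp; field_simp; ring) y hy
  simpa using this

theorem abs_sum_log_sq_sub_le (y : ℝ) (hy : 1 ≤ y) :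
    |∑ m ∈ Finset.Ioc 0 ⌊y⌋₊, Real.log m ^ 2 -
      (y * Real.log y ^ 2 - 2 * (y * Real.log y) + 2 * y - 2)| ≤ Real.log y ^ 2 := by
  have := abs_sum_Ioc_sub_le (f := fun t => Real.log t ^ 2)
    (G := fun t => t * Real.log t ^ 2 - 2 * (t * Real.log t) + 2 * t)
    (fun a ha b hb h => by
      simp at ha
      have := Real.log_le_log (by linarith) h
      have := Real.log_nonneg ha
      beta_reduce; gcongr) (by simp)
    (fun t ht => by
      have hl := Real.hasDerivAt_log (x := t) (by linarith)
      have := (((hasDerivAt_id t).mul (hl.pow 2)).sub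
        (((hasDerivAt_id t).mul hl).const_mul 2)).add ((hasDerivAt_id t).const_mul 2)
      convert! this using 1
      simp; field_simp; ring) y hy
  simpa using this

theorem sum_sqrt_div_le (x : ℕ) : ∑ d ∈ Finset.Ioc 0 x, √((x : ℝ) / d) ≤ 2 * x := by
  have key : ∀ x : ℕ, ∑ d ∈ Finset.Ioc 0 x, 1 / √(d : ℝ) ≤ 2 * √x := by
    intro x
    induction x with
    | zero => simp
    | succ n ih =>
      rw [Finset.sum_Ioc_succ_top (by omega)]
      have h0 : 0 < √((n + 1 : ℕ) : ℝ) := Real.sqrt_pos.mpr (by positivity)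
      have h1 : √(n : ℝ) ≤ √((n + 1 : ℕ) : ℝ) := Real.sqrt_le_sqrt (by push_cast; linarith)
      have h2 : √(n : ℝ) ^ 2 = n := Real.sq_sqrt (by positivity)
      have h3 : √((n + 1 : ℕ) : ℝ) ^ 2 = n + 1 := by
        rw [Real.sq_sqrt (by positivity)]; push_cast; ring
      have h4 : 1 / √((n + 1 : ℕ) : ℝ) ≤ 2 * √((n + 1 : ℕ) : ℝ) - 2 * √(n : ℝ) := by
        rw [div_le_iff₀ h0]
        nlinarith [sq_nonneg (√((n + 1 : ℕ) : ℝ) - √(n : ℝ))]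
      linarith
  have : ∑ d ∈ Finset.Ioc 0 x, √((x : ℝ) / d) = √(x : ℝ) * ∑ d ∈ Finset.Ioc 0 x, 1 / √(d : ℝ) := by
    rw [Finset.mul_sum]
    exact Finset.sum_congr rfl fun d _ => by rw [Real.sqrt_div (by positivity)]; ring
  rw [this]
  have h := mul_le_mul_of_nonneg_left (key x) (Real.sqrt_nonneg (x : ℝ))
  have h2 : √(x : ℝ) * √(x : ℝ) = x := Real.mul_self_sqrt (by positivity)
  linarith

theorem log_le_two_sqrt {t : ℝ} (ht : 0 < t) : Real.log t ≤ 2 * √t := by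
  have := Real.log_le_sub_one_of_pos (Real.sqrt_pos.mpr ht)
  rw [Real.log_sqrt ht.le] at this
  linarith

theorem log_sq_le_sqrt {t : ℝ} (ht : 1 ≤ t) : Real.log t ^ 2 ≤ 16 * √t := by
  have h1 := log_le_two_sqrt (Real.sqrt_pos.mpr (by linarith : 0 < t))
  rw [Real.log_sqrt (by linarith)] at h1
  have h2 := Real.log_nonneg ht
  have h3 : √(√t) ^ 2 = √t := Real.sq_sqrt (Real.sqrt_nonneg t)
  nlinarith [Real.sqrt_nonneg (√t)]

/-- Logarithmically weighted sums of the Möbius function over integers coprime to `q`. -/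
noncomputable def muLogSum (q x j : ℕ) : ℝ :=
  ∑ d ∈ Finset.Ioc 0 x, copMu q d / d * Real.log (x / d) ^ j

theorem abs_sum_copMu_mul_le (q x : ℕ) (F : ℕ → ℝ) :
    |∑ d ∈ Finset.Ioc 0 x, copMu q d * F d| ≤ ∑ d ∈ Finset.Ioc 0 x, |F d| := by
  refine (Finset.abs_sum_le_sum_abs _ _).trans (Finset.sum_le_sum fun d _ => ?_)
  rw [abs_mul]
  exact mul_le_of_le_one_left (abs_nonneg _) (abs_copMu_le q d)

theorem abs_muLogSum_zero_le (q x : ℕ) (hq : 1 ≤ q) (hx : 1 ≤ x) : |muLogSum q x 0| ≤ 2 := by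
  have hx' : (0 : ℝ) < x := by exact_mod_cast hx
  have h1 := ArithmeticFunction.sum_Ioc_mul_zeta_eq_sum (copMu q) x
  rw [copMu_mul_zeta q (by omega)] at h1
  have h2 : ∑ n ∈ Finset.Ioc 0 x, smoothInd q n ≤ x := by
    refine (Finset.sum_le_card_nsmul _ _ 1 fun n _ => smoothInd_le_one q n).trans (by simp)
  have h20 : 0 ≤ ∑ n ∈ Finset.Ioc 0 x, smoothInd q n :=
    Finset.sum_nonneg fun n _ => smoothInd_nonneg q n
  have h3 := abs_sum_copMu_mul_le q x fun d => (x : ℝ) / d - ((x / d : ℕ) : ℝ)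
  have h4 : ∑ d ∈ Finset.Ioc 0 x, |(x : ℝ) / d - ((x / d : ℕ) : ℝ)| ≤ x := by
    refine (Finset.sum_le_card_nsmul _ _ 1 fun d _ => ?_).trans (by simp)
    rw [← Nat.floor_div_eq_div (K := ℝ), abs_le]
    have := Nat.floor_le (by positivity : (0 : ℝ) ≤ x / d)
    have := Nat.lt_floor_add_one ((x : ℝ) / d)
    constructor <;> linarith
  have h5 : x * muLogSum q x 0 = ∑ d ∈ Finset.Ioc 0 x, copMu q d * ((x / d : ℕ) : ℝ) +
      ∑ d ∈ Finset.Ioc 0 x, copMu q d * ((x : ℝ) / d - ((x / d : ℕ) : ℝ)) := by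
    rw [← Finset.sum_add_distrib, muLogSum, Finset.mul_sum]
    exact Finset.sum_congr rfl fun d _ => by ring
  rw [← h1] at h5
  have h6 : |x * muLogSum q x 0| ≤ x * 2 := by
    rw [h5]
    refine (abs_add_le _ _).trans ?_
    rw [abs_of_nonneg h20]
    linarith
  rw [abs_mul, abs_of_pos hx'] at h6
  exact le_of_mul_le_mul_left h6 hx'

theorem abs_muLogSum_one_le (q x : ℕ) (hq : 1 ≤ q) (hx : 1 ≤ x) :
    |muLogSum q x 1| ≤ 13 * kap q x := by
  have hx' : (0 : ℝ) < x := by exact_mod_cast hx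
  have hk := one_le_kap q x hx
  have h0 := abs_muLogSum_zero_le q x hq hx
  have h1 := sum_copMu_mul_sum q (by omega) ArithmeticFunction.vonMangoldt x
  rw [ArithmeticFunction.zeta_mul_vonMangoldt] at h1
  have h2 := sum_smoothInd_mul_le q x vm 6 (fun y _ => sum_vm_Ioc_le y) (by norm_num)
  have h20 : 0 ≤ ∑ a ∈ Finset.Ioc 0 x, smoothInd q a * ∑ c ∈ Finset.Ioc 0 (x / a), vm c :=
    Finset.sum_nonneg fun a _ => mul_nonneg (smoothInd_nonneg q a)
      (Finset.sum_nonneg fun c _ => vm_nonneg c)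
  change ∑ a ∈ Finset.Ioc 0 x, smoothInd q a * ∑ c ∈ Finset.Ioc 0 (x / a),
    ArithmeticFunction.vonMangoldt c ≤ _ at h2
  change 0 ≤ ∑ a ∈ Finset.Ioc 0 x, smoothInd q a * ∑ c ∈ Finset.Ioc 0 (x / a),
    ArithmeticFunction.vonMangoldt c at h20
  set R : ℕ → ℝ := fun d => ∑ m ∈ Finset.Ioc 0 (x / d), Real.log m -
    ((x : ℝ) / d * Real.log (x / d) - x / d + 1) with hR
  have h3 : |∑ d ∈ Finset.Ioc 0 x, copMu q d * (R d + 1)| ≤ 5 * x := by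
    refine (abs_sum_copMu_mul_le q x _).trans ?_
    have : ∀ d ∈ Finset.Ioc 0 x, |R d + 1| ≤ 2 * √((x : ℝ) / d) + 1 := by
      intro d hd
      obtain ⟨hd1, hd2⟩ := Finset.mem_Ioc.mp hd
      have hd0 : (0 : ℝ) < d := by exact_mod_cast hd1
      have hy : 1 ≤ (x : ℝ) / d := (one_le_div hd0).mpr (by exact_mod_cast hd2)
      have := abs_sum_log_sub_le _ hy
      rw [Nat.floor_div_eq_div] at this
      have h' := log_le_two_sqrt (by linarith : 0 < (x : ℝ) / d)
      refine (abs_add_le _ _).trans ?_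
      rw [abs_one]
      linarith
    refine (Finset.sum_le_sum this).trans ?_
    rw [Finset.sum_add_distrib, ← Finset.mul_sum]
    have := sum_sqrt_div_le x
    simp only [Finset.sum_const, Nat.card_Ioc, nsmul_eq_mul, tsub_zero]
    linarith
  have h5 : x * muLogSum q x 1 = x * muLogSum q x 0 + ∑ d ∈ Finset.Ioc 0 x, copMu q d *
      ∑ m ∈ Finset.Ioc 0 (x / d), ArithmeticFunction.log m -
      ∑ d ∈ Finset.Ioc 0 x, copMu q d * (R d + 1) := by
    simp only [muLogSum, Finset.mul_sum (a := (x : ℝ))]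
    rw [← Finset.sum_add_distrib, ← Finset.sum_sub_distrib]
    refine Finset.sum_congr rfl fun d _ => ?_
    simp only [hR, ArithmeticFunction.log_apply]; ring
  rw [h1] at h5
  have h6 : |x * muLogSum q x 1| ≤ x * (13 * kap q x) := by
    rw [h5]
    refine (abs_sub _ _).trans ((add_le_add (abs_add_le _ _) le_rfl).trans ?_)
    rw [abs_mul, abs_of_pos hx', abs_of_nonneg h20]
    nlinarith
  rw [abs_mul, abs_of_pos hx'] at h6
  exact le_of_mul_le_mul_left h6 hx'

theorem abs_muLogSum_two_le (q x : ℕ) (hq : 1 ≤ q) (hx : 1 ≤ x) :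
    |muLogSum q x 2| ≤ 100 * kap q x * (1 + Real.log x) := by
  have hx' : (0 : ℝ) < x := by exact_mod_cast hx
  have hk := one_le_kap q x hx
  have hl : 0 ≤ Real.log x := Real.log_natCast_nonneg x
  have h0 := abs_muLogSum_zero_le q x hq hx
  have h0' := abs_muLogSum_one_le q x hq hx
  have h1 := sum_copMu_mul_sum q (by omega) lam2 x
  rw [zeta_mul_lam2] at h1
  have h2 := sum_smoothInd_mul_le q x lam2 (36 * (1 + Real.log x)) (fun y hy => by
    obtain ⟨hy1, hy2⟩ := Finset.mem_Icc.mp hy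
    refine (sum_lam2_le y).trans ?_
    have : Real.log y ≤ Real.log x := Real.log_le_log (by exact_mod_cast hy1) (by exact_mod_cast hy2)
    have : (y : ℝ) * Real.log y ≤ y * Real.log x := mul_le_mul_of_nonneg_left this (by positivity)
    nlinarith) (by positivity)
  have h20 : 0 ≤ ∑ a ∈ Finset.Ioc 0 x, smoothInd q a * ∑ c ∈ Finset.Ioc 0 (x / a), lam2 c :=
    Finset.sum_nonneg fun a _ => mul_nonneg (smoothInd_nonneg q a)
      (Finset.sum_nonneg fun c _ => lam2_nonneg c)
  set R : ℕ → ℝ := fun d => ∑ m ∈ Finset.Ioc 0 (x / d), Real.log m ^ 2 -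
    ((x : ℝ) / d * Real.log (x / d) ^ 2 - 2 * ((x : ℝ) / d * Real.log (x / d)) +
      2 * ((x : ℝ) / d) - 2) with hR
  have h3 : |∑ d ∈ Finset.Ioc 0 x, copMu q d * (R d - 2)| ≤ 34 * x := by
    refine (abs_sum_copMu_mul_le q x _).trans ?_
    have : ∀ d ∈ Finset.Ioc 0 x, |R d - 2| ≤ 16 * √((x : ℝ) / d) + 2 := by
      intro d hd
      obtain ⟨hd1, hd2⟩ := Finset.mem_Ioc.mp hd
      have hd0 : (0 : ℝ) < d := by exact_mod_cast hd1
      have hy : 1 ≤ (x : ℝ) / d := (one_le_div hd0).mpr (by exact_mod_cast hd2)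
      have := abs_sum_log_sq_sub_le _ hy
      rw [Nat.floor_div_eq_div] at this
      have h' := log_sq_le_sqrt hy
      refine (abs_sub _ _).trans ?_
      rw [abs_two]
      linarith
    refine (Finset.sum_le_sum this).trans ?_
    rw [Finset.sum_add_distrib, ← Finset.mul_sum]
    have := sum_sqrt_div_le x
    simp only [Finset.sum_const, Nat.card_Ioc, nsmul_eq_mul, tsub_zero]
    linarith
  have h5 : x * muLogSum q x 2 = x * (2 * muLogSum q x 1) - x * (2 * muLogSum q x 0) +
      ∑ d ∈ Finset.Ioc 0 x, copMu q d * ∑ m ∈ Finset.Ioc 0 (x / d), logSq m -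
      ∑ d ∈ Finset.Ioc 0 x, copMu q d * (R d - 2) := by
    simp only [muLogSum, Finset.mul_sum (a := (x : ℝ)), Finset.mul_sum (a := (2 : ℝ))]
    rw [← Finset.sum_sub_distrib, ← Finset.sum_add_distrib, ← Finset.sum_sub_distrib]
    refine Finset.sum_congr rfl fun d _ => ?_
    simp only [hR, logSq, ArithmeticFunction.pmul_apply, ArithmeticFunction.log_apply,
      ← pow_two]
    ring
  rw [h1] at h5
  have h6 : |x * muLogSum q x 2| ≤ x * (100 * kap q x * (1 + Real.log x)) := by
    rw [h5]
    refine (abs_sub _ _).trans ((add_le_add ((abs_add_le _ _).trans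
      (add_le_add (abs_sub _ _) le_rfl)) le_rfl).trans ?_)
    simp only [abs_mul, abs_of_pos hx', abs_of_nonneg h20, abs_two]
    have e1 : x * (2 * |muLogSum q x 1|) ≤ x * (26 * kap q x) :=
      mul_le_mul_of_nonneg_left (by linarith) hx'.le
    have e2 : x * (2 * |muLogSum q x 0|) ≤ x * 4 :=
      mul_le_mul_of_nonneg_left (by linarith) hx'.le
    have e3 : (x : ℝ) ≤ x * kap q x := le_mul_of_one_le_right hx'.le hk
    have e4 : 0 ≤ x * kap q x * Real.log x := by positivity
    nlinarith
  rw [abs_mul, abs_of_pos hx'] at h6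
  exact le_of_mul_le_mul_left h6 hx'

theorem sum_mul_eq_abel (c g : ℕ → ℂ) (K : ℕ) :
    ∑ i ∈ Finset.range K, c i * g i = (∑ i ∈ Finset.range K, c i) * g K -
      ∑ i ∈ Finset.range K, (∑ j ∈ Finset.range (i + 1), c j) * (g (i + 1) - g i) := by
  induction K with
  | zero => simp
  | succ K ih =>
    rw [Finset.sum_range_succ, ih, Finset.sum_range_succ (fun i => (∑ j ∈ Finset.range (i + 1), c j) *
      (g (i + 1) - g i)), Finset.sum_range_succ c]
    ring

theorem norm_sum_mul_le (c g : ℕ → ℂ) (K : ℕ) (B : ℝ)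
    (hB : ∀ n ≤ K, ‖∑ i ∈ Finset.range n, c i‖ ≤ B) (hg : g K = 0) :
    ‖∑ i ∈ Finset.range K, c i * g i‖ ≤ B * ∑ i ∈ Finset.range K, ‖g (i + 1) - g i‖ := by
  rw [sum_mul_eq_abel, hg, mul_zero, zero_sub, norm_neg, Finset.mul_sum]
  refine (norm_sum_le _ _).trans (Finset.sum_le_sum fun i hi => ?_)
  rw [norm_mul]
  exact mul_le_mul_of_nonneg_right (hB _ (by have := Finset.mem_range.mp hi; omega)) (norm_nonneg _)

theorem abs_wt_succ_sub_le {N : ℝ} (hN : 0 < N) (n : ℕ) : |wt N (n + 1) - wt N n| ≤ 1 / N := by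
  have hn : (0 : ℝ) ≤ n := by positivity
  have key : ∀ y : ℝ, N ≤ y → y ≤ n + 1 → |wt N (n + 1) - wt N y| ≤ (n + 1 - y) / N := by
    intro y hy hy'
    have hy0 : 0 < y := hN.trans_le hy
    refine (tri_lipschitz _ _).trans ?_
    rw [← Real.log_div (by positivity) (by positivity), div_div_div_cancel_right₀ hN.ne',
      abs_of_nonneg (Real.log_nonneg ((one_le_div hy0).mpr hy'))]
    refine (Real.log_le_sub_one_of_pos (by positivity)).trans ?_
    rw [div_sub_one hy0.ne']
    exact div_le_div_of_nonneg_left (by linarith) hN hy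
  rcases le_total N n with h | h
  · exact (key n h (by linarith)).trans (by simp)
  · rcases le_total (n + 1 : ℝ) N with h' | h'
    · rw [wt_eq_zero_of_le hN (by positivity) h', wt_eq_zero_of_le hN hn h]; simp; positivity
    · have := key N le_rfl h'
      rw [wt_eq_zero_of_le hN hN.le le_rfl] at this
      rw [wt_eq_zero_of_le hN hn h]
      exact this.trans (div_le_div_of_nonneg_right (by linarith) hN.le)

theorem norm_sum_wt_mul_le (N : ℝ) (hN : 1 ≤ N) (K : ℕ) (hK : 2 * N ≤ K) (c : ℕ → ℂ) (A B β : ℝ)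
    (P : ℕ → ℝ) (hB : ∀ n ≤ K, ‖∑ i ∈ Finset.range n, c i‖ ≤ B)
    (hP : ∀ n : ℕ, N ≤ n → (n : ℝ) ≤ 2 * N + 1 → |P n| ≤ A)
    (hP' : ∀ n : ℕ, N ≤ n → (n : ℝ) ≤ 2 * N → |P (n + 1) - P n| ≤ A / N) :
    ‖∑ n ∈ Finset.range K, c n * (wt N n * P n * expi (n * β))‖ ≤ 20 * A * B * (1 + N * |β|) := by
  have hN0 : 0 < N := by linarith
  have hB0 : 0 ≤ B := (norm_nonneg _).trans (hB 0 (Nat.zero_le _))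
  have hA0 : 0 ≤ A := by
    refine (abs_nonneg _).trans (hP ⌈N⌉₊ (Nat.le_ceil N) ?_)
    have := Nat.ceil_lt_add_one hN0.le
    linarith
  set g : ℕ → ℂ := fun n => wt N n * P n * expi (n * β) with hg
  have hgn : ∀ n : ℕ, ‖g n‖ = |wt N n| * |P n| := by
    intro n; simp [hg, norm_expi]
  set D : ℝ := A / N * (2 + 2 * Real.pi * (N * |β|)) with hD
  have hD0 : 0 ≤ D := by have := Real.pi_pos; positivity
  have hdiff : ∀ n : ℕ, ‖g (n + 1) - g n‖ ≤
      if n ∈ Finset.Icc ⌊N⌋₊ ⌊2 * N⌋₊ then D else 0 := by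
    intro n
    split_ifs with hn
    · rw [Finset.mem_Icc] at hn
      have hn2 : (n : ℝ) ≤ 2 * N := (Nat.le_floor_iff (by linarith)).mp hn.2
      have hw := abs_wt_succ_sub_le hN0 n
      rcases le_or_gt N n with h | h
      · have h1 := hP n h (by linarith)
        have h2 := hP' n h hn2
        have h3 := norm_expi_sub_expi_le (((n : ℝ) + 1) * β) (n * β)
        have e1 : g (n + 1) - g n =
            ((wt N (n + 1) - wt N n : ℝ) : ℂ) * (P (n + 1) : ℝ) * expi (((n : ℝ) + 1) * β) +
            (wt N n : ℝ) * ((P (n + 1) - P n : ℝ) : ℂ) * expi (((n : ℝ) + 1) * β) +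
            (wt N n : ℝ) * (P n : ℝ) * (expi (((n : ℝ) + 1) * β) - expi (n * β)) := by
          simp only [hg]; push_cast; ring
        rw [e1]
        refine norm_add₃_le.trans ?_
        simp only [norm_mul, Complex.norm_real, Real.norm_eq_abs, norm_expi, mul_one]
        have hw1 : |wt N n| ≤ 1 := by rw [abs_of_nonneg (wt_nonneg _ _)]; exact wt_le_one _ _
        have h4 := hP (n + 1) (by push_cast; linarith) (by push_cast; linarith)
        have e2 : ((n : ℝ) + 1) * β - n * β = β := by ring
        rw [e2] at h3
        have t1 := mul_le_mul hw h4 (abs_nonneg _) (by positivity)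
        have t2 := mul_le_mul hw1 h2 (abs_nonneg _) zero_le_one
        have t3 := mul_le_mul (mul_le_mul hw1 h1 (abs_nonneg _) zero_le_one) h3 (norm_nonneg _)
          (by positivity)
        have e3 : D = 1 / N * A + 1 * (A / N) + 1 * A * (2 * Real.pi * |β|) := by
          rw [hD]; field_simp; ring
        rw [e3]
        linarith
      · have h0 : g n = 0 := by
          simp [hg, wt_eq_zero_of_le hN0 (Nat.cast_nonneg n) h.le]
        rw [h0, sub_zero, hgn]
        rw [wt_eq_zero_of_le hN0 (Nat.cast_nonneg n) h.le, sub_zero] at hw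
        have hn1 : N ≤ (n + 1 : ℕ) := by
          have := Nat.lt_floor_add_one N
          have h5 : (⌊N⌋₊ : ℝ) ≤ n := by exact_mod_cast hn.1
          push_cast; linarith
        have h4 := hP (n + 1) hn1 (by push_cast; linarith)
        push_cast
        have t1 := mul_le_mul hw h4 (abs_nonneg _) (by positivity)
        refine t1.trans ?_
        have e3 : D = 1 / N * A + (A / N * (1 + 2 * Real.pi * (N * |β|))) := by rw [hD]; ring
        have : 0 ≤ A / N * (1 + 2 * Real.pi * (N * |β|)) := by have := Real.pi_pos; positivity
        linarith
    · rw [Finset.mem_Icc, not_and_or, not_le, not_le] at hn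
      have : g (n + 1) = 0 ∧ g n = 0 := by
        simp only [hg]
        rcases hn with hn | hn
        · have : ((n + 1 : ℕ) : ℝ) ≤ N := by
            refine le_trans ?_ (Nat.floor_le hN0.le)
            exact_mod_cast hn
          rw [wt_eq_zero_of_le hN0 (Nat.cast_nonneg _) this, wt_eq_zero_of_le hN0 (Nat.cast_nonneg _)
            (by push_cast at this; linarith)]
          simp
        · have : 2 * N < n := (Nat.floor_lt (by linarith)).mp hn
          rw [wt_eq_zero_of_ge hN0 (by push_cast; linarith), wt_eq_zero_of_ge hN0 this.le]
          simp
      rw [this.1, this.2]; simp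
  have hgK : g K = 0 := by simp [hg, wt_eq_zero_of_ge hN0 hK]
  refine (norm_sum_mul_le c g K B hB hgK).trans ?_
  have hcard : ∑ i ∈ Finset.range K, ‖g (i + 1) - g i‖ ≤ 3 * N * D := by
    refine (Finset.sum_le_sum fun i _ => hdiff i).trans ?_
    rw [← Finset.sum_filter, Finset.sum_const, nsmul_eq_mul]
    refine mul_le_mul_of_nonneg_right ?_ hD0
    have h1 : (Finset.filter (fun i => i ∈ Finset.Icc ⌊N⌋₊ ⌊2 * N⌋₊) (Finset.range K)).card ≤
        (Finset.Icc ⌊N⌋₊ ⌊2 * N⌋₊).card :=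
      Finset.card_le_card fun i hi => (Finset.mem_filter.mp hi).2
    rw [Nat.card_Icc] at h1
    have h2 := Nat.lt_floor_add_one N
    have h3 := Nat.floor_le (by linarith : 0 ≤ 2 * N)
    have h4 : ⌊N⌋₊ ≤ ⌊2 * N⌋₊ + 1 := (Nat.floor_le_floor (by linarith : N ≤ 2 * N)).trans (by omega)
    have h5 : ((⌊2 * N⌋₊ + 1 - ⌊N⌋₊ : ℕ) : ℝ) = ⌊2 * N⌋₊ + 1 - ⌊N⌋₊ := by
      rw [Nat.cast_sub h4]; push_cast; ring
    refine (Nat.cast_le.mpr h1).trans ?_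
    rw [h5]
    linarith
  refine (mul_le_mul_of_nonneg_left hcard hB0).trans ?_
  have e1 : B * (3 * N * D) = 3 * A * B * (2 + 2 * Real.pi * (N * |β|)) := by
    rw [hD]; field_simp
  rw [e1]
  have hpi := Real.pi_lt_d2
  have h6 : 0 ≤ A * B := by positivity
  have h7 : 0 ≤ A * B * (N * |β|) := by positivity
  nlinarith

theorem norm_sum_expi_le (y δ : ℝ) (hδ : 0 < δ) (h : ∀ k : ℤ, δ ≤ |y - k|) (n : ℕ) :
    ‖∑ m ∈ Finset.range n, expi (m * y)‖ ≤ 1 / (2 * δ) := by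
  have h1 : (expi y - 1) * ∑ m ∈ Finset.range n, expi (m * y) = expi (n * y) - 1 := by
    have := mul_geom_sum (expi y) n
    rw [expi_nat_mul, ← this]
    congr 1
    exact Finset.sum_congr rfl fun m _ => expi_nat_mul m y
  have h2 : ‖expi (n * y) - 1‖ ≤ 2 := by
    refine (norm_sub_le _ _).trans ?_
    rw [norm_expi]; norm_num
  have h3 : 4 * δ ≤ ‖expi y - 1‖ := by
    have h4 := le_norm_expi_sub_one (x := y - round y) (abs_sub_round y)
    have h5 : expi (y - round y) = expi y := by
      have := expi_add_int (y - round y) (round y)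
      rw [sub_add_cancel] at this
      exact this.symm
    rw [h5] at h4
    linarith [h (round y)]
  have h6 : 4 * δ * ‖∑ m ∈ Finset.range n, expi (m * y)‖ ≤ 2 := by
    refine le_trans ?_ h2
    rw [← h1, norm_mul]
    exact mul_le_mul_of_nonneg_right h3 (norm_nonneg _)
  rw [le_div_iff₀ (by positivity)]
  linarith

theorem sum_divisorsAntidiagonal_eq {R : Type*} [AddCommMonoid R] (F : ℕ → ℕ → R) (B : ℕ) :
    ∑ n ∈ Finset.Ioc 0 B, ∑ z ∈ n.divisorsAntidiagonal, F z.1 z.2 =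
      ∑ d ∈ Finset.Ioc 0 B, ∑ m ∈ Finset.Ioc 0 (B / d), F d m := by
  rw [Finset.sum_sigma', Finset.sum_sigma']
  refine Finset.sum_bij' (fun z _ => ⟨z.2.1, z.2.2⟩) (fun z _ => ⟨z.1 * z.2, (z.1, z.2)⟩) ?_ ?_ ?_ ?_ ?_
  · rintro ⟨n, d, m⟩ h
    simp only [Finset.mem_sigma, Finset.mem_Ioc, Nat.mem_divisorsAntidiagonal] at h ⊢
    obtain ⟨⟨h1, h2⟩, rfl, h3⟩ := h
    have hd : 0 < d := Nat.pos_of_ne_zero (left_ne_zero_of_mul h3)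
    have hm : 0 < m := Nat.pos_of_ne_zero (right_ne_zero_of_mul h3)
    refine ⟨⟨hd, ?_⟩, hm, ?_⟩
    · exact (Nat.le_mul_of_pos_right d hm).trans h2
    · rw [Nat.le_div_iff_mul_le hd, mul_comm]; exact h2
  · rintro ⟨d, m⟩ h
    simp only [Finset.mem_sigma, Finset.mem_Ioc, Nat.mem_divisorsAntidiagonal] at h ⊢
    obtain ⟨⟨h1, h2⟩, h3, h4⟩ := h
    rw [Nat.le_div_iff_mul_le h1, mul_comm] at h4
    exact ⟨⟨by positivity, h4⟩, trivial, by positivity⟩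
  · rintro ⟨n, d, m⟩ h
    simp only [Finset.mem_sigma, Nat.mem_divisorsAntidiagonal] at h
    simp [h.2.1]
  · rintro ⟨d, m⟩ h; rfl
  · rintro ⟨n, d, m⟩ h; rfl

theorem log_sq_variation (N w L : ℝ) (hN : 1 ≤ N) (hw : 0 < w) (hL : 1 ≤ L)
    (h : ∀ y, N ≤ y → y ≤ 2 * N + 1 → |Real.log (y / w)| ≤ L) :
    (∀ n : ℕ, N ≤ n → (n : ℝ) ≤ 2 * N + 1 → |Real.log (n / w) ^ 2| ≤ 2 * L ^ 2) ∧
    (∀ n : ℕ, N ≤ n → (n : ℝ) ≤ 2 * N →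
      |Real.log ((n + 1 : ℕ) / w) ^ 2 - Real.log (n / w) ^ 2| ≤ 2 * L ^ 2 / N) := by
  constructor
  · intro n h1 h2
    have := h n h1 h2
    rw [abs_pow]
    have h3 := abs_nonneg (Real.log (n / w))
    nlinarith
  · intro n h1 h2
    have hn : (0 : ℝ) < n := by linarith
    have e1 := h n h1 (by linarith)
    have e2 := h (n + 1 : ℕ) (by push_cast; linarith) (by push_cast; linarith)
    have e3 : |Real.log ((n + 1 : ℕ) / w) - Real.log (n / w)| ≤ 1 / N := by
      rw [← Real.log_div (by positivity) (by positivity), div_div_div_cancel_right₀ hw.ne',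
        abs_of_nonneg (Real.log_nonneg ((one_le_div hn).mpr (by push_cast; linarith)))]
      refine (Real.log_le_sub_one_of_pos (by positivity)).trans ?_
      rw [div_sub_one hn.ne']
      push_cast
      rw [add_sub_cancel_left]
      exact div_le_div_of_nonneg_left zero_le_one (by linarith) h1
    rw [sq_sub_sq, abs_mul]
    have e4 : |Real.log ((n + 1 : ℕ) / w) + Real.log (n / w)| ≤ 2 * L ^ 2 := by
      refine (abs_add_le _ _).trans ?_
      nlinarith
    refine (mul_le_mul e4 e3 (abs_nonneg _) (by positivity)).trans (le_of_eq ?_)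
    ring

theorem wt_mul (N : ℝ) (d m : ℝ) : wt N (d * m) = wt (N / d) m := by
  unfold wt
  congr 2
  rw [div_div_eq_mul_div, mul_comm]

/-- The inner sum in the linear part of Selberg's identity. -/
noncomputable def innerSum (N α : ℝ) (d : ℕ) : ℂ :=
  ∑ m ∈ Finset.Ioc 0 (⌊2 * N⌋₊ / d), ((Real.log m ^ 2 : ℝ) : ℂ) * wt N (d * m) * expi (d * m * α)

theorem norm_innerSum_le_of_sep (N α β γ δ : ℝ) (d : ℕ) (hα : α = γ + β) (hd : 1 ≤ d) (hdN : d ≤ N) (hδ : 0 < δ)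
    (hsep : ∀ k : ℤ, δ ≤ |d * γ - k|) :
    ‖innerSum N α d‖ ≤ 20 * Real.log (3 * N) ^ 2 / δ * (1 + N * |β|) := by
  have hd0 : (0 : ℝ) < d := by exact_mod_cast hd
  have hd1 : (1 : ℝ) ≤ d := by exact_mod_cast hd
  have hN : 1 ≤ N := hd1.trans hdN
  have hN' : 1 ≤ N / d := (one_le_div hd0).mpr hdN
  have hL : 1 ≤ Real.log (3 * N) := by
    rw [Real.le_log_iff_exp_le (by linarith)]
    have := Real.exp_one_lt_d9; linarith
  have hle : N / d ≤ N := div_le_self (by linarith) hd1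
  have hB : ⌊2 * N⌋₊ / d = ⌊2 * (N / d)⌋₊ := by
    rw [← Nat.floor_div_natCast, mul_div_assoc]
  obtain ⟨v1, v2⟩ := log_sq_variation (N / d) 1 (Real.log (3 * N)) hN' one_pos hL (by
    intro y h1 h2
    rw [div_one, abs_of_nonneg (Real.log_nonneg (by linarith))]
    exact Real.log_le_log (by linarith) (by linarith))
  have := norm_sum_wt_mul_le (N / d) hN' (⌊2 * N⌋₊ / d + 1)
    (by rw [hB]; push_cast; exact (Nat.lt_floor_add_one _).le)
    (fun m => expi (m * (d * γ))) (2 * Real.log (3 * N) ^ 2) (1 / (2 * δ)) (d * β)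
    (fun n => Real.log (n / 1) ^ 2) (fun n _ => norm_sum_expi_le _ δ hδ hsep n) v1 v2
  have e1 : innerSum N α d = ∑ m ∈ Finset.range (⌊2 * N⌋₊ / d + 1), expi (m * (d * γ)) *
      (wt (N / d) m * ((Real.log ((m : ℝ) / 1) ^ 2 : ℝ) : ℂ) * expi (m * (d * β))) := by
    rw [Finset.sum_range_eq_add_Ico _ (by omega)]
    rw [innerSum]
    have h0 : wt (N / d) ((0 : ℕ) : ℝ) = 0 := by
      rw [Nat.cast_zero]; exact wt_eq_zero_of_le (by linarith) le_rfl (by linarith)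
    rw [h0]
    simp only [Complex.ofReal_zero, zero_mul, mul_zero, zero_add]
    refine Finset.sum_congr (by ext; simp; omega) fun m _ => ?_
    rw [wt_mul, hα, div_one]
    have : (d * m * (γ + β) : ℝ) = m * (d * γ) + m * (d * β) := by ring
    rw [this, expi_add]
    ring
  rw [e1]
  refine this.trans (le_of_eq ?_)
  rw [abs_mul, abs_of_pos hd0]
  field_simp

theorem sum_Ioc_dvd_eq {R : Type*} [AddCommMonoid R] (F : ℕ → R) (B d : ℕ) (hd : 1 ≤ d) :
    ∑ m ∈ Finset.Ioc 0 (B / d), F (d * m) =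
      ∑ n ∈ Finset.range (B + 1), if 0 < n ∧ d ∣ n then F n else 0 := by
  rw [← Finset.sum_filter]
  refine Finset.sum_bij (fun m _ => d * m) ?_ ?_ ?_ ?_
  · intro m hm
    simp only [Finset.mem_Ioc, Finset.mem_filter, Finset.mem_range] at hm ⊢
    have := (Nat.le_div_iff_mul_le hd).mp hm.2
    refine ⟨by rw [mul_comm]; omega, Nat.mul_pos hd hm.1, dvd_mul_right d m⟩
  · intro m _ m' _ h
    exact Nat.eq_of_mul_eq_mul_left hd h
  · intro n hn
    simp only [Finset.mem_filter, Finset.mem_range] at hn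
    obtain ⟨h1, h2, m, rfl⟩ := hn
    refine ⟨m, ?_, rfl⟩
    rw [Finset.mem_Ioc, Nat.le_div_iff_mul_le hd, mul_comm m]
    exact ⟨Nat.pos_of_mul_pos_left h2, by omega⟩
  · intros; rfl

theorem norm_innerSum_sub_le (N β : ℝ) (a : ℤ) (q d : ℕ) (hq : 1 ≤ q) (hd : 1 ≤ d) (hdN : d ≤ N)
    (hqd : q ∣ d) :
    ‖innerSum N (a / q + β) d - (1 / d : ℝ) * ∑ n ∈ Finset.range (⌊2 * N⌋₊ + 1),
      (wt N n : ℂ) * ((Real.log (n / d) ^ 2 : ℝ) : ℂ) * expi (n * β)‖ ≤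
      40 * Real.log (3 * N) ^ 2 * (1 + N * |β|) := by
  have hd0 : (0 : ℝ) < d := by exact_mod_cast hd
  have hd1 : (1 : ℝ) ≤ d := by exact_mod_cast hd
  have hN : 1 ≤ N := hd1.trans hdN
  have hL : 1 ≤ Real.log (3 * N) := by
    rw [Real.le_log_iff_exp_le (by linarith)]
    have := Real.exp_one_lt_d9; linarith
  set K := ⌊2 * N⌋₊ + 1 with hK
  obtain ⟨v1, v2⟩ := log_sq_variation N d (Real.log (3 * N)) hN hd0 hL (by
    intro y h1 h2
    have h3 : 1 ≤ y / d := (one_le_div hd0).mpr (by linarith)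
    rw [abs_of_nonneg (Real.log_nonneg h3)]
    refine Real.log_le_log (by linarith) ((div_le_self (by linarith) hd1).trans (by linarith)))
  set c : ℕ → ℂ := fun n => (if 0 < n ∧ d ∣ n then 1 else 0) - (if 0 < n then (1 / d : ℝ) else 0)
    with hc
  have hcB : ∀ n ≤ K, ‖∑ i ∈ Finset.range n, c i‖ ≤ 1 := by
    intro n _
    rcases n with _ | n
    · simp
    have h1 : ∑ i ∈ Finset.range (n + 1), c i = ((((n / d : ℕ) : ℝ) - n / d : ℝ) : ℂ) := by
      simp only [hc, Finset.sum_sub_distrib]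
      rw [← sum_Ioc_dvd_eq (fun _ => (1 : ℂ)) n d hd, Finset.sum_range_succ']
      simp
      ring
    rw [h1, Complex.norm_real, Real.norm_eq_abs, ← Nat.floor_div_eq_div (K := ℝ), abs_le]
    have := Nat.floor_le (by positivity : (0 : ℝ) ≤ n / d)
    have := Nat.lt_floor_add_one ((n : ℝ) / d)
    constructor <;> linarith
  have := norm_sum_wt_mul_le N hN K (by rw [hK]; push_cast; exact (Nat.lt_floor_add_one _).le)
    c (2 * Real.log (3 * N) ^ 2) 1 β (fun n => Real.log (n / d) ^ 2) hcB v1 v2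
  have e1 : innerSum N (a / q + β) d = ∑ n ∈ Finset.range K, if 0 < n ∧ d ∣ n then
      (wt N n : ℂ) * ((Real.log (n / d) ^ 2 : ℝ) : ℂ) * expi (n * β) else 0 := by
    rw [← sum_Ioc_dvd_eq (fun n => (wt N n : ℂ) * ((Real.log (n / d) ^ 2 : ℝ) : ℂ) * expi (n * β))
      _ d hd, innerSum]
    refine Finset.sum_congr rfl fun m _ => ?_
    obtain ⟨r, rfl⟩ := hqd
    have hq0 : (q : ℝ) ≠ 0 := by positivity
    have e2 : ((q * r : ℕ) * m * (a / q + β) : ℝ) = (q * r : ℕ) * m * β + ((r * m * a : ℤ) : ℝ) := by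
      push_cast; field_simp; ring
    rw [e2, expi_add_int]
    have e3 : (((q * r * m : ℕ) : ℝ) / (q * r : ℕ) : ℝ) = m := by
      rw [Nat.cast_mul (q * r) m, mul_div_cancel_left₀ _ hd0.ne']
    rw [e3, Nat.cast_mul (q * r) m]
    ring
  have e2 : ∑ n ∈ Finset.range K, c n * (wt N n * ((Real.log (n / d) ^ 2 : ℝ) : ℂ) * expi (n * β)) =
      innerSum N (a / q + β) d - (1 / d : ℝ) * ∑ n ∈ Finset.range K,
      (wt N n : ℂ) * ((Real.log (n / d) ^ 2 : ℝ) : ℂ) * expi (n * β) := by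
    rw [e1, Finset.mul_sum, ← Finset.sum_sub_distrib]
    refine Finset.sum_congr rfl fun n _ => ?_
    simp only [hc]
    rcases Nat.eq_zero_or_pos n with rfl | hn
    · simp [wt_eq_zero_of_le (show 0 < N by linarith) le_rfl (show 0 ≤ N by linarith)]
    · simp only [hn, true_and, if_true]
      split_ifs <;> ring
  rw [e2] at this
  refine this.trans (le_of_eq (by ring))

theorem sum_log_sq_tail_le (N Z : ℝ) (hN : 0 ≤ N) (hZ : 1 ≤ Z) (s : Finset (ℕ × ℕ))
    (hs : ∀ z ∈ s, 1 ≤ z.1 ∧ 1 ≤ z.2 ∧ (z.1 * z.2 : ℝ) ≤ 2 * N ∧ (z.2 : ℝ) ≤ Z) :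
    ∑ z ∈ s, Real.log z.2 ^ 2 ≤ 2 * N * Real.log Z ^ 2 * (1 + Real.log Z) := by
  have hlZ := Real.log_nonneg hZ
  have hsub : s ⊆ (Finset.Icc 1 ⌊Z⌋₊).biUnion
      (fun m => Finset.Icc 1 ⌊2 * N / m⌋₊ ×ˢ {m}) := by
    rintro ⟨d, m⟩ hz
    obtain ⟨h1, h2, h3, h4⟩ := hs _ hz
    simp only [Finset.mem_biUnion, Finset.mem_product, Finset.mem_Icc, Finset.mem_singleton]
    refine ⟨m, ⟨h2, Nat.le_floor h4⟩, ⟨h1, Nat.le_floor ?_⟩, rfl⟩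
    have : (0 : ℝ) < m := by exact_mod_cast h2
    rw [le_div_iff₀ this]; exact h3
  refine (Finset.sum_le_sum_of_subset_of_nonneg hsub fun _ _ _ => by positivity).trans ?_
  rw [Finset.sum_biUnion]
  swap
  · intro m _ m' _ h
    rw [Function.onFun, Finset.disjoint_left]
    rintro ⟨x, y⟩ h1 h2
    simp only [Finset.mem_product, Finset.mem_singleton] at h1 h2
    exact h (h1.2.symm.trans h2.2)
  have h1 : ∀ m ∈ Finset.Icc 1 ⌊Z⌋₊, ∑ z ∈ Finset.Icc 1 ⌊2 * N / m⌋₊ ×ˢ {m}, Real.log ((z : ℕ × ℕ).2 : ℝ) ^ 2 ≤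
      2 * N * Real.log Z ^ 2 * ((m : ℝ)⁻¹) := by
    intro m hm
    obtain ⟨h1, h2⟩ := Finset.mem_Icc.mp hm
    have hm0 : (0 : ℝ) < m := by exact_mod_cast h1
    have hm1 : (1 : ℝ) ≤ m := by exact_mod_cast h1
    rw [Finset.sum_product]
    simp only [Finset.sum_singleton, Finset.sum_const, Nat.card_Icc, add_tsub_cancel_right,
      nsmul_eq_mul]
    have h3 := Nat.floor_le (by positivity : 0 ≤ 2 * N / m)
    have h4 : Real.log m ≤ Real.log Z :=
      Real.log_le_log hm0 ((Nat.le_floor_iff (by linarith)).mp h2)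
    have h5 := Real.log_nonneg hm1
    calc (⌊2 * N / m⌋₊ : ℝ) * Real.log m ^ 2 ≤ 2 * N / m * Real.log Z ^ 2 :=
          mul_le_mul h3 (by gcongr) (by positivity) (by positivity)
      _ = _ := by ring
  refine (Finset.sum_le_sum h1).trans ?_
  rw [← Finset.mul_sum]
  refine mul_le_mul_of_nonneg_left ?_ (by positivity)
  have := harmonic_le_one_add_log ⌊Z⌋₊
  rw [harmonic_eq_sum_Icc] at this
  push_cast at this
  refine this.trans ?_
  have h2 : Real.log ⌊Z⌋₊ ≤ Real.log Z :=
    Real.log_le_log (by exact_mod_cast Nat.floor_pos.mpr hZ) (Nat.floor_le (by linarith))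
  linarith

/-- The smoothly weighted exponential sum with coefficients `f` at scale `N`. -/
noncomputable def expSum (f : ℕ → ℝ) (N α : ℝ) : ℂ :=
  ∑ n ∈ Finset.Ioc 0 ⌊2 * N⌋₊, (f n : ℂ) * wt N n * expi (n * α)

theorem expSum_lam2 (N α : ℝ) : expSum (fun n => lam2 n) N α =
    ∑ d ∈ Finset.Ioc 0 ⌊2 * N⌋₊, (ArithmeticFunction.moebius d : ℂ) * innerSum N α d := by
  have h1 : expSum (fun n => lam2 n) N α = ∑ n ∈ Finset.Ioc 0 ⌊2 * N⌋₊,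
      ∑ z ∈ n.divisorsAntidiagonal, (ArithmeticFunction.moebius z.1 : ℂ) *
        (((Real.log z.2 ^ 2 : ℝ) : ℂ) * wt N (z.1 * z.2) * expi (z.1 * z.2 * α)) := by
    refine Finset.sum_congr rfl fun n _ => ?_
    beta_reduce
    rw [← moebius_mul_logSq, ArithmeticFunction.mul_apply, Complex.ofReal_sum, Finset.sum_mul,
      Finset.sum_mul]
    refine Finset.sum_congr rfl fun z hz => ?_
    have hz' : (n : ℝ) = z.1 * z.2 := by
      rw [← (Nat.mem_divisorsAntidiagonal.mp hz).1, Nat.cast_mul]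
    have h2 : logSq z.2 = Real.log z.2 ^ 2 := by
      rw [logSq, ArithmeticFunction.pmul_apply, ArithmeticFunction.log_apply, sq]
    rw [hz', h2, ArithmeticFunction.intCoe_apply, Complex.ofReal_mul, Complex.ofReal_intCast]
    ring
  rw [h1, sum_divisorsAntidiagonal_eq (fun d m => (ArithmeticFunction.moebius d : ℂ) *
        (((Real.log m ^ 2 : ℝ) : ℂ) * wt N (d * m) * expi (d * m * α)))]
  refine Finset.sum_congr rfl fun d _ => ?_
  rw [innerSum, Finset.mul_sum]

theorem norm_moebius_le (d : ℕ) : ‖(ArithmeticFunction.moebius d : ℂ)‖ ≤ 1 := by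
  rw [Complex.norm_intCast]
  exact_mod_cast ArithmeticFunction.abs_moebius_le_one

theorem norm_sum_innerSum_tail_le (N α Z : ℝ) (D : ℕ) (hN : 0 < N) (hZ : 1 ≤ Z) (hD : 2 * N ≤ Z * (D + 1)) :
    ‖∑ d ∈ Finset.Ioc D ⌊2 * N⌋₊, (ArithmeticFunction.moebius d : ℂ) * innerSum N α d‖ ≤
      2 * N * Real.log Z ^ 2 * (1 + Real.log Z) := by
  refine le_trans ?_ (sum_log_sq_tail_le N Z hN.le hZ
    ((Finset.Ioc 0 ⌊2 * N⌋₊ ×ˢ Finset.Ioc 0 ⌊2 * N⌋₊).filter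
      (fun z => D < z.1 ∧ z.2 ≤ ⌊2 * N⌋₊ / z.1)) ?_)
  · rw [Finset.sum_filter, Finset.sum_product]
    refine (norm_sum_le _ _).trans ?_
    have h1 : ∀ d ∈ Finset.Ioc D ⌊2 * N⌋₊, ‖(ArithmeticFunction.moebius d : ℂ) * innerSum N α d‖ ≤
        ∑ m ∈ Finset.Ioc 0 ⌊2 * N⌋₊, if D < d ∧ m ≤ ⌊2 * N⌋₊ / d then Real.log m ^ 2 else 0 := by
      intro d hd
      rw [Finset.mem_Ioc] at hd
      rw [← Finset.sum_filter, norm_mul]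
      refine (mul_le_of_le_one_left (norm_nonneg _) (norm_moebius_le d)).trans ?_
      have h2 : (Finset.Ioc 0 ⌊2 * N⌋₊).filter (fun m => D < d ∧ m ≤ ⌊2 * N⌋₊ / d) =
          Finset.Ioc 0 (⌊2 * N⌋₊ / d) := by
        ext m
        simp only [Finset.mem_filter, Finset.mem_Ioc, hd.1, true_and]
        have := Nat.div_le_self ⌊2 * N⌋₊ d
        constructor
        · rintro ⟨⟨a, b⟩, c⟩; exact ⟨a, c⟩
        · rintro ⟨a, b⟩; exact ⟨⟨a, by omega⟩, b⟩
      rw [h2]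
      refine (norm_sum_le _ _).trans (Finset.sum_le_sum fun m _ => ?_)
      rw [norm_mul, norm_mul, norm_expi, mul_one, Complex.norm_real, Complex.norm_real,
        Real.norm_of_nonneg (by positivity), Real.norm_of_nonneg (wt_nonneg _ _)]
      exact mul_le_of_le_one_right (by positivity) (wt_le_one _ _)
    refine (Finset.sum_le_sum h1).trans (Finset.sum_le_sum_of_subset_of_nonneg
      (Finset.Ioc_subset_Ioc_left (by omega)) fun d _ _ => Finset.sum_nonneg fun m _ => ?_)
    split_ifs <;> positivity
  · rintro ⟨d, m⟩ hz
    simp only [Finset.mem_filter, Finset.mem_product, Finset.mem_Ioc] at hz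
    obtain ⟨⟨⟨h1, -⟩, h2, -⟩, h3, h4⟩ := hz
    rw [Nat.le_div_iff_mul_le (by omega)] at h4
    have h5 : ((m * d : ℕ) : ℝ) ≤ 2 * N := (Nat.cast_le.mpr h4).trans (Nat.floor_le (by linarith))
    push_cast at h5
    refine ⟨h1, h2, by linarith, ?_⟩
    have h6 : (D + 1 : ℝ) ≤ d := by exact_mod_cast h3
    have h7 : (0 : ℝ) ≤ m := by positivity
    have h8 : (m : ℝ) * (D + 1) ≤ m * d := by gcongr
    exact le_of_mul_le_mul_right (by linarith : (m : ℝ) * (D + 1) ≤ Z * (D + 1)) (by positivity)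

/-- The smooth density attached to multiples of `q` in the linear part of Selberg's identity. -/
noncomputable def muDens (q D : ℕ) (t : ℝ) : ℝ :=
  ∑ d ∈ (Finset.Ioc 0 D).filter (q ∣ ·), (ArithmeticFunction.moebius d : ℝ) / d * Real.log (t / d) ^ 2

theorem muDens_eq (q D : ℕ) (t : ℝ) (hq : 1 ≤ q) (hx : 1 ≤ D / q) (ht : 0 < t) :
    muDens q D t = (ArithmeticFunction.moebius q : ℝ) / q * (muLogSum q (D / q) 2 +
      2 * Real.log (t / (q * (D / q : ℕ))) * muLogSum q (D / q) 1 +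
      Real.log (t / (q * (D / q : ℕ))) ^ 2 * muLogSum q (D / q) 0) := by
  set x := D / q
  set ℓ := Real.log (t / (q * x))
  have hq0 : (0 : ℝ) < q := by exact_mod_cast hq
  have hx0 : (0 : ℝ) < x := by exact_mod_cast hx
  have h1 : muDens q D t = ∑ d ∈ Finset.Ioc 0 x,
      (ArithmeticFunction.moebius q : ℝ) / q * (copMu q d / d * (Real.log (x / d) + ℓ) ^ 2) := by
    rw [muDens]
    symm
    refine Finset.sum_bij (fun d _ => q * d) ?_ ?_ ?_ ?_
    · intro d hd
      simp only [Finset.mem_Ioc, Finset.mem_filter] at hd ⊢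
      have := (Nat.le_div_iff_mul_le hq).mp hd.2
      exact ⟨⟨Nat.mul_pos hq hd.1, by rw [mul_comm]; exact this⟩, dvd_mul_right q d⟩
    · intro d _ d' _ h
      exact Nat.eq_of_mul_eq_mul_left hq h
    · intro n hn
      simp only [Finset.mem_Ioc, Finset.mem_filter] at hn
      obtain ⟨⟨h1, h2⟩, m, rfl⟩ := hn
      refine ⟨m, ?_, rfl⟩
      rw [Finset.mem_Ioc, Nat.le_div_iff_mul_le hq, mul_comm m]
      exact ⟨Nat.pos_of_mul_pos_left h1, h2⟩
    · intro d hd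
      have hd0 : (0 : ℝ) < d := by exact_mod_cast (Finset.mem_Ioc.mp hd).1
      have e1 : Real.log (x / d) + ℓ = Real.log (t / (q * d : ℕ)) := by
        rw [← Real.log_mul (by positivity) (by positivity)]
        congr 1
        push_cast
        field_simp
      rw [e1, copMu_apply]
      split_ifs with hc
      · rw [ArithmeticFunction.isMultiplicative_moebius.map_mul_of_coprime hc.symm]
        push_cast
        field_simp
      · have : ArithmeticFunction.moebius (q * d) = 0 := by
          refine ArithmeticFunction.moebius_eq_zero_of_not_squarefree fun h => hc ?_
          exact (Nat.squarefree_mul_iff.mp h).1.symm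
        rw [this]
        simp
  rw [h1, ← Finset.mul_sum]
  congr 1
  simp only [muLogSum, Finset.mul_sum]
  rw [← Finset.sum_add_distrib, ← Finset.sum_add_distrib]
  refine Finset.sum_congr rfl fun d _ => ?_
  ring

theorem muDens_eq_zero (q D : ℕ) (t : ℝ) (hx : D / q = 0) (hq : 1 ≤ q) : muDens q D t = 0 := by
  refine Finset.sum_eq_zero fun d hd => ?_
  simp only [Finset.mem_Ioc, Finset.mem_filter] at hd
  have := Nat.le_of_dvd hd.1.1 hd.2
  have := (Nat.div_eq_zero_iff).mp hx
  omega

set_option maxHeartbeats 1000000 in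
theorem muDens_variation (q D : ℕ) (N Lz : ℝ) (hq : 1 ≤ q) (hD : 1 ≤ D) (hN : 1 ≤ N) (hDN : D ≤ N)
    (hLz : Real.log (6 * N / D) ≤ Lz) :
    (∀ n : ℕ, N ≤ n → (n : ℝ) ≤ 2 * N + 1 → |muDens q D n| ≤
      mertE q / q * (100 * (1 + Real.log N) + 26 * Lz + 2 * Lz ^ 2)) ∧
    (∀ n : ℕ, N ≤ n → (n : ℝ) ≤ 2 * N → |muDens q D (n + 1 : ℕ) - muDens q D n| ≤
      mertE q / q * (100 * (1 + Real.log N) + 26 * Lz + 2 * Lz ^ 2) / N) := by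
  have hq0 : (0 : ℝ) < q := by exact_mod_cast hq
  have hD0 : (0 : ℝ) < D := by exact_mod_cast hD
  have hLz0 : 0 ≤ Lz := (Real.log_nonneg (by rw [le_div_iff₀ hD0]; linarith)).trans hLz
  have hlN := Real.log_nonneg hN
  have hE := (mertE_pos q).le
  rcases Nat.eq_zero_or_pos (D / q) with hx | hx
  · simp only [muDens_eq_zero q D _ hx hq, abs_zero, sub_zero]
    exact ⟨fun _ _ _ => by positivity, fun _ _ _ => by positivity⟩
  have hx0 : (0 : ℝ) < (D / q : ℕ) := by exact_mod_cast hx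
  have hxD : ((q * (D / q) : ℕ) : ℝ) ≤ D := by exact_mod_cast Nat.mul_div_le D q
  have hxD2 : (D : ℝ) ≤ 2 * (q * (D / q : ℕ)) := by
    have h1 := Nat.lt_mul_div_succ D (show 0 < q by omega)
    have h2 : q ≤ q * (D / q) := Nat.le_mul_of_pos_right q hx
    have : D ≤ 2 * (q * (D / q)) := by rw [mul_add] at h1; omega
    exact_mod_cast this
  push_cast at hxD
  have hxle : Real.log (D / q : ℕ) ≤ Real.log N := by
    refine Real.log_le_log hx0 (le_trans ?_ hDN)
    exact_mod_cast Nat.div_le_self D q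
  have h0 := abs_muLogSum_zero_le q (D / q) hq hx
  have h1 := abs_muLogSum_one_le q (D / q) hq hx
  have h2 := abs_muLogSum_two_le q (D / q) hq hx
  have hk := one_le_kap q (D / q) hx
  have hkE := kap_le_mertE q (D / q) hq
  set κ := mertE q
  have hκ : 1 ≤ κ := hk.trans hkE
  set M0 := muLogSum q (D / q) 0
  set M1 := muLogSum q (D / q) 1
  set M2 := muLogSum q (D / q) 2
  set w : ℝ := q * (D / q : ℕ) with hw
  have hw0 : 0 < w := by positivity
  have h1' : |M1| ≤ 13 * κ := by linarith
  have h2' : |M2| ≤ κ * (100 * (1 + Real.log N)) := by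
    refine h2.trans ?_
    have hx1 := Real.log_natCast_nonneg (D / q)
    have : 100 * kap q (D / q) * (1 + Real.log (D / q : ℕ)) ≤ 100 * κ * (1 + Real.log N) := by
      gcongr
    linarith
  have hl : ∀ n : ℝ, N ≤ n → n ≤ 2 * N + 1 → 0 ≤ Real.log (n / w) ∧ Real.log (n / w) ≤ Lz := by
    intro n e1 e2
    have : 1 ≤ n / w := by rw [le_div_iff₀ hw0]; linarith
    refine ⟨Real.log_nonneg this, le_trans (Real.log_le_log (by linarith) ?_) hLz⟩
    rw [div_le_div_iff₀ hw0 hD0]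
    nlinarith
  have hμ : |(ArithmeticFunction.moebius q : ℝ) / q| ≤ 1 / q := by
    rw [abs_div, abs_of_pos hq0]
    gcongr
    exact_mod_cast ArithmeticFunction.abs_moebius_le_one
  constructor
  · intro n e1 e2
    obtain ⟨l0, l1⟩ := hl n e1 e2
    rw [muDens_eq q D n hq hx (by linarith), abs_mul]
    have : |M2 + 2 * Real.log (n / w) * M1 + Real.log (n / w) ^ 2 * M0| ≤
        κ * (100 * (1 + Real.log N) + 26 * Lz + 2 * Lz ^ 2) := by
      refine (abs_add_three _ _ _).trans ?_
      rw [abs_mul _ M1, abs_mul _ M0, abs_of_nonneg (show 0 ≤ 2 * Real.log (n / w) by positivity),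
        abs_of_nonneg (show 0 ≤ Real.log (n / w) ^ 2 by positivity)]
      have a1 : 2 * Real.log (n / w) * |M1| ≤ 2 * Lz * (13 * κ) := by gcongr
      have a2 : Real.log (n / w) ^ 2 * |M0| ≤ Lz ^ 2 * 2 := by gcongr
      have a3 : Lz ^ 2 * 2 ≤ κ * (Lz ^ 2 * 2) := le_mul_of_one_le_left (by positivity) hκ
      linarith
    refine (mul_le_mul hμ this (abs_nonneg _) (by positivity)).trans (le_of_eq (by ring))
  · intro n e1 e2
    have hn : (0 : ℝ) < n := by linarith
    obtain ⟨l0, l1⟩ := hl n e1 (by linarith)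
    obtain ⟨l2, l3⟩ := hl (n + 1 : ℕ) (by push_cast; linarith) (by push_cast; linarith)
    rw [muDens_eq q D n hq hx (by linarith), muDens_eq q D (n + 1 : ℕ) hq hx (by positivity),
      ← mul_sub, abs_mul]
    have hd0 : |Real.log ((n + 1 : ℕ) / w) - Real.log (n / w)| ≤ 1 / N := by
      rw [← Real.log_div (by positivity) (by positivity), div_div_div_cancel_right₀ hw0.ne',
        abs_of_nonneg (Real.log_nonneg ((one_le_div hn).mpr (by push_cast; linarith)))]
      refine (Real.log_le_sub_one_of_pos (by positivity)).trans ?_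
      rw [div_sub_one hn.ne']
      push_cast
      rw [add_sub_cancel_left]
      exact div_le_div_of_nonneg_left zero_le_one (by linarith) e1
    set a := Real.log ((n + 1 : ℕ) / w)
    set b := Real.log (n / w)
    have e3 : M2 + 2 * a * M1 + a ^ 2 * M0 - (M2 + 2 * b * M1 + b ^ 2 * M0) =
        (a - b) * (2 * M1 + (a + b) * M0) := by ring
    have e4 : |2 * M1 + (a + b) * M0| ≤ κ * (100 * (1 + Real.log N) + 26 * Lz + 2 * Lz ^ 2) := by
      refine (abs_add_le _ _).trans ?_
      rw [abs_mul, abs_mul, abs_of_nonneg zero_le_two, abs_of_nonneg (by positivity : 0 ≤ a + b)]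
      have a2 : (a + b) * |M0| ≤ (Lz + Lz) * 2 := by gcongr
      have a3 : Lz * 4 ≤ κ * (Lz * 4) := le_mul_of_one_le_left (by positivity) hκ
      have a4 : 0 ≤ κ * (74 + 100 * Real.log N + 22 * Lz + 2 * Lz ^ 2) := by positivity
      linarith
    rw [e3, abs_mul]
    have : 0 ≤ κ * (100 * (1 + Real.log N) + 26 * Lz + 2 * Lz ^ 2) := by positivity
    refine (mul_le_mul hμ (mul_le_mul hd0 e4 (abs_nonneg _) (by positivity)) (by positivity)
      (by positivity)).trans (le_of_eq ?_)
    ring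

theorem norm_sum_muDens_le (q D : ℕ) (N β Lz : ℝ) (hq : 1 ≤ q) (hD : 1 ≤ D) (hN : 1 ≤ N) (hDN : D ≤ N)
    (hLz : Real.log (6 * N / D) ≤ Lz) (hβ : |β| ≤ 1 / 2) :
    ‖∑ n ∈ Finset.range (⌊2 * N⌋₊ + 1), (wt N n : ℂ) * muDens q D n * expi (n * β)‖ ≤
      10 * (mertE q / q * (100 * (1 + Real.log N) + 26 * Lz + 2 * Lz ^ 2)) * N /
        max 1 (N * |β|) := by
  obtain ⟨v1, v2⟩ := muDens_variation q D N Lz hq hD hN hDN hLz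
  set A := mertE q / q * (100 * (1 + Real.log N) + 26 * Lz + 2 * Lz ^ 2)
  have hA : 0 ≤ A := by
    obtain ⟨n, hn, hn'⟩ : ∃ n : ℕ, N ≤ n ∧ (n : ℝ) ≤ 2 * N + 1 :=
      ⟨⌈N⌉₊, Nat.le_ceil N, by linarith [Nat.ceil_lt_add_one (show 0 ≤ N by linarith)]⟩
    exact (abs_nonneg _).trans (v1 n hn hn')
  rcases le_total (N * |β|) 1 with h | h
  · rw [max_eq_left h, div_one]
    have h1 : ∀ n ∈ Finset.range (⌊2 * N⌋₊ + 1), ‖(wt N n : ℂ) * muDens q D n * expi (n * β)‖ ≤ A := by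
      intro n hn
      rw [norm_mul, norm_mul, norm_expi, mul_one, Complex.norm_real, Complex.norm_real,
        Real.norm_of_nonneg (wt_nonneg _ _), Real.norm_eq_abs]
      rcases le_total (n : ℝ) N with h1 | h1
      · rw [wt_eq_zero_of_le (by linarith) (by positivity) h1, zero_mul]; exact hA
      · have h2 : (n : ℝ) ≤ ⌊2 * N⌋₊ := by exact_mod_cast Nat.lt_succ_iff.mp (Finset.mem_range.mp hn)
        have := v1 n h1 (by linarith [Nat.floor_le (show 0 ≤ 2 * N by linarith)])
        exact (mul_le_of_le_one_left (abs_nonneg _) (wt_le_one _ _)).trans this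
    refine (norm_sum_le_of_le _ h1).trans ?_
    rw [Finset.sum_const, Finset.card_range, nsmul_eq_mul]
    push_cast
    have := Nat.floor_le (show 0 ≤ 2 * N by linarith)
    nlinarith
  · rw [max_eq_right h]
    have hβ0 : 0 < |β| := by
      by_contra h'
      have : |β| = 0 := le_antisymm (not_lt.mp h') (abs_nonneg _)
      rw [this] at h; linarith
    have := norm_sum_wt_mul_le N hN (⌊2 * N⌋₊ + 1) (by push_cast; exact (Nat.lt_floor_add_one _).le)
      (fun n => expi (n * β)) A (1 / (2 * |β|)) 0 (fun n => muDens q D n) (fun n _ =>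
        norm_sum_expi_le β |β| hβ0 (fun k => by
          rcases eq_or_ne k 0 with rfl | hk
          · simp
          · have h1 : (1 : ℝ) ≤ |(k : ℝ)| := by exact_mod_cast Int.one_le_abs hk
            have h2 := abs_sub_abs_le_abs_sub (k : ℝ) β
            rw [abs_sub_comm] at h2
            linarith) n) v1 v2
    simp only [mul_zero, expi_zero, mul_one, abs_zero, add_zero] at this
    refine (le_of_eq ?_).trans (this.trans (le_of_eq ?_))
    · congr 1
      exact Finset.sum_congr rfl fun n _ => by ring
    · field_simp
      ring

theorem inv_le_abs_mul_div_sub (a : ℤ) (q d : ℕ) (hq : 1 ≤ q) (haq : IsCoprime a (q : ℤ)) (hqd : ¬ q ∣ d)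
    (k : ℤ) : (1 / q : ℝ) ≤ |(d : ℝ) * (a / q) - k| := by
  have hq0 : (0 : ℝ) < q := by exact_mod_cast hq
  have h1 : (d : ℝ) * (a / q) - k = ((d * a - k * q : ℤ) : ℝ) / q := by
    push_cast; field_simp
  rw [h1, abs_div, abs_of_pos hq0]
  gcongr
  have : (d * a - k * q : ℤ) ≠ 0 := by
    intro h
    have h2 : (q : ℤ) ∣ d * a := ⟨k, by linarith⟩
    exact hqd (by exact_mod_cast haq.symm.dvd_of_dvd_mul_right h2)
  exact_mod_cast Int.one_le_abs this

theorem inv_mul_inv_max_le (q τ b : ℝ) (hq : 1 ≤ q) (hτ : τ = max q b) :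
    q ^ (-(1 / 2) : ℝ) / max 1 b ≤ τ ^ (-(1 / 2) : ℝ) := by
  rcases le_total b q with h | h
  · rw [hτ, max_eq_left h]
    exact div_le_self (by positivity) (le_max_left _ _)
  · have hb : 1 ≤ b := hq.trans h
    rw [hτ, max_eq_right h, max_eq_right hb, div_le_iff₀ (by linarith)]
    calc q ^ (-(1 / 2) : ℝ) ≤ 1 := Real.rpow_le_one_of_one_le_of_nonpos hq (by norm_num)
      _ ≤ b ^ (1 / 2 : ℝ) := Real.one_le_rpow hb (by norm_num)
      _ = _ := by
        rw [← Real.rpow_add_one (by positivity)]; norm_num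

theorem exists_norm_expSum_lam2_le : ∃ C : ℝ, 0 ≤ C ∧ ∀ (a : ℤ) (q : ℕ) (β τ N : ℝ), 1 ≤ q → 1 ≤ N →
    IsCoprime a q → τ = max (q : ℝ) (N * |β|) → |β| ≤ 1 / 2 → τ ^ 2 * Real.log (3 * N) ^ 2 ≤ N →
    ‖expSum (fun n => lam2 n) N (a / q + β)‖ ≤
      C * N * (Real.log (12 * (τ ^ 2 * Real.log (3 * N) ^ 2)) ^ 3 +
        τ ^ (-(1 / 2) : ℝ) * (1 + Real.log N)) := by
  obtain ⟨C, hC, hE⟩ := exists_mertE_le (1 / 2) (by norm_num)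
  refine ⟨1000 * C + 400, by positivity, fun a q β τ N hq hN haq hτ hβ hY => ?_⟩
  have hq0 : (0 : ℝ) < q := by exact_mod_cast hq
  have hq1 : (1 : ℝ) ≤ q := by exact_mod_cast hq
  have hqτ : (q : ℝ) ≤ τ := by rw [hτ]; exact le_max_left _ _
  have hβτ : N * |β| ≤ τ := by rw [hτ]; exact le_max_right _ _
  have hτ1 : 1 ≤ τ := hq1.trans hqτ
  have hL : 1 ≤ Real.log (3 * N) := by
    rw [Real.le_log_iff_exp_le (by linarith)]
    have := Real.exp_one_lt_d9; linarith
  set L := Real.log (3 * N)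
  set Y := τ ^ 2 * L ^ 2 with hYdef
  have hY1 : 1 ≤ Y := one_le_mul_of_one_le_of_one_le (one_le_pow₀ hτ1) (one_le_pow₀ hL)
  set D := ⌊N / Y⌋₊ with hDdef
  have hD : 1 ≤ D := Nat.floor_pos.mpr ((one_le_div (by linarith)).mpr hY)
  have hD0 : (0 : ℝ) < D := by exact_mod_cast hD
  have hDY : (D : ℝ) ≤ N / Y := Nat.floor_le (by positivity)
  have hDY2 : N / Y < D + 1 := Nat.lt_floor_add_one _
  have hDN : (D : ℝ) ≤ N := hDY.trans (div_le_self (by linarith) hY1)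
  have hDYN : D * Y ≤ N := by rwa [le_div_iff₀ (by linarith)] at hDY
  have hD1 : (1 : ℝ) ≤ D := by exact_mod_cast hD
  set Lz := Real.log (12 * Y) with hLzdef
  have hLz1 : 1 ≤ Lz := by
    rw [hLzdef, Real.le_log_iff_exp_le (by linarith)]
    have := Real.exp_one_lt_d9; linarith
  have hLz : Real.log (6 * N / D) ≤ Lz := by
    refine Real.log_le_log (by positivity) ?_
    rw [div_le_iff₀ hD0]
    rw [div_lt_iff₀ (by linarith)] at hDY2
    nlinarith
  have hDB : D ≤ ⌊2 * N⌋₊ := Nat.le_floor (by linarith)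
  set α : ℝ := a / q + β
  set μ : ℕ → ℂ := fun d => (ArithmeticFunction.moebius d : ℂ) with hμ
  have hμ1 : ∀ d, ‖μ d‖ ≤ 1 := norm_moebius_le
  set K := ⌊2 * N⌋₊ + 1
  set main : ℕ → ℂ := fun d => (1 / d : ℝ) * ∑ n ∈ Finset.range K,
      (wt N n : ℂ) * ((Real.log (n / d) ^ 2 : ℝ) : ℂ) * expi (n * β) with hmain
  have h1 : ‖∑ d ∈ Finset.Ioc D ⌊2 * N⌋₊, μ d * innerSum N α d‖ ≤ 4 * N * Lz ^ 3 := by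
    refine (norm_sum_innerSum_tail_le N α (2 * Y) D (by linarith) (by linarith) ?_).trans ?_
    · rw [div_lt_iff₀ (by linarith)] at hDY2
      nlinarith
    · have h2 : Real.log (2 * Y) ≤ Lz := Real.log_le_log (by linarith) (by linarith)
      have h3 : 0 ≤ Real.log (2 * Y) := Real.log_nonneg (by linarith)
      calc 2 * N * Real.log (2 * Y) ^ 2 * (1 + Real.log (2 * Y)) ≤ 2 * N * Lz ^ 2 * (Lz + Lz) := by
            gcongr
        _ = _ := by ring
  have h2 : ‖∑ d ∈ (Finset.Ioc 0 D).filter (fun d => ¬ q ∣ d), μ d * innerSum N α d‖ ≤ 40 * N := by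
    have h3 : ∀ d ∈ (Finset.Ioc 0 D).filter (fun d => ¬ q ∣ d), ‖μ d * innerSum N α d‖ ≤ 40 * Y := by
      intro d hd
      simp only [Finset.mem_filter, Finset.mem_Ioc] at hd
      obtain ⟨⟨e1, e2⟩, e3⟩ := hd
      rw [norm_mul]
      refine (mul_le_of_le_one_left (norm_nonneg _) (hμ1 d)).trans ?_
      refine (norm_innerSum_le_of_sep N α β (a / q) (1 / q) d rfl e1
        ((Nat.cast_le.mpr e2).trans hDN) (by positivity)
        (inv_le_abs_mul_div_sub a q d hq haq e3)).trans ?_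
      rw [div_div_eq_mul_div, div_one]
      calc 20 * L ^ 2 * q * (1 + N * |β|) ≤ 20 * L ^ 2 * τ * (τ + τ) := by gcongr
        _ = 40 * Y := by rw [hYdef]; ring
    refine (norm_sum_le_of_le _ h3).trans ?_
    rw [Finset.sum_const, nsmul_eq_mul]
    have h4 : (((Finset.Ioc 0 D).filter (fun d => ¬ q ∣ d)).card : ℝ) ≤ D := by
      exact_mod_cast (Finset.card_filter_le _ _).trans (by simp)
    nlinarith
  have h3 : ‖∑ d ∈ (Finset.Ioc 0 D).filter (fun d => q ∣ d), μ d * (innerSum N α d - main d)‖ ≤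
      80 * N := by
    have h3 : ∀ d ∈ (Finset.Ioc 0 D).filter (fun d => q ∣ d),
        ‖μ d * (innerSum N α d - main d)‖ ≤ 80 * Y := by
      intro d hd
      simp only [Finset.mem_filter, Finset.mem_Ioc] at hd
      obtain ⟨⟨e1, e2⟩, e3⟩ := hd
      rw [norm_mul]
      refine (mul_le_of_le_one_left (norm_nonneg _) (hμ1 d)).trans ?_
      refine (norm_innerSum_sub_le N β a q d hq e1 ((Nat.cast_le.mpr e2).trans hDN) e3).trans ?_
      have : L ^ 2 * 1 * (τ + τ) ≤ L ^ 2 * τ * (τ + τ) := by gcongr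
      calc 40 * L ^ 2 * (1 + N * |β|) ≤ 40 * L ^ 2 * (τ + τ) := by gcongr
        _ ≤ 80 * Y := by rw [hYdef]; nlinarith
    refine (norm_sum_le_of_le _ h3).trans ?_
    rw [Finset.sum_const, nsmul_eq_mul]
    have h4 : (((Finset.Ioc 0 D).filter (fun d => q ∣ d)).card : ℝ) ≤ D := by
      exact_mod_cast (Finset.card_filter_le _ _).trans (by simp)
    nlinarith
  have h4 : ‖∑ d ∈ (Finset.Ioc 0 D).filter (fun d => q ∣ d), μ d * main d‖ ≤
      1000 * C * N * (τ ^ (-(1 / 2) : ℝ) * (1 + Real.log N)) + 280 * C * N * Lz ^ 3 := by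
    have e1 : ∑ d ∈ (Finset.Ioc 0 D).filter (fun d => q ∣ d), μ d * main d =
        ∑ n ∈ Finset.range K, (wt N n : ℂ) * muDens q D n * expi (n * β) := by
      simp only [hmain, Finset.mul_sum]
      rw [Finset.sum_comm]
      refine Finset.sum_congr rfl fun n _ => ?_
      rw [muDens, Complex.ofReal_sum, Finset.mul_sum, Finset.sum_mul]
      refine Finset.sum_congr rfl fun d _ => ?_
      rw [hμ]
      beta_reduce
      simp only [Complex.ofReal_mul, Complex.ofReal_div, Complex.ofReal_intCast, Complex.ofReal_one]
      ring
    rw [e1]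
    refine (norm_sum_muDens_le q D N β Lz hq hD hN hDN hLz hβ).trans ?_
    have hm : 0 < max 1 (N * |β|) := lt_of_lt_of_le one_pos (le_max_left _ _)
    have hlN := Real.log_nonneg hN
    have e2 : mertE q / q ≤ C * q ^ (-(1 / 2) : ℝ) := by
      rw [div_le_iff₀ hq0, mul_assoc, ← Real.rpow_add_one hq0.ne']
      refine (hE q hq).trans (le_of_eq ?_)
      norm_num
    have e3 := inv_mul_inv_max_le q τ (N * |β|) hq1 hτ
    set P := 100 * (1 + Real.log N) + 26 * Lz + 2 * Lz ^ 2 with hP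
    have hP0 : 0 ≤ P := by positivity
    have e4 : τ ^ (-(1 / 2) : ℝ) ≤ 1 := Real.rpow_le_one_of_one_le_of_nonpos hτ1 (by norm_num)
    calc 10 * (mertE q / q * P) * N / max 1 (N * |β|)
        ≤ 10 * (C * q ^ (-(1 / 2) : ℝ) * P) * N / max 1 (N * |β|) := by gcongr
      _ = 10 * C * P * N * (q ^ (-(1 / 2) : ℝ) / max 1 (N * |β|)) := by ring
      _ ≤ 10 * C * P * N * τ ^ (-(1 / 2) : ℝ) := by gcongr
      _ = 1000 * C * N * (τ ^ (-(1 / 2) : ℝ) * (1 + Real.log N)) +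
          C * N * (260 * Lz + 20 * Lz ^ 2) * τ ^ (-(1 / 2) : ℝ) := by rw [hP]; ring
      _ ≤ 1000 * C * N * (τ ^ (-(1 / 2) : ℝ) * (1 + Real.log N)) +
          C * N * (260 * Lz ^ 3 + 20 * Lz ^ 3) * 1 := by
        have f1 : Lz ≤ Lz ^ 3 := le_self_pow₀ hLz1 (by norm_num)
        have f2 : Lz ^ 2 ≤ Lz ^ 3 := pow_le_pow_right₀ hLz1 (by norm_num)
        gcongr
      _ = _ := by ring
  have hsplit : expSum (fun n => lam2 n) N α =
      (∑ d ∈ (Finset.Ioc 0 D).filter (fun d => q ∣ d), μ d * main d +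
      ∑ d ∈ (Finset.Ioc 0 D).filter (fun d => q ∣ d), μ d * (innerSum N α d - main d)) +
      ∑ d ∈ (Finset.Ioc 0 D).filter (fun d => ¬ q ∣ d), μ d * innerSum N α d +
      ∑ d ∈ Finset.Ioc D ⌊2 * N⌋₊, μ d * innerSum N α d := by
    rw [expSum_lam2, ← Finset.sum_Ioc_consecutive _ (Nat.zero_le D) hDB,
      ← Finset.sum_filter_add_sum_filter_not (Finset.Ioc 0 D) (fun d => q ∣ d),
      ← Finset.sum_add_distrib]
    congr 3
    funext d
    rw [hμ]
    ring
  rw [hsplit]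
  have hn1 := norm_add_le ((∑ d ∈ (Finset.Ioc 0 D).filter (fun d => q ∣ d), μ d * main d +
      ∑ d ∈ (Finset.Ioc 0 D).filter (fun d => q ∣ d), μ d * (innerSum N α d - main d)) +
      ∑ d ∈ (Finset.Ioc 0 D).filter (fun d => ¬ q ∣ d), μ d * innerSum N α d)
      (∑ d ∈ Finset.Ioc D ⌊2 * N⌋₊, μ d * innerSum N α d)
  have hn2 := norm_add₃_le (a := ∑ d ∈ (Finset.Ioc 0 D).filter (fun d => q ∣ d), μ d * main d)
      (b := ∑ d ∈ (Finset.Ioc 0 D).filter (fun d => q ∣ d), μ d * (innerSum N α d - main d))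
      (c := ∑ d ∈ (Finset.Ioc 0 D).filter (fun d => ¬ q ∣ d), μ d * innerSum N α d)
  have hL3 : 1 ≤ Lz ^ 3 := one_le_pow₀ hLz1
  have hNL : N ≤ N * Lz ^ 3 := le_mul_of_one_le_right (by linarith) hL3
  have hlN := Real.log_nonneg hN
  have p1 : 0 ≤ C * N * Lz ^ 3 := by positivity
  have p2 : 0 ≤ N * (τ ^ (-(1 / 2) : ℝ) * (1 + Real.log N)) := by positivity
  have p3 : 0 ≤ N * Lz ^ 3 := by positivity
  calc _ ≤ 1000 * C * N * (τ ^ (-(1 / 2) : ℝ) * (1 + Real.log N)) + 280 * C * N * Lz ^ 3 +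
        80 * N + 40 * N + 4 * N * Lz ^ 3 := by linarith
    _ ≤ _ := by linarith

theorem expSum_mul (f g : ArithmeticFunction ℝ) (N α : ℝ) (hN : 0 < N) :
    expSum (fun n => (f * g) n) N α = bilin (fun n => f n) (fun n => g n) N α := by
  have h1 : expSum (fun n => (f * g) n) N α = ∑ n ∈ Finset.Ioc 0 ⌊2 * N⌋₊,
      ∑ z ∈ n.divisorsAntidiagonal, (f z.1 : ℂ) * g z.2 * wt N (z.1 * z.2) * expi (z.1 * z.2 * α) := by
    refine Finset.sum_congr rfl fun n _ => ?_
    beta_reduce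
    rw [ArithmeticFunction.mul_apply, Complex.ofReal_sum, Finset.sum_mul, Finset.sum_mul]
    refine Finset.sum_congr rfl fun z hz => ?_
    have hz' : (n : ℝ) = z.1 * z.2 := by
      rw [← (Nat.mem_divisorsAntidiagonal.mp hz).1, Nat.cast_mul]
    rw [hz', Complex.ofReal_mul]
  rw [h1, sum_divisorsAntidiagonal_eq (fun d m => (f d : ℂ) * g m * wt N (d * m) * expi (d * m * α)),
    bilin]
  refine Finset.sum_congr (by ext; simp; omega) fun d hd => ?_
  have hd0 : 0 < d := (Finset.mem_Icc.mp hd).1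
  refine Finset.sum_subset ?_ ?_
  · intro m hm
    rw [Finset.mem_Ioc] at hm
    rw [Finset.mem_Icc]
    exact ⟨hm.1, hm.2.trans (Nat.div_le_self _ _)⟩
  · intro m hm hm'
    rw [Finset.mem_Icc] at hm
    rw [Finset.mem_Ioc, not_and, Nat.le_div_iff_mul_le hd0, not_le] at hm'
    have h2 := Nat.lt_of_floor_lt (hm' (by omega))
    push_cast at h2
    rw [wt_eq_zero_of_ge hN (by linarith)]
    simp

theorem log_mul_norm_expSum_vm_le (N α : ℝ) (hN : 1 ≤ N) :
    Real.log N * ‖expSum vm N α‖ ≤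
      ‖expSum (fun n => lam2 n) N α‖ + ‖bilin (fun n => vm n) (fun n => vm n) N α‖ + 12 * N := by
  have hlN := Real.log_nonneg hN
  have h1 := expSum_mul ArithmeticFunction.vonMangoldt ArithmeticFunction.vonMangoldt N α (by linarith)
  change _ = bilin (fun n => vm n) (fun n => vm n) N α at h1
  have h2 : Real.log N * expSum vm N α = expSum (fun n => lam2 n) N α -
      bilin (fun n => vm n) (fun n => vm n) N α -
      expSum (fun n => Real.log (n / N) * vm n) N α := by
    rw [← h1]
    unfold expSum
    rw [Finset.mul_sum, ← Finset.sum_sub_distrib, ← Finset.sum_sub_distrib]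
    refine Finset.sum_congr rfl fun n hn => ?_
    have hn0 : (0 : ℝ) < n := by exact_mod_cast (Finset.mem_Ioc.mp hn).1
    have e1 : lam2 n = Real.log n * vm n +
        (ArithmeticFunction.vonMangoldt * ArithmeticFunction.vonMangoldt) n := by
      rw [lam2, ArithmeticFunction.add_apply, ArithmeticFunction.pmul_apply,
        ArithmeticFunction.log_apply]
      rfl
    beta_reduce
    rw [e1, Real.log_div hn0.ne' (by positivity)]
    simp only [Complex.ofReal_add, Complex.ofReal_mul, Complex.ofReal_sub]
    ring
  have h3 : ‖expSum (fun n => Real.log (n / N) * vm n) N α‖ ≤ 12 * N := by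
    have h4 : ∀ n ∈ Finset.Ioc 0 ⌊2 * N⌋₊,
        ‖((Real.log (n / N) * vm n : ℝ) : ℂ) * wt N n * expi (n * α)‖ ≤ vm n := by
      intro n hn
      obtain ⟨hn1, hn2⟩ := Finset.mem_Ioc.mp hn
      have hn0 : (0 : ℝ) < n := by exact_mod_cast hn1
      have hn3 : (n : ℝ) ≤ 2 * N := (Nat.le_floor_iff (by linarith)).mp hn2
      have hv := vm_nonneg n
      rcases le_total (n : ℝ) N with h | h
      · rw [wt_eq_zero_of_le (by linarith) hn0.le h]; simpa using hv
      · have e1 : 0 ≤ Real.log (n / N) := Real.log_nonneg ((one_le_div (by linarith)).mpr h)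
        have e2 : Real.log (n / N) ≤ 1 := by
          have : Real.log (n / N) ≤ Real.log 2 := Real.log_le_log (by positivity) (by
            rw [div_le_iff₀ (by linarith)]; linarith)
          linarith [Real.log_two_lt_d9]
        rw [norm_mul, norm_mul, norm_expi, mul_one, Complex.norm_real, Complex.norm_real,
          Real.norm_of_nonneg (by positivity), Real.norm_of_nonneg (wt_nonneg _ _)]
        calc Real.log (n / N) * vm n * wt N n ≤ 1 * vm n * 1 := by
              gcongr
              · exact wt_nonneg _ _
              · exact wt_le_one _ _
          _ = _ := by ring
    refine (norm_sum_le_of_le _ h4).trans ?_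
    have := sum_vm_Ioc_le ⌊2 * N⌋₊
    have h5 := Nat.floor_le (show 0 ≤ 2 * N by linarith)
    change ∑ n ∈ Finset.Ioc 0 ⌊2 * N⌋₊, vm n ≤ _ at this
    linarith
  have h4 : ‖(Real.log N : ℂ) * expSum vm N α‖ = Real.log N * ‖expSum vm N α‖ := by
    rw [norm_mul, Complex.norm_real, Real.norm_of_nonneg hlN]
  rw [← h4, h2]
  refine (norm_sub_le _ _).trans ?_
  have := norm_sub_le (expSum (fun n => lam2 n) N α) (bilin (fun n => vm n) (fun n => vm n) N α)
  linarith

theorem eventually_log_pow_le : ∀ᶠ N : ℝ in atTop, 1 ≤ Real.log N ∧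
    (Real.log 108 + 34 * Real.log (Real.log N)) ^ 3 ≤ Real.log N ^ (1 / 5 : ℝ) ∧
    108 * Real.log N ^ 34 ≤ N := by
  have h1 : ∀ᶠ x : ℝ in atTop, (Real.log 108 + 34 * Real.log x) ^ 3 ≤ x ^ (1 / 5 : ℝ) := by
    have h2 : (fun x : ℝ => Real.log 108 + 34 * Real.log x) =o[atTop] fun x => x ^ (1 / 15 : ℝ) := by
      refine Asymptotics.IsLittleO.add ?_ ((isLittleO_log_rpow_atTop (by norm_num)).const_mul_left _)
      exact Asymptotics.isLittleO_const_left.mpr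
        (Or.inr (tendsto_norm_atTop_atTop.comp (tendsto_rpow_atTop (by norm_num))))
    filter_upwards [h2.bound one_pos, eventually_ge_atTop 1] with x hx hx1
    rw [one_mul, Real.norm_eq_abs, Real.norm_of_nonneg (by positivity)] at hx
    have := pow_le_pow_left₀ (abs_nonneg _) hx 3
    rw [← Real.rpow_mul_natCast (by positivity)] at this
    norm_num at this
    refine le_trans ?_ (this.trans (le_of_eq (by norm_num)))
    rw [← abs_pow]
    exact le_abs_self _
  have h3 : ∀ᶠ x : ℝ in atTop, 108 * x ^ 34 ≤ Real.exp x := by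
    have := (Real.isLittleO_pow_exp_atTop (n := 34)).bound (show (0 : ℝ) < 1 / 108 by norm_num)
    filter_upwards [this, eventually_ge_atTop 0] with x hx hx0
    rw [Real.norm_of_nonneg (by positivity), Real.norm_of_nonneg (by positivity)] at hx
    linarith
  filter_upwards [Real.tendsto_log_atTop.eventually h1, Real.tendsto_log_atTop.eventually h3,
    Real.tendsto_log_atTop.eventually (eventually_ge_atTop 1), eventually_gt_atTop 0] with N a b c d
  rw [Real.exp_log d] at b
  exact ⟨c, a, b⟩

theorem exists_norm_expSum_vm_le : ∃ C : ℝ, 0 ≤ C ∧ ∀ᶠ N : ℝ in atTop,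
    ∀ (a : ℤ) (q : ℕ) (β τ : ℝ), 1 ≤ q → IsCoprime a q → τ = max (q : ℝ) (N * |β|) →
      τ ≤ Real.log N ^ 16 → ‖expSum vm N (a / q + β)‖ ≤ C * N * τ ^ (-(1 / 20) : ℝ) := by
  obtain ⟨C1, hC1, h1⟩ := exists_norm_expSum_lam2_le
  obtain ⟨C2, hC2, h2⟩ := exists_norm_bilin_vm_le
  refine ⟨3 * C1 + 4 * C2 + 12, by positivity, ?_⟩
  filter_upwards [eventually_log_pow_le, eventually_ge_atTop 1] with N ⟨hl, hz, hbig⟩ hN a q β τ hq haq hτ hτQ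
  have hq1 : (1 : ℝ) ≤ q := by exact_mod_cast hq
  have hqτ : (q : ℝ) ≤ τ := by rw [hτ]; exact le_max_left _ _
  have hβτ : N * |β| ≤ τ := by rw [hτ]; exact le_max_right _ _
  have hτ1 : 1 ≤ τ := hq1.trans hqτ
  set l := Real.log N with hldef
  have hl0 : 0 < l := by linarith
  have hl3 : Real.log (3 * N) ≤ 3 * l := by
    rw [Real.log_mul (by norm_num) (by positivity)]
    have : Real.log 3 ≤ 2 := by linarith [Real.log_le_sub_one_of_pos (show (0 : ℝ) < 3 by norm_num)]
    linarith
  have hl30 : 0 ≤ Real.log (3 * N) := Real.log_nonneg (by linarith)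
  have hl31 : 1 ≤ Real.log (3 * N) := hl.trans (Real.log_le_log (by linarith) (by linarith))
  have hY : 12 * (τ ^ 2 * Real.log (3 * N) ^ 2) ≤ 108 * l ^ 34 := by
    calc 12 * (τ ^ 2 * Real.log (3 * N) ^ 2) ≤ 12 * ((l ^ 16) ^ 2 * (3 * l) ^ 2) := by gcongr
      _ = _ := by ring
  have hτ2 : 1 ≤ τ ^ 2 * Real.log (3 * N) ^ 2 :=
    one_le_mul_of_one_le_of_one_le (one_le_pow₀ hτ1) (one_le_pow₀ hl31)
  have hττ : τ ≤ τ ^ 2 * Real.log (3 * N) ^ 2 :=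
    (le_self_pow₀ hτ1 (by norm_num)).trans (le_mul_of_one_le_right (by positivity) (one_le_pow₀ hl31))
  set Lz := Real.log (12 * (τ ^ 2 * Real.log (3 * N) ^ 2)) with hLz
  have hLz1 : 1 ≤ Lz := by
    rw [hLz, Real.le_log_iff_exp_le (by linarith)]
    have := Real.exp_one_lt_d9; linarith
  have hLz3 : Lz ^ 3 ≤ l ^ (1 / 5 : ℝ) := by
    refine le_trans (pow_le_pow_left₀ (by linarith) ?_ 3) hz
    have : Lz ≤ Real.log (108 * l ^ 34) := Real.log_le_log (by linarith) hY
    rw [Real.log_mul (by norm_num) (by positivity), Real.log_pow] at this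
    exact_mod_cast this
  have hβ : |β| ≤ 1 / 2 := by
    have h3 : N * |β| ≤ N * (1 / 2) := by linarith
    exact le_of_mul_le_mul_left h3 (by linarith)
  have e1 := h1 a q β τ N hq hN haq hτ hβ (by linarith)
  have e2 := h2 a q β τ N hq hN haq hτ
  have e3 := log_mul_norm_expSum_vm_le N (a / q + β) hN
  have hlogτ : Real.log τ + 1 ≤ 2 * Lz ^ 3 := by
    have : Real.log τ ≤ Lz := Real.log_le_log (by linarith) (by linarith)
    have : Lz ≤ Lz ^ 3 := le_self_pow₀ hLz1 (by norm_num)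
    linarith
  have hk : l ^ (1 / 5 : ℝ) ≤ l * τ ^ (-(1 / 20) : ℝ) := by
    rw [Real.rpow_neg (by linarith), ← div_eq_mul_inv, le_div_iff₀ (by positivity)]
    have : τ ^ (1 / 20 : ℝ) ≤ l ^ (4 / 5 : ℝ) := by
      refine (Real.rpow_le_rpow (by linarith) hτQ (by norm_num)).trans (le_of_eq ?_)
      rw [← Real.rpow_natCast_mul (by linarith)]
      norm_num
    calc l ^ (1 / 5 : ℝ) * τ ^ (1 / 20 : ℝ) ≤ l ^ (1 / 5 : ℝ) * l ^ (4 / 5 : ℝ) := by gcongr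
      _ = l := by rw [← Real.rpow_add (by linarith)]; norm_num
  have t1 : τ ^ (-(1 / 2) : ℝ) ≤ τ ^ (-(1 / 20) : ℝ) := Real.rpow_le_rpow_of_exponent_le hτ1 (by norm_num)
  have t2 : τ ^ (-(3 / 8) : ℝ) ≤ τ ^ (-(1 / 20) : ℝ) := Real.rpow_le_rpow_of_exponent_le hτ1 (by norm_num)
  set t := τ ^ (-(1 / 20) : ℝ)
  have ht0 : 0 < t := by positivity
  have hlt : 1 ≤ l * t := (Real.one_le_rpow hl (by norm_num)).trans hk
  have g1 : Lz ^ 3 + τ ^ (-(1 / 2) : ℝ) * (1 + l) ≤ 3 * (l * t) := by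
    have : τ ^ (-(1 / 2) : ℝ) * (1 + l) ≤ t * (l + l) := by gcongr
    linarith
  have g2 : τ ^ (-(3 / 8) : ℝ) * (l + 1) + Real.log τ + 1 ≤ 4 * (l * t) := by
    have : τ ^ (-(3 / 8) : ℝ) * (l + 1) ≤ t * (l + l) := by gcongr
    linarith
  have g3 : l * ‖expSum vm N (a / q + β)‖ ≤ l * ((3 * C1 + 4 * C2 + 12) * N * t) := by
    have k1 : C1 * N * (Lz ^ 3 + τ ^ (-(1 / 2) : ℝ) * (1 + l)) ≤ C1 * N * (3 * (l * t)) := by gcongr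
    have k2 : C2 * N * (τ ^ (-(3 / 8) : ℝ) * (l + 1) + Real.log τ + 1) ≤ C2 * N * (4 * (l * t)) := by
      gcongr
    have k3 : N ≤ N * (l * t) := le_mul_of_one_le_right (by linarith) hlt
    calc _ ≤ C1 * N * (3 * (l * t)) + C2 * N * (4 * (l * t)) + 12 * (N * (l * t)) := by linarith
      _ = _ := by ring
  exact le_of_mul_le_mul_left g3 hl0

theorem card_win_le {X : ℝ} (hX : 0 ≤ X) : ((win X).card : ℝ) ≤ X + 1 := by
  have h1 : (win X).card ≤ ⌊√2 * X⌋₊ + 1 - ⌈X⌉₊ := by rw [win, Nat.card_Icc]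
  have h2 := Nat.floor_le (show 0 ≤ √2 * X by positivity)
  have h3 := Nat.le_ceil X
  have h4 := sqrt_two_lt
  have h5 : ((win X).card : ℝ) ≤ ((⌊√2 * X⌋₊ + 1 - ⌈X⌉₊ : ℕ) : ℝ) := by exact_mod_cast h1
  rcases le_total ⌈X⌉₊ (⌊√2 * X⌋₊ + 1) with h | h
  · rw [Nat.cast_sub h] at h5
    push_cast at h5
    nlinarith
  · rw [Nat.sub_eq_zero_of_le h, Nat.cast_zero] at h5
    linarith

theorem norm_block_sq_le (f g : ℕ → ℂ) (X M U V β : ℝ) (a : ℤ) (q : ℕ) (hX : 1 / 2 ≤ X) (hM : 1 / 2 ≤ M)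
    (hU : 0 ≤ U) (hV : 0 ≤ V) (hf : ∀ k ∈ win X, ‖f k‖ ≤ U) (hg : ∀ l ∈ win M, ‖g l‖ ≤ V)
    (hq : 1 ≤ q) (haq : IsCoprime a (q : ℤ)) (hβ : |β| ≤ 1 / (q : ℝ) ^ 2) :
    ‖block f g X M (a / q + β)‖ ^ 2 ≤
      72 * lsC * U ^ 2 * V ^ 2 * (X * M) * (X / q + 1) * (M + q) * 2 := by
  classical
  have hq0 : (0 : ℝ) < q := by exact_mod_cast hq
  set α : ℝ := a / q + β with hα
  set s : ℕ → ℝ := fun k => ‖trig (win M) g (k * α)‖ with hs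
  have hcs : ‖block f g X M α‖ ^ 2 ≤ (∑ k ∈ win X, ‖f k‖ ^ 2) * ∑ k ∈ win X, s k ^ 2 := by
    refine le_trans (pow_le_pow_left₀ (norm_nonneg _) ?_ 2) (Finset.sum_mul_sq_le_sq_mul_sq _ _ _)
    unfold block
    refine (norm_sum_le _ _).trans (le_of_eq (Finset.sum_congr rfl fun k _ => ?_))
    rw [norm_mul]
  have hF : ∑ k ∈ win X, ‖f k‖ ^ 2 ≤ 3 * X * U ^ 2 := by
    have := Finset.sum_le_card_nsmul (win X) (fun k => ‖f k‖ ^ 2) (U ^ 2)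
      (fun k hk => pow_le_pow_left₀ (norm_nonneg _) (hf k hk) 2)
    rw [nsmul_eq_mul] at this
    have h2 : ((win X).card : ℝ) ≤ 3 * X := by linarith [card_win_le (show 0 ≤ X by linarith)]
    exact this.trans (by gcongr)
  have hG : ∑ k ∈ win M, ‖g k‖ ^ 2 ≤ 3 * M * V ^ 2 := by
    have := Finset.sum_le_card_nsmul (win M) (fun k => ‖g k‖ ^ 2) (V ^ 2)
      (fun k hk => pow_le_pow_left₀ (norm_nonneg _) (hg k hk) 2)
    rw [nsmul_eq_mul] at this
    have h2 : ((win M).card : ℝ) ≤ 3 * M := by linarith [card_win_le (show 0 ≤ M by linarith)]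
    exact this.trans (by gcongr)
  set h := q / 2 + 1 with hh
  set L := 2 * q + ⌊2 * M⌋₊ with hL
  have hL0 : 0 < L := by omega
  have hLle : (L : ℝ) ≤ 2 * (M + q) := by
    rw [hL]; push_cast; linarith [Nat.floor_le (show 0 ≤ 2 * M by linarith)]
  have hgroup : ∀ j ∈ Finset.range (⌊2 * X⌋₊ / h + 1), ∑ k ∈ (win X).filter (fun k => k / h = j), s k ^ 2 ≤
      lsC * (2 * (M + q)) * (3 * M * V ^ 2) := by
    intro j _
    have := large_sieve ((win X).filter (fun k => k / h = j)) (fun k => (k : ℝ) * α) L hL0 0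
      (win M) (by
        intro l hl
        have := win_subset (show 0 < M by linarith) hl
        rw [Finset.mem_Icc] at this
        rw [Finset.mem_Ico]
        omega) g (by
        intro k hk k' hk' hne z
        simp only [Finset.mem_filter] at hk hk'
        have hd : ∀ m n : ℕ, m / h = j → n / h = j → m < n → ∀ z : ℤ,
            1 / (L : ℝ) ≤ |(n : ℝ) * α - m * α - z| := by
          intro m n hm hn hmn z
          obtain ⟨r, rfl⟩ := Nat.exists_eq_add_of_lt hmn
          have hr : r + 1 ≤ q / 2 := by
            have e1 := Nat.div_add_mod m h
            have e2 := Nat.div_add_mod (m + r + 1) h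
            have e3 := Nat.mod_lt (m + r + 1) (show 0 < h by omega)
            rw [hm] at e1; rw [hn] at e2
            omega
          have hr' : ((r + 1 : ℕ) : ℝ) ≤ q / 2 := by
            rw [le_div_iff₀ two_pos]
            exact_mod_cast (by omega : (r + 1) * 2 ≤ q)
          have hnd : ¬ q ∣ (r + 1) := fun h => by
            have := Nat.le_of_dvd (by omega) h; omega
          have e1 := inv_le_abs_mul_div_sub a q (r + 1) hq haq hnd z
          have e2 : |((r + 1 : ℕ) : ℝ) * β| ≤ 1 / (2 * q) := by
            rw [abs_mul, Nat.abs_cast]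
            calc ((r + 1 : ℕ) : ℝ) * |β| ≤ (q / 2) * (1 / (q : ℝ) ^ 2) := by gcongr
              _ = _ := by field_simp
          have e3 : ((m + r + 1 : ℕ) : ℝ) * α - m * α - z =
              (((r + 1 : ℕ) : ℝ) * (a / q) - z) - (-(((r + 1 : ℕ) : ℝ) * β)) := by
            rw [hα]; push_cast; ring
          have e4 := abs_sub_abs_le_abs_sub (((r + 1 : ℕ) : ℝ) * (a / q) - z) (-(((r + 1 : ℕ) : ℝ) * β))
          rw [← e3, abs_neg] at e4
          have e5 : 1 / (L : ℝ) ≤ 1 / (2 * q) := by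
            apply one_div_le_one_div_of_le (by positivity)
            exact_mod_cast Nat.le_add_right (2 * q) _
          have e6 : (1 : ℝ) / q = 1 / (2 * q) + 1 / (2 * q) := by field_simp; norm_num
          linarith
        rcases lt_or_gt_of_ne hne with h1 | h1
        · have := hd k k' hk.2 hk'.2 h1 (-z)
          rw [← abs_neg] at this
          convert this using 2
          push_cast; ring
        · exact hd k' k hk'.2 hk.2 h1 z)
    refine this.trans ?_
    have := lsC_pos
    gcongr
  have hS : ∑ k ∈ win X, s k ^ 2 ≤ (4 * (X / q + 1)) * (lsC * (2 * (M + q)) * (3 * M * V ^ 2)) := by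
    have hmaps : ∀ k ∈ win X, k / h ∈ Finset.range (⌊2 * X⌋₊ / h + 1) := by
      intro k hk
      have := win_subset (show 0 < X by linarith) hk
      rw [Finset.mem_Icc] at this
      rw [Finset.mem_range]
      exact Nat.lt_succ_of_le (Nat.div_le_div_right this.2)
    rw [← Finset.sum_fiberwise_of_maps_to hmaps]
    refine (Finset.sum_le_sum hgroup).trans ?_
    rw [Finset.sum_const, Finset.card_range, nsmul_eq_mul]
    have hh2 : (q : ℝ) / 2 ≤ h := by
      rw [div_le_iff₀ two_pos]
      exact_mod_cast (by omega : q ≤ h * 2)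
    have h1 : ((⌊2 * X⌋₊ / h + 1 : ℕ) : ℝ) ≤ 4 * (X / q + 1) := by
      push_cast
      have e1 : ((⌊2 * X⌋₊ / h : ℕ) : ℝ) ≤ ⌊2 * X⌋₊ / h := Nat.cast_div_le
      have e2 : (⌊2 * X⌋₊ : ℝ) / h ≤ 2 * X / (q / 2) :=
        div_le_div₀ (by linarith) (Nat.floor_le (by linarith)) (by positivity) hh2
      have e3 : 2 * X / (q / 2) = 4 * (X / q) := by field_simp; norm_num
      linarith
    have := lsC_pos
    gcongr
  refine hcs.trans ?_
  have := lsC_pos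
  calc (∑ k ∈ win X, ‖f k‖ ^ 2) * ∑ k ∈ win X, s k ^ 2 ≤
      (3 * X * U ^ 2) * ((4 * (X / q + 1)) * (lsC * (2 * (M + q)) * (3 * M * V ^ 2))) := by gcongr
    _ = 72 * lsC * U ^ 2 * V ^ 2 * (X * M) * (X / q + 1) * (M + q) := by ring
    _ ≤ _ := le_mul_of_one_le_right (by positivity) (by norm_num)

theorem sum_wt_expi_eq (N α : ℝ) (hN : 0 < N) (d : ℕ) (hd : 1 ≤ d) (c : ℕ → ℂ) :
    ∑ m ∈ Finset.Icc 1 ⌊2 * N⌋₊, c m * wt N (d * m) * expi (d * m * α) =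
      ∑ m ∈ Finset.Ioc 0 (⌊2 * N⌋₊ / d), c m * wt N (d * m) * expi (d * m * α) := by
  symm
  refine Finset.sum_subset ?_ ?_
  · intro m hm
    rw [Finset.mem_Ioc] at hm
    rw [Finset.mem_Icc]
    exact ⟨hm.1, hm.2.trans (Nat.div_le_self _ _)⟩
  · intro m hm hm'
    rw [Finset.mem_Icc] at hm
    rw [Finset.mem_Ioc, not_and, Nat.le_div_iff_mul_le hd, not_le] at hm'
    have h2 := Nat.lt_of_floor_lt (hm' (by omega))
    push_cast at h2
    rw [wt_eq_zero_of_ge hN (by linarith)]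
    simp

theorem norm_bilin_tail_le (N α Z : ℝ) (f g : ℕ → ℂ) (hN : 0 < N) (hZ : 1 ≤ Z) (hf : ∀ d, ‖f d‖ ≤ 1)
    (hg : ∀ m : ℕ, ‖g m‖ ≤ if (m : ℝ) ≤ Z then Real.log m ^ 2 else 0) :
    ‖bilin f g N α‖ ≤ 2 * N * Real.log Z ^ 2 * (1 + Real.log Z) := by
  refine le_trans ?_ (sum_log_sq_tail_le N Z hN.le hZ
    ((Finset.Icc 1 ⌊2 * N⌋₊ ×ˢ Finset.Icc 1 ⌊2 * N⌋₊).filter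
      (fun z => (z.1 * z.2 : ℝ) ≤ 2 * N ∧ (z.2 : ℝ) ≤ Z)) ?_)
  · rw [Finset.sum_filter, Finset.sum_product, bilin]
    refine (norm_sum_le _ _).trans (Finset.sum_le_sum fun d _ => (norm_sum_le _ _).trans
      (Finset.sum_le_sum fun m _ => ?_))
    rw [norm_mul, norm_mul, norm_mul, norm_expi, mul_one, Complex.norm_real,
      Real.norm_of_nonneg (wt_nonneg _ _)]
    have hgm := hg m
    have h1 : ‖f d‖ * ‖g m‖ ≤ ‖g m‖ := mul_le_of_le_one_left (norm_nonneg _) (hf d)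
    rcases le_or_gt (d * m : ℝ) (2 * N) with h | h
    · simp only [h, true_and]
      refine le_trans ?_ hgm
      exact (mul_le_of_le_one_right (by positivity) (wt_le_one _ _)).trans h1
    · rw [wt_eq_zero_of_ge hN h.le, mul_zero]
      split_ifs <;> positivity
  · rintro ⟨d, m⟩ hz
    simp only [Finset.mem_filter, Finset.mem_product, Finset.mem_Icc] at hz
    exact ⟨hz.1.1.1, hz.1.2.1, hz.2.1, hz.2.2⟩

theorem norm_block_le_of_large (f g : ℕ → ℂ) (X M U V Y β : ℝ) (a : ℤ) (q : ℕ) (hY : 1 ≤ Y) (hX : Y ≤ X)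
    (hM : Y ≤ M) (hYq : Y ≤ q) (hqY : q * Y ≤ X * M)
    (hU : 0 ≤ U) (hV : 0 ≤ V) (hf : ∀ k ∈ win X, ‖f k‖ ≤ U) (hg : ∀ l ∈ win M, ‖g l‖ ≤ V)
    (hq : 1 ≤ q) (haq : IsCoprime a (q : ℤ)) (hβ : |β| ≤ 1 / (q : ℝ) ^ 2) :
    ‖block f g X M (a / q + β)‖ ≤ √(576 * lsC) * (U * V) * (X * M) / √Y := by
  have h := norm_block_sq_le f g X M U V β a q (by linarith) (by linarith) hU hV hf hg hq haq hβ
  have hq0 : (0 : ℝ) < q := by exact_mod_cast hq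
  have hlc := lsC_pos
  have hY0 : 0 < Y := by linarith
  have hX0 : 0 < X := by linarith
  have hM0 : 0 < M := by linarith
  refine (sq_le_sq₀ (norm_nonneg _) (by positivity)).mp ?_
  rw [div_pow, mul_pow, mul_pow, Real.sq_sqrt (by positivity), Real.sq_sqrt hY0.le, le_div_iff₀ hY0]
  have e1 : (X / q + 1) * (M + q) * Y ≤ 4 * (X * M) := by
    have e2 : (X / q + 1) * (M + q) * Y = X * M * (Y / q) + X * Y + M * Y + q * Y := by
      field_simp; ring
    have e3 : X * M * (Y / q) ≤ X * M := mul_le_of_le_one_right (by positivity) ((div_le_one hq0).mpr hYq)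
    have e4 : X * Y ≤ X * M := by gcongr
    have e5 : M * Y ≤ X * M := by rw [mul_comm X]; gcongr
    linarith
  calc _ ≤ 72 * lsC * U ^ 2 * V ^ 2 * (X * M) * (X / q + 1) * (M + q) * 2 * Y := by gcongr
    _ = 144 * lsC * U ^ 2 * V ^ 2 * (X * M) * ((X / q + 1) * (M + q) * Y) := by ring
    _ ≤ 144 * lsC * U ^ 2 * V ^ 2 * (X * M) * (4 * (X * M)) := by gcongr
    _ = _ := by ring

theorem norm_bilin_vm_minor_le (N Y β : ℝ) (a : ℤ) (q : ℕ) (hN : 3 ≤ N) (hY : 1 ≤ Y)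
    (hYq : Y ≤ q) (hqY : q * Y ≤ N) (hq : 1 ≤ q) (haq : IsCoprime a (q : ℤ)) (hβ : |β| ≤ 1 / (q : ℝ) ^ 2) :
    ‖bilin (fun n => vm n) (fun n => vm n) N (a / q + β)‖ ≤
      √(576 * lsC) * (3 * Real.log N) ^ 2 * N / √Y * (Real.log N + 1) + 288 * N * (Real.log Y + 1) := by
  have hXM : ∀ x : ℝ, Real.exp x * (N * Real.exp (-x)) = N := by
    intro x; rw [mul_left_comm, ← Real.exp_add]; simp
  have hlc := lsC_pos
  have hlN : 0 ≤ Real.log N := Real.log_nonneg (by linarith)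
  have hq0 : (0 : ℝ) < q := by exact_mod_cast hq
  have hvm : ∀ X, 0 < X → X ≤ N → ∀ k ∈ win X, ‖(vm k : ℂ)‖ ≤ 3 * Real.log N := by
    intro X hX hXN k hk
    rw [Complex.norm_real, Real.norm_of_nonneg (vm_nonneg k)]
    have h1 := Finset.mem_Icc.mp (win_subset hX hk)
    have h2 := (Nat.le_floor_iff (by linarith)).mp h1.2
    refine (vm_le_log k).trans ?_
    calc Real.log k ≤ Real.log (N ^ 2) := Real.log_le_log (by exact_mod_cast h1.1) (by nlinarith)
      _ = 2 * Real.log N := by rw [Real.log_pow]; norm_num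
      _ ≤ _ := by linarith
  refine (norm_bilin_le (fun n => (vm n : ℂ)) (fun n => (vm n : ℂ)) N (a / q + β) (144 * N)
    (√(576 * lsC) * (3 * Real.log N) ^ 2 * N / √Y) (Real.log Y) (by linarith) (by positivity) (by positivity)
    (Real.log_nonneg hY)
    (fun x => by
      have hX := Real.exp_pos x
      have hM : 0 < N * Real.exp (-x) := by positivity
      refine (norm_block_le vm vm vm_nonneg vm_nonneg _ _ _).trans ?_
      calc _ ≤ (12 * Real.exp x) * (12 * (N * Real.exp (-x))) := by
            gcongr
            · exact Finset.sum_nonneg fun k _ => vm_nonneg k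
            · exact sum_vm_win_le hX
            · exact sum_vm_win_le hM
        _ = 144 * (Real.exp x * (N * Real.exp (-x))) := by ring
        _ = _ := by rw [hXM])
    (fun x hx1 hx2 => by
      have hX : Y ≤ Real.exp x := by rwa [← Real.log_le_iff_le_exp (by positivity)]
      have hM : Y ≤ N * Real.exp (-x) := by
        have h1 : N * Real.exp (-x) = Real.exp (Real.log N - x) := by
          rw [sub_eq_add_neg, Real.exp_add, Real.exp_log (by linarith)]
        rw [h1, ← Real.log_le_iff_le_exp (by positivity)]; linarith
      have hp := hXM x
      have := norm_block_le_of_large (fun n => (vm n : ℂ)) (fun n => (vm n : ℂ)) (Real.exp x) (N * Real.exp (-x))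
        (3 * Real.log N) (3 * Real.log N) Y β a q hY hX hM hYq (by rw [hXM]; exact hqY) (by positivity)
        (by positivity) (hvm _ (by positivity) (by nlinarith)) (hvm _ (by linarith) (by nlinarith))
        hq haq hβ
      rw [hXM] at this
      refine this.trans (le_of_eq (by ring)))).trans (le_of_eq (by ring))

theorem norm_bilin_moebius_minor_le (N R β : ℝ) (a : ℤ) (q : ℕ) (hN : 3 ≤ N) (hR : 2 ≤ R)
    (hRq : 2 * R ≤ q) (hqR : q * R ≤ N) (hq : 1 ≤ q) (haq : IsCoprime a (q : ℤ))
    (hβ : |β| ≤ 1 / (q : ℝ) ^ 2) (f g : ℕ → ℂ)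
    (hf : ∀ d : ℕ, ‖f d‖ ≤ if (d : ℝ) ≤ R then 0 else 1)
    (hg : ∀ m : ℕ, ‖g m‖ ≤ if (m : ℝ) ≤ R then 0 else Real.log m ^ 2) :
    ‖bilin f g N (a / q + β)‖ ≤
      √(576 * lsC) * (3 * Real.log N) ^ 2 * N / √(R / 2) * (Real.log N + 3) := by
  have hXM : ∀ x : ℝ, Real.exp x * (N * Real.exp (-x)) = N := by
    intro x; rw [mul_left_comm, ← Real.exp_add]; simp
  have hlc := lsC_pos
  have hlN : 0 ≤ Real.log N := Real.log_nonneg (by linarith)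
  have hq0 : (0 : ℝ) < q := by exact_mod_cast hq
  set B := √(576 * lsC) * (3 * Real.log N) ^ 2 * N / √(R / 2) with hB
  have hB0 : 0 ≤ B := by positivity
  have key : ∀ x, ‖block f g (Real.exp x) (N * Real.exp (-x)) (a / q + β)‖ ≤ B := by
    intro x
    have hX0 := Real.exp_pos x
    have hM0 : 0 < N * Real.exp (-x) := by positivity
    have hp := hXM x
    have hzero : ∀ (F : ℕ → ℂ) (X : ℝ), 0 < X → X < R / 2 → (∀ k : ℕ, (k : ℝ) ≤ R → F k = 0) →
        ∀ k ∈ win X, F k = 0 := by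
      intro F X hX hXR hF k hk
      have h1 := Finset.mem_Icc.mp (win_subset hX hk)
      exact hF k (((Nat.le_floor_iff (by linarith)).mp h1.2).trans (by linarith))
    rcases lt_or_ge (Real.exp x) (R / 2) with h | h
    · have : block f g (Real.exp x) (N * Real.exp (-x)) (a / q + β) = 0 :=
        Finset.sum_eq_zero fun k hk => by
          rw [hzero f _ hX0 h (fun k hk => by simpa [hk] using hf k) k hk, zero_mul]
      rw [this, norm_zero]; exact hB0
    rcases lt_or_ge (N * Real.exp (-x)) (R / 2) with h' | h'
    · have : block f g (Real.exp x) (N * Real.exp (-x)) (a / q + β) = 0 :=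
        Finset.sum_eq_zero fun k hk => by
          have : trig (win (N * Real.exp (-x))) g (k * (a / q + β)) = 0 :=
            Finset.sum_eq_zero fun l hl => by
              rw [hzero g _ hM0 h' (fun k hk => by simpa [hk] using hg k) l hl, zero_mul]
          rw [this, mul_zero]
      rw [this, norm_zero]; exact hB0
    have := norm_block_le_of_large f g (Real.exp x) (N * Real.exp (-x))
        1 ((3 * Real.log N) ^ 2) (R / 2) β a q (by linarith) h h' (by linarith)
        (by rw [hXM]; nlinarith) (by positivity)
        (by positivity) (fun k _ => (hf k).trans (by split_ifs <;> norm_num))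
        (fun k hk => by
          have h1 := Finset.mem_Icc.mp (win_subset hM0 hk)
          have h2 := (Nat.le_floor_iff (by linarith)).mp h1.2
          have hk1 : (1 : ℝ) ≤ k := by exact_mod_cast h1.1
          have hlk := Real.log_nonneg hk1
          refine (hg k).trans ?_
          split_ifs
          · positivity
          · refine pow_le_pow_left₀ hlk ?_ 2
            calc Real.log k ≤ Real.log (N ^ 2) := Real.log_le_log (by linarith) (by nlinarith)
              _ = 2 * Real.log N := by rw [Real.log_pow]; norm_num
              _ ≤ _ := by linarith)
        hq haq hβ
    rw [hXM] at this
    exact this.trans (le_of_eq (by rw [hB]; ring))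
  refine (norm_bilin_le f g N (a / q + β) B B 0 (by linarith) hB0 hB0 le_rfl key
    (fun x _ _ => key x)).trans (le_of_eq (by ring))

theorem norm_bilin_small_le (N R β : ℝ) (a : ℤ) (q : ℕ) (hN : 3 ≤ N) (hR : 1 ≤ R)
    (hRq : 2 * R ≤ q) (hqN : q ≤ N) (hq : 1 ≤ q) (haq : IsCoprime a (q : ℤ))
    (hβ : |β| ≤ 1 / (q : ℝ) ^ 2) :
    ‖bilin (fun d => if (d : ℝ) ≤ R then (ArithmeticFunction.moebius d : ℂ) else 0)
      (fun m => (Real.log m ^ 2 : ℝ)) N (a / q + β)‖ ≤ R * (40 * q * Real.log (3 * N) ^ 2) := by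
  have hq0 : (0 : ℝ) < q := by exact_mod_cast hq
  have h1 : bilin (fun d => if (d : ℝ) ≤ R then (ArithmeticFunction.moebius d : ℂ) else 0)
      (fun m => (Real.log m ^ 2 : ℝ)) N (a / q + β) =
      ∑ d ∈ Finset.Icc 1 ⌊R⌋₊, (ArithmeticFunction.moebius d : ℂ) * innerSum N (a / q + β) d := by
    have h2 : Finset.Icc 1 ⌊R⌋₊ = (Finset.Icc 1 ⌊2 * N⌋₊).filter (fun d : ℕ => (d : ℝ) ≤ R) := by
      ext d
      simp only [Finset.mem_Icc, Finset.mem_filter]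
      rw [Nat.le_floor_iff (by linarith), Nat.le_floor_iff (by linarith)]
      constructor
      · rintro ⟨a, b⟩; exact ⟨⟨a, by linarith⟩, b⟩
      · rintro ⟨⟨a, b⟩, c⟩; exact ⟨a, c⟩
    rw [h2, Finset.sum_filter, bilin]
    refine Finset.sum_congr rfl fun d hd => ?_
    have hd0 := (Finset.mem_Icc.mp hd).1
    split_ifs with h
    · rw [innerSum, ← sum_wt_expi_eq N _ (by linarith) d hd0, Finset.mul_sum]
      exact Finset.sum_congr rfl fun m _ => by ring
    · simp
  rw [h1]
  have h3 : ∀ d ∈ Finset.Icc 1 ⌊R⌋₊, ‖(ArithmeticFunction.moebius d : ℂ) * innerSum N (a / q + β) d‖ ≤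
      40 * q * Real.log (3 * N) ^ 2 := by
    intro d hd
    obtain ⟨hd1, hd2⟩ := Finset.mem_Icc.mp hd
    rw [Nat.le_floor_iff (by linarith)] at hd2
    have hd0 : (0 : ℝ) < d := by exact_mod_cast hd1
    have hdq : d < q := by exact_mod_cast (show (d : ℝ) < q by linarith)
    rw [norm_mul]
    refine (mul_le_of_le_one_left (norm_nonneg _) (norm_moebius_le d)).trans ?_
    refine (norm_innerSum_le_of_sep N (a / q + β) 0 (a / q + β) (1 / (2 * q)) d (by ring) hd1
      (by linarith) (by positivity) (fun k => ?_)).trans (le_of_eq ?_)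
    · have e1 := inv_le_abs_mul_div_sub a q d hq haq
        (fun h => by have := Nat.le_of_dvd (by omega) h; omega) k
      have e2 : |(d : ℝ) * β| ≤ 1 / (2 * q) := by
        rw [abs_mul, Nat.abs_cast]
        calc (d : ℝ) * |β| ≤ (q / 2) * (1 / (q : ℝ) ^ 2) := by gcongr; linarith
          _ = _ := by field_simp
      have e3 : (d : ℝ) * (a / q + β) - k = ((d : ℝ) * (a / q) - k) - (-((d : ℝ) * β)) := by ring
      have e4 := abs_sub_abs_le_abs_sub ((d : ℝ) * (a / q) - k) (-((d : ℝ) * β))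
      rw [← e3, abs_neg] at e4
      have e6 : (1 : ℝ) / q = 1 / (2 * q) + 1 / (2 * q) := by field_simp; norm_num
      linarith
    · rw [abs_zero]; field_simp; ring
  refine (norm_sum_le_of_le _ h3).trans ?_
  rw [Finset.sum_const, Nat.card_Icc, nsmul_eq_mul]
  gcongr
  simpa using Nat.floor_le (show 0 ≤ R by linarith)

theorem bilin_add_left (f f' g : ℕ → ℂ) (N α : ℝ) :
    bilin (fun n => f n + f' n) g N α = bilin f g N α + bilin f' g N α := by
  simp only [bilin, add_mul, Finset.sum_add_distrib]

theorem bilin_add_right (f g g' : ℕ → ℂ) (N α : ℝ) :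
    bilin f (fun n => g n + g' n) N α = bilin f g N α + bilin f g' N α := by
  simp only [bilin, add_mul, mul_add, Finset.sum_add_distrib]

set_option maxHeartbeats 1000000 in
theorem exists_norm_expSum_minor_le : ∃ C : ℝ, 0 ≤ C ∧ ∀ᶠ N : ℝ in atTop,
    ∀ (a : ℤ) (q : ℕ) (β : ℝ), 1 ≤ q → IsCoprime a q → |β| ≤ 1 / (q : ℝ) ^ 2 →
      Real.log N ^ 16 ≤ q → q * Real.log N ^ 16 ≤ N →
      ‖expSum vm N (a / q + β)‖ ≤ C * N * Real.log N ^ (-(4 / 5) : ℝ) := by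
  set D := √(576 * lsC) with hD
  have hD0 : 0 ≤ D := Real.sqrt_nonneg _
  refine ⟨18 * D + 288 + 360 + 1 + 72 * D + 12, by positivity, ?_⟩
  filter_upwards [eventually_log_pow_le, eventually_ge_atTop 3,
    Real.tendsto_log_atTop.eventually (eventually_ge_atTop 2)] with N ⟨_, hz, _⟩ hN hl2 a q β hq haq hβ hq1 hq2
  have e3 := log_mul_norm_expSum_vm_le N (a / q + β) (by linarith)
  set l := Real.log N with hl
  have hl0 : 0 < l := by linarith
  have hl1 : 1 ≤ l := by linarith
  set R := l ^ 12 with hR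
  have hR2 : 2 ≤ R := hl2.trans (le_self_pow₀ hl1 (by norm_num))
  have h16 : l ^ 16 = R * l ^ 4 := by rw [hR]; ring
  have hl4 : 16 ≤ l ^ 4 := by
    calc (16 : ℝ) = 2 ^ 4 := by norm_num
      _ ≤ l ^ 4 := by gcongr
  have hRq : 2 * R ≤ q := by nlinarith
  have hq0 : (0 : ℝ) < q := by linarith
  have hqR4 : q * R * l ^ 4 ≤ N := by rw [mul_assoc, ← h16]; exact hq2
  have hqR : q * R ≤ N := le_trans (le_mul_of_one_le_right (by positivity) (by linarith)) hqR4
  have hqN : (q : ℝ) ≤ N := le_trans (le_mul_of_one_le_right (by positivity) (by linarith)) hqR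
  have hsR : √R = l ^ 6 := by
    rw [hR, show l ^ 12 = (l ^ 6) ^ 2 by ring, Real.sqrt_sq (by positivity)]
  have hsR2 : l ^ 6 / 2 ≤ √(R / 2) := by
    apply Real.le_sqrt_of_sq_le
    rw [hR]; ring_nf; nlinarith [show 0 ≤ l ^ 12 by positivity]
  have hlogR : Real.log R = 12 * Real.log l := by rw [hR, Real.log_pow]; norm_num
  have hll : 0 ≤ Real.log l := Real.log_nonneg hl1
  have hl3 : Real.log (3 * N) ≤ 3 * l := by
    rw [Real.log_mul (by norm_num) (by positivity)]
    have : Real.log 3 ≤ 2 := by linarith [Real.log_le_sub_one_of_pos (show (0 : ℝ) < 3 by norm_num)]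
    linarith
  have hl30 : 0 ≤ Real.log (3 * N) := Real.log_nonneg (by linarith)
  have t1 : l ^ 2 * (l + 3) ≤ 4 * l ^ 6 := by
    have h6 : l ^ 3 ≤ l ^ 6 := pow_le_pow_right₀ hl1 (by norm_num)
    have h5 : l ^ 2 ≤ l ^ 6 := pow_le_pow_right₀ hl1 (by norm_num)
    nlinarith
  set z := (Real.log 108 + 34 * Real.log l) with hzdef
  have hz1 : 12 * Real.log l + 1 ≤ z := by
    have : 1 ≤ Real.log 108 := by
      rw [Real.le_log_iff_exp_le (by norm_num)]
      have := Real.exp_one_lt_d9; linarith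
    linarith
  have hz3 : 12 * Real.log l + 1 ≤ z ^ 3 := hz1.trans (le_self_pow₀ (by linarith) (by norm_num))
  set t := l ^ (1 / 5 : ℝ) with ht
  have ht1 : 1 ≤ t := Real.one_le_rpow hl1 (by norm_num)
  have g1 : ‖bilin (fun n => vm n) (fun n => vm n) N (a / q + β)‖ ≤ (18 * D + 288) * N * t := by
    refine (norm_bilin_vm_minor_le N R β a q hN (by linarith) (by linarith) hqR hq haq hβ).trans ?_
    rw [hsR, hlogR]
    have k1 : √(576 * lsC) * (3 * Real.log N) ^ 2 * N / l ^ 6 * (Real.log N + 1) ≤ 18 * D * N * t := by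
      rw [← hl, ← hD, div_mul_eq_mul_div, div_le_iff₀ (by positivity)]
      have : l ^ 2 * (l + 1) ≤ 2 * l ^ 6 := by
        have h6 : l ^ 3 ≤ l ^ 6 := pow_le_pow_right₀ hl1 (by norm_num)
        have h5 : l ^ 2 ≤ l ^ 6 := pow_le_pow_right₀ hl1 (by norm_num)
        nlinarith
      calc D * (3 * l) ^ 2 * N * (l + 1) = 9 * D * N * (l ^ 2 * (l + 1)) := by ring
        _ ≤ 9 * D * N * (2 * l ^ 6) := by gcongr
        _ = 18 * D * N * 1 * l ^ 6 := by ring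
        _ ≤ _ := by gcongr
    have k2 : 288 * N * (12 * Real.log l + 1) ≤ 288 * N * t := by gcongr; exact hz3.trans hz
    linarith
  have g2 : ‖expSum (fun n => lam2 n) N (a / q + β)‖ ≤ (360 + 1 + 72 * D) * N * t := by
    have h1 := expSum_mul (ArithmeticFunction.moebius : ArithmeticFunction ℝ) logSq N (a / q + β) (by linarith)
    rw [moebius_mul_logSq] at h1
    rw [h1]
    set f1 : ℕ → ℂ := fun d => if (d : ℝ) ≤ R then (ArithmeticFunction.moebius d : ℂ) else 0 with hf1
    set f2 : ℕ → ℂ := fun d => if (d : ℝ) ≤ R then 0 else (ArithmeticFunction.moebius d : ℂ) with hf2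
    set g1 : ℕ → ℂ := fun m => if (m : ℝ) ≤ R then ((Real.log m ^ 2 : ℝ) : ℂ) else 0 with hg1
    set g2 : ℕ → ℂ := fun m => if (m : ℝ) ≤ R then 0 else ((Real.log m ^ 2 : ℝ) : ℂ) with hg2
    have hF : (fun n : ℕ => (((ArithmeticFunction.moebius : ArithmeticFunction ℝ) n : ℝ) : ℂ)) =
        fun n => f1 n + f2 n := by
      funext n
      simp only [hf1, hf2, ArithmeticFunction.intCoe_apply, Complex.ofReal_intCast]
      split_ifs <;> simp
    have hG : (fun n : ℕ => ((logSq n : ℝ) : ℂ)) = fun n : ℕ => ((Real.log n ^ 2 : ℝ) : ℂ) := by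
      funext n
      rw [logSq, ArithmeticFunction.pmul_apply, ArithmeticFunction.log_apply, sq]
    have hG2 : (fun n : ℕ => ((Real.log n ^ 2 : ℝ) : ℂ)) = fun n => g1 n + g2 n := by
      funext n
      simp only [hg1, hg2]
      split_ifs <;> simp
    rw [hF, hG, bilin_add_left]
    conv_lhs => rw [hG2]
    rw [bilin_add_right f2, ← hG2]
    have k1 : ‖bilin f1 (fun m => (Real.log m ^ 2 : ℝ)) N (a / q + β)‖ ≤ 360 * N * t := by
      refine (norm_bilin_small_le N R β a q hN (by linarith) hRq hqN hq haq hβ).trans ?_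
      calc R * (40 * q * Real.log (3 * N) ^ 2) ≤ R * (40 * q * (3 * l) ^ 2) := by gcongr
        _ = 360 * (q * R * l ^ 2) := by ring
        _ ≤ 360 * (q * R * l ^ 4) := by gcongr <;> norm_num
        _ ≤ 360 * N := by linarith
        _ ≤ _ := le_mul_of_one_le_right (by positivity) ht1
    have hz' : 2 * N * Real.log R ^ 2 * (1 + Real.log R) ≤ 1 * N * t := by
      have hx : 1 + 34 * Real.log l ≤ z := by
        have : 1 ≤ Real.log 108 := by
          rw [Real.le_log_iff_exp_le (by norm_num)]
          have := Real.exp_one_lt_d9; linarith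
        linarith
      have hx3 := pow_le_pow_left₀ (by positivity) hx 3
      have hx4 : 2 * (12 * Real.log l) ^ 2 * (1 + 12 * Real.log l) ≤ (1 + 34 * Real.log l) ^ 3 := by
        have e1 : 0 ≤ Real.log l ^ 2 := by positivity
        have e2 : 0 ≤ Real.log l ^ 3 := by positivity
        nlinarith
      rw [hlogR]
      calc 2 * N * (12 * Real.log l) ^ 2 * (1 + 12 * Real.log l) =
          N * (2 * (12 * Real.log l) ^ 2 * (1 + 12 * Real.log l)) := by ring
        _ ≤ N * t := by gcongr; exact hx4.trans (hx3.trans hz)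
        _ = _ := by ring
    have k2 : ‖bilin f2 g1 N (a / q + β)‖ ≤ 1 * N * t := by
      refine (norm_bilin_tail_le N (a / q + β) R f2 g1 (by linarith) (by linarith) ?_ ?_).trans hz'
      · intro d
        simp only [hf2]
        split_ifs
        · simp
        · exact norm_moebius_le d
      · intro m
        simp only [hg1]
        split_ifs
        · rw [Complex.norm_real, Real.norm_of_nonneg (by positivity)]
        · simp
    have k3 : ‖bilin f2 g2 N (a / q + β)‖ ≤ 72 * D * N * t := by
      refine (norm_bilin_moebius_minor_le N R β a q hN hR2 hRq hqR hq haq hβ f2 g2 ?_ ?_).trans ?_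
      · intro d
        simp only [hf2]
        split_ifs
        · simp
        · exact norm_moebius_le d
      · intro m
        simp only [hg2]
        split_ifs
        · simp
        · rw [Complex.norm_real, Real.norm_of_nonneg (by positivity)]
      · rw [← hl, ← hD]
        calc D * (3 * l) ^ 2 * N / √(R / 2) * (l + 3) ≤ D * (3 * l) ^ 2 * N / (l ^ 6 / 2) * (l + 3) := by
              gcongr
          _ = 18 * D * N * (l ^ 2 * (l + 3)) / l ^ 6 := by field_simp; ring
          _ ≤ 18 * D * N * (4 * l ^ 6) / l ^ 6 := by gcongr
          _ = 72 * D * N * 1 := by field_simp; ring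
          _ ≤ _ := by gcongr
    refine (norm_add_le _ _).trans ?_
    have := norm_add_le (bilin f2 g1 N (a / q + β)) (bilin f2 g2 N (a / q + β))
    linarith
  have hk : t = l * l ^ (-(4 / 5) : ℝ) := by
    rw [ht]; nth_rw 2 [← Real.rpow_one l]; rw [← Real.rpow_add hl0]; norm_num
  have g3 : l * ‖expSum vm N (a / q + β)‖ ≤
      l * ((18 * D + 288 + 360 + 1 + 72 * D + 12) * N * l ^ (-(4 / 5) : ℝ)) := by
    have k3 : N ≤ N * t := le_mul_of_one_le_right (by linarith) ht1
    calc _ ≤ (18 * D + 288 + 360 + 1 + 72 * D + 12) * N * t := by linarith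
      _ = _ := by rw [hk]; ring
  exact le_of_mul_le_mul_left g3 hl0

/-- The Fejér kernel, as the Fourier transform of the triangle function. -/
noncomputable def fej (x : ℝ) : ℂ :=
  ∫ t in (-1 : ℝ)..1, ((1 - |t| : ℝ) : ℂ) * Complex.exp (t * x * Complex.I)

theorem fej_integrand_continuous :
    Continuous fun p : ℝ × ℝ => ((1 - |p.2| : ℝ) : ℂ) * Complex.exp (p.2 * p.1 * Complex.I) := by
  fun_prop

theorem continuous_fej : Continuous fej := by
  unfold fej
  exact intervalIntegral.continuous_parametric_intervalIntegral_of_continuous'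
    (f := fun (x t : ℝ) => ((1 - |t| : ℝ) : ℂ) * Complex.exp (t * x * Complex.I)) fej_integrand_continuous _ _

theorem norm_fej_le (x : ℝ) : ‖fej x‖ ≤ 2 := by
  have : ‖fej x‖ ≤ 1 * |1 - (-1 : ℝ)| := by
    refine intervalIntegral.norm_integral_le_of_norm_le_const fun t ht => ?_
    rw [Set.uIoc_of_le (by norm_num)] at ht
    have h1 : |t| ≤ 1 := abs_le.mpr ⟨ht.1.le, ht.2⟩
    rw [norm_mul, Complex.norm_real, show (t : ℂ) * x * Complex.I = ((t * x : ℝ) : ℂ) * Complex.I by push_cast; ring,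
      Complex.norm_exp_ofReal_mul_I, mul_one, Real.norm_of_nonneg (by linarith)]
    linarith [abs_nonneg t]
  norm_num at this
  exact this

theorem fej_eq (x : ℝ) (hx : x ≠ 0) : fej x = ((2 - 2 * Real.cos x) / x ^ 2 : ℝ) := by
  set z : ℂ := x * Complex.I with hz
  have hz0 : z ≠ 0 := mul_ne_zero (by exact_mod_cast hx) Complex.I_ne_zero
  have hz2 : z ^ 2 = -(x : ℂ) ^ 2 := by rw [hz, mul_pow, Complex.I_sq]; ring
  have hintg : ∀ a b : ℝ, IntervalIntegrable
      (fun t : ℝ => ((1 - |t| : ℝ) : ℂ) * Complex.exp (t * x * Complex.I)) MeasureTheory.volume a b :=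
    fun a b => Continuous.intervalIntegrable (by fun_prop) _ _
  have hexp : ∀ t : ℝ, HasDerivAt (fun t : ℝ => Complex.exp (t * z)) (z * Complex.exp (t * z)) t := by
    intro t
    have h1 : HasDerivAt (fun t : ℝ => (t : ℂ) * z) (1 * z) t := Complex.ofRealCLM.hasDerivAt.mul_const z
    have := h1.cexp
    rwa [one_mul, mul_comm] at this
  have hid : ∀ t : ℝ, HasDerivAt (fun t : ℝ => (t : ℂ)) 1 t := fun t => Complex.ofRealCLM.hasDerivAt
  have h1 : ∫ t in (0 : ℝ)..1, ((1 - |t| : ℝ) : ℂ) * Complex.exp (t * x * Complex.I) =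
      1 / z ^ 2 * Complex.exp z - (1 / z + 1 / z ^ 2) := by
    have h := intervalIntegral.integral_eq_sub_of_hasDerivAt (a := 0) (b := 1)
      (f := fun t : ℝ => ((1 - (t : ℂ)) / z + 1 / z ^ 2) * Complex.exp (t * z))
      (f' := fun t : ℝ => ((1 - t : ℝ) : ℂ) * Complex.exp (t * z))
      (fun t _ => by
        refine HasDerivAt.congr_deriv (((((hid t).const_sub 1).div_const z).add_const (1 / z ^ 2)).mul (hexp t)) ?_
        push_cast; field_simp; ring)
      (Continuous.intervalIntegrable (by fun_prop) _ _)
    calc _ = ∫ t in (0 : ℝ)..1, ((1 - t : ℝ) : ℂ) * Complex.exp (t * z) := by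
          refine intervalIntegral.integral_congr fun t ht => ?_
          rw [Set.uIcc_of_le (by norm_num)] at ht
          rw [abs_of_nonneg ht.1, hz, mul_assoc]
      _ = _ := by rw [h]; simp
  have h2 : ∫ t in (-1 : ℝ)..0, ((1 - |t| : ℝ) : ℂ) * Complex.exp (t * x * Complex.I) =
      (1 / z - 1 / z ^ 2) + 1 / z ^ 2 * Complex.exp (-z) := by
    have h := intervalIntegral.integral_eq_sub_of_hasDerivAt (a := -1) (b := 0)
      (f := fun t : ℝ => ((1 + (t : ℂ)) / z - 1 / z ^ 2) * Complex.exp (t * z))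
      (f' := fun t : ℝ => ((1 + t : ℝ) : ℂ) * Complex.exp (t * z))
      (fun t _ => by
        refine HasDerivAt.congr_deriv (((((hid t).const_add 1).div_const z).sub_const (1 / z ^ 2)).mul (hexp t)) ?_
        push_cast; field_simp; ring)
      (Continuous.intervalIntegrable (by fun_prop) _ _)
    calc _ = ∫ t in (-1 : ℝ)..0, ((1 + t : ℝ) : ℂ) * Complex.exp (t * z) := by
          refine intervalIntegral.integral_congr fun t ht => ?_
          rw [Set.uIcc_of_le (by norm_num)] at ht
          rw [abs_of_nonpos ht.2, hz, mul_assoc, sub_neg_eq_add]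
      _ = _ := by rw [h]; simp
  have hcos : (2 * Real.cos x : ℝ) = Complex.exp z + Complex.exp (-z) := by
    push_cast
    rw [Complex.cos, hz]
    ring_nf
  rw [fej, ← intervalIntegral.integral_add_adjacent_intervals (hintg (-1) 0) (hintg 0 1), h1, h2]
  rw [Complex.ofReal_div, Complex.ofReal_sub, hcos, Complex.ofReal_pow,
    show (x : ℂ) ^ 2 = -z ^ 2 by rw [hz2]; ring]
  have : z ^ 2 ≠ 0 := pow_ne_zero 2 hz0
  push_cast
  field_simp
  ring

theorem norm_fej_mul_sq_le (x : ℝ) : ‖fej x‖ * x ^ 2 ≤ 4 := by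
  rcases eq_or_ne x 0 with rfl | hx
  · norm_num
  have hc := Real.cos_le_one x
  have hc' := Real.neg_one_le_cos x
  have : 0 < x ^ 2 := by positivity
  rw [fej_eq x hx, Complex.norm_real, Real.norm_of_nonneg (div_nonneg (by linarith) this.le),
    div_mul_cancel₀ _ this.ne']
  linarith

theorem norm_fej_le_inv (x : ℝ) : ‖fej x‖ ≤ 6 * (1 + x ^ 2)⁻¹ := by
  rw [← div_eq_mul_inv, le_div_iff₀ (by positivity), mul_add, mul_one]
  linarith [norm_fej_le x, norm_fej_mul_sq_le x]

theorem integrable_fej : MeasureTheory.Integrable fej :=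
  (integrable_inv_one_add_sq.const_mul 6).mono' continuous_fej.aestronglyMeasurable
    (Eventually.of_forall norm_fej_le_inv)

theorem integral_fej_ne_zero : ∫ x, fej x ≠ 0 := by
  have h0 : ∀ x, 0 ≤ (fej x).re := by
    have h1 : ∀ x ≠ 0, 0 ≤ (fej x).re := fun x hx => by
      rw [fej_eq x hx, Complex.ofReal_re]
      exact div_nonneg (by linarith [Real.cos_le_one x]) (by positivity)
    intro x
    rcases eq_or_ne x 0 with rfl | hx
    · have hd : Dense ({0}ᶜ : Set ℝ) := dense_compl_singleton 0
      have hcl : IsClosed {x : ℝ | 0 ≤ (fej x).re} :=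
        isClosed_le continuous_const (Complex.continuous_re.comp continuous_fej)
      exact hcl.closure_subset_iff.mpr (fun x hx => h1 x hx) (hd 0)
    · exact h1 x hx
  have h2 : 0 < ∫ x, (fej x).re := by
    rw [MeasureTheory.integral_pos_iff_support_of_nonneg h0 integrable_fej.re]
    refine (IsOpen.measure_pos MeasureTheory.volume
      (Complex.continuous_re.comp continuous_fej).isOpen_support ⟨1, ?_⟩)
    change (fej 1).re ≠ 0
    rw [fej_eq 1 one_ne_zero, Complex.ofReal_re]
    have := Real.cos_one_le
    norm_num at this ⊢
    linarith
  intro h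
  have h3 : ∫ x, (fej x).re = (∫ x, fej x).re := integral_re integrable_fej
  rw [h3, h] at h2
  simp at h2

theorem summable_int_inv_one_add_sq : Summable fun j : ℤ => (1 + (j : ℝ) ^ 2)⁻¹ := by
  have h : Summable fun j : ℤ => 1 / (j : ℝ) ^ 2 := Real.summable_one_div_int_pow.mpr (by norm_num)
  refine Summable.of_norm_bounded_eventually (g := fun j : ℤ => 1 / (j : ℝ) ^ 2) h ?_
  filter_upwards [(Set.finite_singleton (0 : ℤ)).compl_mem_cofinite] with j hj
  have hj0 : (j : ℝ) ≠ 0 := by exact_mod_cast hj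
  rw [Real.norm_of_nonneg (by positivity), one_div]
  have : 0 < (j : ℝ) ^ 2 := by positivity
  gcongr
  linarith

theorem exists_sum_cauchy_le : ∃ C : ℝ, 0 ≤ C ∧ ∀ (y : ℝ) (s : Finset ℕ),
    ∑ n ∈ s, (vm n + 1) / n * (1 + (Real.log n - y) ^ 2)⁻¹ ≤ C := by
  classical
  have hsum := summable_int_inv_one_add_sq
  refine ⟨63 * ∑' j : ℤ, (1 + (j : ℝ) ^ 2)⁻¹, mul_nonneg (by norm_num) (tsum_nonneg fun j => by positivity),
    fun y s => ?_⟩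
  have h0 : ∀ n ∈ s, n ∉ s.filter (fun n => 1 ≤ n) →
      (vm n + 1) / n * (1 + (Real.log n - y) ^ 2)⁻¹ = 0 := by
    intro n hn hn'
    have : n = 0 := by
      rw [Finset.mem_filter, not_and] at hn'
      have := hn' hn
      omega
    simp [this]
  rw [← Finset.sum_subset (Finset.filter_subset _ s) h0]
  set s' := s.filter (fun n => 1 ≤ n)
  set φ : ℕ → ℤ := fun n => ⌊Real.log n - y⌋
  rw [← Finset.sum_fiberwise_of_maps_to (t := s'.image φ) (fun n hn => Finset.mem_image_of_mem φ hn)]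
  have hfib : ∀ j ∈ s'.image φ, ∑ n ∈ s'.filter (fun n => φ n = j),
      (vm n + 1) / n * (1 + (Real.log n - y) ^ 2)⁻¹ ≤ 63 * (1 + (j : ℝ) ^ 2)⁻¹ := by
    intro j _
    have hmem : ∀ n ∈ s'.filter (fun n => φ n = j), 1 ≤ n ∧ (j : ℝ) ≤ Real.log n - y ∧ Real.log n - y < j + 1 := by
      intro n hn
      simp only [Finset.mem_filter, s'] at hn
      have := Int.floor_eq_iff.mp hn.2
      exact ⟨hn.1.2, this⟩
    have hE : Real.exp (y + j + 1) = Real.exp (y + j) * Real.exp 1 := by rw [Real.exp_add]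
    have hterm : ∀ n ∈ s'.filter (fun n => φ n = j), (vm n + 1) / n * (1 + (Real.log n - y) ^ 2)⁻¹ ≤
        (vm n + 1) * ((Real.exp (y + j))⁻¹ * (3 * (1 + (j : ℝ) ^ 2)⁻¹)) := by
      intro n hn
      obtain ⟨h1, h2, h3⟩ := hmem n hn
      have hn0 : (0 : ℝ) < n := by exact_mod_cast h1
      have hv := vm_nonneg n
      have e1 : Real.exp (y + j) ≤ n := by
        rw [← Real.le_log_iff_exp_le hn0]; linarith
      have e2 : (1 + (Real.log n - y) ^ 2)⁻¹ ≤ 3 * (1 + (j : ℝ) ^ 2)⁻¹ := by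
        rw [← one_div, ← div_eq_mul_inv, div_le_div_iff₀ (by positivity) (by positivity)]
        nlinarith [sq_nonneg (2 * (Real.log n - y) - j)]
      rw [div_eq_mul_inv, mul_assoc]
      gcongr
    refine (Finset.sum_le_sum hterm).trans ?_
    rw [← Finset.sum_mul]
    have hs : ∑ n ∈ s'.filter (fun n => φ n = j), (vm n + 1) ≤ 7 * Real.exp (y + j + 1) := by
      have hsub : s'.filter (fun n => φ n = j) ⊆ Finset.Icc 1 ⌊Real.exp (y + j + 1)⌋₊ := by
        intro n hn
        obtain ⟨h1, h2, h3⟩ := hmem n hn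
        have hn0 : (0 : ℝ) < n := by exact_mod_cast h1
        rw [Finset.mem_Icc]
        refine ⟨h1, Nat.le_floor ?_⟩
        rw [← Real.log_le_iff_le_exp hn0]; linarith
      refine (Finset.sum_le_sum_of_subset_of_nonneg hsub fun n _ _ => by linarith [vm_nonneg n]).trans ?_
      rw [Finset.sum_add_distrib]
      have := sum_vm_le (Real.exp (y + j + 1)) (by positivity)
      have h2 := Nat.floor_le (show 0 ≤ Real.exp (y + j + 1) by positivity)
      simp only [Finset.sum_const, Nat.card_Icc, add_tsub_cancel_right, nsmul_eq_mul, mul_one]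
      linarith
    calc _ ≤ 7 * Real.exp (y + j + 1) * ((Real.exp (y + j))⁻¹ * (3 * (1 + (j : ℝ) ^ 2)⁻¹)) := by gcongr
      _ = 21 * Real.exp 1 * (1 + (j : ℝ) ^ 2)⁻¹ := by rw [hE]; field_simp; ring
      _ ≤ _ := by
        gcongr
        linarith [Real.exp_one_lt_d9]
  refine (Finset.sum_le_sum hfib).trans ?_
  rw [← Finset.mul_sum]
  gcongr
  exact hsum.sum_le_tsum _ fun j _ => by positivity

theorem exists_tsum_cauchy_le : ∃ C : ℝ, 0 ≤ C ∧ ∀ y : ℝ,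
    Summable (fun n : ℕ => (vm n + 1) / n * (1 + (Real.log n - y) ^ 2)⁻¹) ∧
    ∑' n : ℕ, (vm n + 1) / n * (1 + (Real.log n - y) ^ 2)⁻¹ ≤ C := by
  obtain ⟨C, hC, h⟩ := exists_sum_cauchy_le
  have h0 : ∀ (y : ℝ) (n : ℕ), 0 ≤ (vm n + 1) / n * (1 + (Real.log n - y) ^ 2)⁻¹ := fun y n => by
    have := vm_nonneg n
    positivity
  exact ⟨C, hC, fun y => ⟨summable_of_sum_le (h0 y) (h y), Real.tsum_le_of_sum_le (h0 y) (h y)⟩⟩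

theorem term_vertical (c : ℕ → ℝ) (σ R t : ℝ) (n : ℕ) :
    LSeries.term (fun n => (c n : ℂ)) (σ - R * t * Complex.I) n =
      LSeries.term (fun n => (c n : ℂ)) σ n * Complex.exp (t * (R * Real.log n : ℝ) * Complex.I) := by
  rcases eq_or_ne n 0 with rfl | hn
  · simp
  have hn0 : (n : ℂ) ≠ 0 := by exact_mod_cast hn
  rw [LSeries.term_of_ne_zero hn, LSeries.term_of_ne_zero hn, Complex.cpow_def_of_ne_zero hn0,
    Complex.cpow_def_of_ne_zero hn0, div_eq_mul_inv, div_eq_mul_inv, ← Complex.exp_neg, ← Complex.exp_neg,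
    mul_assoc (c n : ℂ), ← Complex.exp_add]
  congr 2
  rw [Complex.ofReal_mul, Complex.natCast_log]
  ring

theorem hasSum_term_mul_fej (c : ℕ → ℝ) (σ R y : ℝ)
    (hs : LSeriesSummable (fun n => (c n : ℂ)) σ) :
    HasSum (fun n => LSeries.term (fun n => (c n : ℂ)) σ n * fej (R * (Real.log n - y)))
      (∫ t in (-1 : ℝ)..1, ((1 - |t| : ℝ) : ℂ) * Complex.exp (-(t * (R * y) * Complex.I)) *
        LSeries (fun n => (c n : ℂ)) (σ - R * t * Complex.I)) := by
  set T : ℕ → ℂ := fun n => LSeries.term (fun n => (c n : ℂ)) σ n with hT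
  have hsn : Summable fun n => ‖T n‖ := hs.norm
  have key := intervalIntegral.hasSum_integral_of_dominated_convergence (a := -1) (b := 1)
    (μ := MeasureTheory.volume) (ι := ℕ)
    (F := fun n t => T n * (((1 - |t| : ℝ) : ℂ) * Complex.exp (t * (R * (Real.log n - y) : ℝ) * Complex.I)))
    (f := fun t => ((1 - |t| : ℝ) : ℂ) * Complex.exp (-(t * (R * y) * Complex.I)) *
        LSeries (fun n => (c n : ℂ)) (σ - R * t * Complex.I))
    (fun n _ => ‖T n‖) (fun n => Continuous.aestronglyMeasurable (by fun_prop)) ?_ ?_ ?_ ?_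
  · refine cast (congrArg (fun F => HasSum F _) (funext fun n => ?_)) key
    rw [intervalIntegral.integral_const_mul, fej]
  · intro n
    refine Eventually.of_forall fun t ht => ?_
    rw [Set.uIoc_of_le (by norm_num)] at ht
    have h1 : |t| ≤ 1 := abs_le.mpr ⟨ht.1.le, ht.2⟩
    rw [norm_mul, norm_mul, Complex.norm_real, ← Complex.ofReal_mul, Complex.norm_exp_ofReal_mul_I, mul_one,
      Real.norm_of_nonneg (by linarith)]
    exact mul_le_of_le_one_right (norm_nonneg _) (by linarith [abs_nonneg t])
  · exact Eventually.of_forall fun t _ => hsn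
  · exact intervalIntegrable_const
  · refine Eventually.of_forall fun t _ => ?_
    have hst : LSeriesSummable (fun n => (c n : ℂ)) (σ - R * t * Complex.I) := by
      refine hs.of_re_le_re ?_
      simp
    have h := (hst.hasSum).mul_left (((1 - |t| : ℝ) : ℂ) * Complex.exp (-(t * (R * y) * Complex.I)))
    refine cast (congrArg (fun F => HasSum F _) (funext fun n => ?_)) h
    rw [term_vertical]
    rw [show (t : ℂ) * (R * (Real.log n - y) : ℝ) * Complex.I =
      -(t * (R * y) * Complex.I) + t * (R * Real.log n : ℝ) * Complex.I by push_cast; ring, Complex.exp_add]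
    ring

theorem norm_fej_mul_le (R x : ℝ) (hR : 0 < R) :
    ‖fej (R * x)‖ ≤ 6 * (1 + (R ^ 2)⁻¹) * (1 + x ^ 2)⁻¹ := by
  refine (norm_fej_le_inv _).trans ?_
  rw [mul_assoc]
  gcongr 6 * ?_
  rw [← div_eq_mul_inv, ← one_div, div_le_div_iff₀ (by positivity) (by positivity)]
  have : (1 + (R ^ 2)⁻¹) * (1 + (R * x) ^ 2) = 1 + (R ^ 2)⁻¹ + (R * x) ^ 2 + x ^ 2 := by field_simp; ring
  have h2 : 0 ≤ (R ^ 2)⁻¹ := by positivity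
  nlinarith [sq_nonneg (R * x)]

theorem tendsto_integral_exp_neg_mul (f : ℝ → ℂ) (R : ℝ) (hR : 0 < R) :
    Tendsto (fun y : ℝ => ∫ t in (-1 : ℝ)..1, Complex.exp (-(t * (R * y) * Complex.I)) * f t) atTop
      (nhds 0) := by
  have h := Real.tendsto_integral_exp_smul_cocompact (Set.indicator (Set.Ioc (-1 : ℝ) 1) f)
  have h2 : Tendsto (fun y : ℝ => R * y / (2 * Real.pi)) atTop (cocompact ℝ) :=
    ((tendsto_id.const_mul_atTop hR).atTop_div_const (by positivity)).mono_right atTop_le_cocompact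
  refine (h.comp h2).congr fun y => ?_
  rw [intervalIntegral.integral_of_le (by norm_num), ← MeasureTheory.integral_indicator measurableSet_Ioc]
  refine MeasureTheory.integral_congr_ae (Eventually.of_forall fun t => ?_)
  beta_reduce
  by_cases ht : t ∈ Set.Ioc (-1 : ℝ) 1
  · rw [Set.indicator_of_mem ht, Set.indicator_of_mem ht, Circle.smul_def, Real.fourierChar_apply, smul_eq_mul]
    congr 2
    push_cast
    field_simp
  · rw [Set.indicator_of_notMem ht, Set.indicator_of_notMem ht, smul_zero]

theorem tendsto_tsum_mul_fej (c : ℕ → ℝ) (hc : ∀ n, |c n| ≤ vm n + 1) (G : ℂ → ℂ)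
    (hG : ContinuousOn G {s | 1 ≤ s.re})
    (hs : ∀ s : ℂ, 1 < s.re → LSeriesSummable (fun n => (c n : ℂ)) s)
    (hL : ∀ s : ℂ, 1 < s.re → LSeries (fun n => (c n : ℂ)) s = G s) (R : ℝ) (hR : 0 < R) :
    Tendsto (fun y : ℝ => ∑' n : ℕ, ((c n / n : ℝ) : ℂ) * fej (R * (Real.log n - y))) atTop (nhds 0) := by
  have hline : ∀ σ t : ℝ, ((σ : ℂ) - R * t * Complex.I).re = σ := by intro σ t; simp
  have hkey : ∀ y : ℝ, ∑' n : ℕ, ((c n / n : ℝ) : ℂ) * fej (R * (Real.log n - y)) =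
      ∫ t in (-1 : ℝ)..1, Complex.exp (-(t * (R * y) * Complex.I)) *
        (((1 - |t| : ℝ) : ℂ) * G (1 - R * t * Complex.I)) := by
    intro y
    have hleft : Tendsto (fun σ : ℝ => ∑' n : ℕ, LSeries.term (fun n => (c n : ℂ)) σ n *
        fej (R * (Real.log n - y))) (nhdsWithin 1 (Set.Ioi 1))
        (nhds (∑' n : ℕ, ((c n / n : ℝ) : ℂ) * fej (R * (Real.log n - y)))) := by
      obtain ⟨C, -, hC⟩ := exists_tsum_cauchy_le
      refine tendsto_tsum_of_dominated_convergence ((hC y).1.mul_left (6 * (1 + (R ^ 2)⁻¹))) ?_ ?_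
      · intro n
        refine Tendsto.mul_const _ ?_
        rcases eq_or_ne n 0 with rfl | hn
        · simp
        have hn0 : (n : ℂ) ≠ 0 := by exact_mod_cast hn
        simp only [LSeries.term_of_ne_zero hn]
        have : ContinuousAt (fun σ : ℝ => (c n : ℂ) / (n : ℂ) ^ (σ : ℂ)) 1 := by
          refine ContinuousAt.div continuousAt_const ?_ ?_
          · exact (Complex.continuous_ofReal.continuousAt).const_cpow (Or.inl hn0)
          · simp [hn0]
        have h2 := this.tendsto.mono_left (nhdsWithin_le_nhds (s := Set.Ioi 1))
        simpa using h2
      · filter_upwards [self_mem_nhdsWithin] with σ hσ n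
        rw [Set.mem_Ioi] at hσ
        rw [norm_mul]
        have h1 : ‖LSeries.term (fun n => (c n : ℂ)) σ n‖ ≤ (vm n + 1) / n := by
          have := vm_nonneg n
          rcases eq_or_ne n 0 with rfl | hn
          · simp
          rw [LSeries.norm_term_eq, if_neg hn, Complex.norm_real, Complex.ofReal_re]
          have hn1 : (1 : ℝ) ≤ n := by exact_mod_cast Nat.one_le_iff_ne_zero.mpr hn
          gcongr
          · exact hc n
          · calc (n : ℝ) = (n : ℝ) ^ (1 : ℝ) := (Real.rpow_one _).symm
              _ ≤ _ := Real.rpow_le_rpow_of_exponent_le hn1 hσ.le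
        refine (mul_le_mul h1 (norm_fej_mul_le R _ hR) (norm_nonneg _) ((norm_nonneg _).trans h1)).trans
          (le_of_eq (by ring))
    have hcompact : IsCompact (Set.Icc (1 : ℝ) 2 ×ˢ Set.Icc (-1 : ℝ) 1) := isCompact_Icc.prod isCompact_Icc
    have hcont : ContinuousOn (fun p : ℝ × ℝ => G ((p.1 : ℂ) - R * p.2 * Complex.I)) (Set.Ici 1 ×ˢ Set.univ) := by
      refine hG.comp (Continuous.continuousOn (by fun_prop)) ?_
      rintro ⟨σ, t⟩ ⟨h1, -⟩
      change 1 ≤ ((σ : ℂ) - R * t * Complex.I).re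
      rw [hline]
      exact h1
    obtain ⟨B, hB⟩ := (hcompact.image_of_continuousOn (hcont.mono (by
      rintro ⟨σ, t⟩ ⟨h1, -⟩; exact ⟨h1.1, trivial⟩))).isBounded.exists_norm_le
    have hcσ : ∀ σ : ℝ, 1 ≤ σ → Continuous fun t : ℝ => G ((σ : ℂ) - R * t * Complex.I) := by
      intro σ hσ
      have h1 : ContinuousOn ((fun p : ℝ × ℝ => G ((p.1 : ℂ) - R * p.2 * Complex.I)) ∘ fun t : ℝ => (σ, t))
          Set.univ := hcont.comp (Continuous.continuousOn (by fun_prop)) (fun t _ => ⟨hσ, trivial⟩)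
      exact continuousOn_univ.mp h1
    have hright : Tendsto (fun σ : ℝ => ∫ t in (-1 : ℝ)..1, ((1 - |t| : ℝ) : ℂ) *
        Complex.exp (-(t * (R * y) * Complex.I)) * LSeries (fun n => (c n : ℂ)) (σ - R * t * Complex.I))
        (nhdsWithin 1 (Set.Ioi 1))
        (nhds (∫ t in (-1 : ℝ)..1, ((1 - |t| : ℝ) : ℂ) *
        Complex.exp (-(t * (R * y) * Complex.I)) * G (1 - R * t * Complex.I))) := by
      have hev : ∀ᶠ σ : ℝ in nhdsWithin 1 (Set.Ioi 1), σ ∈ Set.Ioo (1 : ℝ) 2 :=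
        Ioo_mem_nhdsGT (by norm_num)
      refine intervalIntegral.tendsto_integral_filter_of_dominated_convergence (fun _ => B) ?_ ?_
        intervalIntegrable_const ?_
      · filter_upwards [hev] with σ hσ
        refine Continuous.aestronglyMeasurable ?_
        have : (fun t : ℝ => ((1 - |t| : ℝ) : ℂ) * Complex.exp (-(t * (R * y) * Complex.I)) *
            LSeries (fun n => (c n : ℂ)) (σ - R * t * Complex.I)) =
            (fun t : ℝ => ((1 - |t| : ℝ) : ℂ) * Complex.exp (-(t * (R * y) * Complex.I)) *
              G (σ - R * t * Complex.I)) := by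
          funext t
          rw [hL _ (by rw [hline]; exact hσ.1)]
        rw [this]
        exact Continuous.mul (by fun_prop) (hcσ σ hσ.1.le)
      · filter_upwards [hev] with σ hσ
        refine Eventually.of_forall fun t ht => ?_
        rw [Set.uIoc_of_le (by norm_num)] at ht
        have h1 : |t| ≤ 1 := abs_le.mpr ⟨ht.1.le, ht.2⟩
        rw [hL _ (by rw [hline]; exact hσ.1), norm_mul, norm_mul, Complex.norm_real,
          show -((t : ℂ) * (R * y) * Complex.I) = ((-(t * (R * y)) : ℝ) : ℂ) * Complex.I by push_cast; ring,
          Complex.norm_exp_ofReal_mul_I, mul_one, Real.norm_of_nonneg (by linarith)]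
        have hb := hB _ (Set.mem_image_of_mem _ (Set.mk_mem_prod (a := σ) (b := t) ⟨hσ.1.le, hσ.2.le⟩ ⟨ht.1.le, ht.2⟩))
        refine (mul_le_of_le_one_left (norm_nonneg _) (by linarith [abs_nonneg t])).trans hb
      · refine Eventually.of_forall fun t _ => ?_
        refine Tendsto.const_mul _ ?_
        have h1 := hcont (1, t) ⟨le_refl (1 : ℝ), trivial⟩
        have h2 : Tendsto (fun σ : ℝ => (σ, t)) (nhdsWithin 1 (Set.Ioi 1))
            (nhdsWithin ((1 : ℝ), t) (Set.Ici 1 ×ˢ Set.univ)) := by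
          refine tendsto_nhdsWithin_iff.mpr ⟨?_, ?_⟩
          · exact ((by fun_prop : Continuous fun σ : ℝ => (σ, t)).tendsto 1).mono_left nhdsWithin_le_nhds
          · filter_upwards [self_mem_nhdsWithin] with σ hσ
            exact ⟨Set.mem_Ici.mpr (le_of_lt hσ), trivial⟩
        have h3 := h1.tendsto.comp h2
        simp only [Complex.ofReal_one] at h3
        refine h3.congr' ?_
        filter_upwards [self_mem_nhdsWithin] with σ hσ
        exact (hL _ (by rw [hline]; exact hσ)).symm
    have hEq := tendsto_nhds_unique (hleft.congr' ?_) hright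
    · rw [hEq]
      refine intervalIntegral.integral_congr fun t _ => ?_
      ring
    · filter_upwards [self_mem_nhdsWithin] with σ hσ
      exact (hasSum_term_mul_fej c σ R y (hs _ (by simpa using hσ))).tsum_eq
  simp only [hkey]
  exact tendsto_integral_exp_neg_mul _ R hR

theorem norm_le_of_lipschitz_support {φ : ℝ → ℂ} {M : ℝ} (hM : 0 ≤ M)
    (hsupp : ∀ x, x ∉ Set.Icc (0 : ℝ) 1 → φ x = 0) (hlip : ∀ x y, ‖φ x - φ y‖ ≤ M * |x - y|) (x : ℝ) :
    ‖φ x‖ ≤ 2 * M := by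
  by_cases hx : x ∈ Set.Icc (0 : ℝ) 1
  · have h := hlip x (-1)
    rw [hsupp (-1) (by simp), sub_zero] at h
    have : |x - -1| ≤ 2 := abs_le.mpr ⟨by linarith [hx.1], by linarith [hx.2]⟩
    nlinarith
  · rw [hsupp x hx]; simpa using hM

theorem integral_comp_mul_sub {E : Type*} [NormedAddCommGroup E] [NormedSpace ℝ E] (g : ℝ → E) {R : ℝ}
    (hR : 0 < R) (v : ℝ) : ∫ w, R • g (R * (v - w)) = ∫ x, g x := by
  rw [MeasureTheory.integral_smul, MeasureTheory.integral_sub_left_eq_self (fun w => g (R * w)) MeasureTheory.volume v,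
    MeasureTheory.Measure.integral_comp_mul_left, abs_of_pos (inv_pos.mpr hR), smul_smul,
    mul_inv_cancel₀ hR.ne', one_smul]

theorem integrable_comp_mul_sub {E : Type*} [NormedAddCommGroup E] [NormedSpace ℝ E] {g : ℝ → E}
    (hg : MeasureTheory.Integrable g) {R : ℝ} (hR : 0 < R) (v : ℝ) :
    MeasureTheory.Integrable fun w => R • g (R * (v - w)) :=
  ((hg.comp_mul_left' hR.ne').comp_sub_left v).smul R

/-- The first moment, truncated, of the rescaled Fejér kernel. -/
noncomputable def fejDev (R : ℝ) : ℝ := ∫ x, min 4 (|x| / R) * ‖fej x‖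

theorem integrable_min_mul_fej (R : ℝ) (hR : 0 < R) :
    MeasureTheory.Integrable fun x => min 4 (|x| / R) * ‖fej x‖ := by
  refine (integrable_fej.norm.const_mul 4).mono' (Continuous.aestronglyMeasurable ?_)
    (Eventually.of_forall fun x => ?_)
  · have := continuous_fej
    fun_prop
  · have : 0 ≤ min 4 (|x| / R) := le_min (by norm_num) (by positivity)
    rw [Real.norm_of_nonneg (by positivity)]
    gcongr
    exact min_le_left _ _

theorem tendsto_fejDev : Tendsto fejDev atTop (nhds 0) := by
  have h := MeasureTheory.tendsto_integral_filter_of_dominated_convergence (l := atTop)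
    (F := fun (R : ℝ) x => min 4 (|x| / R) * ‖fej x‖) (f := fun _ => 0) (fun x => 4 * ‖fej x‖)
    (μ := MeasureTheory.volume) ?_ ?_ (integrable_fej.norm.const_mul 4) ?_
  · rw [MeasureTheory.integral_zero] at h
    exact h
  · filter_upwards [eventually_gt_atTop 0] with R hR
    exact (integrable_min_mul_fej R hR).aestronglyMeasurable
  · filter_upwards [eventually_gt_atTop 0] with R hR
    refine Eventually.of_forall fun x => ?_
    have : 0 ≤ min 4 (|x| / R) := le_min (by norm_num) (by positivity)
    rw [Real.norm_of_nonneg (by positivity)]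
    gcongr
    exact min_le_left _ _
  · refine Eventually.of_forall fun x => ?_
    have h1 : Tendsto (fun R : ℝ => min 4 (|x| / R)) atTop (nhds (min 4 0)) :=
      tendsto_const_nhds.min (tendsto_const_nhds.div_atTop tendsto_id)
    have h2 := h1.mul_const ‖fej x‖
    simpa using h2

/-- Convolution of `φ` (supported on the unit interval) with the rescaled Fejér kernel. -/
noncomputable def fejConv (φ : ℝ → ℂ) (R v : ℝ) : ℂ :=
  ∫ w in (0 : ℝ)..1, φ w * (R * fej (R * (v - w)))

theorem norm_fejConv_sub_le {φ : ℝ → ℂ} {M : ℝ} (hM : 0 ≤ M)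
    (hsupp : ∀ x, x ∉ Set.Icc (0 : ℝ) 1 → φ x = 0) (hlip : ∀ x y, ‖φ x - φ y‖ ≤ M * |x - y|)
    {R : ℝ} (hR : 0 < R) (v : ℝ) :
    ‖fejConv φ R v - (∫ x, fej x) * φ v‖ ≤ M * fejDev R := by
  have hb := norm_le_of_lipschitz_support hM hsupp hlip
  have hcont : Continuous φ := by
    refine (LipschitzWith.of_dist_le_mul (K := ⟨M, hM⟩) fun x y => ?_).continuous
    rw [dist_eq_norm, Real.dist_eq]; exact hlip x y
  have hI := integrable_comp_mul_sub integrable_fej hR v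
  have hI1 : MeasureTheory.Integrable fun w => φ w * (R * fej (R * (v - w))) := by
    refine (hI.bdd_mul (c := 2 * M) hcont.aestronglyMeasurable (Eventually.of_forall hb)).congr
      (Eventually.of_forall fun w => ?_)
    beta_reduce
    rw [Complex.real_smul]
  have e1 : fejConv φ R v = ∫ w, φ w * (R * fej (R * (v - w))) := by
    rw [fejConv, intervalIntegral.integral_of_le zero_le_one, ← MeasureTheory.integral_Icc_eq_integral_Ioc]
    refine MeasureTheory.setIntegral_eq_integral_of_forall_compl_eq_zero fun w hw => ?_
    rw [hsupp w hw, zero_mul]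
  have e2 : (∫ x, fej x) * φ v = ∫ w, φ v * (R * fej (R * (v - w))) := by
    rw [← integral_comp_mul_sub fej hR v, mul_comm, ← MeasureTheory.integral_const_mul]
    simp only [Complex.real_smul]
  have hI2 : MeasureTheory.Integrable fun w => φ v * (R * fej (R * (v - w))) := by
    refine (hI.const_mul (φ v)).congr (Eventually.of_forall fun w => ?_)
    beta_reduce
    rw [Complex.real_smul]
  rw [e1, e2, ← MeasureTheory.integral_sub hI1 hI2]
  have hI3 := integrable_comp_mul_sub (integrable_min_mul_fej R hR) hR v
  refine (MeasureTheory.norm_integral_le_of_norm_le (hI3.const_mul M) (Eventually.of_forall fun w => ?_)).trans_eq ?_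
  · have h1 : ‖φ w - φ v‖ ≤ M * min 4 (|v - w|) := by
      rw [mul_min_of_nonneg _ _ hM]
      refine le_min ?_ ?_
      · linarith [norm_sub_le (φ w) (φ v), hb w, hb v]
      · rw [abs_sub_comm]; exact hlip w v
    have h2 : |R * (v - w)| / R = |v - w| := by
      rw [abs_mul, abs_of_pos hR]; field_simp
    rw [← sub_mul, norm_mul, norm_mul, Complex.norm_real, Real.norm_of_nonneg hR.le, h2, smul_eq_mul]
    calc _ ≤ M * min 4 |v - w| * (R * ‖fej (R * (v - w))‖) := by gcongr
      _ = _ := by ring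
  · rw [MeasureTheory.integral_const_mul, integral_comp_mul_sub (fun x => min 4 (|x| / R) * ‖fej x‖) hR v, fejDev]

theorem norm_fejConv_le {φ : ℝ → ℂ} {M : ℝ} (hM : 0 ≤ M)
    (hsupp : ∀ x, x ∉ Set.Icc (0 : ℝ) 1 → φ x = 0) (hlip : ∀ x y, ‖φ x - φ y‖ ≤ M * |x - y|)
    {R : ℝ} (hR : 0 < R) (v : ℝ) (hv : 2 ≤ |v|) :
    ‖fejConv φ R v‖ ≤ 32 * M / (R * v ^ 2) := by
  have hb := norm_le_of_lipschitz_support hM hsupp hlip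
  have : ‖fejConv φ R v‖ ≤ 32 * M / (R * v ^ 2) * |1 - (0 : ℝ)| := by
    refine intervalIntegral.norm_integral_le_of_norm_le_const fun w hw => ?_
    rw [Set.uIoc_of_le zero_le_one] at hw
    have hv0 : 0 < v ^ 2 := by
      have : 0 < |v| := by linarith
      have := pow_pos this 2
      rwa [sq_abs] at this
    have h1 : v ^ 2 ≤ 4 * (v - w) ^ 2 := by
      have h3 : |v| / 2 ≤ |v - w| := by
        have := abs_sub_abs_le_abs_sub v w
        rw [abs_of_pos hw.1] at this
        linarith [hw.2]
      have h4 : (|v| / 2) ^ 2 ≤ |v - w| ^ 2 := by gcongr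
      rw [div_pow, sq_abs, sq_abs] at h4
      linarith
    have h2 := norm_fej_mul_sq_le (R * (v - w))
    have h5 : ‖fej (R * (v - w))‖ * (R ^ 2 * v ^ 2) ≤ 16 := by
      have h6 : ‖fej (R * (v - w))‖ * (R ^ 2 * v ^ 2) ≤ ‖fej (R * (v - w))‖ * (R ^ 2 * (4 * (v - w) ^ 2)) := by
        gcongr
      nlinarith
    rw [norm_mul, norm_mul, Complex.norm_real, Real.norm_of_nonneg hR.le, le_div_iff₀ (by positivity)]
    calc _ = ‖φ w‖ * (‖fej (R * (v - w))‖ * (R ^ 2 * v ^ 2)) := by ring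
      _ ≤ 2 * M * 16 := mul_le_mul (hb w) h5 (by positivity) (by positivity)
      _ = _ := by ring
  simpa using this

theorem norm_fejConv_sub_le_cauchy {φ : ℝ → ℂ} {M : ℝ} (hM : 0 ≤ M)
    (hsupp : ∀ x, x ∉ Set.Icc (0 : ℝ) 1 → φ x = 0) (hlip : ∀ x y, ‖φ x - φ y‖ ≤ M * |x - y|)
    {R : ℝ} (hR : 0 < R) (v : ℝ) :
    ‖fejConv φ R v - (∫ x, fej x) * φ v‖ ≤ M * (5 * fejDev R + 40 / R) * (1 + v ^ 2)⁻¹ := by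
  have h0 : 0 ≤ fejDev R := by
    refine MeasureTheory.integral_nonneg fun x => ?_
    have : 0 ≤ min 4 (|x| / R) := le_min (by norm_num) (by positivity)
    positivity
  rw [← div_eq_mul_inv, le_div_iff₀ (by positivity)]
  have hR' : 0 ≤ 40 / R := by positivity
  rcases le_or_gt 2 |v| with hv | hv
  · have hφ : φ v = 0 := hsupp v fun h => by
      rw [abs_of_nonneg h.1] at hv
      linarith [h.2]
    rw [hφ, mul_zero, sub_zero]
    have h1 := norm_fejConv_le hM hsupp hlip hR v hv
    have hv4 : 4 ≤ v ^ 2 := by rw [← sq_abs]; nlinarith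
    have hv0 : v ≠ 0 := by rintro rfl; norm_num at hv4
    calc _ ≤ 32 * M / (R * v ^ 2) * (1 + v ^ 2) := by gcongr
      _ ≤ 32 * M / (R * v ^ 2) * (5 / 4 * v ^ 2) := by gcongr; linarith
      _ = M * (40 / R) := by field_simp; ring
      _ ≤ _ := by gcongr; linarith
  · have h1 := norm_fejConv_sub_le hM hsupp hlip hR v
    have hv4 : v ^ 2 ≤ 4 := by rw [← sq_abs]; nlinarith [abs_nonneg v]
    calc _ ≤ M * fejDev R * 5 := mul_le_mul h1 (by linarith) (by positivity) (by positivity)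
      _ = M * (5 * fejDev R) := by ring
      _ ≤ _ := by gcongr; linarith

theorem hasSum_mul_fejConv (c : ℕ → ℝ) (hc : ∀ n, |c n| ≤ vm n + 1) {φ : ℝ → ℂ} {M : ℝ} (hM : 0 ≤ M)
    (hsupp : ∀ x, x ∉ Set.Icc (0 : ℝ) 1 → φ x = 0) (hlip : ∀ x y, ‖φ x - φ y‖ ≤ M * |x - y|)
    {R : ℝ} (hR : 0 < R) (y : ℝ) :
    HasSum (fun n : ℕ => ((c n / n : ℝ) : ℂ) * fejConv φ R (Real.log n - y))
      (∫ w in (0 : ℝ)..1, φ w * (R * ∑' n : ℕ, ((c n / n : ℝ) : ℂ) * fej (R * (Real.log n - (y + w))))) := by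
  have hb := norm_le_of_lipschitz_support hM hsupp hlip
  obtain ⟨C, -, hC⟩ := exists_tsum_cauchy_le
  have hcont : Continuous φ := by
    refine (LipschitzWith.of_dist_le_mul (K := ⟨M, hM⟩) fun x y => ?_).continuous
    rw [dist_eq_norm, Real.dist_eq]; exact hlip x y
  have hcf := continuous_fej
  have hterm : ∀ (n : ℕ) (w : ℝ), ‖((c n / n : ℝ) : ℂ) * fej (R * (Real.log n - (y + w)))‖ ≤
      6 * (1 + (R ^ 2)⁻¹) * ((vm n + 1) / n * (1 + (Real.log n - (y + w)) ^ 2)⁻¹) := by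
    intro n w
    have hv := vm_nonneg n
    rw [norm_mul, Complex.norm_real, Real.norm_eq_abs, abs_div, Nat.abs_cast]
    have h1 := norm_fej_mul_le R (Real.log n - (y + w)) hR
    calc _ ≤ (vm n + 1) / n * (6 * (1 + (R ^ 2)⁻¹) * (1 + (Real.log n - (y + w)) ^ 2)⁻¹) := by
          gcongr
          exact hc n
      _ = _ := by ring
  have key := intervalIntegral.hasSum_integral_of_dominated_convergence (a := 0) (b := 1)
    (μ := MeasureTheory.volume) (ι := ℕ)
    (F := fun n w => φ w * (R * (((c n / n : ℝ) : ℂ) * fej (R * (Real.log n - (y + w))))))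
    (f := fun w => φ w * (R * ∑' n : ℕ, ((c n / n : ℝ) : ℂ) * fej (R * (Real.log n - (y + w)))))
    (fun n _ => 2 * M * (R * (6 * (1 + (R ^ 2)⁻¹) * (3 * ((vm n + 1) / n * (1 + (Real.log n - y) ^ 2)⁻¹)))))
    (fun n => Continuous.aestronglyMeasurable (by fun_prop)) ?_ ?_ ?_ ?_
  · refine cast (congrArg (fun F => HasSum F _) (funext fun n => ?_)) key
    rw [fejConv, ← intervalIntegral.integral_const_mul]
    refine intervalIntegral.integral_congr fun w _ => ?_
    rw [show Real.log n - (y + w) = Real.log n - y - w by ring]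
    push_cast
    ring
  · intro n
    refine Eventually.of_forall fun w hw => ?_
    rw [Set.uIoc_of_le zero_le_one] at hw
    have hv := vm_nonneg n
    rw [norm_mul, norm_mul, Complex.norm_real, Real.norm_of_nonneg hR.le]
    gcongr
    · exact hb w
    · refine (hterm n w).trans ?_
      rw [mul_left_comm 3]
      gcongr
      rw [← div_eq_mul_inv, ← one_div, div_le_div_iff₀ (by positivity) (by positivity)]
      nlinarith [sq_nonneg (Real.log n - y - 2 * w), hw.1, hw.2]
  · exact Eventually.of_forall fun t _ => ((((hC y).1.mul_left 3).mul_left _).mul_left R).mul_left _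
  · exact intervalIntegrable_const
  · refine Eventually.of_forall fun w _ => ?_
    have hsm : Summable fun n : ℕ => ((c n / n : ℝ) : ℂ) * fej (R * (Real.log n - (y + w))) := by
      refine Summable.of_norm_bounded ((hC (y + w)).1.mul_left (6 * (1 + (R ^ 2)⁻¹))) fun n => ?_
      exact_mod_cast hterm n w
    exact (hsm.hasSum.mul_left _).mul_left _

theorem exists_forall_norm_tsum_lipschitz_le (c : ℕ → ℝ) (hc : ∀ n, |c n| ≤ vm n + 1)
    (hfej : ∀ R : ℝ, 0 < R →
      Tendsto (fun y : ℝ => ∑' n : ℕ, ((c n / n : ℝ) : ℂ) * fej (R * (Real.log n - y))) atTop (nhds 0))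
    (M ε : ℝ) (hM : 0 ≤ M) (hε : 0 < ε) :
    ∃ y₀ : ℝ, ∀ y ≥ y₀, ∀ φ : ℝ → ℂ, (∀ x, x ∉ Set.Icc (0 : ℝ) 1 → φ x = 0) →
      (∀ x y, ‖φ x - φ y‖ ≤ M * |x - y|) →
      ‖∑' n : ℕ, ((c n / n : ℝ) : ℂ) * φ (Real.log n - y)‖ ≤ ε := by
  obtain ⟨C, hC0, hC⟩ := exists_tsum_cauchy_le
  set κ : ℂ := ∫ x, fej x with hκ
  have hκ0 : 0 < ‖κ‖ := norm_pos_iff.mpr integral_fej_ne_zero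
  have ht : Tendsto (fun R : ℝ => M * (5 * fejDev R + 40 / R) * C) atTop (nhds 0) := by
    have := (((tendsto_fejDev.const_mul 5).add
      ((tendsto_const_nhds (x := (40 : ℝ))).div_atTop tendsto_id)).const_mul M).mul_const C
    simpa using this
  obtain ⟨R, hRlt, hR⟩ := ((ht.eventually (gt_mem_nhds (show 0 < ‖κ‖ * ε / 2 by positivity))).and
    (eventually_gt_atTop 0)).exists
  set δ : ℝ := ‖κ‖ * ε / 2 / (2 * (M + 1) * R) with hδ
  have hδ0 : 0 < δ := by positivity
  have h1 := (hfej R hR).norm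
  rw [norm_zero] at h1
  obtain ⟨y₀, hy₀⟩ := eventually_atTop.mp (h1.eventually (gt_mem_nhds hδ0))
  refine ⟨y₀, fun y hy φ hsupp hlip => ?_⟩
  have hb := norm_le_of_lipschitz_support hM hsupp hlip
  have hA := hasSum_mul_fejConv c hc hM hsupp hlip hR y
  have hdev : ∀ n : ℕ, ‖((c n / n : ℝ) : ℂ) * (fejConv φ R (Real.log n - y) - κ * φ (Real.log n - y))‖ ≤
      M * (5 * fejDev R + 40 / R) * ((vm n + 1) / n * (1 + (Real.log n - y) ^ 2)⁻¹) := by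
    intro n
    have hv := vm_nonneg n
    rw [norm_mul, Complex.norm_real, Real.norm_eq_abs, abs_div, Nat.abs_cast]
    have h1 := norm_fejConv_sub_le_cauchy hM hsupp hlip hR (Real.log n - y)
    calc _ ≤ (vm n + 1) / n * (M * (5 * fejDev R + 40 / R) * (1 + (Real.log n - y) ^ 2)⁻¹) :=
          mul_le_mul (div_le_div_of_nonneg_right (hc n) (Nat.cast_nonneg _)) h1 (norm_nonneg _) (by positivity)
      _ = _ := by ring
  have hsB := (hC y).1.mul_left (M * (5 * fejDev R + 40 / R))
  have hsD : Summable fun n : ℕ => ((c n / n : ℝ) : ℂ) * (fejConv φ R (Real.log n - y) - κ * φ (Real.log n - y)) :=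
    Summable.of_norm_bounded hsB hdev
  have hD : ‖∑' n : ℕ, ((c n / n : ℝ) : ℂ) * (fejConv φ R (Real.log n - y) - κ * φ (Real.log n - y))‖ ≤
      ‖κ‖ * ε / 2 := by
    refine (tsum_of_norm_bounded hsB.hasSum hdev).trans ?_
    rw [tsum_mul_left]
    have h0 : 0 ≤ fejDev R := by
      refine MeasureTheory.integral_nonneg fun x => ?_
      have : 0 ≤ min 4 (|x| / R) := le_min (by norm_num) (by positivity)
      positivity
    refine (mul_le_mul_of_nonneg_left (hC y).2 (by positivity)).trans hRlt.le
  have hconv : ‖∑' n : ℕ, ((c n / n : ℝ) : ℂ) * fejConv φ R (Real.log n - y)‖ ≤ ‖κ‖ * ε / 2 := by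
    rw [hA.tsum_eq]
    have : ‖∫ w in (0 : ℝ)..1, φ w * (R * ∑' n : ℕ, ((c n / n : ℝ) : ℂ) *
        fej (R * (Real.log n - (y + w))))‖ ≤ 2 * M * (R * δ) * |1 - (0 : ℝ)| := by
      refine intervalIntegral.norm_integral_le_of_norm_le_const fun w hw => ?_
      rw [Set.uIoc_of_le zero_le_one] at hw
      rw [norm_mul, norm_mul, Complex.norm_real, Real.norm_of_nonneg hR.le]
      have h2 : ‖∑' n : ℕ, ((c n / n : ℝ) : ℂ) * fej (R * (Real.log n - (y + w)))‖ ≤ δ :=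
        (hy₀ (y + w) (by linarith [hw.1])).le
      gcongr
      exact hb w
    refine this.trans ?_
    rw [hδ]
    have : 2 * M * (R * (‖κ‖ * ε / 2 / (2 * (M + 1) * R))) = ‖κ‖ * ε / 2 * (M / (M + 1)) := by field_simp
    rw [sub_zero, abs_one, mul_one, this]
    exact mul_le_of_le_one_right (by positivity) (by rw [div_le_one (by positivity)]; linarith)
  have hfin : κ * ∑' n : ℕ, ((c n / n : ℝ) : ℂ) * φ (Real.log n - y) =
      (∑' n : ℕ, ((c n / n : ℝ) : ℂ) * fejConv φ R (Real.log n - y)) -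
      ∑' n : ℕ, ((c n / n : ℝ) : ℂ) * (fejConv φ R (Real.log n - y) - κ * φ (Real.log n - y)) := by
    rw [← hA.summable.tsum_sub hsD, ← tsum_mul_left]
    refine tsum_congr fun n => ?_
    ring
  have h3 : ‖κ‖ * ‖∑' n : ℕ, ((c n / n : ℝ) : ℂ) * φ (Real.log n - y)‖ ≤ ‖κ‖ * ε := by
    rw [← norm_mul, hfin]
    refine (norm_sub_le _ _).trans ?_
    linarith
  exact le_of_mul_le_mul_left h3 hκ0

open ArithmeticFunction.vonMangoldt in
theorem tendsto_residueClass_fej (W : ℕ) [NeZero W] (r : ZMod W) (hr : IsUnit r) (R : ℝ) (hR : 0 < R) :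
    Tendsto (fun y : ℝ => ∑' n : ℕ, (((residueClass r n - (W.totient : ℝ)⁻¹) / n : ℝ) : ℂ) *
      fej (R * (Real.log n - y))) atTop (nhds 0) := by
  have htot : 1 ≤ (W.totient : ℝ) := by
    exact_mod_cast Nat.totient_pos.mpr (Nat.pos_of_ne_zero (NeZero.ne W))
  have hA : (W.totient : ℝ)⁻¹ ≤ 1 := inv_le_one_of_one_le₀ htot
  have hA0 : 0 ≤ (W.totient : ℝ)⁻¹ := by positivity
  have hres : ∀ s : ℂ, 1 < s.re → LSeriesSummable (fun n => (residueClass r n : ℂ)) s := fun s hs =>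
    LSeriesSummable_of_abscissaOfAbsConv_lt_re
      ((abscissaOfAbsConv_residueClass_le_one r).trans_lt (by exact_mod_cast hs))
  have hone : ∀ s : ℂ, 1 < s.re → LSeriesSummable ((W.totient : ℂ)⁻¹ • (1 : ℕ → ℂ)) s := fun s hs =>
    (LSeriesSummable_one_iff.mpr hs).smul _
  have hcoe : (fun n => ((residueClass r n - (W.totient : ℝ)⁻¹ : ℝ) : ℂ)) =
      (fun n => (residueClass r n : ℂ)) - (W.totient : ℂ)⁻¹ • (1 : ℕ → ℂ) := by
    funext n
    simp
  refine tendsto_tsum_mul_fej (fun n => residueClass r n - (W.totient : ℝ)⁻¹) ?_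
    (fun s => LFunctionResidueClassAux r s - (W.totient : ℂ)⁻¹ *
      Function.update (fun s : ℂ => riemannZeta s - 1 / (s - 1)) 1 (Real.eulerMascheroniConstant : ℂ) s) ?_ ?_ ?_ R hR
  · intro n
    have h1 := residueClass_nonneg r n
    have h2 : residueClass r n ≤ vm n := residueClass_le r n
    have := vm_nonneg n
    exact abs_le.mpr ⟨by linarith, by linarith⟩
  · refine (continuousOn_LFunctionResidueClassAux r).sub (Continuous.continuousOn ?_)
    refine continuous_const.mul (continuous_iff_continuousAt.mpr fun s => ?_)
    rcases eq_or_ne s 1 with rfl | hs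
    · exact continuousAt_update_same.mpr tendsto_riemannZeta_sub_one_div
    · rw [continuousAt_update_of_ne hs]
      refine (differentiableAt_riemannZeta hs).continuousAt.sub (continuousAt_const.div ?_ (sub_ne_zero.mpr hs))
      fun_prop
  · intro s hs
    rw [hcoe]
    exact (hres s hs).sub (hone s hs)
  · intro s hs
    have hs1 : s ≠ 1 := by rintro rfl; simp at hs
    rw [hcoe, LSeries_sub (hres s hs) (hone s hs), LSeries_smul, LSeries_one_eq_riemannZeta hs,
      eqOn_LFunctionResidueClassAux hr hs, Function.update_of_ne hs1]
    ring

theorem abs_min_exp_sub_le (u v : ℝ) : |Real.exp (min u 1) - Real.exp (min v 1)| ≤ 3 * |u - v| := by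
  have key : ∀ a b : ℝ, a ≤ b → b ≤ 1 → |Real.exp b - Real.exp a| ≤ 3 * (b - a) := by
    intro a b hab hb
    have h1 : Real.exp a = Real.exp b * Real.exp (a - b) := by rw [← Real.exp_add]; ring_nf
    have h2 := Real.add_one_le_exp (a - b)
    have h3 : Real.exp b ≤ 3 := (Real.exp_le_exp.mpr hb).trans (by linarith [Real.exp_one_lt_d9])
    have h4 := Real.exp_pos b
    rw [abs_of_nonneg (sub_nonneg.mpr (Real.exp_le_exp.mpr hab)), h1]
    nlinarith
  rcases le_total (min u 1) (min v 1) with h | h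
  · rw [abs_sub_comm]
    refine (key _ _ h (min_le_right _ _)).trans ?_
    gcongr
    refine (le_abs_self _).trans ?_
    rw [abs_sub_comm]
    refine (abs_min_sub_min_le_max u 1 v 1).trans ?_
    simp
  · refine (key _ _ h (min_le_right _ _)).trans ?_
    gcongr
    refine (le_abs_self _).trans ((abs_min_sub_min_le_max u 1 v 1).trans ?_)
    simp

/-- The logarithmic profile of the weight `wt` twisted by an additive character of frequency `k`. -/
noncomputable def profile (k u : ℝ) : ℂ :=
  (Real.exp (min u 1) : ℂ) * tri u * expi (k * Real.exp (min u 1))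

theorem profile_eq_zero (k x : ℝ) (hx : x ∉ Set.Icc (0 : ℝ) 1) : profile k x = 0 := by
  have : tri x = 0 := by
    rcases lt_or_ge x 0 with h | h
    · exact tri_eq_zero_of_nonpos h.le
    · refine tri_eq_zero_of_ge ?_
      have : 1 < x := by
        by_contra h2
        exact hx ⟨h, not_lt.mp h2⟩
      linarith [Real.log_two_lt_d9]
  simp [profile, this]

theorem profile_lipschitz (T k : ℝ) (hk : |k| ≤ T) (x y : ℝ) :
    ‖profile k x - profile k y‖ ≤ (6 + 54 * Real.pi * T) * |x - y| := by
  have hT : 0 ≤ T := (abs_nonneg k).trans hk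
  set E : ℝ → ℝ := fun u => Real.exp (min u 1) with hE
  have hE0 : ∀ u, 0 < E u := fun u => Real.exp_pos _
  have hE3 : ∀ u, E u ≤ 3 := fun u =>
    (Real.exp_le_exp.mpr (min_le_right _ _)).trans (by linarith [Real.exp_one_lt_d9])
  have hEl : |E x - E y| ≤ 3 * |x - y| := abs_min_exp_sub_le x y
  have e1 : profile k x - profile k y = ((E x - E y : ℝ) : ℂ) * tri x * expi (k * E x) +
      (E y : ℂ) * ((tri x - tri y : ℝ) : ℂ) * expi (k * E x) +
      (E y : ℂ) * tri y * (expi (k * E x) - expi (k * E y)) := by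
    simp only [profile, hE]
    push_cast
    ring
  have n1 : ‖((E x - E y : ℝ) : ℂ) * tri x * expi (k * E x)‖ ≤ 3 * |x - y| := by
    rw [norm_mul, norm_mul, norm_expi, mul_one, Complex.norm_real, Complex.norm_real, Real.norm_eq_abs,
      Real.norm_of_nonneg (tri_nonneg x)]
    exact (mul_le_of_le_one_right (abs_nonneg _) (tri_le_one x)).trans hEl
  have n2 : ‖(E y : ℂ) * ((tri x - tri y : ℝ) : ℂ) * expi (k * E x)‖ ≤ 3 * |x - y| := by
    rw [norm_mul, norm_mul, norm_expi, mul_one, Complex.norm_real, Complex.norm_real, Real.norm_eq_abs,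
      Real.norm_eq_abs, abs_of_pos (hE0 y)]
    exact mul_le_mul (hE3 y) (tri_lipschitz x y) (abs_nonneg _) (by norm_num)
  have n3 : ‖(E y : ℂ) * tri y * (expi (k * E x) - expi (k * E y))‖ ≤ 54 * Real.pi * T * |x - y| := by
    rw [norm_mul, norm_mul, Complex.norm_real, Complex.norm_real, Real.norm_eq_abs, abs_of_pos (hE0 y),
      Real.norm_of_nonneg (tri_nonneg y)]
    have h1 := norm_expi_sub_expi_le (k * E x) (k * E y)
    rw [← mul_sub, abs_mul] at h1
    have h2 : ‖expi (k * E x) - expi (k * E y)‖ ≤ 2 * Real.pi * (T * (3 * |x - y|)) := by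
      refine h1.trans ?_
      have := Real.pi_pos
      gcongr
    calc _ ≤ 3 * 1 * (2 * Real.pi * (T * (3 * |x - y|))) :=
          mul_le_mul (mul_le_mul (hE3 y) (tri_le_one y) (tri_nonneg y) (by norm_num)) h2 (norm_nonneg _) (by norm_num)
      _ = 18 * Real.pi * T * |x - y| := by ring
      _ ≤ _ := by
          have := Real.pi_pos
          gcongr
          norm_num
  rw [e1]
  refine (norm_add₃_le).trans ?_
  linarith

open ArithmeticFunction.vonMangoldt in
theorem norm_sum_residueClass_sub_le (W : ℕ) [NeZero W] (r : ZMod W) (hr : IsUnit r) (T ε : ℝ) (hT : 0 ≤ T)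
    (hε : 0 < ε) : ∀ᶠ N : ℝ in atTop, ∀ β : ℝ, N * |β| ≤ T →
      ‖∑ n ∈ Finset.Ioc 0 ⌊2 * N⌋₊, (((residueClass r n - (W.totient : ℝ)⁻¹ : ℝ)) : ℂ) * wt N n * expi (n * β)‖
        ≤ ε * N := by
  have htot : 1 ≤ (W.totient : ℝ) := by
    exact_mod_cast Nat.totient_pos.mpr (Nat.pos_of_ne_zero (NeZero.ne W))
  have hA : (W.totient : ℝ)⁻¹ ≤ 1 := inv_le_one_of_one_le₀ htot
  have hA0 : 0 ≤ (W.totient : ℝ)⁻¹ := by positivity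
  have hpi := Real.pi_pos
  obtain ⟨y₀, hy₀⟩ := exists_forall_norm_tsum_lipschitz_le (fun n => residueClass r n - (W.totient : ℝ)⁻¹)
    (by
      intro n
      have h1 := residueClass_nonneg r n
      have h2 : residueClass r n ≤ vm n := residueClass_le r n
      have := vm_nonneg n
      exact abs_le.mpr ⟨by linarith, by linarith⟩)
    (fun R hR => tendsto_residueClass_fej W r hr R hR) (6 + 54 * Real.pi * T) ε (by positivity) hε
  filter_upwards [Real.tendsto_log_atTop.eventually_ge_atTop y₀, eventually_gt_atTop 0] with N hN hN0 β hβ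
  have hk : |β * N| ≤ T := by rw [abs_mul, abs_of_pos hN0, mul_comm]; exact hβ
  have h := hy₀ (Real.log N) hN (profile (β * N)) (profile_eq_zero _) (profile_lipschitz T _ hk)
  have hterm : ∀ n : ℕ, n ∈ Finset.Ioc 0 ⌊2 * N⌋₊ → (((residueClass r n - (W.totient : ℝ)⁻¹) / n : ℝ) : ℂ) *
      profile (β * N) (Real.log n - Real.log N) =
      (1 / N : ℂ) * ((((residueClass r n - (W.totient : ℝ)⁻¹ : ℝ)) : ℂ) * wt N n * expi (n * β)) := by
    intro n hn
    rw [Finset.mem_Ioc] at hn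
    have hn0 : (0 : ℝ) < n := by exact_mod_cast hn.1
    have hn2 : (n : ℝ) ≤ 2 * N := (Nat.le_floor_iff (by positivity)).mp hn.2
    have hnC : (n : ℂ) ≠ 0 := by exact_mod_cast hn0.ne'
    have hNC : (N : ℂ) ≠ 0 := by exact_mod_cast hN0.ne'
    have hlog : Real.log n - Real.log N = Real.log (n / N) := (Real.log_div hn0.ne' hN0.ne').symm
    have hmin : min (Real.log (n / N)) 1 = Real.log (n / N) := by
      refine min_eq_left ?_
      refine (Real.log_le_log (by positivity) ((div_le_iff₀ hN0).mpr hn2)).trans ?_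
      linarith [Real.log_two_lt_d9]
    rw [hlog, profile, hmin, Real.exp_log (by positivity), wt, show β * N * (n / N) = n * β by field_simp]
    rw [Complex.ofReal_div _ (n : ℝ), Complex.ofReal_div (n : ℝ) N, Complex.ofReal_natCast]
    field_simp
  have hz : ∀ n : ℕ, n ∉ Finset.Ioc 0 ⌊2 * N⌋₊ → (((residueClass r n - (W.totient : ℝ)⁻¹) / n : ℝ) : ℂ) *
      profile (β * N) (Real.log n - Real.log N) = 0 := by
    intro n hn
    rcases Nat.eq_zero_or_pos n with rfl | hn0
    · simp
    have hn2 : 2 * N < n := by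
      refine (Nat.floor_lt (by positivity)).mp ?_
      by_contra h2
      exact hn (Finset.mem_Ioc.mpr ⟨hn0, not_lt.mp h2⟩)
    have hn0' : (0 : ℝ) < n := by exact_mod_cast hn0
    have : tri (Real.log n - Real.log N) = 0 := by
      refine tri_eq_zero_of_ge ?_
      rw [← Real.log_div hn0'.ne' hN0.ne']
      exact Real.log_le_log (by norm_num) ((le_div_iff₀ hN0).mpr hn2.le)
    simp [profile, this]
  rw [tsum_eq_sum (s := Finset.Ioc 0 ⌊2 * N⌋₊) (fun n hn => hz n hn), Finset.sum_congr rfl hterm,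
    ← Finset.mul_sum, norm_mul, norm_div, norm_one, Complex.norm_real, Real.norm_of_nonneg hN0.le,
    one_div, ← div_eq_inv_mul, div_le_iff₀ hN0] at h
  exact h

/-- The normalised indicator function of the integers coprime to `W`. -/
noncomputable def bmod (W n : ℕ) : ℝ := if n.Coprime W then (W : ℝ) / W.totient else 0

theorem norm_sum_wt_expi_le (N : ℝ) (hN : 1 ≤ N) (c : ℕ → ℂ) (B β : ℝ)
    (hB : ∀ n, ‖∑ i ∈ Finset.range n, c i‖ ≤ B) :
    ‖∑ n ∈ Finset.Ioc 0 ⌊2 * N⌋₊, c n * wt N n * expi (n * β)‖ ≤ 20 * B * (1 + N * |β|) := by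
  have h := norm_sum_wt_mul_le N hN (⌊2 * N⌋₊ + 1) (by push_cast; exact (Nat.lt_floor_add_one _).le) c 1 B β
    (fun _ => 1) (fun n _ => hB n) (fun _ _ _ => by norm_num) (fun _ _ _ => by
      rw [sub_self, abs_zero]; positivity)
  rw [Finset.range_eq_Ico, Finset.sum_eq_sum_Ico_succ_bot (Nat.succ_pos _)] at h
  have h0 : wt N ((0 : ℕ) : ℝ) = 0 := wt_eq_zero_of_le (by linarith) (by simp) (by simp; linarith)
  rw [h0] at h
  simp only [Complex.ofReal_zero, Complex.ofReal_one, zero_mul, mul_zero, zero_add, mul_one] at h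
  refine le_trans (le_of_eq ?_) h
  congr 1
  refine Finset.sum_congr (by ext n; simp only [Finset.mem_Ioc, Finset.mem_Ico]; omega) fun n _ => ?_
  ring

theorem norm_sum_range_one_sub_le (W : ℕ) [NeZero W] (r : ZMod W) (n : ℕ) :
    ‖∑ i ∈ Finset.range n, ((1 - if (i : ZMod W) = r then (W : ℝ) else 0 : ℝ) : ℂ)‖ ≤ W := by
  have hW : 0 < W := Nat.pos_of_ne_zero (NeZero.ne W)
  rw [← Complex.ofReal_sum, Complex.norm_real, Finset.sum_sub_distrib, Finset.sum_const, Finset.card_range,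
    nsmul_eq_mul, mul_one]
  have hcnt : (∑ i ∈ Finset.range n, if (i : ZMod W) = r then (W : ℝ) else 0) =
      W * (n.count (· ≡ r.val [MOD W]) : ℕ) := by
    rw [Nat.count_eq_card_filter_range, ← Finset.sum_filter, Finset.sum_const, nsmul_eq_mul, mul_comm]
    congr 3
    refine Finset.filter_congr fun i _ => ?_
    rw [← ZMod.natCast_eq_natCast_iff, ZMod.natCast_zmod_val]
  rw [hcnt, Nat.count_modEq_card _ hW]
  have h1 : (n : ℝ) = W * ((n / W : ℕ) : ℝ) + ((n % W : ℕ) : ℝ) := by exact_mod_cast (Nat.div_add_mod n W).symm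
  have h2 : ((n % W : ℕ) : ℝ) ≤ W := by exact_mod_cast (Nat.mod_lt n hW).le
  have h3 : (0 : ℝ) ≤ ((n % W : ℕ) : ℝ) := by positivity
  rw [Real.norm_eq_abs, abs_le]
  push_cast
  split_ifs <;> constructor <;> push_cast <;> linarith

theorem exists_sum_vm_not_coprime_le (W : ℕ) (hW : 1 ≤ W) : ∃ C : ℝ, 0 ≤ C ∧ ∀ N : ℝ, 1 ≤ N →
    ∑ n ∈ Finset.Ioc 0 ⌊2 * N⌋₊, (if n.Coprime W then 0 else vm n) ≤ C * Real.sqrt (2 * N) := by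
  obtain ⟨C, hC0, hC⟩ := exists_sum_vm_sub_lamP_le
  refine ⟨C + W * Real.log W, by positivity, fun N hN => ?_⟩
  have hset : Finset.Ioc 0 ⌊2 * N⌋₊ = Finset.Icc 1 ⌊2 * N⌋₊ := by
    ext n; simp only [Finset.mem_Ioc, Finset.mem_Icc]; omega
  have h1 : ∀ n ∈ Finset.Ioc 0 ⌊2 * N⌋₊, (if n.Coprime W then 0 else vm n) ≤
      (vm n - lamP n) + (if n ∈ Finset.Icc 1 W then Real.log W else 0) := by
    intro n hn
    have hle := lamP_le_vm n
    have hW0 : 0 ≤ Real.log W := Real.log_natCast_nonneg W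
    have hif : 0 ≤ (if n ∈ Finset.Icc 1 W then Real.log W else 0) := by split_ifs <;> simp [hW0]
    split_ifs with hcop hmem hmem
    · linarith
    · linarith
    · have : lamP n ≤ Real.log W := by
        rw [Finset.mem_Icc] at hmem
        refine hle.trans ((vm_le_log n).trans ?_)
        exact Real.log_le_log (by exact_mod_cast hmem.1) (by exact_mod_cast hmem.2)
      linarith
    · have : lamP n = 0 := by
        rw [lamP]
        refine if_neg fun hp => hmem ?_
        rw [Finset.mem_Icc]
        have hdvd : n ∣ W := by
          by_contra h
          exact hcop ((Nat.Prime.coprime_iff_not_dvd hp).mpr h)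
        exact ⟨hp.one_le, Nat.le_of_dvd hW hdvd⟩
      linarith
  refine (Finset.sum_le_sum h1).trans ?_
  rw [Finset.sum_add_distrib, add_mul]
  refine add_le_add ?_ ?_
  · rw [hset]
    exact hC _ (by linarith)
  · have hs1 : 1 ≤ Real.sqrt (2 * N) := Real.one_le_sqrt.mpr (by linarith)
    have hW0 : 0 ≤ Real.log W := Real.log_natCast_nonneg W
    calc _ ≤ ∑ n ∈ Finset.Icc 1 W, Real.log W := by
          rw [← Finset.sum_filter]
          refine Finset.sum_le_sum_of_subset_of_nonneg ?_ fun _ _ _ => hW0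
          intro n hn
          exact (Finset.mem_filter.mp hn).2
      _ = W * Real.log W := by simp
      _ ≤ _ := le_mul_of_one_le_right (by positivity) hs1

open ArithmeticFunction.vonMangoldt in
theorem norm_expSum_vm_sub_bmod_le (W : ℕ) [NeZero W] (T ε : ℝ) (hT : 0 ≤ T) (hε : 0 < ε) :
    ∀ᶠ N : ℝ in atTop, ∀ (q : ℕ) (a : ℤ) (β : ℝ), q ∣ W → N * |β| ≤ T →
      ‖expSum vm N (a / q + β) - expSum (bmod W) N (a / q + β)‖ ≤ ε * N := by
  classical
  have hW : 0 < W := Nat.pos_of_ne_zero (NeZero.ne W)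
  have htot : 1 ≤ (W.totient : ℝ) := by exact_mod_cast Nat.totient_pos.mpr hW
  have hA : (W.totient : ℝ)⁻¹ ≤ 1 := inv_le_one_of_one_le₀ htot
  have hA0 : 0 ≤ (W.totient : ℝ)⁻¹ := by positivity
  set U : Finset (ZMod W) := Finset.univ.filter IsUnit with hU
  have hcard : (U.card : ℝ) = W.totient := by
    have : U.card = W.totient := by
      rw [← ZMod.card_units_eq_totient, ← Finset.card_univ, hU]
      refine (Finset.card_nbij' (fun u : (ZMod W)ˣ => (u : ZMod W))
        (fun r => if h : IsUnit r then h.unit else 1) ?_ ?_ ?_ ?_).symm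
      · intro u _; simp
      · intro u _; simp
      · intro u _; ext; simp
      · intro r hr
        simp only [Finset.coe_filter, Finset.mem_univ, true_and, Set.mem_ofPred_eq] at hr
        simp [hr]
    exact_mod_cast this
  have hUW : (U.card : ℝ) ≤ W := by rw [hcard]; exact_mod_cast Nat.totient_le W
  have hW1 : (1 : ℝ) ≤ W := by exact_mod_cast hW
  have hev : ∀ᶠ N : ℝ in atTop, ∀ r ∈ U, ∀ β : ℝ, N * |β| ≤ T →
      ‖∑ n ∈ Finset.Ioc 0 ⌊2 * N⌋₊, (((residueClass r n - (W.totient : ℝ)⁻¹ : ℝ)) : ℂ) * wt N n * expi (n * β)‖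
        ≤ ε / (3 * W) * N := by
    rw [eventually_all_finset]
    intro r hr
    exact norm_sum_residueClass_sub_le W r (Finset.mem_filter.mp hr).2 T _ hT (by positivity)
  obtain ⟨C, hC0, hC⟩ := exists_sum_vm_not_coprime_le W hW
  have hsq : ∀ᶠ N : ℝ in atTop, C * Real.sqrt (2 * N) ≤ ε / 3 * N := by
    filter_upwards [eventually_ge_atTop (2 * (3 * C / ε) ^ 2), eventually_ge_atTop 1] with N hN hN1
    have h1 : 3 * C / ε * Real.sqrt (2 * N) ≤ N := by
      refine (sq_le_sq₀ (by positivity) (by linarith)).mp ?_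
      rw [mul_pow, Real.sq_sqrt (by linarith)]
      nlinarith
    calc C * Real.sqrt (2 * N) = ε / 3 * (3 * C / ε * Real.sqrt (2 * N)) := by field_simp
      _ ≤ _ := by gcongr
  filter_upwards [hev, hsq, eventually_ge_atTop 1,
    eventually_ge_atTop (60 * W ^ 2 * (1 + T) / ε)] with N h1 h2 hN1 hN2 q a β hq hβ
  have hN0 : 0 < N := by linarith
  have hq0 : 0 < q := Nat.pos_of_dvd_of_pos hq hW
  have hE : ∀ n : ℕ, expi (n * (a / q : ℝ)) = expi (((n : ZMod W).val : ℕ) * (a / q : ℝ)) := by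
    intro n
    obtain ⟨k, hk⟩ := hq
    rw [ZMod.val_natCast]
    have hn : (n : ℝ) = ((n % W : ℕ) : ℝ) + W * ((n / W : ℕ) : ℝ) := by exact_mod_cast (Nat.mod_add_div n W).symm
    generalize n / W = m at hn
    have : (n : ℝ) * (a / q : ℝ) = ((n % W : ℕ) : ℝ) * (a / q : ℝ) + ((k * m * a : ℤ) : ℝ) := by
      have hq' : (q : ℝ) ≠ 0 := by positivity
      have hWk : (W : ℝ) = q * k := by exact_mod_cast hk
      rw [hn, hWk]
      push_cast
      field_simp
    rw [this, expi_add_int]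
  have hid : ∀ n : ℕ, ((vm n : ℂ) - bmod W n) * expi (n * (a / q : ℝ)) =
      (∑ r ∈ U, expi ((r.val : ℕ) * (a / q : ℝ)) * ((residueClass r n - (W.totient : ℝ)⁻¹ : ℝ) : ℂ)) +
      (∑ r ∈ U, expi ((r.val : ℕ) * (a / q : ℝ)) * ((W.totient : ℝ)⁻¹ : ℝ) *
        ((1 - if (n : ZMod W) = r then (W : ℝ) else 0 : ℝ) : ℂ)) +
      ((if n.Coprime W then 0 else vm n : ℝ) : ℂ) * expi (n * (a / q : ℝ)) := by
    intro n
    have hcomb : (∑ r ∈ U, expi ((r.val : ℕ) * (a / q : ℝ)) * ((residueClass r n - (W.totient : ℝ)⁻¹ : ℝ) : ℂ)) +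
      (∑ r ∈ U, expi ((r.val : ℕ) * (a / q : ℝ)) * ((W.totient : ℝ)⁻¹ : ℝ) *
        ((1 - if (n : ZMod W) = r then (W : ℝ) else 0 : ℝ) : ℂ)) =
        ∑ r ∈ U, if (n : ZMod W) = r then expi ((r.val : ℕ) * (a / q : ℝ)) *
          ((vm n - W / W.totient : ℝ) : ℂ) else 0 := by
      rw [← Finset.sum_add_distrib]
      refine Finset.sum_congr rfl fun r _ => ?_
      have hres : residueClass r n = if (n : ZMod W) = r then vm n else 0 := by
        rw [residueClass, Set.indicator_apply]
        rfl
      rw [hres]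
      split_ifs
      · push_cast; ring
      · push_cast; ring
    rw [hcomb, Finset.sum_ite_eq, hE n]
    have hmem : (n : ZMod W) ∈ U ↔ n.Coprime W := by
      simp only [hU, Finset.mem_filter, Finset.mem_univ, true_and]
      exact ZMod.isUnit_iff_coprime n W
    by_cases hcop : n.Coprime W
    · rw [if_pos (hmem.mpr hcop), if_pos hcop, bmod, if_pos hcop]
      push_cast; ring
    · rw [if_neg (fun h => hcop (hmem.mp h)), if_neg hcop, bmod, if_neg hcop]
      push_cast; ring
  have hmain : expSum vm N (a / q + β) - expSum (bmod W) N (a / q + β) =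
      (∑ r ∈ U, expi ((r.val : ℕ) * (a / q : ℝ)) * ∑ n ∈ Finset.Ioc 0 ⌊2 * N⌋₊,
        ((residueClass r n - (W.totient : ℝ)⁻¹ : ℝ) : ℂ) * wt N n * expi (n * β)) +
      (∑ r ∈ U, expi ((r.val : ℕ) * (a / q : ℝ)) * ((W.totient : ℝ)⁻¹ : ℝ) * ∑ n ∈ Finset.Ioc 0 ⌊2 * N⌋₊,
        ((1 - if (n : ZMod W) = r then (W : ℝ) else 0 : ℝ) : ℂ) * wt N n * expi (n * β)) +
      ∑ n ∈ Finset.Ioc 0 ⌊2 * N⌋₊, ((if n.Coprime W then 0 else vm n : ℝ) : ℂ) * expi (n * (a / q : ℝ)) *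
        wt N n * expi (n * β) := by
    simp only [expSum, Finset.mul_sum]
    rw [Finset.sum_comm (s := U), Finset.sum_comm (s := U), ← Finset.sum_add_distrib, ← Finset.sum_add_distrib,
      ← Finset.sum_sub_distrib]
    refine Finset.sum_congr rfl fun n _ => ?_
    rw [mul_add, expi_add]
    have := congrArg (fun z : ℂ => z * (wt N n * expi (n * β))) (hid n)
    simp only [add_mul, Finset.sum_mul] at this
    calc _ = ((vm n : ℂ) - bmod W n) * expi (n * (a / q : ℝ)) * (wt N n * expi (n * β)) := by ring
      _ = _ := by
        rw [this]
        congr 1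
        · congr 1
          · exact Finset.sum_congr rfl fun r _ => by ring
          · exact Finset.sum_congr rfl fun r _ => by ring
        · ring
  rw [hmain]
  refine (norm_add₃_le).trans ?_
  have b1 : ‖∑ r ∈ U, expi ((r.val : ℕ) * (a / q : ℝ)) * ∑ n ∈ Finset.Ioc 0 ⌊2 * N⌋₊,
        ((residueClass r n - (W.totient : ℝ)⁻¹ : ℝ) : ℂ) * wt N n * expi (n * β)‖ ≤ ε / 3 * N := by
    refine (norm_sum_le _ _).trans ?_
    calc _ ≤ ∑ r ∈ U, ε / (3 * W) * N := Finset.sum_le_sum fun r hr => by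
          rw [norm_mul, norm_expi, one_mul]
          exact h1 r hr β hβ
      _ = U.card * (ε / (3 * W) * N) := by rw [Finset.sum_const, nsmul_eq_mul]
      _ ≤ W * (ε / (3 * W) * N) := by gcongr
      _ = _ := by field_simp
  have b2 : ‖∑ r ∈ U, expi ((r.val : ℕ) * (a / q : ℝ)) * ((W.totient : ℝ)⁻¹ : ℝ) * ∑ n ∈ Finset.Ioc 0 ⌊2 * N⌋₊,
        ((1 - if (n : ZMod W) = r then (W : ℝ) else 0 : ℝ) : ℂ) * wt N n * expi (n * β)‖ ≤ ε / 3 * N := by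
    refine (norm_sum_le _ _).trans ?_
    calc _ ≤ ∑ r ∈ U, 20 * (W : ℝ) * (1 + T) := Finset.sum_le_sum fun r hr => by
          rw [norm_mul, norm_mul, norm_expi, one_mul, Complex.norm_real, Real.norm_of_nonneg hA0]
          refine (mul_le_of_le_one_left (norm_nonneg _) hA).trans ?_
          refine (norm_sum_wt_expi_le N hN1 _ W β (norm_sum_range_one_sub_le W r)).trans ?_
          gcongr
      _ = U.card * (20 * (W : ℝ) * (1 + T)) := by rw [Finset.sum_const, nsmul_eq_mul]
      _ ≤ W * (20 * (W : ℝ) * (1 + T)) := by gcongr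
      _ = ε / 3 * (60 * W ^ 2 * (1 + T) / ε) := by field_simp; ring
      _ ≤ _ := by gcongr
  have b3 : ‖∑ n ∈ Finset.Ioc 0 ⌊2 * N⌋₊, ((if n.Coprime W then 0 else vm n : ℝ) : ℂ) *
      expi (n * (a / q : ℝ)) * wt N n * expi (n * β)‖ ≤ ε / 3 * N := by
    refine (norm_sum_le _ _).trans (le_trans ?_ ((hC N hN1).trans h2))
    refine Finset.sum_le_sum fun n _ => ?_
    have hv := vm_nonneg n
    have hif : 0 ≤ (if n.Coprime W then 0 else vm n) := by split_ifs <;> simp [hv]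
    rw [norm_mul, norm_mul, norm_mul, norm_expi, norm_expi, mul_one, mul_one, Complex.norm_real, Complex.norm_real,
      Real.norm_of_nonneg hif, Real.norm_of_nonneg (wt_nonneg N n)]
    exact mul_le_of_le_one_right hif (wt_le_one N n)
  linarith

theorem bmod_nonneg (W n : ℕ) : 0 ≤ bmod W n := by unfold bmod; split_ifs <;> positivity

theorem bmod_le (W n : ℕ) [NeZero W] : bmod W n ≤ W := by
  have h : (1 : ℝ) ≤ W.totient := by
    exact_mod_cast Nat.totient_pos.mpr (Nat.pos_of_ne_zero (NeZero.ne W))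
  unfold bmod
  split_ifs
  · exact div_le_self (by positivity) h
  · positivity

theorem bmod_add_self (W n : ℕ) : bmod W (n + W) = bmod W n := by
  unfold bmod
  simp

theorem norm_sum_range_periodic_mul_expi_le (W : ℕ) (f : ℕ → ℝ) (B : ℝ) (hf : ∀ n, f (n + W) = f n)
    (hB : ∀ n, |f n| ≤ B) (α δ : ℝ) (hδ : 0 < δ) (hα : ∀ k : ℤ, δ ≤ |W * α - k|) (x : ℕ) :
    ‖∑ n ∈ Finset.range x, (f n : ℂ) * expi (n * α)‖ ≤ W * B / (2 * δ) := by
  set F : ℕ → ℂ := fun n => (f n : ℂ) * expi (n * α) with hF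
  have hFn : ∀ n, ‖F n‖ ≤ B := fun n => by
    rw [hF]
    beta_reduce
    rw [norm_mul, norm_expi, mul_one, Complex.norm_real]
    exact hB n
  have hshift : ∀ n, F (n + W) = expi (W * α) * F n := by
    intro n
    simp only [hF]
    rw [hf, Nat.cast_add, add_mul, expi_add]
    ring
  have h1 : (expi (W * α) - 1) * ∑ n ∈ Finset.range x, F n =
      (∑ n ∈ Finset.range W, F (x + n)) - ∑ n ∈ Finset.range W, F n := by
    have e1 : ∑ n ∈ Finset.range x, F (W + n) = expi (W * α) * ∑ n ∈ Finset.range x, F n := by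
      rw [Finset.mul_sum]
      exact Finset.sum_congr rfl fun n _ => by rw [add_comm, hshift]
    have e2 := Finset.sum_range_add F W x
    have e3 := Finset.sum_range_add F x W
    rw [add_comm x W] at e3
    rw [sub_mul, ← e1, one_mul]
    linear_combination e3 - e2
  have h2 : ‖(expi (W * α) - 1) * ∑ n ∈ Finset.range x, F n‖ ≤ 2 * (W * B) := by
    rw [h1]
    have hb : ∀ g : ℕ → ℕ, ‖∑ n ∈ Finset.range W, F (g n)‖ ≤ W * B := fun g => by
      refine (norm_sum_le _ _).trans ((Finset.sum_le_sum fun n _ => hFn (g n)).trans_eq ?_)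
      simp
    linarith [norm_sub_le (∑ n ∈ Finset.range W, F (x + n)) (∑ n ∈ Finset.range W, F n),
      hb (fun n => x + n), hb (fun n => n)]
  have h3 : 4 * δ ≤ ‖expi (W * α) - 1‖ := by
    set k := round (W * α)
    have e : expi (W * α) = expi (W * α - k) := by
      have := expi_add_int (W * α - k) k
      rwa [sub_add_cancel] at this
    rw [e]
    have := le_norm_expi_sub_one (abs_sub_round (W * α))
    linarith [hα k]
  rw [norm_mul] at h2
  rw [le_div_iff₀ (by positivity)]
  nlinarith [norm_nonneg (∑ n ∈ Finset.range x, F n)]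

theorem exists_norm_expSum_bmod_le (W : ℕ) [NeZero W] (η : ℝ) (hη : 0 < η) :
    ∃ T₀ : ℝ, ∀ T ≥ T₀, ∀ N : ℝ, 1 ≤ N → ∀ α : ℝ, (∀ k : ℤ, T / N ≤ |α - k / W|) →
      ‖expSum (bmod W) N α‖ ≤ η * N := by
  have hW : (0 : ℝ) < W := by exact_mod_cast Nat.pos_of_ne_zero (NeZero.ne W)
  refine ⟨10 * W / η + 1, fun T hT N hN α hα => ?_⟩
  have hT0 : 0 < T := lt_of_lt_of_le (by positivity) hT
  have hN0 : 0 < N := by linarith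
  have hδ : 0 < W * T / N := by positivity
  have h1 := norm_sum_range_periodic_mul_expi_le W (fun n => bmod W n) W (bmod_add_self W)
    (fun n => by rw [abs_of_nonneg (bmod_nonneg W n)]; exact bmod_le W n) α _ hδ (fun k => by
      have h := mul_le_mul_of_nonneg_left (hα k) hW.le
      rw [← abs_of_pos hW, ← abs_mul, abs_of_pos hW, mul_sub, mul_div_cancel₀ _ hW.ne'] at h
      rwa [mul_div_assoc])
  have h2 := norm_sum_wt_expi_le N hN (fun n => (bmod W n : ℂ) * expi (n * α)) _ 0 h1
  rw [abs_zero, mul_zero, add_zero, mul_one] at h2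
  have h3 : expSum (bmod W) N α = ∑ n ∈ Finset.Ioc 0 ⌊2 * N⌋₊,
      (bmod W n : ℂ) * expi (n * α) * wt N n * expi (n * 0) := by
    refine Finset.sum_congr rfl fun n _ => ?_
    rw [mul_zero, expi_zero]
    ring
  rw [h3]
  refine h2.trans ?_
  have h4 : 10 * W ≤ η * T := by
    have : 10 * W / η ≤ T := by linarith
    rwa [div_le_iff₀ hη, mul_comm T] at this
  calc 20 * ((W : ℝ) * W / (2 * (W * T / N))) = 10 * W / T * N := by field_simp; ring
    _ ≤ η * N := by
        gcongr
        rwa [div_le_iff₀ hT0]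

/-- `n` and `m - n` are both coprime to all primes up to `k`. -/
def Unsieved (k m n : ℕ) : Prop := ∀ p : ℕ, p.Prime → p ≤ k → ¬ p ∣ n ∧ ¬ n ≡ m [MOD p]

open scoped Classical in
/-- The number of residues modulo the primorial of `k` that are `Unsieved`. -/
noncomputable def unsievedCount (k m : ℕ) : ℕ := Nat.count (Unsieved k m) (primorial k)

/-- The product of `p - 1` over the primes `p ≤ k`. -/
def primeSubOneProd (k : ℕ) : ℕ := ∏ p ∈ Finset.range (k + 1) with p.Prime, (p - 1)

theorem primorial_succ_prime {k : ℕ} (h : (k + 1).Prime) : primorial (k + 1) = primorial k * (k + 1) := by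
  rw [primorial, primorial, Finset.range_add_one (n := k + 1), Finset.filter_insert, if_pos h,
    Finset.prod_insert (by simp), mul_comm]

theorem primorial_succ_not_prime {k : ℕ} (h : ¬ (k + 1).Prime) : primorial (k + 1) = primorial k := by
  rw [primorial, primorial, Finset.range_add_one (n := k + 1), Finset.filter_insert, if_neg h]

theorem primeSubOneProd_succ_prime {k : ℕ} (h : (k + 1).Prime) :
    primeSubOneProd (k + 1) = primeSubOneProd k * k := by
  rw [primeSubOneProd, primeSubOneProd, Finset.range_add_one (n := k + 1), Finset.filter_insert, if_pos h,
    Finset.prod_insert (by simp), mul_comm, Nat.add_sub_cancel]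

theorem primeSubOneProd_succ_not_prime {k : ℕ} (h : ¬ (k + 1).Prime) :
    primeSubOneProd (k + 1) = primeSubOneProd k := by
  rw [primeSubOneProd, primeSubOneProd, Finset.range_add_one (n := k + 1), Finset.filter_insert, if_neg h]

theorem primeSubOneProd_pos (k : ℕ) : 0 < primeSubOneProd k := by
  refine Finset.prod_pos fun p hp => ?_
  have := (Finset.mem_filter.mp hp).2.two_le
  omega

theorem unsieved_succ_not_prime {k : ℕ} (h : ¬ (k + 1).Prime) (m : ℕ) : Unsieved (k + 1) m = Unsieved k m := by
  funext n
  refine propext ⟨fun H p hp hpk => H p hp (by omega), fun H p hp hpk => H p hp ?_⟩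
  rcases Nat.lt_or_ge p (k + 1) with h1 | h1
  · omega
  · exact absurd (le_antisymm hpk h1 ▸ hp) h

theorem unsieved_periodic (k m P : ℕ) (hP : primorial k ∣ P) : Function.Periodic (Unsieved k m) P := by
  intro n
  have key : ∀ p : ℕ, p.Prime → p ≤ k → ((n + P) ≡ n [MOD p]) := fun p hp hpk => by
    have h1 : p ∣ P := (hp.dvd_primorial_iff.mpr hpk).trans hP
    exact (Nat.modEq_zero_iff_dvd.mpr h1).add_left n
  refine propext (forall_congr' fun p => forall_congr' fun hp => forall_congr' fun hpk => ?_)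
  have h1 := key p hp hpk
  refine and_congr (not_congr ?_) (not_congr ⟨fun h => h1.symm.trans h, fun h => h1.trans h⟩)
  exact h1.dvd_iff dvd_rfl

theorem card_filter_modEq_le_one {p P n c : ℕ} (hp : p.Prime) (hP : p.Coprime P) :
    ((Finset.range p).filter fun j => n + P * j ≡ c [MOD p]).card ≤ 1 := by
  rw [Finset.card_le_one]
  intro i hi j hj
  simp only [Finset.mem_filter, Finset.mem_range] at hi hj
  have h1 : P * i ≡ P * j [MOD p] := Nat.ModEq.add_left_cancel' n (hi.2.trans hj.2.symm)
  have h2 : i ≡ j [MOD p] := Nat.ModEq.cancel_left_of_coprime hP h1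
  exact Nat.ModEq.eq_of_lt_of_lt h2 hi.1 hj.1

theorem unsievedCount_mul_le {k : ℕ} (h : (k + 1).Prime) (m : ℕ) :
    unsievedCount k m * (k + 1 - 2) ≤ unsievedCount (k + 1) m := by
  classical
  set P := primorial k with hP
  have hP0 : 0 < P := primorial_pos k
  have hcop : (k + 1).Coprime P := by
    rw [Nat.Prime.coprime_iff_not_dvd h, hP, h.dvd_primorial_iff]
    omega
  set A := (Finset.range P).filter (Unsieved k m) with hA
  set J : ℕ → Finset ℕ := fun n => (Finset.range (k + 1)).filter fun j =>
    ¬ (k + 1) ∣ (n + P * j) ∧ ¬ (n + P * j ≡ m [MOD (k + 1)]) with hJ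
  have hJc : ∀ n, k + 1 - 2 ≤ (J n).card := by
    intro n
    have h1 := card_filter_modEq_le_one (n := n) (c := 0) h hcop
    have h2 := card_filter_modEq_le_one (n := n) (c := m) h hcop
    have hsub : Finset.range (k + 1) ⊆ J n ∪ (((Finset.range (k + 1)).filter fun j => n + P * j ≡ 0 [MOD (k + 1)]) ∪
        ((Finset.range (k + 1)).filter fun j => n + P * j ≡ m [MOD (k + 1)])) := by
      intro j hj
      simp only [hJ, Finset.mem_union, Finset.mem_filter, hj, true_and, Nat.modEq_zero_iff_dvd]
      tauto
    have h3 := (Finset.card_le_card hsub).trans (Finset.card_union_le _ _)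
    have h4 := Finset.card_union_le ((Finset.range (k + 1)).filter fun j => n + P * j ≡ 0 [MOD (k + 1)])
        ((Finset.range (k + 1)).filter fun j => n + P * j ≡ m [MOD (k + 1)])
    rw [Finset.card_range] at h3
    omega
  have hcount : unsievedCount (k + 1) m = ((Finset.range (P * (k + 1))).filter (Unsieved (k + 1) m)).card := by
    rw [unsievedCount, Nat.count_eq_card_filter_range, primorial_succ_prime h]
  have hcount' : unsievedCount k m = A.card := by
    rw [unsievedCount, Nat.count_eq_card_filter_range]
  rw [hcount, hcount']
  calc A.card * (k + 1 - 2) = ∑ n ∈ A, (k + 1 - 2) := by rw [Finset.sum_const, smul_eq_mul]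
    _ ≤ ∑ n ∈ A, (J n).card := Finset.sum_le_sum fun n _ => hJc n
    _ = (A.sigma J).card := (Finset.card_sigma _ _).symm
    _ ≤ _ := by
      refine Finset.card_le_card_of_injOn (fun z => z.1 + P * z.2) ?_ ?_
      · rintro ⟨n, j⟩ hz
        simp only [Finset.coe_sigma, Set.mem_sigma_iff, Finset.mem_coe, hA, hJ, Finset.mem_filter,
          Finset.mem_range] at hz
        obtain ⟨⟨hn, hu⟩, hj, hj1, hj2⟩ := hz
        simp only [Finset.mem_coe, Finset.mem_filter, Finset.mem_range]
        refine ⟨?_, fun p hp hpk => ?_⟩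
        · calc n + P * j < P + P * j := by omega
            _ = P * (j + 1) := by ring
            _ ≤ P * (k + 1) := Nat.mul_le_mul_left _ (by omega)
        · rcases Nat.lt_or_ge p (k + 1) with h1 | h1
          · have hper := unsieved_periodic k m (P * j) (Dvd.intro _ rfl) n
            exact (cast hper.symm hu) p hp (by omega)
          · obtain rfl := le_antisymm hpk h1
            exact ⟨hj1, hj2⟩
      · rintro ⟨n, j⟩ hz ⟨n', j'⟩ hz' heq
        simp only [Finset.coe_sigma, Set.mem_sigma_iff, Finset.mem_coe, hA, Finset.mem_filter,
          Finset.mem_range] at hz hz'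
        beta_reduce at heq
        have e1 : n = n' := by
          have := congrArg (· % P) heq
          simpa [Nat.mod_eq_of_lt hz.1.1, Nat.mod_eq_of_lt hz'.1.1] using this
        subst e1
        have e2 : j = j' := Nat.eq_of_mul_eq_mul_left hP0 (by simpa using heq)
        subst e2
        rfl

theorem unsievedCount_lower (m : ℕ) (hm : Even m) (k : ℕ) (hk : 2 ≤ k) :
    k * primeSubOneProd k ^ 2 ≤ unsievedCount k m * primorial k * (k - 1) := by
  classical
  induction k, hk using Nat.le_induction with
  | base =>
    have h1 : unsievedCount 2 m = 1 := by
      have hp : primorial 2 = 2 := by decide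
      have h0 : ¬ Unsieved 2 m 0 := fun h => (h 2 Nat.prime_two le_rfl).1 (dvd_zero _)
      have h1 : Unsieved 2 m 1 := by
        intro p hp hp2
        obtain rfl := le_antisymm hp2 hp.two_le
        refine ⟨by norm_num, fun h => ?_⟩
        rw [Nat.ModEq, Nat.even_iff.mp hm] at h
        norm_num at h
      rw [unsievedCount, hp, Nat.count_succ, Nat.count_succ, Nat.count_zero, if_neg h0, if_pos h1]
    have h2 : primeSubOneProd 2 = 1 := by decide
    have h3 : primorial 2 = 2 := by decide
    rw [h1, h2, h3]
    norm_num
  | succ k hk ih =>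
    obtain ⟨j, rfl⟩ : ∃ j, k = j + 2 := ⟨k - 2, by omega⟩
    by_cases hp : (j + 2 + 1).Prime
    · have h1 := unsievedCount_mul_le hp m
      rw [primorial_succ_prime hp, primeSubOneProd_succ_prime hp]
      simp only [show j + 2 + 1 - 2 = j + 1 by omega, show j + 2 - 1 = j + 1 by omega,
        show j + 2 + 1 - 1 = j + 2 by omega] at *
      set F := primeSubOneProd (j + 2)
      set A := unsievedCount (j + 2) m
      set P := primorial (j + 2)
      calc (j + 2 + 1) * (F * (j + 2)) ^ 2 = (j + 2) * F ^ 2 * ((j + 3) * (j + 2)) := by ring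
        _ ≤ A * P * (j + 1) * ((j + 3) * (j + 2)) := Nat.mul_le_mul_right _ ih
        _ = A * (j + 1) * (P * (j + 3) * (j + 2)) := by ring
        _ ≤ unsievedCount (j + 2 + 1) m * (P * (j + 3) * (j + 2)) := Nat.mul_le_mul_right _ h1
        _ = _ := by ring
    · rw [primorial_succ_not_prime hp, primeSubOneProd_succ_not_prime hp]
      have h1 : unsievedCount (j + 2 + 1) m = unsievedCount (j + 2) m := by
        rw [unsievedCount, unsievedCount, primorial_succ_not_prime hp]
        congr 1
        exact unsieved_succ_not_prime hp m
      rw [h1]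
      simp only [show j + 2 - 1 = j + 1 by omega, show j + 2 + 1 - 1 = j + 2 by omega] at *
      set F := primeSubOneProd (j + 2)
      set A := unsievedCount (j + 2) m
      set P := primorial (j + 2)
      have h2 : (j + 2) * ((j + 2 + 1) * F ^ 2) ≤ (j + 2) * (A * P * (j + 2)) := by
        calc (j + 2) * ((j + 2 + 1) * F ^ 2) = (j + 3) * ((j + 2) * F ^ 2) := by ring
          _ ≤ (j + 3) * (A * P * (j + 1)) := Nat.mul_le_mul_left _ ih
          _ = A * P * ((j + 3) * (j + 1)) := by ring
          _ ≤ A * P * ((j + 2) * (j + 2)) := Nat.mul_le_mul_left _ (by ring_nf; omega)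
          _ = _ := by ring
      exact Nat.le_of_mul_le_mul_left h2 (by omega)

/-- The additive convolution square of `n ↦ f n * wt N n`. -/
noncomputable def wconv (f : ℕ → ℝ) (N : ℝ) (m : ℕ) : ℝ :=
  ∑ z ∈ Finset.HasAntidiagonal.antidiagonal m, f z.1 * wt N z.1 * (f z.2 * wt N z.2)

theorem primeFactors_factorial (k : ℕ) :
    k.factorial.primeFactors = (Finset.range (k + 1)).filter Nat.Prime := by
  ext p
  simp only [Nat.mem_primeFactors, Finset.mem_filter, Finset.mem_range]
  constructor
  · rintro ⟨hp, hd, _⟩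
    exact ⟨by have := hp.dvd_factorial.mp hd; omega, hp⟩
  · rintro ⟨hk, hp⟩
    exact ⟨hp, hp.dvd_factorial.mpr (by omega), Nat.factorial_ne_zero k⟩

theorem factorial_div_totient (k : ℕ) :
    (k.factorial : ℝ) / k.factorial.totient = primorial k / primeSubOneProd k := by
  have h := Nat.totient_mul_prod_primeFactors k.factorial
  rw [primeFactors_factorial] at h
  have h1 : (0 : ℝ) < k.factorial.totient := by
    exact_mod_cast Nat.totient_pos.mpr (Nat.factorial_pos k)
  have h2 : (0 : ℝ) < primeSubOneProd k := by exact_mod_cast primeSubOneProd_pos k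
  rw [div_eq_div_iff h1.ne' h2.ne']
  have h3 : k.factorial.totient * primorial k = k.factorial * primeSubOneProd k := h
  rw [mul_comm (primorial k : ℝ)]
  exact_mod_cast h3.symm

theorem count_unsieved_mul (k m j : ℕ) [DecidablePred (Unsieved k m)] :
    Nat.count (Unsieved k m) (primorial k * j) = j * Nat.count (Unsieved k m) (primorial k) := by
  induction j with
  | zero => simp
  | succ j ih =>
    have h : (fun n => Unsieved k m (primorial k * j + n)) = Unsieved k m := by
      funext n
      rw [add_comm]
      exact unsieved_periodic k m _ (Dvd.intro _ rfl) n
    rw [mul_add, mul_one, Nat.count_add, ih]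
    simp only [h]
    rw [add_mul, one_mul]

theorem Unsieved.coprime_factorial {k m n : ℕ} (h : Unsieved k m n) : n.Coprime k.factorial :=
  Nat.Coprime.symm (Nat.coprime_of_dvd fun p hp hd hn => (h p hp (hp.dvd_factorial.mp hd)).1 hn)

theorem Unsieved.coprime_sub_factorial {k m n : ℕ} (h : Unsieved k m n) (hn : n ≤ m) :
    (m - n).Coprime k.factorial :=
  Nat.Coprime.symm (Nat.coprime_of_dvd fun p hp hd hn' =>
    (h p hp (hp.dvd_factorial.mp hd)).2 ((Nat.modEq_iff_dvd' hn).mpr hn'))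

theorem exists_wt_lower (δ : ℝ) (hδ : 0 < δ) : ∃ c : ℝ, 0 < c ∧ ∀ N n : ℝ, 0 < N →
    (1 + δ) * N ≤ n → n ≤ 7 / 4 * N → c ≤ wt N n := by
  have h1 : 0 < Real.log (1 + δ) := Real.log_pos (by linarith)
  have h2 : 0 < Real.log 2 - Real.log (7 / 4) := sub_pos.mpr (Real.log_lt_log (by norm_num) (by norm_num))
  refine ⟨min (Real.log (1 + δ)) (Real.log 2 - Real.log (7 / 4)), lt_min h1 h2, fun N n hN ha hb => ?_⟩
  have h3 : Real.log (1 + δ) ≤ Real.log (n / N) :=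
    Real.log_le_log (by linarith) (by rwa [le_div_iff₀ hN])
  have h4 : Real.log (n / N) ≤ Real.log (7 / 4) := by
    refine Real.log_le_log ?_ (by rwa [div_le_iff₀ hN])
    exact div_pos (lt_of_lt_of_le (by positivity) ha) hN
  refine le_trans ?_ (le_max_right _ _)
  unfold hlog
  have h5 := min_le_left (Real.log (1 + δ)) (Real.log 2 - Real.log (7 / 4))
  have h6 := min_le_right (Real.log (1 + δ)) (Real.log 2 - Real.log (7 / 4))
  rcases abs_cases (Real.log (n / N) - Real.log 2 / 2) with h | h <;> linarith [h.1]

theorem exists_wconv_bmod_lower (δ : ℝ) (hδ : 0 < δ) (hδ1 : δ ≤ 1) : ∃ c : ℝ, 0 < c ∧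
    ∀ k : ℕ, 2 ≤ k → ∀ᶠ N : ℝ in atTop, ∀ m : ℕ, Even m → (2 + δ) * N ≤ m → (m : ℝ) ≤ 3 * N →
      c * N ≤ wconv (bmod k.factorial) N m := by
  classical
  obtain ⟨c, hc, hwt⟩ := exists_wt_lower (δ / 4) (by positivity)
  refine ⟨δ / 8 * c ^ 2, by positivity, fun k hk => ?_⟩
  set P := primorial k with hP
  have hP0 : (0 : ℝ) < P := by exact_mod_cast primorial_pos k
  filter_upwards [eventually_ge_atTop (8 * P / δ), eventually_ge_atTop (4 / δ), eventually_ge_atTop 1]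
    with N hN1 hN2 hN3 m hm hm1 hm2
  rw [div_le_iff₀ hδ] at hN1 hN2
  set a := ⌈(m : ℝ) / 2 - δ * N / 4⌉₊ with ha
  set J := ⌊δ * N / (4 * P)⌋₊ with hJ
  have hδN : δ * N ≤ 1 * N := by gcongr
  have ha0 : (m : ℝ) / 2 - δ * N / 4 ≤ a := Nat.le_ceil _
  have ha1 : (a : ℝ) < (m : ℝ) / 2 - δ * N / 4 + 1 := Nat.ceil_lt_add_one (by linarith)
  have hJ0 : (J : ℝ) ≤ δ * N / (4 * P) := Nat.floor_le (by positivity)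
  have hJ1 : δ * N / (4 * P) < J + 1 := Nat.lt_floor_add_one _
  have hPJ0 : (P : ℝ) * J ≤ δ * N / 4 := by
    rw [le_div_iff₀ (by positivity)] at hJ0; linarith
  have hPJ1 : δ * N / 8 ≤ P * J := by
    rw [div_lt_iff₀ (by positivity)] at hJ1; nlinarith
  set I := (Finset.Ico a (a + P * J)).filter (Unsieved k m) with hI
  have hIcard : I.card = J * unsievedCount k m := by
    rw [hI, Nat.filter_Ico_card_eq_of_periodic _ _ _ (unsieved_periodic k m _ (Dvd.intro _ rfl)),
      count_unsieved_mul]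
    rfl
  have hmem : ∀ n ∈ I, n ≤ m ∧ c ≤ wt N n ∧ c ≤ wt N (m - n : ℕ) ∧ Unsieved k m n := by
    intro n hn
    rw [hI, Finset.mem_filter, Finset.mem_Ico] at hn
    obtain ⟨⟨h1, h2⟩, h3⟩ := hn
    have h1' : (a : ℝ) ≤ n := by exact_mod_cast h1
    have h2' : (n : ℝ) < a + P * J := by exact_mod_cast h2
    have hnm : n ≤ m := by
      have : (n : ℝ) ≤ m := by linarith
      exact_mod_cast this
    refine ⟨hnm, hwt N n (by linarith) (by linarith) (by linarith), ?_, h3⟩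
    rw [Nat.cast_sub hnm]
    exact hwt N _ (by linarith) (by linarith) (by linarith)
  set R : ℝ := (P : ℝ) / primeSubOneProd k with hR
  have hR0 : 0 ≤ R := by positivity
  have hterm : ∀ n ∈ I, R ^ 2 * c ^ 2 ≤ bmod k.factorial n * wt N n *
      (bmod k.factorial (m - n) * wt N (m - n : ℕ)) := by
    intro n hn
    obtain ⟨h1, h2, h3, h4⟩ := hmem n hn
    rw [bmod, bmod, if_pos h4.coprime_factorial, if_pos (h4.coprime_sub_factorial h1), factorial_div_totient]
    calc R ^ 2 * c ^ 2 = R * c * (R * c) := by ring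
      _ ≤ R * wt N n * (R * wt N (m - n : ℕ)) := by
        have := wt_nonneg N n
        gcongr
  have hsub : I ⊆ Finset.range (m + 1) := fun n hn =>
    Finset.mem_range.mpr (Nat.lt_succ_of_le (hmem n hn).1)
  have hlow : (I.card : ℝ) * (R ^ 2 * c ^ 2) ≤ wconv (bmod k.factorial) N m := by
    rw [wconv, Finset.Nat.sum_antidiagonal_eq_sum_range_succ_mk, ← nsmul_eq_mul, ← Finset.sum_const]
    refine (Finset.sum_le_sum hterm).trans (Finset.sum_le_sum_of_subset_of_nonneg hsub fun n _ _ => ?_)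
    exact mul_nonneg (mul_nonneg (bmod_nonneg _ _) (wt_nonneg _ _)) (mul_nonneg (bmod_nonneg _ _) (wt_nonneg _ _))
  refine le_trans ?_ hlow
  have hF : (0 : ℝ) < primeSubOneProd k := by exact_mod_cast primeSubOneProd_pos k
  have hkey : (P : ℝ) ≤ unsievedCount k m * R ^ 2 := by
    have h1 := unsievedCount_lower m hm k hk
    have h2 : k * primeSubOneProd k ^ 2 ≤ k * (unsievedCount k m * P) := by
      calc _ ≤ _ := h1
        _ ≤ unsievedCount k m * P * k := Nat.mul_le_mul_left _ (Nat.sub_le _ _)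
        _ = _ := mul_comm _ _
    have h3 : ((primeSubOneProd k : ℝ)) ^ 2 ≤ unsievedCount k m * P := by
      exact_mod_cast Nat.le_of_mul_le_mul_left h2 (by omega)
    rw [hR, div_pow, mul_div_assoc', le_div_iff₀ (by positivity)]
    nlinarith
  rw [hIcard, Nat.cast_mul]
  calc δ / 8 * c ^ 2 * N = δ * N / 8 * c ^ 2 := by ring
    _ ≤ P * J * c ^ 2 := by gcongr
    _ = J * P * c ^ 2 := by ring
    _ ≤ J * (unsievedCount k m * R ^ 2) * c ^ 2 := by gcongr
    _ = _ := by ring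

theorem exists_norm_expSum_vm_sub_lamP_le : ∃ C : ℝ, 0 ≤ C ∧ ∀ N : ℝ, 0 ≤ N → ∀ α : ℝ,
    ‖expSum vm N α - expSum lamP N α‖ ≤ C * √N := by
  obtain ⟨C, hC, h⟩ := exists_sum_vm_sub_lamP_le
  refine ⟨C * √2, by positivity, fun N hN α => ?_⟩
  have h1 := h (2 * N) (by positivity)
  rw [Real.sqrt_mul (by norm_num), ← mul_assoc] at h1
  refine le_trans ?_ h1
  rw [expSum, expSum, ← Finset.sum_sub_distrib]
  refine norm_sum_le_of_le _ fun n _ => ?_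
  have h2 : (vm n : ℂ) * wt N n * expi (n * α) - (lamP n : ℂ) * wt N n * expi (n * α) =
      (((vm n - lamP n) * wt N n : ℝ) : ℂ) * expi (n * α) := by push_cast; ring
  have h3 := sub_nonneg.mpr (lamP_le_vm n)
  rw [h2, norm_mul, norm_expi, mul_one, Complex.norm_real, Real.norm_of_nonneg (mul_nonneg h3 (wt_nonneg _ _))]
  exact mul_le_of_le_one_right h3 (wt_le_one _ _)

theorem eventually_sqrt_le_mul_log_rpow : ∀ᶠ N : ℝ in atTop, 1 ≤ Real.log N ∧
    √N ≤ N * Real.log N ^ (-(4 / 5) : ℝ) := by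
  have h := (isLittleO_log_rpow_atTop (show (0 : ℝ) < 1 / 2 by norm_num)).bound (show (0 : ℝ) < 1 by norm_num)
  filter_upwards [h, Real.tendsto_log_atTop.eventually (eventually_ge_atTop 1), eventually_gt_atTop 0] with N h1 h2 h3
  refine ⟨h2, ?_⟩
  rw [one_mul, Real.norm_of_nonneg (by linarith), Real.norm_of_nonneg (by positivity), ← Real.sqrt_eq_rpow] at h1
  have h4 : Real.log N ^ (4 / 5 : ℝ) ≤ √N := by
    refine le_trans ?_ h1
    calc _ ≤ Real.log N ^ (1 : ℝ) := Real.rpow_le_rpow_of_exponent_le h2 (by norm_num)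
      _ = _ := Real.rpow_one _
  rw [Real.rpow_neg (by linarith), ← div_eq_mul_inv, le_div_iff₀ (by positivity)]
  calc √N * Real.log N ^ (4 / 5 : ℝ) ≤ √N * √N := by gcongr
    _ = N := Real.mul_self_sqrt h3.le

theorem exists_norm_expSum_lamP_medium_le : ∃ C : ℝ, 0 ≤ C ∧ ∀ᶠ N : ℝ in atTop,
    ∀ (a : ℤ) (q : ℕ) (β τ : ℝ), 1 ≤ q → IsCoprime a q → τ = max (q : ℝ) (N * |β|) →
      τ ≤ Real.log N ^ 16 → ‖expSum lamP N (a / q + β)‖ ≤ C * N * τ ^ (-(1 / 20) : ℝ) := by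
  obtain ⟨C1, hC1, h1⟩ := exists_norm_expSum_vm_sub_lamP_le
  obtain ⟨C2, hC2, h2⟩ := exists_norm_expSum_vm_le
  refine ⟨C1 + C2, by positivity, ?_⟩
  filter_upwards [h2, eventually_sqrt_le_mul_log_rpow, eventually_ge_atTop 1] with N h2 ⟨h3, h4⟩ hN a q β τ hq haq hτ hτQ
  have h5 := h2 a q β τ hq haq hτ hτQ
  have h6 := h1 N (by linarith) (a / q + β)
  have hτ1 : 1 ≤ τ := by
    rw [hτ]; exact le_max_of_le_left (by exact_mod_cast hq)
  have h7 : Real.log N ^ (-(4 / 5) : ℝ) ≤ τ ^ (-(1 / 20) : ℝ) := by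
    calc Real.log N ^ (-(4 / 5) : ℝ) = (Real.log N ^ 16) ^ (-(1 / 20) : ℝ) := by
          rw [← Real.rpow_natCast, ← Real.rpow_mul (by linarith)]; norm_num
      _ ≤ _ := Real.rpow_le_rpow_of_nonpos (by linarith) hτQ (by norm_num)
  have h8 : √N ≤ N * τ ^ (-(1 / 20) : ℝ) := h4.trans (by gcongr)
  have h9 := norm_sub_norm_le (expSum lamP N (a / q + β)) (expSum vm N (a / q + β))
  rw [norm_sub_rev] at h9
  have h10 := mul_le_mul_of_nonneg_left h8 hC1
  linarith

theorem exists_norm_expSum_lamP_minor_le : ∃ C : ℝ, 0 ≤ C ∧ ∀ᶠ N : ℝ in atTop,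
    ∀ (a : ℤ) (q : ℕ) (β : ℝ), 1 ≤ q → IsCoprime a q → |β| ≤ 1 / (q : ℝ) ^ 2 →
      Real.log N ^ 16 ≤ q → q * Real.log N ^ 16 ≤ N →
      ‖expSum lamP N (a / q + β)‖ ≤ C * N * Real.log N ^ (-(4 / 5) : ℝ) := by
  obtain ⟨C1, hC1, h1⟩ := exists_norm_expSum_vm_sub_lamP_le
  obtain ⟨C2, hC2, h2⟩ := exists_norm_expSum_minor_le
  refine ⟨C1 + C2, by positivity, ?_⟩
  filter_upwards [h2, eventually_sqrt_le_mul_log_rpow, eventually_ge_atTop 1] with N h2 ⟨h3, h4⟩ hN a q β hq haq hβ hq1 hq2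
  have h5 := h2 a q β hq haq hβ hq1 hq2
  have h6 := h1 N (by linarith) (a / q + β)
  have h9 := norm_sub_norm_le (expSum lamP N (a / q + β)) (expSum vm N (a / q + β))
  rw [norm_sub_rev] at h9
  have h10 := mul_le_mul_of_nonneg_left h4 hC1
  linarith

theorem norm_expSum_lamP_sub_bmod_le (W : ℕ) [NeZero W] (T ε : ℝ) (hT : 0 ≤ T) (hε : 0 < ε) :
    ∀ᶠ N : ℝ in atTop, ∀ (q : ℕ) (a : ℤ) (β : ℝ), q ∣ W → N * |β| ≤ T →
      ‖expSum lamP N (a / q + β) - expSum (bmod W) N (a / q + β)‖ ≤ ε * N := by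
  obtain ⟨C1, hC1, h1⟩ := exists_norm_expSum_vm_sub_lamP_le
  have hlim : ∀ᶠ N : ℝ in atTop, 2 * C1 / ε ≤ √N := Real.tendsto_sqrt_atTop.eventually (eventually_ge_atTop _)
  filter_upwards [norm_expSum_vm_sub_bmod_le W T (ε / 2) hT (by positivity), hlim, eventually_ge_atTop 1]
    with N h2 h3 hN q a β hq hβ
  have h5 := h2 q a β hq hβ
  have h6 := h1 N (by linarith) (a / q + β)
  rw [norm_sub_rev] at h6
  rw [div_le_iff₀ hε] at h3
  have h4 : C1 * √N ≤ ε / 2 * N := by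
    have := mul_le_mul_of_nonneg_right h3 (Real.sqrt_nonneg N)
    rw [mul_right_comm (√N), Real.mul_self_sqrt (by linarith)] at this
    linarith
  have h7 := norm_sub_le_norm_sub_add_norm_sub (expSum lamP N (a / q + β)) (expSum vm N (a / q + β))
    (expSum (bmod W) N (a / q + β))
  linarith

theorem wt_natCast_eq_zero {N : ℝ} (hN : 0 < N) {n : ℕ} (hn : n ∉ Finset.Ioc 0 ⌊2 * N⌋₊) : wt N n = 0 := by
  rw [Finset.mem_Ioc, not_and_or, not_lt, not_le] at hn
  rcases hn with h | h
  · exact wt_eq_zero_of_le hN (by positivity) (by rw [Nat.le_zero.mp h]; simpa using hN.le)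
  · exact wt_eq_zero_of_ge hN (Nat.lt_of_floor_lt h).le

theorem expSum_sq (f : ℕ → ℝ) (N α : ℝ) (hN : 0 < N) : expSum f N α ^ 2 =
    trig (Finset.range (2 * ⌊2 * N⌋₊ + 1)) (fun m => (wconv f N m : ℂ)) α := by
  set M := ⌊2 * N⌋₊ with hM
  set s := Finset.Ioc 0 M with hs
  have h1 : expSum f N α ^ 2 = ∑ z ∈ s ×ˢ s,
      (f z.1 : ℂ) * wt N z.1 * (f z.2 * wt N z.2) * expi ((z.1 + z.2 : ℕ) * α) := by
    rw [sq, expSum, Finset.sum_mul_sum, ← Finset.sum_product']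
    refine Finset.sum_congr rfl fun z _ => ?_
    rw [Nat.cast_add, add_mul, expi_add]
    ring
  rw [h1, trig, ← Finset.sum_fiberwise_of_maps_to (t := Finset.range (2 * M + 1)) (g := fun z : ℕ × ℕ => z.1 + z.2)]
  · refine Finset.sum_congr rfl fun m _ => ?_
    rw [wconv, Complex.ofReal_sum, Finset.sum_mul]
    refine Finset.sum_subset_zero_on_sdiff ?_ ?_ ?_
    · intro z hz
      exact Finset.HasAntidiagonal.mem_antidiagonal.mpr (Finset.mem_filter.mp hz).2
    · intro z hz
      rw [Finset.mem_sdiff, Finset.HasAntidiagonal.mem_antidiagonal, Finset.mem_filter, Finset.mem_product] at hz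
      have hz2 : z.1 ∉ s ∨ z.2 ∉ s := by tauto
      rcases hz2 with h | h <;> rw [wt_natCast_eq_zero hN h] <;> simp
    · intro z hz
      rw [(Finset.mem_filter.mp hz).2]
      push_cast
      ring
  · intro z hz
    rw [hs, Finset.mem_product, Finset.mem_Ioc, Finset.mem_Ioc] at hz
    rw [Finset.mem_range]
    omega

theorem sum_norm_expSum_sq (f : ℕ → ℝ) (N : ℝ) :
    ∑ u ∈ Finset.range (2 * ⌊2 * N⌋₊ + 1), ‖expSum f N (u / (2 * ⌊2 * N⌋₊ + 1 : ℕ))‖ ^ 2 =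
      (2 * ⌊2 * N⌋₊ + 1 : ℕ) * ∑ n ∈ Finset.Ioc 0 ⌊2 * N⌋₊, (f n * wt N n) ^ 2 := by
  have h := sum_norm_trig_sq (2 * ⌊2 * N⌋₊ + 1) (by omega) 0 (Finset.Ioc 0 ⌊2 * N⌋₊)
    (fun n hn => by rw [Finset.mem_Ioc] at hn; rw [Finset.mem_Ico]; omega) (fun n => (f n : ℂ) * wt N n)
  refine h.trans ?_
  congr 1
  refine Finset.sum_congr rfl fun n _ => ?_
  rw [← Complex.ofReal_mul, Complex.norm_real, Real.norm_eq_abs, sq_abs]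

theorem sum_norm_expSum_sq_sub_sq (f g : ℕ → ℝ) (N : ℝ) (hN : 0 < N) :
    ∑ u ∈ Finset.range (2 * ⌊2 * N⌋₊ + 1), ‖expSum f N (u / (2 * ⌊2 * N⌋₊ + 1 : ℕ)) ^ 2 -
        expSum g N (u / (2 * ⌊2 * N⌋₊ + 1 : ℕ)) ^ 2‖ ^ 2 =
      (2 * ⌊2 * N⌋₊ + 1 : ℕ) * ∑ m ∈ Finset.range (2 * ⌊2 * N⌋₊ + 1), (wconv f N m - wconv g N m) ^ 2 := by
  have h := sum_norm_trig_sq (2 * ⌊2 * N⌋₊ + 1) (by omega) 0 (Finset.range (2 * ⌊2 * N⌋₊ + 1))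
    (by rw [Finset.range_eq_Ico, zero_add]) (fun m => (wconv f N m : ℂ) - wconv g N m)
  refine (Finset.sum_congr rfl fun u _ => ?_).trans (h.trans ?_)
  · rw [expSum_sq f N _ hN, expSum_sq g N _ hN, trig, trig, trig, ← Finset.sum_sub_distrib]
    simp_rw [sub_mul]
  · congr 1
    refine Finset.sum_congr rfl fun n _ => ?_
    rw [← Complex.ofReal_sub, Complex.norm_real, Real.norm_eq_abs, sq_abs]

theorem sum_lamP_mul_wt_sq_le (N : ℝ) (hN : 2 ≤ N) :
    ∑ n ∈ Finset.Ioc 0 ⌊2 * N⌋₊, (lamP n * wt N n) ^ 2 ≤ 24 * N * Real.log N := by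
  have hl : Real.log (2 * N) ≤ 2 * Real.log N := by
    rw [Real.log_mul (by norm_num) (by linarith)]
    have := Real.log_le_log (by norm_num) hN
    linarith
  have hl0 : 0 ≤ Real.log N := Real.log_nonneg (by linarith)
  have hterm : ∀ n ∈ Finset.Ioc 0 ⌊2 * N⌋₊, (lamP n * wt N n) ^ 2 ≤ 2 * Real.log N * vm n := by
    intro n hn
    rw [Finset.mem_Ioc] at hn
    have h1 : (n : ℝ) ≤ 2 * N := (Nat.le_floor_iff (by linarith)).mp hn.2
    have hn0 : (0 : ℝ) < n := by exact_mod_cast hn.1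
    have h2 : lamP n * wt N n ≤ lamP n := mul_le_of_le_one_right (lamP_nonneg n) (wt_le_one _ _)
    have h3 : lamP n ≤ 2 * Real.log N := (lamP_le_vm n).trans ((vm_le_log n).trans
      ((Real.log_le_log hn0 h1).trans hl))
    calc (lamP n * wt N n) ^ 2 = (lamP n * wt N n) * (lamP n * wt N n) := sq _
      _ ≤ (2 * Real.log N) * vm n := mul_le_mul (h2.trans h3) (h2.trans (lamP_le_vm n))
          (mul_nonneg (lamP_nonneg n) (wt_nonneg _ _)) (by positivity)
  refine (Finset.sum_le_sum hterm).trans ?_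
  rw [← Finset.mul_sum]
  have h4 := sum_vm_le (2 * N) (by linarith)
  have h5 : ∑ n ∈ Finset.Ioc 0 ⌊2 * N⌋₊, vm n ≤ 6 * (2 * N) := h4
  calc _ ≤ 2 * Real.log N * (6 * (2 * N)) := by gcongr
    _ = _ := by ring

theorem eventually_grid_size : ∀ᶠ N : ℝ in atTop, 2 ≤ N ∧ 8 * Real.log 2 ≤ Real.log N ∧
    88 * Real.log N ^ 48 ≤ N ^ (1 / 2 : ℝ) := by
  have h := (isLittleO_log_rpow_rpow_atTop (s := 1 / 2) 48 (by norm_num)).bound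
    (show (0 : ℝ) < 1 / 88 by norm_num)
  filter_upwards [h, eventually_ge_atTop 2, Real.tendsto_log_atTop.eventually (eventually_ge_atTop (8 * Real.log 2))]
    with N h1 h2 h3
  refine ⟨h2, h3, ?_⟩
  have h4 : 0 ≤ Real.log N := Real.log_nonneg (by linarith)
  rw [Real.norm_of_nonneg (by positivity), Real.norm_of_nonneg (by positivity)] at h1
  have h5 : Real.log N ^ (48 : ℝ) = Real.log N ^ 48 := by
    rw [← Real.rpow_natCast]; norm_num
  rw [h5] at h1
  linarith

theorem exists_sum_norm_expSum_sq_le : ∃ C : ℝ, 0 ≤ C ∧ ∀ᶠ N : ℝ in atTop,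
    ∀ (U : Finset ℕ) (c : ℕ → ℤ) (q : ℕ → ℕ) (β : ℕ → ℝ) (T : ℕ), 1 ≤ T →
      (T : ℝ) ≤ 2 * Real.log N ^ 16 → (∀ u ∈ U, u < 2 * ⌊2 * N⌋₊ + 1) →
      (∀ u ∈ U, 1 ≤ q u ∧ q u ≤ T ∧ N * |β u| ≤ T ∧
        (u / (2 * ⌊2 * N⌋₊ + 1 : ℕ) : ℝ) = c u / q u + β u) →
      ∑ u ∈ U, ‖expSum lamP N (u / (2 * ⌊2 * N⌋₊ + 1 : ℕ))‖ ^ 2 ≤ C * (T : ℝ) ^ (1 / 20 : ℝ) * N ^ 2 := by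
  obtain ⟨C1, hC1, hmert⟩ := exists_mertE_le (1 / 20) (by norm_num)
  refine ⟨960 * C1 * lsC, by have := lsC_pos; positivity, ?_⟩
  filter_upwards [eventually_grid_size] with N ⟨hN2, hN8, hN88⟩ U c q β T hT1 hT hUr hU
  have hN0 : 0 < N := by linarith
  have hl2 : 0 < Real.log 2 := Real.log_pos (by norm_num)
  have hl0 : 0 < Real.log N := by linarith
  set M := ⌊2 * N⌋₊ with hM
  set L := 2 * M + 1 with hL
  have hM0 : (M : ℝ) ≤ 2 * N := Nat.floor_le (by positivity)
  have hM1 : 2 * N < M + 1 := Nat.lt_floor_add_one _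
  have hLc : (L : ℝ) = 2 * M + 1 := by rw [hL]; push_cast; ring
  have hL0 : (0 : ℝ) < L := by rw [hLc]; positivity
  have hL5 : (L : ℝ) ≤ 5 * N := by linarith
  have hLN : N ≤ L := by linarith
  set Y := ⌊N ^ (1 / 4 : ℝ)⌋₊ with hY
  have hN4 : 1 ≤ N ^ (1 / 4 : ℝ) := Real.one_le_rpow (by linarith) (by norm_num)
  have hY0 : (Y : ℝ) ≤ N ^ (1 / 4 : ℝ) := Nat.floor_le (by positivity)
  have hY1 : N ^ (1 / 4 : ℝ) < Y + 1 := Nat.lt_floor_add_one _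
  have hYone : (1 : ℝ) ≤ Y := by exact_mod_cast (Nat.one_le_floor_iff _).mpr hN4
  have hYN : (Y : ℝ) ≤ N := hY0.trans (by
    calc N ^ (1 / 4 : ℝ) ≤ N ^ (1 : ℝ) := Real.rpow_le_rpow_of_exponent_le (by linarith) (by norm_num)
      _ = N := Real.rpow_one N)
  have hlogY : Real.log N / 8 ≤ Real.log Y := by
    have h1 : Real.log (N ^ (1 / 4 : ℝ)) ≤ Real.log (2 * Y) := Real.log_le_log (by positivity) (by linarith)
    rw [Real.log_rpow hN0, Real.log_mul (by norm_num) (by positivity)] at h1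
    linarith
  have hY2 : (Y : ℝ) ^ 2 ≤ N ^ (1 / 2 : ℝ) := by
    calc (Y : ℝ) ^ 2 ≤ (N ^ (1 / 4 : ℝ)) ^ 2 := by gcongr
      _ = N ^ (1 / 2 : ℝ) := by rw [← Real.rpow_natCast, ← Real.rpow_mul hN0.le]; norm_num
  have hTr : (1 : ℝ) ≤ T := by exact_mod_cast hT1
  set s := (Finset.Ioc 0 M).filter fun n => n.Prime ∧ Y < n with hs
  set a : ℕ → ℂ := fun n => (lamP n : ℂ) * wt N n with ha
  have htrig : ∀ α, expSum lamP N α = trig s a α := by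
    intro α
    rw [trig, hs, Finset.sum_filter, expSum]
    refine Finset.sum_congr rfl fun n hn => ?_
    split_ifs with h
    · rfl
    · rw [not_and_or] at h
      rcases h with h | h
      · rw [lamP, if_neg h]; simp
      · have h' : (n : ℝ) ≤ Y := by exact_mod_cast not_lt.mp h
        rw [wt_eq_zero_of_le hN0 (Nat.cast_nonneg n) (h'.trans hYN)]; simp
  have hls := prime_large_sieve U c q β L (by omega) 0 s (fun n hn => by
      have := Finset.mem_Ioc.mp (Finset.mem_filter.mp hn).1
      rw [Finset.mem_Ico]; omega) a T Y (5 * T) (by positivity) (fun u hu => ⟨(hU u hu).1, (hU u hu).2.1⟩)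
    (fun u hu => ?_) (fun u hu v hv huv k hk => ?_) (fun n hn => (Finset.mem_filter.mp hn).2) ?_
  · have hsum : ∑ u ∈ U, ‖trig s a (c u / q u + β u)‖ ^ 2 = ∑ u ∈ U, ‖expSum lamP N (u / L)‖ ^ 2 := by
      refine Finset.sum_congr rfl fun u hu => ?_
      rw [htrig, (hU u hu).2.2.2]
    have hsq : ∑ n ∈ s, ‖a n‖ ^ 2 ≤ 24 * N * Real.log N := by
      have hsub : s ⊆ Finset.Ioc 0 M := Finset.filter_subset _ _
      refine le_trans (le_trans (le_of_eq ?_) (Finset.sum_le_sum_of_subset_of_nonneg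
        hsub fun n _ _ => sq_nonneg (lamP n * wt N n))) (sum_lamP_mul_wt_sq_le N hN2)
      refine Finset.sum_congr rfl fun n _ => ?_
      rw [ha]; beta_reduce
      rw [← Complex.ofReal_mul, Complex.norm_real, Real.norm_eq_abs, sq_abs]
    rw [hsum] at hls
    set X := ∑ u ∈ U, ‖expSum lamP N (u / L)‖ ^ 2
    have hX : 0 ≤ X := Finset.sum_nonneg fun _ _ => sq_nonneg _
    have hlsb : Real.log N / 8 * X ≤ (C1 * (T : ℝ) ^ (1 / 20 : ℝ)) * (lsC * (5 * N) * (24 * N * Real.log N)) := by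
      calc Real.log N / 8 * X ≤ Real.log Y * X := by gcongr
        _ ≤ _ := hls
        _ ≤ _ := by
          have := lsC_pos
          have := hmert T hT1
          have h0 : 0 ≤ ∑ n ∈ s, ‖a n‖ ^ 2 := Finset.sum_nonneg fun _ _ => sq_nonneg _
          gcongr
    refine le_of_mul_le_mul_left (hlsb.trans (le_of_eq ?_)) (show 0 < Real.log N / 8 by positivity)
    ring
  · have h1 := (hU u hu).2.2.1
    rw [le_div_iff₀ hL0]
    calc |β u| * L ≤ |β u| * (5 * N) := by gcongr
      _ = 5 * (N * |β u|) := by ring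
      _ ≤ 5 * T := by gcongr
  · have h1 := (hU u hu).2.2.2
    have h2 := (hU v hv).2.2.2
    have hne : (u : ℤ) - v - k * L ≠ 0 := by
      intro h0
      have hu' := hUr u hu
      have hv' := hUr v hv
      rcases lt_trichotomy k 0 with hk0 | hk0 | hk0
      · have : k * L ≤ -L := by nlinarith
        omega
      · subst hk0; omega
      · have : (L : ℤ) ≤ k * L := by nlinarith
        omega
    have h3 : β u - β v = ((u : ℤ) - v - k * L : ℤ) / L := by
      have e1 : β u = u / L - c u / q u := by linarith
      have e2 : β v = v / L - c v / q v := by linarith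
      rw [e1, e2, show (u : ℝ) / L - c u / q u - (v / L - c v / q v) =
        u / L - v / L - (c u / q u - c v / q v) by ring, hk]
      push_cast
      field_simp
    rw [h3, abs_div, abs_of_pos hL0]
    gcongr
    rw [← Int.cast_abs]
    exact_mod_cast Int.one_le_abs hne
  · have hTl : (T : ℝ) ^ 3 ≤ 8 * Real.log N ^ 48 := by
      calc (T : ℝ) ^ 3 ≤ (2 * Real.log N ^ 16) ^ 3 := by gcongr
        _ = _ := by ring
    calc ((T : ℝ) * Y) ^ 2 * (2 * (5 * T) + 1) ≤ ((T : ℝ) * Y) ^ 2 * (11 * T) := by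
          gcongr; linarith
      _ = 11 * (T : ℝ) ^ 3 * (Y : ℝ) ^ 2 := by ring
      _ ≤ 11 * (8 * Real.log N ^ 48) * N ^ (1 / 2 : ℝ) := by gcongr
      _ = 88 * Real.log N ^ 48 * N ^ (1 / 2 : ℝ) := by ring
      _ ≤ N ^ (1 / 2 : ℝ) * N ^ (1 / 2 : ℝ) := by gcongr
      _ = N := by rw [← Real.rpow_add hN0]; norm_num
      _ ≤ L := hLN

theorem exists_sum_medium_pow_four_le (ε : ℝ) (hε : 0 < ε) : ∃ t₀ : ℕ, ∀ᶠ N : ℝ in atTop,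
    ∀ (U : Finset ℕ) (c : ℕ → ℤ) (q : ℕ → ℕ) (β : ℕ → ℝ), (∀ u ∈ U, u < 2 * ⌊2 * N⌋₊ + 1) →
      (∀ u ∈ U, 1 ≤ q u ∧ IsCoprime (c u) (q u) ∧
        (u / (2 * ⌊2 * N⌋₊ + 1 : ℕ) : ℝ) = c u / q u + β u ∧
        (2 : ℝ) ^ t₀ ≤ max (q u : ℝ) (N * |β u|) ∧ max (q u : ℝ) (N * |β u|) ≤ Real.log N ^ 16) →
      ∑ u ∈ U, ‖expSum lamP N (u / (2 * ⌊2 * N⌋₊ + 1 : ℕ))‖ ^ 4 ≤ ε * N ^ 4 := by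
  obtain ⟨C1, hC1, h1⟩ := exists_norm_expSum_lamP_medium_le
  obtain ⟨C2, hC2, h2⟩ := exists_sum_norm_expSum_sq_le
  set ρ : ℝ := (2 : ℝ) ^ (1 / 20 : ℝ) with hρ
  have hρ1 : 1 < ρ := Real.one_lt_rpow (by norm_num) (by norm_num)
  have hρ2 : ρ ≤ 2 := by
    calc ρ ≤ (2 : ℝ) ^ (1 : ℝ) := Real.rpow_le_rpow_of_exponent_le (by norm_num) (by norm_num)
      _ = 2 := Real.rpow_one _
  set r := ρ⁻¹ with hr
  have hr0 : 0 < r := by positivity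
  have hr1 : r < 1 := inv_lt_one_of_one_lt₀ hρ1
  have hrho : ∀ t : ℕ, ((2 : ℝ) ^ t) ^ (1 / 20 : ℝ) = ρ ^ t := fun t => by
    rw [hρ, ← Real.rpow_natCast, ← Real.rpow_natCast, ← Real.rpow_mul (by norm_num),
      ← Real.rpow_mul (by norm_num), mul_comm]
  set D := C1 ^ 2 * (2 * C2) with hD
  have hD0 : 0 ≤ D := by positivity
  obtain ⟨t₀, ht₀⟩ : ∃ t₀ : ℕ, D * (r ^ t₀ / (1 - r)) ≤ ε := by
    have hl : Tendsto (fun t : ℕ => D * (r ^ t / (1 - r))) atTop (nhds (D * (0 / (1 - r)))) :=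
      ((tendsto_pow_atTop_nhds_zero_of_lt_one hr0.le hr1).div_const _).const_mul _
    rw [zero_div, mul_zero] at hl
    exact (hl.eventually (eventually_le_nhds hε)).exists
  refine ⟨t₀, ?_⟩
  filter_upwards [h1, h2, eventually_ge_atTop 1] with N h1 h2 hN U c q β hUr hU
  set L := 2 * ⌊2 * N⌋₊ + 1 with hL
  set τ : ℕ → ℝ := fun u => max (q u : ℝ) (N * |β u|) with hτ
  set g : ℕ → ℕ := fun u => Nat.log 2 ⌊τ u⌋₊ with hg
  have hτ1 : ∀ u ∈ U, 1 ≤ τ u := fun u hu => le_max_of_le_left (by exact_mod_cast (hU u hu).1)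
  have hgl : ∀ u ∈ U, (2 : ℝ) ^ g u ≤ τ u := fun u hu => by
    have hfl : ⌊τ u⌋₊ ≠ 0 := (Nat.floor_pos.mpr (hτ1 u hu)).ne'
    have := Nat.pow_log_le_self 2 hfl
    calc (2 : ℝ) ^ g u ≤ ⌊τ u⌋₊ := by exact_mod_cast this
      _ ≤ τ u := Nat.floor_le (by linarith [hτ1 u hu])
  have hgu : ∀ u, τ u < (2 : ℝ) ^ (g u + 1) := fun u => by
    have := Nat.lt_pow_succ_log_self (b := 2) (by norm_num) ⌊τ u⌋₊
    have := Nat.lt_of_floor_lt this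
    push_cast at this
    exact this
  set t₁ := Nat.log 2 ⌊Real.log N ^ 16⌋₊ + 1
  have hmaps : ∀ u ∈ U, g u ∈ Finset.Ico t₀ t₁ := fun u hu => by
    rw [Finset.mem_Ico]
    obtain ⟨-, -, -, h3, h4⟩ := hU u hu
    refine ⟨Nat.le_log_of_pow_le (by norm_num) (Nat.le_floor ?_), Nat.lt_succ_of_le
      (Nat.log_mono_right (Nat.floor_le_floor h4))⟩
    push_cast
    exact h3
  rw [← Finset.sum_fiberwise_of_maps_to hmaps]
  have hclass : ∀ t ∈ Finset.Ico t₀ t₁, ∑ u ∈ U with g u = t, ‖expSum lamP N (u / L)‖ ^ 4 ≤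
      D * N ^ 4 * r ^ t := by
    intro t _
    rcases (U.filter fun u => g u = t).eq_empty_or_nonempty with he | ⟨v, hv⟩
    · rw [he, Finset.sum_empty]; positivity
    rw [Finset.mem_filter] at hv
    have hT : (((2 ^ (t + 1) : ℕ)) : ℝ) ≤ 2 * Real.log N ^ 16 := by
      have := hgl v hv.1
      have := (hU v hv.1).2.2.2.2
      rw [hv.2] at *
      push_cast
      rw [pow_succ]
      linarith
    have hL2 := h2 (U.filter fun u => g u = t) c q β (2 ^ (t + 1)) Nat.one_le_two_pow hT
      (fun u hu => hUr u (Finset.mem_filter.mp hu).1) (fun u hu => by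
        obtain ⟨hu1, hu2⟩ := Finset.mem_filter.mp hu
        have h3 := hgu u
        rw [hu2] at h3
        have h4 : (q u : ℝ) ≤ (2 : ℝ) ^ (t + 1) := (le_max_left _ _).trans h3.le
        refine ⟨(hU u hu1).1, by exact_mod_cast h4, ?_, (hU u hu1).2.2.1⟩
        push_cast
        exact (le_max_right _ _).trans h3.le)
    have hsup : ∀ u ∈ U.filter (fun u => g u = t), ‖expSum lamP N (u / L)‖ ≤ C1 * N * r ^ t := by
      intro u hu
      obtain ⟨hu1, hu2⟩ := Finset.mem_filter.mp hu
      obtain ⟨h3, h4, h5, h6, h7⟩ := hU u hu1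
      rw [h5]
      refine (h1 (c u) (q u) (β u) (τ u) h3 h4 rfl h7).trans ?_
      have h8 := hgl u hu1
      rw [hu2] at h8
      have h9 : τ u ^ (-(1 / 20) : ℝ) ≤ r ^ t := by
        calc τ u ^ (-(1 / 20) : ℝ) ≤ ((2 : ℝ) ^ t) ^ (-(1 / 20) : ℝ) :=
              Real.rpow_le_rpow_of_nonpos (by positivity) h8 (by norm_num)
          _ = r ^ t := by rw [Real.rpow_neg (by positivity), hrho, hr, inv_pow]
      gcongr
    have hpow : ((2 ^ (t + 1) : ℕ) : ℝ) ^ (1 / 20 : ℝ) ≤ 2 * ρ ^ t := by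
      push_cast
      rw [hrho, pow_succ, mul_comm]
      gcongr
    calc ∑ u ∈ U with g u = t, ‖expSum lamP N (u / L)‖ ^ 4
        ≤ ∑ u ∈ U with g u = t, (C1 * N * r ^ t) ^ 2 * ‖expSum lamP N (u / L)‖ ^ 2 := by
          refine Finset.sum_le_sum fun u hu => ?_
          rw [show 4 = 2 + 2 by norm_num, pow_add]
          have := hsup u hu
          gcongr
      _ = (C1 * N * r ^ t) ^ 2 * ∑ u ∈ U with g u = t, ‖expSum lamP N (u / L)‖ ^ 2 := by rw [Finset.mul_sum]
      _ ≤ (C1 * N * r ^ t) ^ 2 * (C2 * (2 * ρ ^ t) * N ^ 2) := by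
          refine mul_le_mul_of_nonneg_left (hL2.trans ?_) (sq_nonneg _)
          gcongr
      _ = D * N ^ 4 * r ^ t * (r ^ t * ρ ^ t) := by rw [hD]; ring
      _ = D * N ^ 4 * r ^ t := by rw [← mul_pow, hr, inv_mul_cancel₀ (by positivity), one_pow, mul_one]
  refine (Finset.sum_le_sum hclass).trans ?_
  rw [← Finset.mul_sum]
  calc D * N ^ 4 * ∑ t ∈ Finset.Ico t₀ t₁, r ^ t ≤ D * N ^ 4 * (r ^ t₀ / (1 - r)) := by
        gcongr
        exact geom_sum_Ico_le_of_lt_one hr0.le hr1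
    _ = D * (r ^ t₀ / (1 - r)) * N ^ 4 := by ring
    _ ≤ ε * N ^ 4 := by gcongr

theorem eventually_minor_size (D ε : ℝ) (hε : 0 < ε) : ∀ᶠ N : ℝ in atTop, 2 ≤ N ∧ 1 ≤ Real.log N ∧
    Real.log N ^ 16 ≤ N ∧ D * ((Real.log N ^ (-(4 / 5) : ℝ)) ^ 2 * Real.log N) ≤ ε := by
  have h := (isLittleO_log_rpow_rpow_atTop (s := 1) 16 (by norm_num)).bound (show (0 : ℝ) < 1 by norm_num)
  have h0 : Tendsto (fun x : ℝ => D * x ^ (-(3 / 5) : ℝ)) atTop (nhds (D * 0)) :=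
    (tendsto_rpow_neg_atTop (by norm_num)).const_mul D
  rw [mul_zero] at h0
  filter_upwards [h, eventually_ge_atTop 2, Real.tendsto_log_atTop.eventually (eventually_ge_atTop 1),
    Real.tendsto_log_atTop.eventually (h0.eventually (eventually_le_nhds hε))] with N h1 h2 h3 h4
  refine ⟨h2, h3, ?_, ?_⟩
  · rw [Real.norm_of_nonneg (by positivity), Real.norm_of_nonneg (by positivity), Real.rpow_one, one_mul] at h1
    refine le_trans (le_of_eq ?_) h1
    rw [← Real.rpow_natCast]; norm_num
  · refine le_trans (le_of_eq (congrArg (D * ·) ?_)) h4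
    have h5 : 0 < Real.log N := by linarith
    rw [← Real.rpow_natCast, ← Real.rpow_mul h5.le]
    nth_rw 2 [← Real.rpow_one (Real.log N)]
    rw [← Real.rpow_add h5]
    norm_num

theorem exists_sum_norm_expSum_lamP_pow_four_le (ε : ℝ) (hε : 0 < ε) : ∃ K : ℕ, 2 ≤ K ∧ ∀ᶠ N : ℝ in atTop,
    ∀ U : Finset ℕ, (∀ u ∈ U, u < 2 * ⌊2 * N⌋₊ + 1) →
      (∀ u ∈ U, ∀ (a : ℤ) (q : ℕ), 1 ≤ q → q < K →
        K ≤ N * |(u / (2 * ⌊2 * N⌋₊ + 1 : ℕ) : ℝ) - a / q|) →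
      ∑ u ∈ U, ‖expSum lamP N (u / (2 * ⌊2 * N⌋₊ + 1 : ℕ))‖ ^ 4 ≤ ε * N ^ 4 := by
  obtain ⟨t₀, h1⟩ := exists_sum_medium_pow_four_le (ε / 2) (by positivity)
  obtain ⟨C, hC, h2⟩ := exists_norm_expSum_lamP_minor_le
  refine ⟨2 ^ (t₀ + 1), by rw [pow_succ]; have := Nat.one_le_two_pow (n := t₀); omega, ?_⟩
  filter_upwards [h1, h2, eventually_minor_size (120 * C ^ 2) (ε / 2) (by positivity)]
    with N h1 h2 ⟨hN2, hl1, hlN, hsmall⟩ U hUr hU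
  have hN0 : 0 < N := by linarith
  have hsq := sum_norm_expSum_sq lamP N
  have hM0 : (⌊2 * N⌋₊ : ℝ) ≤ 2 * N := Nat.floor_le (by positivity)
  set L := 2 * ⌊2 * N⌋₊ + 1 with hL
  have hL5 : (L : ℝ) ≤ 5 * N := by rw [hL]; push_cast; linarith
  set Q := Real.log N ^ 16 with hQ
  have hQ1 : 1 ≤ Q := one_le_pow₀ hl1
  set n := ⌊N / Q⌋₊ with hn
  have hn0 : 0 < n := Nat.floor_pos.mpr ((one_le_div (by linarith)).mpr hlN)
  have hn1 : N / Q < n + 1 := Nat.lt_floor_add_one _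
  have hn2 : (n : ℝ) ≤ N / Q := Nat.floor_le (by positivity)
  choose R hR1 hR2 using fun u : ℕ => Real.exists_rat_abs_sub_le_and_den_le ((u : ℝ) / L) hn0
  have hden : ∀ u, (1 : ℝ) ≤ (R u).den := fun u => by exact_mod_cast (R u).den_pos
  have hrep : ∀ u : ℕ, (u : ℝ) / L = (R u).num / (R u).den + (u / L - R u) := fun u => by
    have : ((R u : ℚ) : ℝ) = (R u).num / (R u).den := by
      conv_lhs => rw [← Rat.num_div_den (R u)]
      push_cast; rfl
    rw [this]; ring
  have hcop : ∀ u, IsCoprime (R u).num (R u).den := fun u => by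
    rw [Int.isCoprime_iff_gcd_eq_one]
    exact (R u).reduced
  have hβ : ∀ u : ℕ, N * |(u : ℝ) / L - R u| ≤ Q := fun u => by
    have h3 : |(u : ℝ) / L - R u| ≤ 1 / (n + 1) := (hR1 u).trans (by
      refine one_div_le_one_div_of_le (by positivity) ?_
      exact le_mul_of_one_le_right (by positivity) (hden u))
    have h4 : N < (n + 1) * Q := by rwa [div_lt_iff₀ (by linarith)] at hn1
    calc N * |(u : ℝ) / L - R u| ≤ N * (1 / (n + 1)) := by gcongr
      _ ≤ Q := by
        rw [mul_one_div, div_le_iff₀ (by positivity)]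
        linarith
  rw [← Finset.sum_filter_add_sum_filter_not U (fun u => ((R u).den : ℝ) ≤ Q)]
  have hmed := h1 (U.filter fun u => ((R u).den : ℝ) ≤ Q) (fun u => (R u).num) (fun u => (R u).den)
    (fun u => u / L - R u) (fun u hu => hUr u (Finset.mem_filter.mp hu).1) (fun u hu => by
      obtain ⟨hu1, hu2⟩ := Finset.mem_filter.mp hu
      refine ⟨(R u).den_pos, hcop u, hrep u, ?_, max_le hu2 (hβ u)⟩
      have hpp : (2 : ℝ) ^ t₀ ≤ ((2 ^ (t₀ + 1) : ℕ) : ℝ) := by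
        push_cast; exact pow_le_pow_right₀ (by norm_num) (by omega)
      rcases Nat.lt_or_ge (R u).den (2 ^ (t₀ + 1)) with h3 | h3
      · have h4 := hU u hu1 (R u).num (R u).den (R u).den_pos h3
        have h5 : ((R u : ℚ) : ℝ) = (R u).num / (R u).den := by
          have := hrep u; linarith
        rw [← h5] at h4
        exact le_max_of_le_right (hpp.trans h4)
      · exact le_max_of_le_left (hpp.trans (by exact_mod_cast h3)))
  have hminor : ∑ u ∈ U with ¬ ((R u).den : ℝ) ≤ Q, ‖expSum lamP N (u / L)‖ ^ 4 ≤ ε / 2 * N ^ 4 := by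
    have hsup : ∀ u ∈ U.filter (fun u => ¬ ((R u).den : ℝ) ≤ Q), ‖expSum lamP N (u / L)‖ ≤
        C * N * Real.log N ^ (-(4 / 5) : ℝ) := by
      intro u hu
      obtain ⟨hu1, hu2⟩ := Finset.mem_filter.mp hu
      have h3 : ((R u).den : ℝ) ≤ n := by exact_mod_cast hR2 u
      have hd := hden u
      have h4 : |(u : ℝ) / L - R u| ≤ 1 / ((R u).den : ℝ) ^ 2 := (hR1 u).trans (by
        refine one_div_le_one_div_of_le (by positivity) ?_
        rw [sq]
        gcongr
        linarith)
      have := h2 (R u).num (R u).den (u / L - R u) (R u).den_pos (hcop u) h4 (not_le.mp hu2).le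
        ((le_div_iff₀ (by linarith)).mp (h3.trans hn2))
      rwa [← hrep u] at this
    calc ∑ u ∈ U with ¬ ((R u).den : ℝ) ≤ Q, ‖expSum lamP N (u / L)‖ ^ 4
        ≤ ∑ u ∈ U with ¬ ((R u).den : ℝ) ≤ Q,
            (C * N * Real.log N ^ (-(4 / 5) : ℝ)) ^ 2 * ‖expSum lamP N (u / L)‖ ^ 2 := by
          refine Finset.sum_le_sum fun u hu => ?_
          have := hsup u hu
          calc _ = ‖expSum lamP N (u / L)‖ ^ 2 * ‖expSum lamP N (u / L)‖ ^ 2 := by ring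
            _ ≤ _ := by gcongr
      _ ≤ ∑ u ∈ Finset.range L, (C * N * Real.log N ^ (-(4 / 5) : ℝ)) ^ 2 * ‖expSum lamP N (u / L)‖ ^ 2 := by
          refine Finset.sum_le_sum_of_subset_of_nonneg (fun u hu => ?_) fun _ _ _ => by positivity
          exact Finset.mem_range.mpr (hUr u (Finset.mem_filter.mp hu).1)
      _ ≤ (C * N * Real.log N ^ (-(4 / 5) : ℝ)) ^ 2 * (5 * N * (24 * N * Real.log N)) := by
          rw [← Finset.mul_sum, hsq]
          have := sum_lamP_mul_wt_sq_le N hN2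
          gcongr
      _ = 120 * C ^ 2 * ((Real.log N ^ (-(4 / 5) : ℝ)) ^ 2 * Real.log N) * N ^ 4 := by ring
      _ ≤ ε / 2 * N ^ 4 := by gcongr
  linarith

theorem sum_norm_expSum_bmod_sq_le (W : ℕ) [NeZero W] (N : ℝ) (hN : 1 ≤ N) :
    ∑ u ∈ Finset.range (2 * ⌊2 * N⌋₊ + 1), ‖expSum (bmod W) N (u / (2 * ⌊2 * N⌋₊ + 1 : ℕ))‖ ^ 2 ≤
      10 * W ^ 2 * N ^ 2 := by
  rw [sum_norm_expSum_sq]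
  have hM : (⌊2 * N⌋₊ : ℝ) ≤ 2 * N := Nat.floor_le (by positivity)
  have h1 : ∑ n ∈ Finset.Ioc 0 ⌊2 * N⌋₊, (bmod W n * wt N n) ^ 2 ≤ ∑ n ∈ Finset.Ioc 0 ⌊2 * N⌋₊, (W : ℝ) ^ 2 := by
    refine Finset.sum_le_sum fun n _ => ?_
    have h2 : bmod W n * wt N n ≤ W := (mul_le_of_le_one_right (bmod_nonneg W n) (wt_le_one _ _)).trans (bmod_le W n)
    have h3 : 0 ≤ bmod W n * wt N n := mul_nonneg (bmod_nonneg W n) (wt_nonneg _ _)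
    gcongr
  rw [Finset.sum_const, Nat.card_Ioc, Nat.sub_zero, nsmul_eq_mul] at h1
  push_cast
  calc _ ≤ (2 * (2 * N) + N) * (2 * N * (W : ℝ) ^ 2) := by
        refine mul_le_mul (by linarith) (h1.trans (by gcongr))
          (Finset.sum_nonneg fun _ _ => sq_nonneg _) (by positivity)
    _ = _ := by ring

theorem norm_sq_sub_sq_sq_le (x y : ℂ) : ‖x ^ 2 - y ^ 2‖ ^ 2 ≤ 2 * ‖x‖ ^ 4 + 2 * ‖y‖ ^ 4 := by
  have h := norm_sub_le (x ^ 2) (y ^ 2)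
  rw [norm_pow, norm_pow] at h
  calc ‖x ^ 2 - y ^ 2‖ ^ 2 ≤ (‖x‖ ^ 2 + ‖y‖ ^ 2) ^ 2 := by gcongr
    _ ≤ _ := by nlinarith [sq_nonneg (‖x‖ ^ 2 - ‖y‖ ^ 2)]

theorem norm_sq_sub_sq_sq_le' (x y : ℂ) :
    ‖x ^ 2 - y ^ 2‖ ^ 2 ≤ ‖x - y‖ ^ 2 * (2 * ‖x‖ ^ 2 + 2 * ‖y‖ ^ 2) := by
  rw [show x ^ 2 - y ^ 2 = (x - y) * (x + y) by ring, norm_mul, mul_pow]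
  have h := norm_add_le x y
  gcongr
  calc ‖x + y‖ ^ 2 ≤ (‖x‖ + ‖y‖) ^ 2 := by gcongr
    _ ≤ _ := by nlinarith [sq_nonneg (‖x‖ - ‖y‖)]

theorem exists_sq_mul_le (A κ : ℝ) (hA : 0 ≤ A) (hκ : 0 < κ) : ∃ η : ℝ, 0 < η ∧ η ^ 2 * A ≤ κ := by
  refine ⟨√(κ / (A + 1)), by positivity, ?_⟩
  rw [Real.sq_sqrt (by positivity), div_mul_eq_mul_div, div_le_iff₀ (by positivity)]
  nlinarith

theorem exists_sum_norm_sq_sub_bmod_sq_le (κ : ℝ) (hκ : 0 < κ) : ∃ K : ℕ, 2 ≤ K ∧ ∀ᶠ N : ℝ in atTop,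
    ∑ u ∈ Finset.range (2 * ⌊2 * N⌋₊ + 1), ‖expSum lamP N (u / (2 * ⌊2 * N⌋₊ + 1 : ℕ)) ^ 2 -
        expSum (bmod K.factorial) N (u / (2 * ⌊2 * N⌋₊ + 1 : ℕ)) ^ 2‖ ^ 2 ≤ κ * N ^ 4 := by
  classical
  obtain ⟨K, hK2, hK⟩ := exists_sum_norm_expSum_lamP_pow_four_le (κ / 8) (by positivity)
  refine ⟨K, hK2, ?_⟩
  set W := K.factorial with hW
  have : NeZero W := ⟨Nat.factorial_ne_zero K⟩
  have hW0 : (0 : ℝ) < W := by exact_mod_cast Nat.factorial_pos K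
  obtain ⟨η, hη, hη2⟩ := exists_sq_mul_le (10 * W ^ 2) (κ / 8) (by positivity) (by positivity)
  obtain ⟨T₀, hT₀⟩ := exists_norm_expSum_bmod_le W η hη
  set T := max T₀ K with hT
  have hTK : (K : ℝ) ≤ T := le_max_right _ _
  have hT0 : 0 ≤ T := (Nat.cast_nonneg K).trans hTK
  obtain ⟨C, hC, hls⟩ := exists_sum_norm_expSum_sq_le
  set T' := max W ⌈T⌉₊ with hT'
  obtain ⟨η', hη', hη2'⟩ := exists_sq_mul_le (2 * (C * (T' : ℝ) ^ (1 / 20 : ℝ)) + 20 * W ^ 2) (κ / 2)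
    (by positivity) (by positivity)
  have hlog : ∀ᶠ N : ℝ in atTop, (T' : ℝ) ≤ 2 * Real.log N ^ 16 := by
    filter_upwards [Real.tendsto_log_atTop.eventually (eventually_ge_atTop (T' : ℝ)),
      Real.tendsto_log_atTop.eventually (eventually_ge_atTop (1 : ℝ))] with N h1 h2
    have := le_self_pow₀ h2 (show 16 ≠ 0 by norm_num)
    linarith
  filter_upwards [hK, hls, norm_expSum_lamP_sub_bmod_le W T η' hT0 hη', hlog, eventually_ge_atTop 1]
    with N hK hls hmaj hlog hN
  have hN0 : 0 < N := by linarith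
  have hb := sum_norm_expSum_bmod_sq_le W N hN
  set L := 2 * ⌊2 * N⌋₊ + 1 with hL
  set P : ℕ → Prop := fun u => ∃ k : ℤ, |(u : ℝ) / L - k / W| < T / N with hP
  rw [← Finset.sum_filter_add_sum_filter_not (Finset.range L) P]
  set U := (Finset.range L).filter P with hU
  set V := (Finset.range L).filter fun u => ¬ P u with hV
  have hbsub : ∀ X ⊆ Finset.range L, ∑ u ∈ X, ‖expSum (bmod W) N (u / L)‖ ^ 2 ≤ 10 * W ^ 2 * N ^ 2 :=
    fun X hX => (Finset.sum_le_sum_of_subset_of_nonneg hX fun _ _ _ => sq_nonneg _).trans hb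
  have hoff : ∀ u ∈ V, ∀ k : ℤ, T / N ≤ |(u : ℝ) / L - k / W| := fun u hu k => by
    have := (Finset.mem_filter.mp hu).2
    simp only [hP, not_exists, not_lt] at this
    exact this k
  have hVa : ∑ u ∈ V, ‖expSum lamP N (u / L)‖ ^ 4 ≤ κ / 8 * N ^ 4 := by
    refine hK V (fun u hu => Finset.mem_range.mp (Finset.mem_filter.mp hu).1) fun u hu a q hq hqK => ?_
    obtain ⟨d, hd⟩ : q ∣ W := Nat.dvd_factorial hq hqK.le
    have hq0 : (0 : ℝ) < q := by exact_mod_cast hq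
    have hWd : (W : ℝ) = q * d := by exact_mod_cast hd
    have hd0 : (d : ℝ) ≠ 0 := fun h => by rw [h, mul_zero] at hWd; exact hW0.ne' hWd
    have h := hoff u hu (a * d)
    rw [hWd] at h
    push_cast at h
    rw [mul_div_mul_right _ _ hd0, div_le_iff₀' hN0] at h
    exact hTK.trans h
  have hVb : ∑ u ∈ V, ‖expSum (bmod W) N (u / L)‖ ^ 4 ≤ κ / 8 * N ^ 4 := by
    calc ∑ u ∈ V, ‖expSum (bmod W) N (u / L)‖ ^ 4
        ≤ ∑ u ∈ V, (η * N) ^ 2 * ‖expSum (bmod W) N (u / L)‖ ^ 2 := by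
          refine Finset.sum_le_sum fun u hu => ?_
          have := hT₀ T (le_max_left _ _) N hN (u / L) (hoff u hu)
          calc _ = ‖expSum (bmod W) N (u / L)‖ ^ 2 * ‖expSum (bmod W) N (u / L)‖ ^ 2 := by ring
            _ ≤ _ := by gcongr
      _ ≤ (η * N) ^ 2 * (10 * W ^ 2 * N ^ 2) := by
          rw [← Finset.mul_sum]
          have := hbsub V (Finset.filter_subset _ _)
          gcongr
      _ = η ^ 2 * (10 * W ^ 2) * N ^ 4 := by ring
      _ ≤ _ := by gcongr
  have hVsum : ∑ u ∈ V, ‖expSum lamP N (u / L) ^ 2 - expSum (bmod W) N (u / L) ^ 2‖ ^ 2 ≤ κ / 2 * N ^ 4 := by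
    refine (Finset.sum_le_sum fun u _ => norm_sq_sub_sq_sq_le _ _).trans ?_
    rw [Finset.sum_add_distrib, ← Finset.mul_sum, ← Finset.mul_sum]
    linarith
  have hkU : ∀ u : ℕ, ∃ k : ℤ, u ∈ U → |(u : ℝ) / L - k / W| < T / N := fun u => by
    by_cases hu : u ∈ U
    · obtain ⟨k, hk⟩ := (Finset.mem_filter.mp hu).2
      exact ⟨k, fun _ => hk⟩
    · exact ⟨0, fun h => absurd h hu⟩
  choose k hk using hkU
  have hβ : ∀ u ∈ U, N * |(u : ℝ) / L - k u / W| ≤ T := fun u hu =>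
    (le_div_iff₀' hN0).mp (hk u hu).le
  have hUa := hls U k (fun _ => W) (fun u => u / L - k u / W) T'
    (le_max_of_le_left (Nat.factorial_pos K)) hlog
    (fun u hu => Finset.mem_range.mp (Finset.mem_filter.mp hu).1) (fun u hu =>
      ⟨Nat.factorial_pos K, le_max_left _ _, (hβ u hu).trans ((Nat.le_ceil T).trans
        (by exact_mod_cast le_max_right _ _)), by ring⟩)
  have hUsum : ∑ u ∈ U, ‖expSum lamP N (u / L) ^ 2 - expSum (bmod W) N (u / L) ^ 2‖ ^ 2 ≤ κ / 2 * N ^ 4 := by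
    calc _ ≤ ∑ u ∈ U, (η' * N) ^ 2 * (2 * ‖expSum lamP N (u / L)‖ ^ 2 + 2 * ‖expSum (bmod W) N (u / L)‖ ^ 2) := by
          refine Finset.sum_le_sum fun u hu => (norm_sq_sub_sq_sq_le' _ _).trans ?_
          have h := hmaj W (k u) (u / L - k u / W) dvd_rfl (hβ u hu)
          rw [add_sub_cancel] at h
          gcongr
      _ = (η' * N) ^ 2 * (2 * ∑ u ∈ U, ‖expSum lamP N (u / L)‖ ^ 2 +
            2 * ∑ u ∈ U, ‖expSum (bmod W) N (u / L)‖ ^ 2) := by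
          rw [← Finset.mul_sum, Finset.sum_add_distrib, ← Finset.mul_sum, ← Finset.mul_sum]
      _ ≤ (η' * N) ^ 2 * (2 * (C * (T' : ℝ) ^ (1 / 20 : ℝ) * N ^ 2) + 2 * (10 * W ^ 2 * N ^ 2)) := by
          have := hbsub U (Finset.filter_subset _ _)
          gcongr
      _ = η' ^ 2 * (2 * (C * (T' : ℝ) ^ (1 / 20 : ℝ)) + 20 * W ^ 2) * N ^ 4 := by ring
      _ ≤ _ := by gcongr
  linarith

/-- Almost all even integers in `[(2 + δ) N, 3 N]` are sums of two primes between `N` and `2 N`. -/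
theorem card_exceptional_le (δ ε : ℝ) (hδ : 0 < δ) (hδ1 : δ ≤ 1) (hε : 0 < ε) : ∀ᶠ N : ℝ in atTop,
    ∀ E : Finset ℕ, (∀ m ∈ E, Even m ∧ (2 + δ) * N ≤ m ∧ (m : ℝ) ≤ 3 * N ∧ wconv lamP N m = 0) →
      (E.card : ℝ) ≤ ε * N := by
  obtain ⟨c, hc, hlow⟩ := exists_wconv_bmod_lower δ hδ hδ1
  obtain ⟨K, hK2, hK⟩ := exists_sum_norm_sq_sub_bmod_sq_le (ε * c ^ 2) (by positivity)
  filter_upwards [hK, hlow K hK2, eventually_ge_atTop 2] with N hK hlow hN E hE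
  have hN0 : 0 < N := by linarith
  rw [sum_norm_expSum_sq_sub_sq _ _ N hN0] at hK
  have hM1 : 2 * N < ⌊2 * N⌋₊ + 1 := Nat.lt_floor_add_one _
  set L := 2 * ⌊2 * N⌋₊ + 1 with hL
  have hLc : (L : ℝ) = 2 * ⌊2 * N⌋₊ + 1 := by rw [hL]; push_cast; ring
  have hsub : E ⊆ Finset.range L := fun m hm => by
    have h1 := (hE m hm).2.2.1
    rw [Finset.mem_range]
    have : (m : ℝ) < L := by linarith
    exact_mod_cast this
  have h1 : (E.card : ℝ) * (c * N) ^ 2 ≤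
      ∑ m ∈ Finset.range L, (wconv lamP N m - wconv (bmod K.factorial) N m) ^ 2 := by
    rw [← nsmul_eq_mul, ← Finset.sum_const]
    refine (Finset.sum_le_sum fun m hm => ?_).trans
      (Finset.sum_le_sum_of_subset_of_nonneg hsub fun _ _ _ => sq_nonneg _)
    obtain ⟨h2, h3, h4, h5⟩ := hE m hm
    have h6 := hlow m h2 h3 h4
    rw [h5, zero_sub, neg_sq]
    gcongr
  have h2 : N * ((E.card : ℝ) * (c * N) ^ 2) ≤ ε * c ^ 2 * N ^ 4 :=
    le_trans (mul_le_mul (by linarith) h1 (by positivity) (by positivity)) hK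
  refine le_of_mul_le_mul_left (a := N * (c * N) ^ 2) ?_ (by positivity)
  linarith

lemma nthPrime_prime (n : ℕ) : (nthPrime n).Prime := Nat.prime_nth_prime _

lemma tendsto_nthPrime : Tendsto nthPrime atTop atTop :=
  (Nat.nth_strictMono Nat.infinite_setOfPred_prime).tendsto_atTop.comp (tendsto_sub_atTop_nat 1)

lemma tendsto_nthPrime_real : Tendsto (fun n => (nthPrime n : ℝ)) atTop atTop :=
  tendsto_natCast_atTop_atTop.comp tendsto_nthPrime

lemma mem_S_of_wconv_ne_zero {n m : ℕ} (h : wconv lamP (nthPrime n) m ≠ 0) : m ∈ S n := by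
  obtain ⟨z, hz, hne⟩ := Finset.exists_ne_zero_of_sum_ne_zero h
  have hN : (0 : ℝ) < nthPrime n := by exact_mod_cast (nthPrime_prime n).pos
  have key : ∀ k : ℕ, lamP k * wt (nthPrime n) k ≠ 0 → k ∈ S n := fun k hk => by
    refine AddSubmonoid.subset_closure ⟨?_, ?_⟩
    · by_contra hp
      exact left_ne_zero_of_mul hk (if_neg hp)
    · by_contra! hp
      exact right_ne_zero_of_mul hk
        (wt_eq_zero_of_le hN (Nat.cast_nonneg k) (by exact_mod_cast hp.le))
  rw [← Finset.HasAntidiagonal.mem_antidiagonal.mp hz]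
  exact add_mem (key _ (left_ne_zero_of_mul hne)) (key _ (right_ne_zero_of_mul hne))

lemma eq_zero_or_of_mem_S {n m : ℕ} (hp : 2 < nthPrime n) (hm : m ∈ S n) :
    m = 0 ∨ (m.Prime ∧ nthPrime n ≤ m) ∨ (2 * nthPrime n ≤ m ∧ Even m) ∨ 3 * nthPrime n ≤ m := by
  induction hm using AddSubmonoid.closure_induction with
  | mem x hx => exact Or.inr (Or.inl hx)
  | zero => exact Or.inl rfl
  | add x y _ _ hx hy =>
    have hodd : ∀ q : ℕ, q.Prime → nthPrime n ≤ q → Odd q := fun q hq hle =>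
      hq.odd_of_ne_two (by omega)
    rcases hx with rfl | hx
    · simpa using hy
    rcases hy with rfl | hy
    · simpa using Or.inr hx
    rcases hx with ⟨hx1, hx2⟩ | hx
    · rcases hy with ⟨hy1, hy2⟩ | hy
      · exact Or.inr (Or.inr (Or.inl ⟨by omega, (hodd x hx1 hx2).add_odd (hodd y hy1 hy2)⟩))
      · omega
    · omega

lemma bddAbove_of_frob_ne_zero {n : ℕ} (h : frob n ≠ 0) : BddAbove {m : ℕ | m ∉ S n} := by
  by_contra hb
  exact h (Nat.sSup_of_not_bddAbove hb)

lemma genus_lower {n : ℕ} (hp : 2 < nthPrime n) (hb : BddAbove {m : ℕ | m ∉ S n}) :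
    3 * nthPrime n ≤ genus n + 1 + Nat.primeCounting (3 * nthPrime n) + (nthPrime n / 2 + 1) := by
  classical
  have hfin := hb.finite
  set p := nthPrime n with hpdef
  have hsub : Finset.range (3 * p) ⊆ ((hfin.toFinset ∪ {0}) ∪ Nat.primesLE (3 * p)) ∪
      (Finset.Ico p (3 * p / 2 + 1)).image (2 * ·) := fun m hm => by
    rw [Finset.mem_range] at hm
    by_cases hS : m ∈ S n
    · rcases eq_zero_or_of_mem_S hp hS with h | h | ⟨h1, k, hk⟩ | h
      · simp [h]
      · have : m ∈ Nat.primesLE (3 * p) := by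
          rw [Nat.mem_primesLE]; exact ⟨hm.le, h.1⟩
        simp only [Finset.mem_union]; tauto
      · refine Finset.mem_union_right _ (Finset.mem_image.mpr ⟨k, ?_, by omega⟩)
        rw [Finset.mem_Ico]; omega
      · omega
    · have : m ∈ hfin.toFinset := by simpa using hS
      simp only [Finset.mem_union]; tauto
  have h := Finset.card_le_card hsub
  rw [Finset.card_range] at h
  refine h.trans ((Finset.card_union_le _ _).trans (add_le_add ((Finset.card_union_le _ _).trans
    (add_le_add ((Finset.card_union_le _ _).trans (add_le_add ?_ ?_)) ?_)) ?_))
  · rw [genus, Set.ncard_eq_toFinset_card _ hfin]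
  · simp
  · rw [Nat.primesLE_card_eq_primeCounting]
  · refine Finset.card_image_le.trans ?_
    rw [Nat.card_Ico]; omega

lemma genus_upper {n : ℕ} {δ ε : ℝ} (hδ : 0 < δ) (hb : BddAbove {m : ℕ | m ∉ S n})
    (hE : ∀ E : Finset ℕ, (∀ m ∈ E, Even m ∧ (2 + δ) * nthPrime n ≤ m ∧
      (m : ℝ) ≤ 3 * nthPrime n ∧ wconv lamP (nthPrime n) m = 0) → (E.card : ℝ) ≤ ε * nthPrime n) :
    (genus n : ℝ) ≤ ((2 + δ) * nthPrime n + 1) + (nthPrime n / 2 + 1) + ε * nthPrime n +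
      ((frob n - 3 * nthPrime n : ℕ) : ℝ) := by
  classical
  have hfin := hb.finite
  set p := nthPrime n with hpdef
  set E := (Finset.range (3 * p + 1)).filter
    (fun m : ℕ => Even m ∧ (2 + δ) * p ≤ (m : ℝ) ∧ m ∉ S n) with hEdef
  have hEc := hE E fun m hm => by
    obtain ⟨h1, h2, h3, h4⟩ := Finset.mem_filter.mp hm
    refine ⟨h2, h3, ?_, ?_⟩
    · have : m ≤ 3 * p := by simpa [Nat.lt_succ_iff] using h1
      exact_mod_cast this
    · by_contra hw
      exact h4 (mem_S_of_wconv_ne_zero hw)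
  have hsub : hfin.toFinset ⊆ ((Finset.range ⌈(2 + δ) * p⌉₊ ∪
      (Finset.Ico p (3 * p / 2 + 1)).image (2 * · + 1)) ∪ E) ∪ Finset.Ioc (3 * p) (frob n) :=
    fun m hm => by
    have hS : m ∉ S n := by simpa using hm
    have hf : m ≤ frob n := le_csSup hb hS
    by_cases h3 : m ≤ 3 * p
    · refine Finset.mem_union_left _ ?_
      by_cases h2 : (2 + δ) * p ≤ m
      · rcases Nat.even_or_odd m with he | ⟨k, hk⟩
        · refine Finset.mem_union_right _ (Finset.mem_filter.mpr ⟨?_, he, h2, hS⟩)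
          rw [Finset.mem_range]; omega
        · refine Finset.mem_union_left _ (Finset.mem_union_right _
            (Finset.mem_image.mpr ⟨k, ?_, by omega⟩))
          have : (2 * p : ℝ) ≤ m := le_trans (by gcongr; linarith) h2
          have : 2 * p ≤ m := by exact_mod_cast this
          rw [Finset.mem_Ico]; omega
      · refine Finset.mem_union_left _ (Finset.mem_union_left _ ?_)
        rw [Finset.mem_range, Nat.lt_ceil]
        linarith
    · refine Finset.mem_union_right _ ?_
      rw [Finset.mem_Ioc]; omega
  have h := (Finset.card_le_card hsub).trans ((Finset.card_union_le _ _).trans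
    (add_le_add_left ((Finset.card_union_le _ _).trans
      (add_le_add_left (Finset.card_union_le _ _) _)) _))
  rw [Finset.card_range, Nat.card_Ioc, ← Set.ncard_eq_toFinset_card _ hfin] at h
  have hi : ((Finset.Ico p (3 * p / 2 + 1)).image (2 * · + 1)).card ≤ p / 2 + 1 := by
    refine Finset.card_image_le.trans ?_
    rw [Nat.card_Ico]; omega
  have hi' : ((((Finset.Ico p (3 * p / 2 + 1)).image (2 * · + 1)).card : ℕ) : ℝ) ≤ p / 2 + 1 := by
    refine (Nat.cast_le.mpr hi).trans ?_
    push_cast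
    gcongr
    exact Nat.cast_div_le
  have hc : ((⌈(2 + δ) * p⌉₊ : ℕ) : ℝ) < (2 + δ) * p + 1 := Nat.ceil_lt_add_one (by positivity)
  have h' : (genus n : ℝ) ≤ ((⌈(2 + δ) * p⌉₊ +
      ((Finset.Ico p (3 * p / 2 + 1)).image (2 * · + 1)).card + E.card +
      (frob n - 3 * p) : ℕ) : ℝ) := Nat.cast_le.mpr h
  push_cast at h' ⊢
  linarith

lemma eventually_primeCounting_three_mul_le {ε : ℝ} (hε : 0 < ε) :
    ∀ᶠ N : ℕ in atTop, (Nat.primeCounting (3 * N) : ℝ) ≤ ε * N := by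
  have ht : Tendsto (fun N : ℕ => ((3 * N : ℕ) : ℝ)) atTop atTop :=
    tendsto_natCast_atTop_atTop.comp (tendsto_id.const_mul_atTop' (by norm_num))
  filter_upwards [ht.eventually (Chebyshev.eventually_primeCounting_le one_pos),
    ht.eventually (Real.tendsto_log_atTop.eventually_ge_atTop (3 * (Real.log 4 + 1) / ε)),
    ht.eventually (Real.tendsto_log_atTop.eventually_gt_atTop 0)] with N h1 h2 h3
  rw [Nat.floor_natCast] at h1
  refine h1.trans ?_
  rw [div_le_iff₀ h3]
  rw [div_le_iff₀ hε] at h2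
  have hN : (0 : ℝ) ≤ N := Nat.cast_nonneg N
  have := mul_le_mul_of_nonneg_right h2 hN
  push_cast at this ⊢
  linarith

theorem genus_div_frob_asymptotic
    (h : Filter.Tendsto (fun n => (nthPrime n : ℝ) / (frob n : ℝ)) Filter.atTop
      (nhds (1 / 3))) :
    Filter.Tendsto (fun n => (genus n : ℝ) / (1 + frob n : ℝ)) Filter.atTop
      (nhds (5 / 6)) := by
  have hp := tendsto_nthPrime_real
  have hb : ∀ᶠ n in atTop, BddAbove {m : ℕ | m ∉ S n} := by
    filter_upwards [h.eventually_ne (show (1 / 3 : ℝ) ≠ 0 by norm_num)] with n hn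
    refine bddAbove_of_frob_ne_zero fun h0 => hn ?_
    simp [h0]
  have hf : Tendsto (fun n => (frob n : ℝ) / nthPrime n) atTop (nhds 3) := by
    have := h.inv₀ (by norm_num)
    simpa using this
  have hg : Tendsto (fun n => (genus n : ℝ) / nthPrime n) atTop (nhds (5 / 2)) := by
    rw [Metric.tendsto_nhds]
    intro η hη
    obtain ⟨δ, hδ, hδ1, hδη⟩ : ∃ δ : ℝ, 0 < δ ∧ δ ≤ 1 ∧ 4 * δ < η :=
      ⟨min 1 (η / 5), by positivity, min_le_left _ _, by
        have := min_le_right 1 (η / 5); linarith⟩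
    filter_upwards [hb, hp.eventually (card_exceptional_le δ δ hδ hδ1 hδ),
      hf.eventually (gt_mem_nhds (show (3 : ℝ) < 3 + δ by linarith)),
      tendsto_nthPrime.eventually (eventually_primeCounting_three_mul_le hδ),
      tendsto_nthPrime.eventually_gt_atTop 2, hp.eventually_ge_atTop (2 / δ)]
      with n hb hE hfn hπ hp2 hpδ
    have hp0 : (0 : ℝ) < nthPrime n := by exact_mod_cast (nthPrime_prime n).pos
    rw [div_lt_iff₀ hp0] at hfn
    rw [div_le_iff₀ hδ] at hpδ
    have hup := genus_upper hδ hb hE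
    have hsub : ((frob n - 3 * nthPrime n : ℕ) : ℝ) ≤ δ * nthPrime n := by
      rcases le_total (3 * nthPrime n) (frob n) with hle | hle
      · rw [Nat.cast_sub hle]
        push_cast
        linarith
      · rw [Nat.sub_eq_zero_of_le hle, Nat.cast_zero]
        positivity
    have hlo : ((3 * nthPrime n : ℕ) : ℝ) ≤ _ := Nat.cast_le.mpr (genus_lower hp2 hb)
    push_cast at hlo
    have hhalf : ((nthPrime n / 2 : ℕ) : ℝ) ≤ nthPrime n / 2 := Nat.cast_div_le
    have hpη := mul_lt_mul_of_pos_right hδη hp0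
    rw [Real.dist_eq, abs_lt, lt_sub_iff_add_lt, sub_lt_iff_lt_add, lt_div_iff₀ hp0,
      div_lt_iff₀ hp0]
    constructor <;> linarith
  have hq := hg.div ((tendsto_inv_atTop_zero.comp hp).add hf) (by norm_num)
  rw [show (5 / 2 : ℝ) / (0 + 3) = 5 / 6 by norm_num] at hq
  refine hq.congr fun n => ?_
  have hp0 : (nthPrime n : ℝ) ≠ 0 := by exact_mod_cast (nthPrime_prime n).ne_zero
  simp only [Pi.div_apply, Function.comp_apply]
  rw [inv_eq_one_div, ← add_div, div_div_div_cancel_right₀ hp0]
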